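/- There exists an absolute constant C > 0 such that for every measurable function u : ℝ → ℝ and every Schwartz function f : ℝ² → ℂ, the Hilbert transform along the one-variable vector field (1, u), defined by H₁^u f(x₁, x₂) := p.v. ∫_ℝ f(x₁ − t, x₂ − u(x₁) t) dt/t, satisfies ‖H₁^u f‖_{L²(ℝ²)} ≤ C ‖f‖_{L²(ℝ²)}. -/

import Mathlib

open MeasureTheory Filter Set
open scoped ENNReal Topology
noncomputable section
namespace Carl
abbrev Tile := ℤ × ℤ × ℤ
def W (t : ℝ) : ℝ := (1 + |t|)⁻¹
def nu (k n : ℤ) (x : ℝ) : ℝ := (8:ℝ)^k * x - n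
def II (k n : ℤ) : Set ℝ := {x | ⌊(8:ℝ)^k * x⌋ = n}
def om1 (k m : ℤ) : Set ℝ := {ξ | ξ ∈ II (-k) m ∧ nu (-k) m ξ < 1/8}
def om2 (k m : ℤ) : Set ℝ := {ξ | ξ ∈ II (-k) m ∧ 1/2 ≤ nu (-k) m ξ}
lemma W_pos (t : ℝ) : 0 < W t := by unfold W; positivity
lemma W_le_one (t : ℝ) : W t ≤ 1 := by
  unfold W; exact inv_le_one_of_one_le₀ (by linarith [abs_nonneg t])
lemma W_nn (t : ℝ) : 0 ≤ W t := (W_pos t).le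
lemma W_anti {s t : ℝ} (h : |s| ≤ |t|) : W t ≤ W s := by
  unfold W; gcongr
lemma W_neg (t : ℝ) : W (-t) = W t := by simp [W]
lemma W_mul_le (u v : ℝ) : W u * W v ≤ W (u + v) := by
  unfold W
  rw [← mul_inv]
  gcongr
  nlinarith [abs_add_le u v, abs_nonneg u, abs_nonneg v, mul_nonneg (abs_nonneg u) (abs_nonneg v)]
lemma W_le_mul (u v : ℝ) : W u ≤ (1 + |v|) * W (u + v) := by
  have := W_mul_le u v
  have h2 : W v * (1 + |v|) = 1 := by unfold W; field_simp
  have : W u = (1+|v|) * (W u * W v) := by linear_combination (-W u) * h2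
  rw [this]; gcongr
lemma W_le_two {u v : ℝ} (h : |u - v| ≤ 1) : W u ≤ 2 * W v := by
  have := W_le_mul u (v - u)
  rw [add_sub_cancel] at this
  refine this.trans ?_
  have := W_nn v
  gcongr
  rw [abs_sub_comm]; linarith
lemma W_pow_anti {p q : ℕ} (h : p ≤ q) (t : ℝ) : W t ^ q ≤ W t ^ p :=
  pow_le_pow_of_le_one (W_nn t) (W_le_one t) h
@[fun_prop] lemma W_cont : Continuous W := by
  unfold W; exact Continuous.inv₀ (by fun_prop) (fun x => by positivity)
@[fun_prop] lemma W_meas : Measurable W := W_cont.measurable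
@[fun_prop] lemma nu_cont (k n : ℤ) : Continuous (nu k n) := by unfold nu; fun_prop
@[fun_prop] lemma nu_meas (k n : ℤ) : Measurable (nu k n) := (nu_cont k n).measurable
lemma W2_le (t : ℝ) : W t ^ 2 ≤ (1 + t^2)⁻¹ := by
  unfold W; rw [inv_pow]; gcongr; nlinarith [abs_nonneg t, sq_abs t]
lemma intW {p : ℕ} (hp : 2 ≤ p) : Integrable (fun t => W t ^ p) := by
  refine integrable_inv_one_add_sq.mono' (by fun_prop) (ae_of_all _ fun t => ?_)
  rw [Real.norm_of_nonneg (by have := W_nn t; positivity)]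
  exact (W_pow_anti hp t).trans (W2_le t)
lemma intW_le {p : ℕ} (hp : 2 ≤ p) : ∫ t, W t ^ p ≤ 4 := by
  calc ∫ t, W t ^ p ≤ ∫ t, (1 + t^2)⁻¹ := integral_mono (intW hp) integrable_inv_one_add_sq
        (fun t => (W_pow_anti hp t).trans (W2_le t))
    _ = Real.pi := integral_univ_inv_one_add_sq
    _ ≤ 4 := Real.pi_le_four
lemma e8 (k : ℤ) : (0:ℝ) < 8^k := by positivity
lemma e8_le {k l : ℤ} (h : k ≤ l) : (8:ℝ)^k ≤ 8^l := zpow_le_zpow_right₀ (by norm_num) h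
lemma e8_neg (k : ℤ) : (8:ℝ)^k * 8^(-k) = 1 := by rw [← zpow_add₀ (by norm_num)]; simp
lemma e8_neg' (k : ℤ) : (8:ℝ)^(-k) * 8^k = 1 := by rw [mul_comm, e8_neg]
lemma e8_add (k l : ℤ) : (8:ℝ)^(k+l) = 8^k * 8^l := zpow_add₀ (by norm_num) _ _
lemma intWa {p : ℕ} (hp : 2 ≤ p) {a : ℝ} (ha : 0 < a) (c : ℝ) :
    Integrable (fun x => W (a * x - c) ^ p) :=
  ((intW hp).comp_sub_right c).comp_mul_left' ha.ne'
lemma intWa_le {p : ℕ} (hp : 2 ≤ p) {a : ℝ} (ha : 0 < a) (c : ℝ) :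
    ∫ x, W (a * x - c) ^ p ≤ 4 * a⁻¹ := by
  have := Measure.integral_comp_mul_left (fun x => W (x - c) ^ p) a
  rw [this, integral_sub_right_eq_self (fun x => W x ^ p) c, abs_of_pos (by positivity), smul_eq_mul]
  have := intW_le hp
  have : 0 < a⁻¹ := by positivity
  nlinarith
lemma intWn {p : ℕ} (hp : 2 ≤ p) (k n : ℤ) : Integrable (fun x => W (nu k n x) ^ p) :=
  intWa hp (e8 k) n
lemma intWn_le {p : ℕ} (hp : 2 ≤ p) (k n : ℤ) : ∫ x, W (nu k n x) ^ p ≤ 4 * 8^(-k) := by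
  rw [zpow_neg]; exact intWa_le hp (e8 k) n
lemma setW_le {p : ℕ} (hp : 2 ≤ p) (k n : ℤ) (A : Set ℝ) :
    ∫ x in A, W (nu k n x) ^ p ≤ 4 * 8^(-k) :=
  (setIntegral_le_integral (intWn hp k n) (ae_of_all _ fun x => by have := W_nn (nu k n x); positivity)).trans
    (intWn_le hp k n)
lemma mem_II {k n : ℤ} {x : ℝ} : x ∈ II k n ↔ (n:ℝ) ≤ 8^k * x ∧ 8^k * x < n + 1 := Int.floor_eq_iff
lemma nu_II {k n : ℤ} {x : ℝ} : x ∈ II k n ↔ 0 ≤ nu k n x ∧ nu k n x < 1 := by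
  rw [mem_II]; unfold nu; constructor <;> rintro ⟨h1, h2⟩ <;> constructor <;> linarith
lemma self_II (k : ℤ) (x : ℝ) : x ∈ II k ⌊(8:ℝ)^k * x⌋ := rfl
lemma II_eq (k n : ℤ) : II k n = Ico ((n:ℝ) * 8^(-k)) (((n:ℝ)+1) * 8^(-k)) := by
  ext x
  rw [mem_II, mem_Ico, zpow_neg, ← div_eq_mul_inv, ← div_eq_mul_inv, div_le_iff₀ (e8 k), lt_div_iff₀ (e8 k),
    mul_comm x]
lemma II_meas (k n : ℤ) : MeasurableSet (II k n) := by rw [II_eq]; exact measurableSet_Ico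
lemma II_vol (k n : ℤ) : volume (II k n) = ENNReal.ofReal (8^(-k)) := by
  rw [II_eq, Real.volume_Ico]; congr 1; ring
lemma II_real (k n : ℤ) : volume.real (II k n) = 8^(-k) := by
  rw [measureReal_def, II_vol, ENNReal.toReal_ofReal (e8 _).le]
lemma II_disj {k n n' : ℤ} {x : ℝ} (h : x ∈ II k n) (h' : x ∈ II k n') : n = n' := h.symm.trans h'
lemma cen_II (k n : ℤ) : (n:ℝ) * 8^(-k) ∈ II k n := by
  rw [II_eq]; constructor; · exact le_rfl
  have := e8 (-k); nlinarith
lemma II_ne (k n : ℤ) : (II k n).Nonempty := ⟨_, cen_II k n⟩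
lemma floor_nest {k k' : ℤ} (h : k ≤ k') {x y : ℝ} (hxy : ⌊(8:ℝ)^k' * x⌋ = ⌊(8:ℝ)^k' * y⌋) :
    ⌊(8:ℝ)^k * x⌋ = ⌊(8:ℝ)^k * y⌋ := by
  obtain ⟨j, rfl⟩ := Int.le.dest h
  have key : ∀ z : ℝ, ⌊(8:ℝ)^k * z⌋ = ⌊(8:ℝ)^(k+j) * z⌋ / ((8^j : ℕ) : ℤ) := by
    intro z
    rw [← Int.floor_div_natCast]
    congr 1
    rw [e8_add]; push_cast; rw [zpow_natCast]; field_simp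
  rw [key, key, hxy]
lemma II_sub {k k' n n' : ℤ} (h : k ≤ k') {x : ℝ} (hx : x ∈ II k n) (hx' : x ∈ II k' n') :
    II k' n' ⊆ II k n := by
  intro y hy
  have : ⌊(8:ℝ)^k * y⌋ = ⌊(8:ℝ)^k * x⌋ := floor_nest h (hy.trans hx'.symm)
  exact this.trans hx
lemma II_sub_scale {k k' n n' : ℤ} (h : II k' n' ⊆ II k n) : k ≤ k' := by
  by_contra hc
  have : volume (II k' n') ≤ volume (II k n) := measure_mono h
  rw [II_vol, II_vol, ENNReal.ofReal_le_ofReal_iff (e8 _).le] at this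
  have h3 : (8:ℝ)^(-k) < 8^(-k') := zpow_lt_zpow_right₀ (by norm_num) (by omega)
  linarith
lemma II_sub_or {k k' n n' : ℤ} (h : k ≤ k') : II k' n' ⊆ II k n ∨ Disjoint (II k n) (II k' n') := by
  by_cases hd : Disjoint (II k n) (II k' n')
  · exact .inr hd
  · obtain ⟨x, hx, hx'⟩ := Set.not_disjoint_iff.1 hd
    exact .inl (II_sub h hx hx')
lemma om2_sub (k m : ℤ) : om2 k m ⊆ II (-k) m := fun _ h => h.1
lemma om1_sub (k m : ℤ) : om1 k m ⊆ II (-k) m := fun _ h => h.1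
lemma om2_meas (k m : ℤ) : MeasurableSet (om2 k m) :=
  (II_meas _ _).inter (measurableSet_le measurable_const (nu_meas _ _))
lemma om1_nest {k k' m m' : ℤ} (h : k < k') {x : ℝ} (hx : x ∈ II (-k) m) (hx' : x ∈ om1 k' m') :
    II (-k) m ⊆ om1 k' m' := by
  have e : om1 k' m' = II (-k'+1) (8 * m') := by
    ext y; unfold om1 nu; simp only [mem_ofPred_eq, mem_II]; rw [e8_add]; push_cast
    constructor
    · rintro ⟨⟨h1, h2⟩, h3⟩; constructor <;> rw [zpow_one] <;> linarith
    · rintro ⟨h1, h2⟩; rw [zpow_one] at h1 h2; refine ⟨⟨?_, ?_⟩, ?_⟩ <;> linarith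
  rw [e] at hx' ⊢
  exact II_sub (by omega) hx' hx
lemma om2_nest {k k' m m' : ℤ} (h : k < k') {x : ℝ} (hx : x ∈ II (-k) m) (hx' : x ∈ om2 k' m') :
    II (-k) m ⊆ om2 k' m' := by
  intro y hy
  have hxy : ⌊(8:ℝ)^(-k'+1) * y⌋ = ⌊(8:ℝ)^(-k'+1) * x⌋ := floor_nest (by omega : -k'+1 ≤ -k) (hy.trans hx.symm)
  refine ⟨II_sub (by omega) hx'.1 hx hy, ?_⟩
  have hx2 := hx'.2
  unfold nu at hx2 ⊢
  have h4 : (8 * m' + 4 : ℤ) ≤ ⌊(8:ℝ)^(-k'+1) * x⌋ := by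
    rw [Int.le_floor, e8_add]; push_cast; rw [zpow_one]; linarith
  rw [← hxy, Int.le_floor, e8_add] at h4; push_cast at h4; rw [zpow_one] at h4; linarith
lemma nu_sub (k n : ℤ) (x y : ℝ) : nu k n x - nu k n y = 8^k * (x - y) := by unfold nu; ring
/-- same scale interval comparability -/
lemma II_comp {k j : ℤ} {x y : ℝ} {k0 n0 : ℤ} (h : k0 ≤ k) (hx : x ∈ II k j) (hy : y ∈ II k j) :
    |nu k0 n0 x - nu k0 n0 y| ≤ 1 := by
  rw [nu_sub]
  have h1 := mem_II.1 hx; have h2 := mem_II.1 hy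
  have : |(8:ℝ)^k * (x - y)| ≤ 1 := by rw [abs_le]; constructor <;> linarith
  rw [abs_mul, abs_of_pos (e8 _)] at this ⊢
  exact (mul_le_mul_of_nonneg_right (e8_le h) (abs_nonneg _)).trans this
lemma II_W {k j : ℤ} {x y : ℝ} {k0 n0 : ℤ} (h : k0 ≤ k) (hx : x ∈ II k j) (hy : y ∈ II k j) :
    W (nu k0 n0 x) ≤ 2 * W (nu k0 n0 y) := W_le_two (II_comp h hx hy)
/-- P, single interval -/
lemma P1 {p : ℕ} (hp : 2 ≤ p) {k j k0 n0 : ℤ} (h : k0 ≤ k) {x : ℝ} (hx : x ∈ II k j) :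
    8^(-k) * W (nu k0 n0 x) ^ p ≤ 2^p * ∫ y in II k j, W (nu k0 n0 y) ^ p := by
  have h1 : ∫ y in II k j, W (nu k0 n0 x) ^ p ≤ ∫ y in II k j, 2^p * W (nu k0 n0 y) ^ p := by
    apply setIntegral_mono_on
    · rw [integrableOn_const_iff]; right; rw [II_vol]; exact ENNReal.ofReal_lt_top
    · exact ((intWn hp k0 n0).const_mul _).integrableOn
    · exact II_meas _ _
    · intro y hy; rw [← mul_pow]; exact pow_le_pow_left₀ (W_nn _) (II_W h hx hy) p
  rw [setIntegral_const, II_real, integral_const_mul] at h1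
  exact h1
lemma P2 {ι : Type*} {p : ℕ} (hp : 2 ≤ p) (S : Finset ι) (K J : ι → ℤ) (X : ι → ℝ) (k0 n0 : ℤ) (A : Set ℝ)
    (hK : ∀ i ∈ S, k0 ≤ K i) (hX : ∀ i ∈ S, X i ∈ II (K i) (J i)) (hS : ∀ i ∈ S, II (K i) (J i) ⊆ A)
    (hd : ∀ i ∈ S, ∀ j ∈ S, i ≠ j → Disjoint (II (K i) (J i)) (II (K j) (J j))) :
    ∑ i ∈ S, 8^(-K i) * W (nu k0 n0 (X i)) ^ p ≤ 2^p * ∫ y in A, W (nu k0 n0 y) ^ p := by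
  calc _ ≤ ∑ i ∈ S, 2^p * ∫ y in II (K i) (J i), W (nu k0 n0 y) ^ p :=
        Finset.sum_le_sum fun i hi => P1 hp (hK i hi) (hX i hi)
    _ = 2^p * ∫ y in ⋃ i ∈ S, II (K i) (J i), W (nu k0 n0 y) ^ p := by
        rw [← Finset.mul_sum, integral_biUnion_finset S (fun i _ => II_meas _ _) (fun i hi j hj h => hd i hi j hj h)
          (fun i _ => (intWn hp k0 n0).integrableOn)]
    _ ≤ _ := by
        gcongr
        · exact ae_of_all _ fun x => pow_nonneg (W_nn _) _
        · exact (intWn hp k0 n0).integrableOn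
        · exact (iUnion₂_subset hS)
lemma sumW {p : ℕ} (hp : 2 ≤ p) (S : Finset ℤ) (t : ℝ) : ∑ n ∈ S, W (t - n) ^ p ≤ 2^p * 4 := by
  have h := P2 hp S (fun _ => 0) (fun n => -n) (fun n => t - n - ⌊t⌋ + (0:ℝ)) 0 (-⌊t⌋) univ
    (fun _ _ => le_rfl) ?_ (fun _ _ => subset_univ _) ?_
  · refine le_trans (le_of_eq ?_) (h.trans (mul_le_mul_of_nonneg_left (setW_le hp 0 _ _) (by positivity)) |>.trans ?_)
    · apply Finset.sum_congr rfl; intro n _; simp [nu]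
    · simp
  · intro n _; rw [mem_II]; push_cast; simp
    constructor <;> linarith [Int.floor_le t, Int.lt_floor_add_one t]
  · intro i _ j _ hij; rw [Set.disjoint_left]; intro x h1 h2
    exact hij (by have := II_disj h1 h2; omega)
/-- G: geometric sums over scales -/
lemma geoUp (S : Finset ℤ) (k0 : ℤ) (h : ∀ k ∈ S, k0 ≤ k) : ∑ k ∈ S, (8:ℝ)^(-k) ≤ 2 * 8^(-k0) := by
  have h1 : ∑ k ∈ S, (8:ℝ)^(-k) = ∑ j ∈ S.image (fun k => (k - k0).toNat), 8^(-k0) * (1/8:ℝ)^j := by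
    rw [Finset.sum_image]
    · apply Finset.sum_congr rfl; intro k hk
      have := h k hk
      obtain ⟨j, rfl⟩ := Int.le.dest this
      simp [e8_add, mul_comm]
    · intro a ha b hb hab; have := h a ha; have := h b hb; dsimp at hab; omega
  rw [h1, ← Finset.mul_sum, mul_comm]
  gcongr
  calc _ ≤ ∑' j : ℕ, (1/8:ℝ)^j := (summable_geometric_of_lt_one (by norm_num) (by norm_num)).sum_le_tsum _
          (fun _ _ => by positivity)
    _ ≤ 2 := by rw [tsum_geometric_of_lt_one (by norm_num) (by norm_num)]; norm_num
end Carl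
end
noncomputable section
namespace Carl
open scoped FourierTransform SchwartzMap ContDiff
def ee (x : ℝ) : ℂ := Complex.exp ((2 * Real.pi * x : ℝ) * Complex.I)
lemma ee_norm (x : ℝ) : ‖ee x‖ = 1 := Complex.norm_exp_ofReal_mul_I _
lemma ee_add (x y : ℝ) : ee (x + y) = ee x * ee y := by
  unfold ee; rw [← Complex.exp_add]; congr 1; push_cast; ring
lemma ee_neg (x : ℝ) : ee (-x) = (starRingEnd ℂ) (ee x) := by
  unfold ee; rw [← Complex.exp_conj]; congr 1; rw [map_mul, Complex.conj_ofReal, Complex.conj_I]; push_cast; ring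
@[fun_prop] lemma ee_cont : Continuous ee := by unfold ee; fun_prop
@[fun_prop] lemma ee_meas : Measurable ee := ee_cont.measurable
lemma fourier_ee (g : ℝ → ℂ) (ξ : ℝ) : 𝓕 g ξ = ∫ x, ee (-(x * ξ)) * g x := by
  rw [Real.fourier_real_eq_integral_exp_smul]
  refine integral_congr_ae (ae_of_all _ fun x => ?_)
  simp only [smul_eq_mul, ee]; congr 2; push_cast; ring
lemma ex_packet (c r R : ℝ) (hr : 0 < r) (hrR : r < R) : ∃ (χ : ℝ → ℝ) (φ : 𝓢(ℝ, ℂ)),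
    (∀ x, 𝓕 (φ : ℝ → ℂ) x = (χ x : ℂ)) ∧ (∀ x, 0 ≤ χ x) ∧ (∀ x, χ x ≤ 1) ∧ (∀ x, |x - c| ≤ r → χ x = 1) ∧
    (∀ x, R ≤ |x - c| → χ x = 0) ∧ Continuous χ := by
  let b : ContDiffBump c := ⟨r, R, hr, hrR⟩
  have hc : HasCompactSupport (fun x => ((b x : ℝ) : ℂ)) :=
    b.hasCompactSupport.comp_left (g := fun y : ℝ => (y : ℂ)) (by simp)
  have hs : ContDiff ℝ ∞ (fun x => ((b x : ℝ) : ℂ)) := Complex.ofRealCLM.contDiff.comp b.contDiff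
  refine ⟨b, 𝓕⁻ (hc.toSchwartzMap hs), ?_, fun x => b.nonneg, fun x => b.le_one, ?_, ?_, b.continuous⟩
  · intro x
    rw [← SchwartzMap.fourier_coe, FourierTransform.fourier_fourierInv_eq]; rfl
  · intro x hx; exact b.one_of_mem_closedBall (by rwa [Metric.mem_closedBall, Real.dist_eq])
  · intro x hx; exact b.zero_of_le_dist (by rwa [Real.dist_eq])
def chi : ℝ → ℝ := (ex_packet (1/16) (1/32) (1/16) (by norm_num) (by norm_num)).choose
def phi : 𝓢(ℝ, ℂ) := (ex_packet (1/16) (1/32) (1/16) (by norm_num) (by norm_num)).choose_spec.choose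
lemma phi_spec : (∀ x, 𝓕 (phi : ℝ → ℂ) x = (chi x : ℂ)) ∧ (∀ x, 0 ≤ chi x) ∧ (∀ x, chi x ≤ 1) ∧
    (∀ x, |x - 1/16| ≤ 1/32 → chi x = 1) ∧ (∀ x, 1/16 ≤ |x - 1/16| → chi x = 0) ∧ Continuous chi :=
  (ex_packet (1/16) (1/32) (1/16) (by norm_num) (by norm_num)).choose_spec.choose_spec
def etah : ℝ → ℝ := (ex_packet 0 (1/8) (3/8) (by norm_num) (by norm_num)).choose
def eta : 𝓢(ℝ, ℂ) := (ex_packet 0 (1/8) (3/8) (by norm_num) (by norm_num)).choose_spec.choose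
lemma eta_spec : (∀ x, 𝓕 (eta : ℝ → ℂ) x = (etah x : ℂ)) ∧ (∀ x, 0 ≤ etah x) ∧ (∀ x, etah x ≤ 1) ∧
    (∀ x, |x - 0| ≤ 1/8 → etah x = 1) ∧ (∀ x, 3/8 ≤ |x - 0| → etah x = 0) ∧ Continuous etah :=
  (ex_packet 0 (1/8) (3/8) (by norm_num) (by norm_num)).choose_spec.choose_spec
lemma schwartz_bd (f : 𝓢(ℝ, ℂ)) : ∃ C : ℝ, 1 ≤ C ∧ (∀ x, ‖f x‖ ≤ C * W x ^ 20) ∧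
    (∀ x, ‖deriv f x‖ ≤ C * W x ^ 20) := by
  have h := fun n (hn : n ≤ 1) (x : ℝ) =>
    SchwartzMap.one_add_le_sup_seminorm_apply (𝕜 := ℝ) (m := (20,1)) (k := 20) (n := n) le_rfl hn f x
  set C := 2 ^ (20,1).1 * (Finset.Iic (20,1)).sup (fun m => SchwartzMap.seminorm ℝ m.1 m.2) f with hC
  have aux : ∀ x a : ℝ, (1 + ‖x‖)^20 * a ≤ C → a ≤ max C 1 * W x ^ 20 := by
    intro x a ha
    unfold W
    rw [inv_pow, ← div_eq_mul_inv, le_div_iff₀ (by positivity)]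
    rw [Real.norm_eq_abs] at ha
    calc _ = _ := mul_comm _ _
      _ ≤ _ := ha
      _ ≤ _ := le_max_left _ _
  refine ⟨max C 1, le_max_right _ _, fun x => aux x _ ?_, fun x => aux x _ ?_⟩
  · have := h 0 (by norm_num) x; rwa [norm_iteratedFDeriv_zero] at this
  · have := h 1 le_rfl x; rwa [norm_iteratedFDeriv_one, ← norm_deriv_eq_norm_fderiv] at this
def Cp : ℝ := max (schwartz_bd phi).choose (schwartz_bd eta).choose
lemma Cp1 : 1 ≤ Cp := (schwartz_bd phi).choose_spec.1.trans (le_max_left _ _)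
lemma Cp0 : 0 < Cp := one_pos.trans_le Cp1
lemma phi_bd (x : ℝ) : ‖phi x‖ ≤ Cp * W x ^ 20 := ((schwartz_bd phi).choose_spec.2.1 x).trans
  (mul_le_mul_of_nonneg_right (le_max_left _ _) (pow_nonneg (W_nn _) _))
lemma eta_bd (x : ℝ) : ‖eta x‖ ≤ Cp * W x ^ 20 := ((schwartz_bd eta).choose_spec.2.1 x).trans
  (mul_le_mul_of_nonneg_right (le_max_right _ _) (pow_nonneg (W_nn _) _))
def sc (φ : ℝ → ℂ) (k : ℤ) (c : ℝ) (x : ℝ) : ℂ := (((8:ℝ)^k : ℝ) : ℂ) * φ (8^k * x) * ee (c * 8^k * x)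
lemma sc_norm (φ : ℝ → ℂ) (k : ℤ) (c : ℝ) (x : ℝ) : ‖sc φ k c x‖ = 8^k * ‖φ (8^k * x)‖ := by
  unfold sc; rw [norm_mul, norm_mul, ee_norm, mul_one]; congr 1
  simp
lemma sc_cont {φ : ℝ → ℂ} (h : Continuous φ) (k : ℤ) (c : ℝ) : Continuous (sc φ k c) := by
  unfold sc; fun_prop
lemma sc_int {φ : ℝ → ℂ} (h : Continuous φ) (hi : Integrable φ) (k : ℤ) (c : ℝ) : Integrable (sc φ k c) := by
  refine (((hi.comp_mul_left' (e8 k).ne').const_mul ((8:ℝ)^k : ℂ))).mono (sc_cont h k c).aestronglyMeasurable ?_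
  refine ae_of_all _ fun x => ?_
  rw [sc_norm]; simp
lemma sc_fourier (φ : ℝ → ℂ) (k : ℤ) (c ξ : ℝ) : 𝓕 (sc φ k c) ξ = 𝓕 φ (8^(-k) * ξ - c) := by
  rw [fourier_ee, fourier_ee]
  have := Measure.integral_comp_mul_left (fun x => ee (-(x * (8^(-k) * ξ - c))) * φ x) ((8:ℝ)^k)
  have h8 := e8 k
  rw [abs_of_pos (by positivity)] at this
  have h2 : ∫ x, ee (-(x * (8^(-k) * ξ - c))) * φ x =
      ((8:ℝ)^k : ℂ) * ∫ x, ee (-(8^k * x * (8^(-k) * ξ - c))) * φ (8^k * x) := by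
    rw [this, Complex.real_smul, ← mul_assoc]; push_cast
    rw [mul_inv_cancel₀ (zpow_ne_zero _ (by norm_num)), one_mul]
  rw [h2, ← integral_const_mul]
  refine integral_congr_ae (ae_of_all _ fun x => ?_)
  simp only [sc]
  have h3 : -(8^k * x * (8^(-k) * ξ - c)) = -(x*ξ) + c * 8^k * x := by linear_combination (-x * ξ) * e8_neg k
  rw [h3, ee_add]; push_cast; ring
lemma conv_eq {A B D : ℝ → ℂ} (hA : Integrable A) (hB : Integrable B) (hBc : Continuous B)
    (hBb : ∃ M, ∀ x, ‖B x‖ ≤ M) (hD : Integrable D) (hDc : Continuous D) (hD' : Integrable (𝓕 D))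
    (h : ∀ ξ, 𝓕 A ξ * 𝓕 B ξ = 𝓕 D ξ) (x : ℝ) : ∫ z, A z * B (x - z) = D x := by
  have h1 : 𝓕 (convolution A B (ContinuousLinearMap.mul ℂ ℂ) volume) = 𝓕 D := by
    ext ξ; rw [Real.fourier_mul_convolution_eq hA hB, h]
  have hc : Continuous (convolution A B (ContinuousLinearMap.mul ℂ ℂ) volume) := by
    obtain ⟨M, hM⟩ := hBb
    refine BddAbove.continuous_convolution_right_of_integrable _ ⟨M, ?_⟩ hA hBc
    rintro _ ⟨x, rfl⟩; exact hM x
  have h2 := Continuous.fourierInv_fourier_eq hc (hA.integrable_convolution _ hB) (by rw [h1]; exact hD')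
  rw [h1, Continuous.fourierInv_fourier_eq hDc hD hD'] at h2
  rw [h2]; rfl
def ph (k m : ℤ) : ℝ → ℂ := sc phi k m
def et (k : ℤ) (ξ : ℝ) : ℝ → ℂ := sc eta k (8^(-k) * ξ)
@[fun_prop] lemma ph_cont (k m : ℤ) : Continuous (ph k m) := sc_cont phi.continuous _ _
@[fun_prop] lemma et_cont (k : ℤ) (ξ : ℝ) : Continuous (et k ξ) := sc_cont eta.continuous _ _
@[fun_prop] lemma ph_meas (k m : ℤ) : Measurable (ph k m) := (ph_cont k m).measurable
@[fun_prop] lemma et_meas (k : ℤ) (ξ : ℝ) : Measurable (et k ξ) := (et_cont k ξ).measurable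
lemma ph_int (k m : ℤ) : Integrable (ph k m) := sc_int phi.continuous phi.integrable _ _
lemma et_int (k : ℤ) (ξ : ℝ) : Integrable (et k ξ) := sc_int eta.continuous eta.integrable _ _
lemma ph_bd (k m : ℤ) (x : ℝ) : ‖ph k m x‖ ≤ Cp * 8^k * W (8^k * x) ^ 20 := by
  unfold ph; rw [sc_norm]; have := phi_bd (8^k * x); have := e8 k; nlinarith
lemma et_bd (k : ℤ) (ξ x : ℝ) : ‖et k ξ x‖ ≤ Cp * 8^k * W (8^k * x) ^ 20 := by
  unfold et; rw [sc_norm]; have := eta_bd (8^k * x); have := e8 k; nlinarith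
lemma ph_bd' (k m : ℤ) (x : ℝ) : ‖ph k m x‖ ≤ Cp * 8^k := (ph_bd k m x).trans <| by
  have h1 := pow_le_one₀ (n := 20) (W_nn (8^k * x)) (W_le_one _)
  have := mul_pos Cp0 (e8 k); nlinarith
lemma et_bd' (k : ℤ) (ξ x : ℝ) : ‖et k ξ x‖ ≤ Cp * 8^k := (et_bd k ξ x).trans <| by
  have h1 := pow_le_one₀ (n := 20) (W_nn (8^k * x)) (W_le_one _)
  have := mul_pos Cp0 (e8 k); nlinarith
lemma ph_fourier (k m : ℤ) (ξ : ℝ) : 𝓕 (ph k m) ξ = (chi (nu (-k) m ξ) : ℂ) := by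
  unfold ph; rw [sc_fourier, phi_spec.1]; rfl
lemma et_fourier (k : ℤ) (ξ0 ξ : ℝ) : 𝓕 (et k ξ0) ξ = (etah (8^(-k) * (ξ - ξ0)) : ℂ) := by
  unfold et; rw [sc_fourier, eta_spec.1]; congr 2; ring
lemma chi_supp {x : ℝ} (h : chi x ≠ 0) : 0 < x ∧ x < 1/8 := by
  have : ¬ _ := fun h' => h (phi_spec.2.2.2.2.1 x h')
  rw [not_le, abs_lt] at this; constructor <;> linarith
lemma ph_fourier_int (k m : ℤ) : Integrable (𝓕 (ph k m)) := by
  have h1 : 𝓕 (ph k m) = fun ξ => 𝓕 (phi : ℝ → ℂ) (8^(-k) * ξ - m) := by ext ξ; exact sc_fourier _ _ _ _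
  rw [h1, ← SchwartzMap.fourier_coe]
  exact ((𝓕 phi).integrable.comp_sub_right (m:ℝ)).comp_mul_left' (e8 (-k)).ne'
lemma chi_om1 {k m : ℤ} {ξ : ℝ} (h : chi (nu (-k) m ξ) ≠ 0) : ξ ∈ om1 k m := by
  have := chi_supp h
  exact ⟨nu_II.2 ⟨this.1.le, by linarith⟩, this.2⟩
lemma ph_orth {k m k' m' : ℤ} (h : Disjoint (om1 k m) (om1 k' m')) (x : ℝ) :
    ∫ z, ph k m z * ph k' m' (x - z) = 0 := by
  refine conv_eq (D := 0) (ph_int k m) (ph_int _ _) (ph_cont _ _) ⟨_, ph_bd' _ _⟩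
    (integrable_zero _ _ _) continuous_zero ?_ (fun ξ => ?_) x
  · have : 𝓕 (0 : ℝ → ℂ) = 0 := by ext ξ; rw [fourier_ee]; simp
    rw [this]; exact integrable_zero _ _ _
  · rw [ph_fourier, ph_fourier, fourier_ee]
    simp only [Pi.zero_apply, mul_zero, integral_zero, mul_eq_zero, Complex.ofReal_eq_zero]
    by_contra! hc
    exact Set.disjoint_left.1 h (chi_om1 hc.1) (chi_om1 hc.2)
lemma phi_conj (x : ℝ) : (starRingEnd ℂ) (phi x) = phi (-x) := by
  have h := Continuous.fourierInv_fourier_eq phi.continuous phi.integrable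
    (by rw [← SchwartzMap.fourier_coe]; exact (𝓕 phi).integrable)
  rw [← h, Real.fourierInv_eq_fourier_neg, Real.fourierInv_eq_fourier_neg, fourier_ee, fourier_ee,
    ← integral_conj]
  refine integral_congr_ae (ae_of_all _ fun y => ?_)
  simp only [map_mul]
  rw [← ee_neg, phi_spec.1, Complex.conj_ofReal]; congr 2; ring
lemma ph_conj (k m : ℤ) (x : ℝ) : (starRingEnd ℂ) (ph k m x) = ph k m (-x) := by
  unfold ph sc
  rw [map_mul, map_mul, phi_conj, ← ee_neg, Complex.conj_ofReal]; congr 3 <;> ring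
/-- inner products of packets vanish -/
lemma ph_orth' {k m k' m' : ℤ} (h : Disjoint (om1 k m) (om1 k' m')) (y y' : ℝ) :
    ∫ z, ph k m (y - z) * (starRingEnd ℂ) (ph k' m' (y' - z)) = 0 := by
  rw [← ph_orth h (y - y'), ← integral_sub_left_eq_self (fun z => ph k m z * ph k' m' (y - y' - z)) _ y]
  refine integral_congr_ae (ae_of_all _ fun z => ?_)
  simp only [ph_conj]; congr 2; ring
lemma om1_cases {k m k' m' : ℤ} (h : ¬ Disjoint (om1 k m) (om1 k' m')) :
    (k = k' ∧ m = m') ∨ (k < k' ∧ II (-k) m ⊆ om1 k' m') ∨ (k' < k ∧ II (-k') m' ⊆ om1 k m) := by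
  obtain ⟨x, hx, hx'⟩ := Set.not_disjoint_iff.1 h
  rcases lt_trichotomy k k' with hk | rfl | hk
  · exact .inr (.inl ⟨hk, om1_nest hk hx.1 hx'⟩)
  · exact .inl ⟨rfl, II_disj hx.1 hx'.1⟩
  · exact .inr (.inr ⟨hk, om1_nest hk hx'.1 hx⟩)
/-- in a 2-tree: coarse frequency cutoffs -/
lemma ph_eta {k m κ : ℤ} {ξ : ℝ} (h : ξ ∈ om2 k m) (x : ℝ) :
    ∫ z, ph k m z * et κ ξ (x - z) = if k < κ then ph k m x else 0 := by
  have hm : ∀ ζ, chi (nu (-k) m ζ) ≠ 0 → 8^k * (3/8) < ξ - ζ ∧ ξ - ζ < 8^k := by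
    intro ζ hζ
    have h1 := chi_supp hζ
    have h2 := h.2; have h3 := (nu_II.1 h.1).2
    have h4 := nu_sub (-k) m ξ ζ
    have h5 : ξ - ζ = 8^k * (nu (-k) m ξ - nu (-k) m ζ) := by rw [h4, ← mul_assoc, e8_neg, one_mul]
    rw [h5]
    have := e8 k
    constructor <;> nlinarith
  split_ifs with hk
  · refine conv_eq (ph_int k m) (et_int _ _) (et_cont _ _) ⟨_, et_bd' _ _⟩
      (ph_int k m) (ph_cont k m) (ph_fourier_int k m) (fun ζ => ?_) x
    rw [ph_fourier, et_fourier]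
    by_cases hz : chi (nu (-k) m ζ) = 0
    · simp [hz]
    · have h1 := hm ζ hz
      rw [eta_spec.2.2.2.1, Complex.ofReal_one, mul_one]
      have h2 : (8:ℝ)^k * 8 ≤ 8^κ := by
        have := e8_le (show k + 1 ≤ κ by omega); rwa [e8_add, zpow_one] at this
      have h3 := e8_neg' κ
      have h4 := e8 (-κ)
      have h5 := e8 k
      rw [abs_le]; constructor
      · nlinarith
      · nlinarith
  · refine conv_eq (D := 0) (ph_int k m) (et_int _ _) (et_cont _ _) ⟨_, et_bd' _ _⟩
      (integrable_zero _ _ _) continuous_zero ?_ (fun ζ => ?_) x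
    · have : 𝓕 (0 : ℝ → ℂ) = 0 := by ext ξ; rw [fourier_ee]; simp
      rw [this]; exact integrable_zero _ _ _
    · rw [ph_fourier, et_fourier, fourier_ee]
      simp only [Pi.zero_apply, mul_zero, integral_zero, mul_eq_zero, Complex.ofReal_eq_zero]
      by_contra! hc
      have h1 := hm ζ hc.1
      apply hc.2
      apply eta_spec.2.2.2.2.1
      have h2 : (8:ℝ)^κ ≤ 8^k := e8_le (by omega)
      have h3 := e8_neg' κ
      have h4 := e8 (-κ)
      rw [sub_zero, abs_mul, abs_of_pos h4, abs_sub_comm, abs_of_pos (by nlinarith [e8 k])]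
      nlinarith
end Carl
end
noncomputable section
namespace Carl
open scoped FourierTransform SchwartzMap ContDiff
lemma D1 (p : ℕ) {k k' : ℤ} (h : k ≤ k') (x x' : ℝ) :
    ∫ z, (8^k * W (8^k * (x - z)) ^ (p+2)) * (8^k' * W (8^k' * (x' - z)) ^ (p+2)) ≤
      4 * 8^k * W (8^k * (x - x')) ^ p := by
  have hi : Integrable (fun z => 8^k' * W (8^k' * (x' - z)) ^ 2) := by
    have := (intWa (p := 2) le_rfl (e8 k') (8^k' * x')).const_mul ((8:ℝ)^k')
    refine this.congr (ae_of_all _ fun z => ?_)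
    simp only; rw [← W_neg]; congr 3; ring
  have hv : ∫ z, 8^k' * W (8^k' * (x' - z)) ^ 2 ≤ 4 := by
    have := intWa_le (p := 2) le_rfl (e8 k') (8^k' * x')
    rw [integral_const_mul]
    have h2 : ∫ z, W (8^k' * (x' - z)) ^ 2 = ∫ z, W (8^k' * z - 8^k' * x') ^ 2 := by
      congr 1; ext z; rw [← W_neg]; congr 2; ring
    rw [h2]
    have h8 := e8 k'
    calc _ ≤ (8:ℝ)^k' * (4 * ((8:ℝ)^k')⁻¹) := by gcongr
      _ = 4 := by field_simp
  have key : ∀ z, (8^k * W (8^k * (x - z)) ^ (p+2)) * (8^k' * W (8^k' * (x' - z)) ^ (p+2)) ≤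
      8^k * W (8^k * (x - x')) ^ p * (8^k' * W (8^k' * (x' - z)) ^ 2) := by
    intro z
    have h1 : W (8^k' * (x' - z)) ≤ W (8^k * (x' - z)) := by
      apply W_anti; rw [abs_mul, abs_mul, abs_of_pos (e8 k), abs_of_pos (e8 k')]; gcongr; norm_num
    have h2 : W (8^k * (x - z)) * W (8^k' * (x' - z)) ≤ W (8^k * (x - x')) := by
      calc _ ≤ W (8^k * (x - z)) * W (-(8^k * (x' - z))) := by
            rw [W_neg]; exact mul_le_mul_of_nonneg_left h1 (W_nn _)
        _ ≤ _ := by refine (W_mul_le _ _).trans (le_of_eq ?_); congr 1; ring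
    have h3 := pow_le_pow_left₀ (mul_nonneg (W_nn _) (W_nn _)) h2 p
    have h4 := pow_le_one₀ (n := 2) (W_nn (8^k * (x - z))) (W_le_one _)
    have e1 : (8^k * W (8^k * (x - z)) ^ (p+2)) * (8^k' * W (8^k' * (x' - z)) ^ (p+2)) =
      8^k * (W (8^k * (x - z)) * W (8^k' * (x' - z))) ^ p * (8^k' * W (8^k' * (x' - z)) ^ 2) *
        W (8^k * (x - z)) ^ 2 := by ring
    rw [e1]
    have h5 := W_nn (8^k * (x - z)); have h6 := W_nn (8^k' * (x' - z))
    have h8 := e8 k'; have h9 := e8 k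
    calc _ ≤ 8^k * (W (8^k * (x - z)) * W (8^k' * (x' - z))) ^ p * (8^k' * W (8^k' * (x' - z)) ^ 2) * 1 := by
          gcongr
      _ ≤ _ := by rw [mul_one]; gcongr
  calc _ ≤ ∫ z, 8^k * W (8^k * (x - x')) ^ p * (8^k' * W (8^k' * (x' - z)) ^ 2) := by
        apply integral_mono_of_nonneg
        · exact ae_of_all _ fun z => by
            have h5 := W_nn (8^k * (x - z)); have h6 := W_nn (8^k' * (x' - z)); positivity
        · exact hi.const_mul _
        · exact ae_of_all _ key
    _ = 8^k * W (8^k * (x - x')) ^ p * ∫ z, 8^k' * W (8^k' * (x' - z)) ^ 2 := integral_const_mul _ _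
    _ ≤ 8^k * W (8^k * (x - x')) ^ p * 4 := by have := W_nn (8^k * (x - x')); gcongr
    _ = _ := by ring
/-- off-interval sums -/
lemma Q0 (S : Finset ℤ) (k kT nT : ℤ) (hS : ∀ n ∈ S, II k n ⊆ II kT nT) :
    ∑ n ∈ S, ∫ y in (II kT nT)ᶜ, W (nu k n y) ^ 4 ≤ 128 * 8^(-k) := by
  set A : ℝ := nT * 8^(-kT)
  set B : ℝ := (nT + 1) * 8^(-kT)
  have hI := II_eq kT nT
  rw [← integral_finsetSum _ (fun n _ => (intWn (by norm_num) k n).integrableOn)]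
  have hA := intWa (p := 2) le_rfl (e8 k) (8^k * A)
  have hB := intWa (p := 2) le_rfl (e8 k) (8^k * B)
  have hpt : ∀ y ∈ (II kT nT)ᶜ, ∑ n ∈ S, W (nu k n y) ^ 4 ≤
      16 * (W (8^k * y - 8^k * A) ^ 2 + W (8^k * y - 8^k * B) ^ 2) := by
    intro y hy
    have h1 : ∀ n ∈ S, W (nu k n y) ^ 2 ≤ W (8^k * y - 8^k * A) ^ 2 + W (8^k * y - 8^k * B) ^ 2 := by
      intro n hn
      have hs := hS n hn
      rw [hI, II_eq k n] at hs
      have hlt : (n:ℝ) * 8^(-k) < (n+1) * 8^(-k) := by have := e8 (-k); nlinarith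
      obtain ⟨h2, h3⟩ := (Ico_subset_Ico_iff hlt).1 hs
      have h8 := e8 k
      have e1 := e8_neg' k
      have h2' : 8^k * A ≤ n := by
        calc 8^k * A ≤ 8^k * (n * 8^(-k)) := by gcongr
          _ = n := by linear_combination (n:ℝ) * e1
      have h3' : n + 1 ≤ 8^k * B := by
        calc (n:ℝ) + 1 = 8^k * ((n+1) * 8^(-k)) := by linear_combination (-(n:ℝ)-1) * e1
          _ ≤ _ := by gcongr
      have hW1 := pow_nonneg (W_nn (8^k * y - 8^k * A)) 2
      have hW2 := pow_nonneg (W_nn (8^k * y - 8^k * B)) 2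
      rw [hI, mem_compl_iff, mem_Ico, not_and_or, not_le, not_lt] at hy
      rcases hy with hy | hy
      · have : W (nu k n y) ≤ W (8^k * y - 8^k * A) := by
          have h0 : 8^k * y ≤ 8^k * A := by gcongr
          apply W_anti; unfold nu; rw [abs_of_nonpos (by linarith), abs_of_nonpos (by linarith)]; linarith
        have := pow_le_pow_left₀ (W_nn _) this 2; linarith
      · have : W (nu k n y) ≤ W (8^k * y - 8^k * B) := by
          have h0 : 8^k * B ≤ 8^k * y := by gcongr
          apply W_anti; unfold nu; rw [abs_of_nonneg (by linarith), abs_of_nonneg (by linarith)]; linarith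
        have := pow_le_pow_left₀ (W_nn _) this 2; linarith
    calc ∑ n ∈ S, W (nu k n y) ^ 4 ≤ ∑ n ∈ S, (W (8^k * y - 8^k * A) ^ 2 + W (8^k * y - 8^k * B) ^ 2) * W (8^k * y - n) ^ 2 := by
          apply Finset.sum_le_sum; intro n hn
          have := h1 n hn
          have h0 := pow_nonneg (W_nn (nu k n y)) 2
          calc W (nu k n y) ^ 4 = W (nu k n y) ^ 2 * W (nu k n y) ^ 2 := by ring
            _ ≤ _ := mul_le_mul_of_nonneg_right this h0
      _ ≤ _ := by
          rw [← Finset.mul_sum, mul_comm]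
          have := sumW le_rfl S (8^k * y)
          have hW1 := pow_nonneg (W_nn (8^k * y - 8^k * A)) 2
          have hW2 := pow_nonneg (W_nn (8^k * y - 8^k * B)) 2
          gcongr; linarith
  calc _ ≤ ∫ y in (II kT nT)ᶜ, 16 * (W (8^k * y - 8^k * A) ^ 2 + W (8^k * y - 8^k * B) ^ 2) := by
        apply setIntegral_mono_on
        · exact (integrable_finsetSum _ fun n _ => intWn (by norm_num) k n).integrableOn
        · exact ((hA.add hB).const_mul _).integrableOn
        · exact (II_meas _ _).compl
        · exact hpt
    _ ≤ ∫ y, 16 * (W (8^k * y - 8^k * A) ^ 2 + W (8^k * y - 8^k * B) ^ 2) := by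
        apply setIntegral_le_integral ((hA.add hB).const_mul _)
        exact ae_of_all _ fun y => by
          have hW1 := pow_nonneg (W_nn (8^k * y - 8^k * A)) 2
          have hW2 := pow_nonneg (W_nn (8^k * y - 8^k * B)) 2
          simp only [Pi.zero_apply, Pi.add_apply]; linarith
    _ ≤ _ := by
        rw [integral_const_mul, integral_add hA hB, zpow_neg]
        linarith [intWa_le (p := 2) le_rfl (e8 k) (8^k * A), intWa_le (p := 2) le_rfl (e8 k) (8^k * B)]
lemma Q1 (S : Finset Tile) (kT nT : ℤ) (hS : ∀ s ∈ S, II s.1 s.2.1 ⊆ II kT nT)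
    (hinj : ∀ s ∈ S, ∀ t ∈ S, s.1 = t.1 → s.2.1 = t.2.1 → s = t) :
    ∑ s ∈ S, ∫ y in (II kT nT)ᶜ, W (nu s.1 s.2.1 y) ^ 4 ≤ 256 * 8^(-kT) := by
  classical
  rw [← Finset.sum_fiberwise_of_maps_to (s := S) (t := S.image Prod.fst) (g := Prod.fst)
    (fun s hs => Finset.mem_image_of_mem _ hs)]
  calc _ ≤ ∑ k ∈ S.image Prod.fst, 128 * (8:ℝ)^(-k) := by
        apply Finset.sum_le_sum; intro k _
        have h1 : ∑ s ∈ S.filter (fun s => s.1 = k), ∫ y in (II kT nT)ᶜ, W (nu s.1 s.2.1 y) ^ 4 =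
          ∑ n ∈ (S.filter (fun s => s.1 = k)).image (fun s => s.2.1), ∫ y in (II kT nT)ᶜ, W (nu k n y) ^ 4 := by
          rw [Finset.sum_image]
          · apply Finset.sum_congr rfl; intro s hs; rw [(Finset.mem_filter.1 hs).2]
          · intro s hs t ht hst
            simp only [Finset.coe_filter, mem_ofPred_eq] at hs ht
            exact hinj s hs.1 t ht.1 (hs.2.trans ht.2.symm) hst
        rw [h1]; apply Q0
        intro n hn
        obtain ⟨s, hs, rfl⟩ := Finset.mem_image.1 hn
        rw [Finset.mem_filter] at hs
        rw [← hs.2]; exact hS s hs.1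
    _ ≤ _ := by
        rw [← Finset.mul_sum]
        have := geoUp (S.image Prod.fst) kT (by
          intro k hk; obtain ⟨s, hs, rfl⟩ := Finset.mem_image.1 hk; exact II_sub_scale (hS s hs))
        linarith
lemma schur (S : Finset Tile) (B : Tile → ℝ) :
    ∑ s ∈ S, ∑ t ∈ S, (if s.1 = t.1 ∧ s.2.2 = t.2.2 then
      B s * B t * 8^(-s.1) * W ((s.2.1 : ℝ) - t.2.1) ^ 2 else 0) ≤ 16 * ∑ s ∈ S, 8^(-s.1) * B s ^ 2 := by
  classical
  have key : ∀ s ∈ S, ∑ t ∈ S, (if s.1 = t.1 ∧ s.2.2 = t.2.2 then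
      8^(-s.1) * B s ^ 2 * W ((s.2.1 : ℝ) - t.2.1) ^ 2 else 0) ≤ 16 * (8^(-s.1) * B s ^ 2) := by
    intro s _
    rw [← Finset.sum_filter, ← Finset.mul_sum]
    have h1 : ∑ t ∈ S.filter (fun t => s.1 = t.1 ∧ s.2.2 = t.2.2), W ((s.2.1 : ℝ) - t.2.1) ^ 2 =
      ∑ n ∈ (S.filter (fun t => s.1 = t.1 ∧ s.2.2 = t.2.2)).image (fun t => t.2.1), W ((s.2.1 : ℝ) - n) ^ 2 := by
      rw [Finset.sum_image]
      intro a ha b hb hab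
      simp only [Finset.coe_filter, mem_ofPred_eq] at ha hb
      exact Prod.ext (ha.2.1.symm.trans hb.2.1) (Prod.ext hab (ha.2.2.symm.trans hb.2.2))
    rw [h1]
    have h2 := sumW le_rfl ((S.filter (fun t => s.1 = t.1 ∧ s.2.2 = t.2.2)).image (fun t => t.2.1)) (s.2.1:ℝ)
    have h3 : (0:ℝ) ≤ 8^(-s.1) * B s ^ 2 := by positivity
    nlinarith
  have sym : ∑ s ∈ S, ∑ t ∈ S, (if s.1 = t.1 ∧ s.2.2 = t.2.2 then
      8^(-s.1) * B t ^ 2 * W ((s.2.1 : ℝ) - t.2.1) ^ 2 else 0) =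
      ∑ s ∈ S, ∑ t ∈ S, (if s.1 = t.1 ∧ s.2.2 = t.2.2 then
      8^(-s.1) * B s ^ 2 * W ((s.2.1 : ℝ) - t.2.1) ^ 2 else 0) := by
    rw [Finset.sum_comm]
    apply Finset.sum_congr rfl; intro s _; apply Finset.sum_congr rfl; intro t _
    by_cases h : s.1 = t.1 ∧ s.2.2 = t.2.2
    · rw [if_pos h, if_pos ⟨h.1.symm, h.2.symm⟩, h.1, ← W_neg, neg_sub]
    · rw [if_neg h, if_neg (fun h' => h ⟨h'.1.symm, h'.2.symm⟩)]
  calc _ ≤ ∑ s ∈ S, ∑ t ∈ S, ((1/2) * (if s.1 = t.1 ∧ s.2.2 = t.2.2 then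
      8^(-s.1) * B s ^ 2 * W ((s.2.1 : ℝ) - t.2.1) ^ 2 else 0) + (1/2) * (if s.1 = t.1 ∧ s.2.2 = t.2.2 then
      8^(-s.1) * B t ^ 2 * W ((s.2.1 : ℝ) - t.2.1) ^ 2 else 0)) := by
        apply Finset.sum_le_sum; intro s _; apply Finset.sum_le_sum; intro t _
        split_ifs
        · have h1 : (0:ℝ) ≤ 8^(-s.1) * W ((s.2.1 : ℝ) - t.2.1) ^ 2 := by positivity
          nlinarith [mul_nonneg h1 (sq_nonneg (B s - B t))]
        · simp
    _ = ∑ s ∈ S, ∑ t ∈ S, (if s.1 = t.1 ∧ s.2.2 = t.2.2 then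
      8^(-s.1) * B s ^ 2 * W ((s.2.1 : ℝ) - t.2.1) ^ 2 else 0) := by
        simp only [Finset.sum_add_distrib, ← Finset.mul_sum]; rw [sym]; ring
    _ ≤ _ := by rw [Finset.mul_sum]; exact Finset.sum_le_sum key
lemma gram {ι : Type*} (S : Finset ι) (h : ι → ℝ → ℂ)
    (hi : ∀ s ∈ S, ∀ t ∈ S, Integrable (fun x => h s x * (starRingEnd ℂ) (h t x))) :
    ∫ x, ‖∑ s ∈ S, h s x‖ ^ 2 ≤ ∑ s ∈ S, ∑ t ∈ S, ‖∫ x, h s x * (starRingEnd ℂ) (h t x)‖ := by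
  have h1 : ∀ x, ((‖∑ s ∈ S, h s x‖ ^ 2 : ℝ) : ℂ) = ∑ s ∈ S, ∑ t ∈ S, h s x * (starRingEnd ℂ) (h t x) := by
    intro x
    push_cast
    rw [← Complex.mul_conj', map_sum, Finset.sum_mul_sum]
  have h2 : ((∫ x, ‖∑ s ∈ S, h s x‖ ^ 2 : ℝ) : ℂ) = ∑ s ∈ S, ∑ t ∈ S, ∫ x, h s x * (starRingEnd ℂ) (h t x) := by
    rw [← integral_complex_ofReal]
    simp only [h1]
    rw [integral_finsetSum _ (fun s hs => integrable_finsetSum _ fun t ht => hi s hs t ht)]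
    exact Finset.sum_congr rfl fun s hs => integral_finsetSum _ fun t ht => hi s hs t ht
  have h3 : 0 ≤ ∫ x, ‖∑ s ∈ S, h s x‖ ^ 2 := integral_nonneg fun x => by positivity
  calc _ = ‖((∫ x, ‖∑ s ∈ S, h s x‖ ^ 2 : ℝ) : ℂ)‖ := by
        rw [Complex.norm_real, Real.norm_of_nonneg h3]
    _ ≤ _ := by
        rw [h2]
        exact (norm_sum_le _ _).trans (Finset.sum_le_sum fun s _ => norm_sum_le _ _)
lemma fub {g K H : ℝ → ℂ} (hg : Integrable g) (hK : Integrable K) (hH : AEStronglyMeasurable H volume)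
    {M : ℝ} (hM : ∀ x, ‖H x‖ ≤ M) :
    ∫ x, (∫ y, g y * K (x - y)) * H x = ∫ y, g y * ∫ x, K (x - y) * H x := by
  have h0 := hg.convolution_integrand (ContinuousLinearMap.mul ℝ ℂ) hK
  have h1 : Integrable (fun p : ℝ × ℝ => g p.2 * K (p.1 - p.2) * H p.1) (volume.prod volume) :=
    (Integrable.bdd_mul (c := M) h0 hH.comp_fst (ae_of_all _ fun p => hM p.1)).congr
      (ae_of_all _ fun p => by simp [mul_comm])
  calc _ = ∫ x, ∫ y, g y * K (x - y) * H x := by simp only [integral_mul_const]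
    _ = ∫ y, ∫ x, g y * K (x - y) * H x := integral_integral_swap h1
    _ = _ := by simp only [mul_assoc, integral_const_mul]
end Carl
end
noncomputable section
namespace Carl
lemma csE {f g : ℝ → ℝ≥0∞} (hf : AEMeasurable f) (hg : AEMeasurable g) :
    (∫⁻ x, f x * g x) ^ 2 ≤ (∫⁻ x, f x ^ 2) * ∫⁻ x, g x ^ 2 := by
  have h := ENNReal.lintegral_mul_le_Lp_mul_Lq volume (Real.HolderConjugate.two_two) hf hg
  have h2 := pow_le_pow_left' h 2
  refine h2.trans (le_of_eq ?_)
  rw [mul_pow, ← ENNReal.rpow_natCast, ← ENNReal.rpow_natCast, ← ENNReal.rpow_mul, ← ENNReal.rpow_mul]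
  norm_num
def aR (k : ℤ) (t : ℝ) : ℝ := 8^k * W (8^k * t) ^ 4
def aK (k : ℤ) (t : ℝ) : ℝ≥0∞ := ENNReal.ofReal (aR k t)
lemma aR_nn (k : ℤ) (t : ℝ) : 0 ≤ aR k t := by
  unfold aR; have := W_nn (8^k * t); positivity
@[fun_prop] lemma aR_cont (k : ℤ) : Continuous (aR k) := by unfold aR; fun_prop
@[fun_prop] lemma aK_meas (k : ℤ) : Measurable (aK k) := by unfold aK; fun_prop
lemma aR_neg (k : ℤ) (t : ℝ) : aR k (-t) = aR k t := by unfold aR; rw [mul_neg, W_neg]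
lemma aK_neg (k : ℤ) (t : ℝ) : aK k (-t) = aK k t := by unfold aK; rw [aR_neg]
lemma aK_int (k : ℤ) (x : ℝ) : ∫⁻ y, aK k (x - y) ≤ 4 := by
  rw [lintegral_sub_left_eq_self (aK k)]
  have h1 := intWa (p := 4) (by norm_num) (e8 k) 0
  have h2 := intWa_le (p := 4) (by norm_num) (e8 k) 0
  simp only [sub_zero] at h1 h2
  have e : ∫⁻ y, aK k y = ENNReal.ofReal (∫ y, 8^k * W (8^k * y) ^ 4) :=
    (ofReal_integral_eq_lintegral_ofReal (h1.const_mul _) (ae_of_all _ (aR_nn k))).symm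
  rw [e, integral_const_mul, show (4:ℝ≥0∞) = ENNReal.ofReal 4 by simp]
  apply ENNReal.ofReal_le_ofReal
  calc _ ≤ (8:ℝ)^k * (4 * ((8:ℝ)^k)⁻¹) := by gcongr
    _ = 4 := by field_simp
lemma aR_mul {k k' : ℤ} (h : k ≤ k') (u v : ℝ) :
    aR k u * aR k' v ≤ 48 * aR k (u - v) * (aR k u + aR k' v) := by
  have h8 := e8 k
  have hd : |u - v| ≤ |u| + |v| := abs_sub _ _
  have nn1 := aR_nn k u; have nn2 := aR_nn k' v; have nn3 := aR_nn k (u - v)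
  by_cases hc : 8^k * |u - v| ≤ 1 ∨ |u - v| / 2 ≤ |u|
  · have h1 : W (8^k * u) ≤ 2 * W (8^k * (u - v)) := by
      rcases hc with hc | hc
      · have : 1/2 ≤ W (8^k * (u - v)) := by
          unfold W; rw [abs_mul, abs_of_pos h8, one_div]; gcongr; linarith
        linarith [W_le_one (8^k * u)]
      · unfold W
        rw [abs_mul, abs_mul, abs_of_pos h8, ← div_eq_mul_inv, inv_eq_one_div, div_le_div_iff₀ (by positivity) (by positivity)]
        nlinarith [abs_nonneg (u-v)]
    have h2 : aR k u ≤ 16 * aR k (u - v) := by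
      unfold aR
      have := pow_le_pow_left₀ (W_nn _) h1 4
      rw [mul_pow] at this; nlinarith
    nlinarith [mul_le_mul_of_nonneg_right h2 nn2, mul_nonneg nn3 nn1, mul_nonneg nn3 nn2]
  · push Not at hc
    have hv : |u - v| / 2 ≤ |v| := by linarith
    have h1 : W (8^k * v) ≤ 2 * W (8^k * (u - v)) := by
      unfold W
      rw [abs_mul, abs_mul, abs_of_pos h8, ← div_eq_mul_inv, inv_eq_one_div, div_le_div_iff₀ (by positivity) (by positivity)]
      nlinarith [abs_nonneg (u-v)]
    have h2 : 8^k' * W (8^k' * v) ≤ 3 * (8^k * W (8^k * v)) := by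
      unfold W
      have hr : 1/2 < 8^k * |v| := by nlinarith
      have h8' := e8 k'
      have hle := e8_le h
      rw [abs_mul, abs_mul, abs_of_pos h8, abs_of_pos h8', ← div_eq_mul_inv, ← div_eq_mul_inv,
        ← mul_div_assoc, div_le_div_iff₀ (by positivity) (by positivity)]
      nlinarith
    have h3 : W (8^k' * v) ≤ W (8^k * v) := by
      apply W_anti; rw [abs_mul, abs_mul, abs_of_pos h8, abs_of_pos (e8 k')]; gcongr; norm_num
    have h4 : aR k' v ≤ 48 * aR k (u - v) := by
      unfold aR
      have w0 := W_nn (8^k' * v); have w1 := W_nn (8^k * v)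
      calc 8^k' * W (8^k' * v) ^ 4 = (8^k' * W (8^k' * v)) * W (8^k' * v) ^ 3 := by ring
        _ ≤ (3 * (8^k * W (8^k * v))) * W (8^k * v) ^ 3 := by gcongr
        _ = 3 * 8^k * W (8^k * v) ^ 4 := by ring
        _ ≤ 3 * 8^k * (2 * W (8^k * (u - v))) ^ 4 := by gcongr
        _ = _ := by ring
    nlinarith [mul_le_mul_of_nonneg_right h4 nn1, mul_nonneg nn3 nn1, mul_nonneg nn3 nn2]
lemma aK_conv0 {k k' : ℤ} (h : k ≤ k') (x x' : ℝ) :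
    ∫⁻ y, aK k (x - y) * aK k' (x' - y) ≤ 384 * aK k (x - x') := by
  calc _ ≤ ∫⁻ y, 48 * aK k (x - x') * (aK k (x - y) + aK k' (x' - y)) := by
        apply lintegral_mono; intro y; dsimp only
        have := aR_mul h (x - y) (x' - y)
        rw [sub_sub_sub_cancel_right] at this
        unfold aK
        rw [← ENNReal.ofReal_mul (aR_nn _ _), ← ENNReal.ofReal_add (aR_nn _ _) (aR_nn _ _),
          show (48:ℝ≥0∞) = ENNReal.ofReal 48 by simp, ← ENNReal.ofReal_mul (by norm_num),
          ← ENNReal.ofReal_mul (mul_nonneg (by norm_num) (aR_nn _ _))]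
        exact ENNReal.ofReal_le_ofReal this
    _ = 48 * aK k (x - x') * ((∫⁻ y, aK k (x - y)) + ∫⁻ y, aK k' (x' - y)) := by
        rw [lintegral_const_mul _ (by fun_prop), lintegral_add_left (by fun_prop)]
    _ ≤ 48 * aK k (x - x') * (4 + 4) := by gcongr <;> apply aK_int
    _ = _ := by rw [mul_right_comm]; norm_num
lemma aK_conv (k k' : ℤ) (x x' : ℝ) :
    ∫⁻ y, aK k (x - y) * aK k' (x' - y) ≤ 384 * (aK k (x - x') + aK k' (x' - x)) := by
  rcases le_total k k' with h | h
  · exact (aK_conv0 h x x').trans (by gcongr; exact le_self_add)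
  · simp only [mul_comm (aK k _)]
    exact (aK_conv0 h x' x).trans (by gcongr; exact le_add_self)
def Av (κ : ℝ → ℤ) (g : ℝ → ℝ≥0∞) (x : ℝ) : ℝ≥0∞ := ∫⁻ y, g y * aK (κ x) (x - y)
lemma aKκ_meas {κ : ℝ → ℤ} (hκ : Measurable κ) : Measurable (fun p : ℝ × ℝ => aK (κ p.1) (p.1 - p.2)) := by
  have : Measurable (fun q : ℤ × ℝ => aK q.1 q.2) := measurable_from_prod_countable_right (fun k => aK_meas k)
  exact this.comp ((hκ.comp measurable_fst).prodMk (measurable_fst.sub measurable_snd))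
lemma Av_meas {κ : ℝ → ℤ} (hκ : Measurable κ) {g : ℝ → ℝ≥0∞} (hg : Measurable g) : Measurable (Av κ g) :=
  Measurable.lintegral_prod_right' (f := fun p : ℝ × ℝ => g p.2 * aK (κ p.1) (p.1 - p.2))
    ((hg.comp measurable_snd).mul (aKκ_meas hκ))
lemma young (k : ℤ) {g : ℝ → ℝ≥0∞} (hg : Measurable g) :
    ∫⁻ x, (∫⁻ y, g y * aK k (x - y)) ^ 2 ≤ 16 * ∫⁻ y, g y ^ 2 := by
  have h1 : ∀ x, (∫⁻ y, g y * aK k (x - y)) ^ 2 ≤ (∫⁻ y, g y ^ 2 * aK k (x - y)) * 4 := by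
    intro x
    have hs : ∀ y, aK k (x - y) = ENNReal.ofReal (Real.sqrt (aR k (x - y))) ^ 2 := by
      intro y; rw [← ENNReal.ofReal_pow (Real.sqrt_nonneg _), Real.sq_sqrt (aR_nn _ _)]; rfl
    have := csE (f := fun y => g y * ENNReal.ofReal (Real.sqrt (aR k (x - y))))
      (g := fun y => ENNReal.ofReal (Real.sqrt (aR k (x - y)))) (by fun_prop) (by fun_prop)
    simp only [mul_assoc, mul_pow, ← pow_two, ← hs] at this
    exact this.trans (by gcongr; exact aK_int k x)
  calc _ ≤ ∫⁻ x, (∫⁻ y, g y ^ 2 * aK k (x - y)) * 4 := lintegral_mono h1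
    _ = (∫⁻ y, g y ^ 2 * ∫⁻ x, aK k (x - y)) * 4 := by
        rw [lintegral_mul_const' _ _ (by simp), lintegral_lintegral_swap (by fun_prop)]
        congr 2; ext y; rw [lintegral_const_mul _ (by fun_prop)]
    _ ≤ (∫⁻ y, g y ^ 2 * 4) * 4 := by
        gcongr with y
        refine le_trans (le_of_eq ?_) (aK_int k y)
        congr 1; ext x; rw [← aK_neg, neg_sub]
    _ = _ := by rw [lintegral_mul_const' _ _ (by simp), mul_assoc, mul_comm]; norm_num
def QQ (κ : ℝ → ℤ) (c : ℝ≥0∞) : Prop := ∀ g : ℝ → ℝ≥0∞, Measurable g →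
  ∫⁻ x, Av κ g x ^ 2 ≤ c * ∫⁻ x, g x ^ 2
lemma QQ0 {κ : ℝ → ℤ} (𝒦 : Finset ℤ) (h𝒦 : ∀ x, κ x ∈ 𝒦) : QQ κ (𝒦.card * 16) := by
  intro g hg
  calc _ ≤ ∫⁻ x, ∑ k ∈ 𝒦, (∫⁻ y, g y * aK k (x - y)) ^ 2 := by
        apply lintegral_mono; intro x
        exact Finset.single_le_sum (f := fun k => (∫⁻ y, g y * aK k (x - y)) ^ 2) (fun _ _ => zero_le) (h𝒦 x)
    _ = ∑ k ∈ 𝒦, ∫⁻ x, (∫⁻ y, g y * aK k (x - y)) ^ 2 := by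
        apply lintegral_finsetSum
        intro k _
        exact (Measurable.lintegral_prod_right' (f := fun p : ℝ × ℝ => g p.2 * aK k (p.1 - p.2))
          (by fun_prop)).pow_const 2
    _ ≤ ∑ k ∈ 𝒦, 16 * ∫⁻ y, g y ^ 2 := Finset.sum_le_sum fun k _ => young k hg
    _ = _ := by rw [Finset.sum_const, nsmul_eq_mul, mul_assoc]
lemma symB {B : ℝ × ℝ → ℝ≥0∞} (hB : Measurable B) :
    ∫⁻ x, ∫⁻ x', (384 * B (x, x') + 384 * B (x', x)) = 768 * ∫⁻ x, ∫⁻ x', B (x, x') := by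
  have m1 : Measurable fun x => ∫⁻ x', B (x, x') := hB.lintegral_prod_right'
  have m2 : Measurable fun x => ∫⁻ x', B (x', x) := (hB.comp measurable_swap).lintegral_prod_right'
  have b1 : ∀ x, Measurable fun x' => B (x, x') := fun x => hB.comp (measurable_const.prodMk measurable_id)
  have b2 : ∀ x, Measurable fun x' => B (x', x) := fun x => hB.comp (measurable_id.prodMk measurable_const)
  have e : ∀ x, ∫⁻ x', (384 * B (x, x') + 384 * B (x', x)) = 384 * (∫⁻ x', B (x, x')) + 384 * ∫⁻ x', B (x', x) := by
    intro x
    rw [lintegral_add_left ((b1 x).const_mul _), lintegral_const_mul _ (b1 x), lintegral_const_mul _ (b2 x)]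
  simp only [e]
  rw [lintegral_add_left (m1.const_mul _), lintegral_const_mul _ m1, lintegral_const_mul _ m2,
    lintegral_lintegral_swap (f := fun x x' => B (x', x)) (hB.comp measurable_swap).aemeasurable, ← add_mul]
  norm_num
lemma QQ_step {κ : ℝ → ℤ} (hκ : Measurable κ) {c0 : ℝ≥0∞} (hc0 : c0 ≠ ∞) (h0 : QQ κ c0) {c : ℝ≥0∞} (hcp : c ≠ 0)
    (h : QQ κ (c^2)) : QQ κ (768 * c) := by
  intro g hg
  set H := Av κ g with hH
  have hHm : Measurable H := Av_meas hκ hg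
  set X := ∫⁻ x, H x ^ 2
  set Y := ∫⁻ x, g x ^ 2
  by_cases hY : Y = ∞
  · rw [hY, ENNReal.mul_top (by simp [hcp])]; exact le_top
  have hX : X ≠ ∞ := ne_top_of_le_ne_top (ENNReal.mul_ne_top hc0 hY) (h0 g hg)
  by_cases hX0 : X = 0
  · rw [hX0]; exact zero_le
  have hkm := aKκ_meas hκ
  have hkm' : Measurable (fun p : ℝ × ℝ => aK (κ p.2) (p.2 - p.1)) := hkm.comp measurable_swap
  set As : ℝ → ℝ≥0∞ := fun y => ∫⁻ x, H x * aK (κ x) (x - y)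
  have hAs : Measurable As := Measurable.lintegral_prod_right'
    (f := fun p : ℝ × ℝ => H p.2 * aK (κ p.2) (p.2 - p.1)) ((hHm.comp measurable_snd).mul hkm')
  have e1 : X = ∫⁻ y, g y * As y := by
    calc X = ∫⁻ x, ∫⁻ y, H x * (g y * aK (κ x) (x - y)) := by
          apply lintegral_congr; intro x
          rw [lintegral_const_mul _ (by exact hg.mul (hkm.comp (measurable_const.prodMk measurable_id))), pow_two]
          rfl
      _ = ∫⁻ y, ∫⁻ x, H x * (g y * aK (κ x) (x - y)) := by
          apply lintegral_lintegral_swap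
          exact ((hHm.comp measurable_fst).mul ((hg.comp measurable_snd).mul hkm)).aemeasurable
      _ = _ := by
          apply lintegral_congr; intro y
          rw [← lintegral_const_mul _ (by exact hHm.mul (hkm.comp (measurable_id.prodMk measurable_const)))]
          apply lintegral_congr; intro x; ring
  have e2 : X ^ 2 ≤ Y * ∫⁻ y, As y ^ 2 := by
    conv_lhs => rw [e1]
    exact csE hg.aemeasurable hAs.aemeasurable
  have hAH : Measurable (Av κ H) := Av_meas hκ hHm
  have e3 : ∫⁻ y, As y ^ 2 ≤ 768 * ∫⁻ x, H x * Av κ H x := by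
    have hk1 : ∀ x, Measurable fun y => aK (κ x) (x - y) := fun x => hkm.comp (measurable_const.prodMk measurable_id)
    have hk2 : ∀ y, Measurable fun x => aK (κ x) (x - y) := fun y => hkm.comp (measurable_id.prodMk measurable_const)
    have hint : Measurable (fun p : ℝ × ℝ => H p.1 * H p.2 * aK (κ p.1) (p.1 - p.2)) := by fun_prop
    calc ∫⁻ y, As y ^ 2 = ∫⁻ y, ∫⁻ x, ∫⁻ x', H x * H x' * (aK (κ x) (x - y) * aK (κ x') (x' - y)) := by
          apply lintegral_congr; intro y
          rw [pow_two]
          rw [← lintegral_mul_const'' _ (by exact (hHm.mul (hk2 y)).aemeasurable)]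
          apply lintegral_congr; intro x
          rw [← lintegral_const_mul _ (by exact hHm.mul (hk2 y))]
          apply lintegral_congr; intro x'; ring
      _ = ∫⁻ x, ∫⁻ y, ∫⁻ x', H x * H x' * (aK (κ x) (x - y) * aK (κ x') (x' - y)) := by
          apply lintegral_lintegral_swap
          refine (Measurable.lintegral_prod_right' (f := fun p : (ℝ × ℝ) × ℝ =>
            H p.1.2 * H p.2 * (aK (κ p.1.2) (p.1.2 - p.1.1) * aK (κ p.2) (p.2 - p.1.1))) ?_).aemeasurable
          have a1 : Measurable (fun p : (ℝ × ℝ) × ℝ => aK (κ p.1.2) (p.1.2 - p.1.1)) := hkm'.comp measurable_fst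
          have a2 : Measurable (fun p : (ℝ × ℝ) × ℝ => aK (κ p.2) (p.2 - p.1.1)) :=
            hkm.comp (f := fun p : (ℝ × ℝ) × ℝ => (p.2, p.1.1)) (by fun_prop)
          fun_prop
      _ = ∫⁻ x, ∫⁻ x', H x * H x' * ∫⁻ y, (aK (κ x) (x - y) * aK (κ x') (x' - y)) := by
          apply lintegral_congr; intro x
          rw [lintegral_lintegral_swap]
          · apply lintegral_congr; intro x'
            rw [lintegral_const_mul _ (by exact (hk1 x).mul (hk1 x'))]
          · have a1 : Measurable (fun p : ℝ × ℝ => aK (κ x) (x - p.1)) := (hk1 x).comp measurable_fst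
            refine Measurable.aemeasurable ?_
            simp only [Function.uncurry_def]
            fun_prop
      _ ≤ ∫⁻ x, ∫⁻ x', (384 * (H x * H x' * aK (κ x) (x - x')) + 384 * (H x' * H x * aK (κ x') (x' - x))) := by
          apply lintegral_mono; intro x; apply lintegral_mono; intro x'
          refine (mul_le_mul_right (aK_conv (κ x) (κ x') x x') _).trans (le_of_eq ?_)
          ring
      _ = 768 * (∫⁻ x, ∫⁻ x', H x * H x' * aK (κ x) (x - x')) := symB hint
      _ = _ := by
          congr 1; apply lintegral_congr; intro x
          rw [Av, ← lintegral_const_mul _ (by exact hHm.mul (hk1 x))]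
          apply lintegral_congr; intro x'; ring
  have e4 : ∫⁻ x, H x * Av κ H x ≤ c * X := by
    have h1 := csE hHm.aemeasurable hAH.aemeasurable
    have h2 : (∫⁻ x, H x * Av κ H x) ^ 2 ≤ (c * X) ^ 2 := by
      refine h1.trans ((mul_le_mul_right (h H hHm) _).trans (le_of_eq ?_)); ring
    exact (ENNReal.pow_le_pow_left_iff (n := 2) (by norm_num)).1 h2
  have e5 : X * X ≤ (768 * c * Y) * X := by
    rw [← pow_two]
    refine e2.trans ((mul_le_mul_right (e3.trans (mul_le_mul_right e4 _)) _).trans (le_of_eq ?_)); ring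
  exact (ENNReal.mul_le_mul_iff_left hX0 hX).1 e5
lemma maximal_lin {κ : ℝ → ℤ} (hκ : Measurable κ) (𝒦 : Finset ℤ) (h𝒦 : ∀ x, κ x ∈ 𝒦) :
    QQ κ (768^2 * 4) := by
  have h0 := QQ0 𝒦 h𝒦
  have hfin : (𝒦.card * 16 : ℝ≥0∞) ≠ ∞ := by finiteness
  have mono : ∀ {a b : ℝ≥0∞}, a ≤ b → QQ κ a → QQ κ b := fun hab h g hg => (h g hg).trans (by gcongr)
  obtain ⟨n, hn⟩ : ∃ n : ℕ, (𝒦.card * 16 : ℝ≥0∞) ≤ 768^2 * 4^(2^n) := by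
    refine ⟨𝒦.card, ?_⟩
    have h1 : 𝒦.card * 16 ≤ 768^2 * 4^(2^𝒦.card) := by
      have : 𝒦.card < 2 ^ 𝒦.card := Nat.lt_two_pow_self
      have h2 : 2^𝒦.card < 4 ^ (2^𝒦.card) := Nat.lt_pow_self (by norm_num)
      omega
    exact_mod_cast h1
  have h1 : QQ κ (768^2 * 4^(2^n)) := mono hn h0
  clear hn
  induction n with
  | zero => simpa using h1
  | succ n ih =>
    apply ih
    have := QQ_step hκ hfin h0 (c := 768 * 4^(2^n)) (by simp) (by rw [mul_pow, ← pow_mul, ← pow_succ]; exact h1)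
    rwa [← mul_assoc, ← pow_two] at this
lemma argmax (𝒦 : Finset ℤ) (hne : 𝒦.Nonempty) (u : ℤ → ℝ → ℝ≥0∞) (hu : ∀ k, Measurable (u k)) :
    ∃ κ : ℝ → ℤ, Measurable κ ∧ (∀ x, κ x ∈ 𝒦) ∧ ∀ x, ∀ k ∈ 𝒦, u k x ≤ u (κ x) x := by
  classical
  induction hne using Finset.Nonempty.cons_induction with
  | singleton a => exact ⟨fun _ => a, measurable_const, by simp, by simp⟩
  | cons a s ha hs ih =>
    obtain ⟨κ, h1, h2, h3⟩ := ih
    have hm : Measurable (fun x => u (κ x) x) := by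
      have : Measurable (fun q : ℤ × ℝ => u q.1 q.2) := measurable_from_prod_countable_right hu
      exact this.comp (h1.prodMk measurable_id)
    refine ⟨fun x => if u (κ x) x ≤ u a x then a else κ x,
      Measurable.ite (measurableSet_le hm (hu a)) measurable_const h1, fun x => ?_, fun x k hk => ?_⟩
    · dsimp only; split_ifs <;> simp [h2]
    · rw [Finset.mem_cons] at hk; dsimp only
      split_ifs with hc
      · rcases hk with rfl | hk
        · exact le_rfl
        · exact (h3 x k hk).trans hc
      · rcases hk with rfl | hk
        · exact (not_le.1 hc).le
        · exact h3 x k hk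
/-- maximal theorem -/
lemma maximal (𝒦 : Finset ℤ) (hne : 𝒦.Nonempty) {g : ℝ → ℝ≥0∞} (hg : Measurable g) :
    ∃ M : ℝ → ℝ≥0∞, Measurable M ∧ (∀ x, ∀ k ∈ 𝒦, ∫⁻ y, g y * aK k (x - y) ≤ M x) ∧
      ∫⁻ x, M x ^ 2 ≤ 768^2 * 4 * ∫⁻ x, g x ^ 2 := by
  obtain ⟨κ, h1, h2, h3⟩ := argmax 𝒦 hne (fun k x => ∫⁻ y, g y * aK k (x - y)) (fun k =>
    (Measurable.lintegral_prod_right' (f := fun p : ℝ × ℝ => g p.2 * aK k (p.1 - p.2)) (by fun_prop)))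
  exact ⟨Av κ g, Av_meas h1 hg, h3, maximal_lin h1 𝒦 h2 g hg⟩
end Carl
end
noncomputable section
namespace Carl
abbrev Is (s : Tile) : Set ℝ := II s.1 s.2.1
abbrev om (s : Tile) : Set ℝ := II (-s.1) s.2.2
abbrev o2 (s : Tile) : Set ℝ := om2 s.1 s.2.2
abbrev nus (s : Tile) (x : ℝ) : ℝ := nu s.1 s.2.1 x
structure Nice (f : ℝ → ℂ) : Prop where
  m : Measurable f
  i : Integrable f
  b : ∃ M, ∀ x, ‖f x‖ ≤ M
def Fw (f : ℝ → ℂ) (k m : ℤ) (x : ℝ) : ℂ := ∫ y, f y * ph k m (x - y)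
def Psi (f : ℝ → ℂ) (s : Tile) (x : ℝ) : ℂ := ∫ y, (Is s).indicator (Fw f s.1 s.2.2) y * ph s.1 s.2.2 (x - y)
lemma conv_meas {f g : ℝ → ℂ} (hf : Measurable f) (hg : Measurable g) : Measurable (fun x => ∫ y, f y * g (x - y)) := by
  have : StronglyMeasurable (fun p : ℝ × ℝ => f p.2 * g (p.1 - p.2)) := by
    apply Measurable.stronglyMeasurable; fun_prop
  exact this.integral_prod_right'.measurable
lemma conv_int {f g : ℝ → ℂ} (hf : Integrable f) (hg : Integrable g) : Integrable (fun x => ∫ y, f y * g (x - y)) :=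
  hf.integrable_convolution (ContinuousLinearMap.mul ℝ ℂ) hg
lemma Fw_bd {f : ℝ → ℂ} (hf : Integrable f) (k m : ℤ) (x : ℝ) : ‖Fw f k m x‖ ≤ Cp * 8^k * ∫ y, ‖f y‖ := by
  refine (norm_integral_le_integral_norm _).trans ?_
  rw [← integral_const_mul]
  refine integral_mono_of_nonneg (ae_of_all _ fun _ => norm_nonneg _) (hf.norm.const_mul _) (ae_of_all _ fun y => ?_)
  dsimp only; rw [norm_mul, mul_comm]; gcongr; exact ph_bd' _ _ _
lemma Fw_meas {f : ℝ → ℂ} (hf : Measurable f) (k m : ℤ) : Measurable (Fw f k m) := conv_meas hf (ph_meas k m)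
lemma Fw_int {f : ℝ → ℂ} (hf : Integrable f) (k m : ℤ) : Integrable (Fw f k m) := conv_int hf (ph_int k m)
lemma near_max {u : ℝ → ℝ} {B : Set ℝ} (hB : B.Nonempty) {M : ℝ} (h0 : ∀ x, 0 ≤ u x) (hM : ∀ x, u x ≤ M) :
    ∃ y ∈ B, ∀ x ∈ B, u x ≤ 2 * u y := by
  by_contra hc
  push Not at hc
  obtain ⟨y, hy⟩ := hB
  obtain ⟨x, hx, hxy⟩ := hc y hy
  have hpos : 0 < u x := by linarith [h0 y]
  have : ∀ n : ℕ, ∃ z ∈ B, 2^n * u x ≤ u z := by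
    intro n
    induction n with
    | zero => exact ⟨x, hx, by simp⟩
    | succ n ih =>
      obtain ⟨z, hz, h⟩ := ih
      obtain ⟨w, hw, h'⟩ := hc z hz
      exact ⟨w, hw, by rw [pow_succ]; linarith⟩
  obtain ⟨n, hn⟩ := pow_unbounded_of_one_lt (M / u x) (by norm_num : (1:ℝ) < 2)
  obtain ⟨z, -, h⟩ := this n
  rw [div_lt_iff₀ hpos] at hn
  linarith [hM z]
lemma Fw_cont {f : ℝ → ℂ} (hf : Integrable f) (k m : ℤ) : Continuous (Fw f k m) := by
  refine continuous_of_dominated (bound := fun y => Cp * 8^k * ‖f y‖) (fun x => ?_) (fun x => ae_of_all _ fun y => ?_)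
    (hf.norm.const_mul _) (ae_of_all _ fun y => ?_)
  · exact hf.1.mul ((ph_cont k m).comp (by fun_prop : Continuous fun y => x - y)).aestronglyMeasurable
  · rw [norm_mul, mul_comm]; gcongr; exact ph_bd' _ _ _
  · exact continuous_const.mul ((ph_cont k m).comp (by fun_prop))
lemma Fw_sq_int {f : ℝ → ℂ} (hf : Integrable f) (s : Tile) : IntegrableOn (fun x => ‖Fw f s.1 s.2.2 x‖ ^ 2) (Is s) := by
  have h := ((Fw_cont hf s.1 s.2.2).norm.pow 2).continuousOn (s := Icc ((s.2.1:ℝ) * 8^(-s.1)) (((s.2.1:ℝ)+1) * 8^(-s.1)))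
  refine (h.integrableOn_compact isCompact_Icc).mono_set ?_
  rw [Is, II_eq]; exact Ico_subset_Icc_self
open Classical in
def ys (f : ℝ → ℂ) (s : Tile) : ℝ :=
  if h : ∃ y ∈ Is s, ‖Fw f s.1 s.2.2 y‖ ^ 2 = ⨍ x in Is s, ‖Fw f s.1 s.2.2 x‖ ^ 2 then h.choose else 0
def AA (f : ℝ → ℂ) (s : Tile) : ℝ := ‖Fw f s.1 s.2.2 (ys f s)‖
lemma AA_nn (f : ℝ → ℂ) (s : Tile) : 0 ≤ AA f s := norm_nonneg _
lemma ys_spec {f : ℝ → ℂ} (hf : Integrable f) (s : Tile) : ys f s ∈ Is s ∧ 8^(-s.1) * AA f s ^ 2 = ∫ x in Is s, ‖Fw f s.1 s.2.2 x‖ ^ 2 := by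
  have hi := Fw_sq_int hf s
  have h0 : volume (Is s) ≠ 0 := by rw [II_vol]; simpa using e8 _
  have h1 : volume (Is s) ≠ ∞ := by rw [II_vol]; exact ENNReal.ofReal_ne_top
  have h : ∃ y ∈ Is s, ‖Fw f s.1 s.2.2 y‖ ^ 2 = ⨍ x in Is s, ‖Fw f s.1 s.2.2 x‖ ^ 2 := by
    obtain ⟨a, ha, ha'⟩ := exists_le_setAverage h0 h1 hi
    obtain ⟨b, hb, hb'⟩ := exists_setAverage_le h0 h1 hi
    have hc : IsPreconnected (Is s) := by rw [Is, II_eq]; exact isPreconnected_Ico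
    exact hc.intermediate_value ha hb ((Fw_cont hf s.1 s.2.2).norm.pow 2).continuousOn ⟨ha', hb'⟩
  have e : ys f s = h.choose := by unfold ys; rw [dif_pos h]
  have := h.choose_spec
  rw [← e, setAverage_eq, II_real, smul_eq_mul] at this
  refine ⟨this.1, ?_⟩
  unfold AA; rw [this.2, mul_inv_cancel_left₀ (e8 _).ne']
lemma W_II {k n : ℤ} {x y : ℝ} (hy : y ∈ II k n) : W (8^k * (x - y)) ≤ 2 * W (nu k n x) := by
  apply W_le_two
  have := nu_II.1 hy
  unfold nu at *
  rw [abs_le]; constructor <;> nlinarith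
def Cq : ℝ := 2^21 * Cp
lemma Cq0 : 0 < Cq := mul_pos (by norm_num) Cp0
lemma Psi_meas {f : ℝ → ℂ} (hf : Measurable f) (s : Tile) : Measurable (Psi f s) :=
  conv_meas ((Fw_meas hf _ _).indicator (II_meas _ _)) (ph_meas _ _)
lemma Psi_int {f : ℝ → ℂ} (hf : Integrable f) (s : Tile) : Integrable (Psi f s) :=
  conv_int ((Fw_int hf _ _).indicator (II_meas _ _)) (ph_int _ _)
lemma Psi_eq (f : ℝ → ℂ) (s : Tile) (x : ℝ) : Psi f s x = ∫ y in Is s, Fw f s.1 s.2.2 y * ph s.1 s.2.2 (x - y) := by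
  unfold Psi
  rw [← integral_indicator (II_meas _ _)]
  congr 1; ext y; by_cases h : y ∈ Is s <;> simp [h]
/-- bound by any bound of F on I_s -/
lemma Psi_bd0 {f : ℝ → ℂ} (s : Tile) {B : ℝ} (hB : ∀ y ∈ Is s, ‖Fw f s.1 s.2.2 y‖ ≤ B) (x : ℝ) :
    ‖Psi f s x‖ ≤ 2^20 * Cp * B * W (nus s x) ^ 20 := by
  rw [Psi_eq]
  have hv : volume (Is s) < ∞ := by rw [II_vol]; exact ENNReal.ofReal_lt_top
  have hB0 : 0 ≤ B := (norm_nonneg _).trans (hB _ (cen_II _ _))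
  have hC := Cp0
  refine (norm_setIntegral_le_of_norm_le_const (C := B * (Cp * 8^s.1 * (2 * W (nus s x)) ^ 20)) hv (fun y hy => ?_)).trans ?_
  · rw [norm_mul]
    refine mul_le_mul (hB y hy) ((ph_bd _ _ _).trans ?_) (norm_nonneg _) hB0
    have := e8 s.1; have := W_nn (8^s.1 * (x - y))
    gcongr
    exact W_II hy
  · rw [II_real]
    apply le_of_eq
    have : (8:ℝ)^s.1 * 8^(-s.1) = 1 := by rw [← e8_add]; simp
    linear_combination (B * Cp * (2 * W (nus s x)) ^ 20) * this
lemma Psi_bd {f : ℝ → ℂ} (hf : Integrable f) (s : Tile) (x : ℝ) : ‖Psi f s x‖ ≤ Cq * AA f s * W (nus s x) ^ 20 := by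
  rw [Psi_eq]
  have hC := Cp0; have h8 := e8 s.1; have hw := W_nn (nus s x)
  have hi : IntegrableOn (fun y => ‖Fw f s.1 s.2.2 y‖) (Is s) := (Fw_int hf _ _).norm.integrableOn
  have hi2 := Fw_sq_int hf s
  have key : ∫ y in Is s, ‖Fw f s.1 s.2.2 y‖ ≤ AA f s * 8^(-s.1) := by
    rw [← div_le_iff₀ (e8 _)]
    refine le_of_forall_gt_imp_ge_of_dense fun B hB => ?_
    rw [div_le_iff₀ (e8 _)]
    have hA := AA_nn f s
    have hB0 : 0 < B := hA.trans_lt hB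
    calc _ ≤ ∫ y in Is s, (‖Fw f s.1 s.2.2 y‖ ^ 2 * (1 / (2 * B)) + B / 2) := by
          refine setIntegral_mono hi ((hi2.mul_const _).add ?_) fun y => ?_
          · refine integrableOn_const ?_
            rw [II_vol]; exact ENNReal.ofReal_ne_top
          · dsimp only
            rw [← sub_nonneg]
            have : ‖Fw f s.1 s.2.2 y‖ ^ 2 * (1 / (2 * B)) + B / 2 - ‖Fw f s.1 s.2.2 y‖ = (‖Fw f s.1 s.2.2 y‖ - B) ^ 2 / (2 * B) := by
              field_simp; ring
            rw [this]; positivity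
      _ = (AA f s ^ 2 / (2 * B) + B / 2) * 8^(-s.1) := by
          rw [integral_add (hi2.mul_const _) (by refine integrableOn_const ?_; rw [II_vol]; exact ENNReal.ofReal_ne_top),
            integral_mul_const, ← (ys_spec hf s).2, setIntegral_const, II_real, smul_eq_mul]; ring
      _ ≤ B * 8^(-s.1) := by
          refine mul_le_mul_of_nonneg_right ?_ (e8 _).le
          have : AA f s ^ 2 / (2 * B) ≤ B / 2 := by
            rw [div_le_iff₀ (by positivity)]; nlinarith
          linarith
  refine (norm_integral_le_integral_norm _).trans ?_
  calc _ ≤ ∫ y in Is s, ‖Fw f s.1 s.2.2 y‖ * (Cp * 8^s.1 * (2 * W (nus s x)) ^ 20) := by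
        refine integral_mono_of_nonneg (ae_of_all _ fun _ => norm_nonneg _) (hi.mul_const _) ?_
        refine (ae_restrict_iff' (II_meas _ _)).2 (ae_of_all _ fun y hy => ?_)
        dsimp only
        rw [norm_mul]
        refine mul_le_mul_of_nonneg_left ((ph_bd _ _ _).trans ?_) (norm_nonneg _)
        have := W_nn (8^s.1 * (x - y))
        gcongr
        exact W_II hy
    _ ≤ (AA f s * 8^(-s.1)) * (Cp * 8^s.1 * (2 * W (nus s x)) ^ 20) := by
        rw [integral_mul_const]; exact mul_le_mul_of_nonneg_right key (by positivity)
    _ = 2^20 * Cp * AA f s * W (nus s x) ^ 20 * (8^s.1 * 8^(-s.1)) := by ring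
    _ ≤ _ := by
        rw [e8_neg, mul_one]; unfold Cq
        have := AA_nn f s
        refine mul_le_mul_of_nonneg_right (mul_le_mul_of_nonneg_right ?_ this) (by positivity)
        nlinarith
lemma W_pow_le_one (t : ℝ) (n : ℕ) : W t ^ n ≤ 1 := pow_le_one₀ (W_nn t) (W_le_one t)
lemma Psi_bd' {f : ℝ → ℂ} (hf : Integrable f) (s : Tile) (x : ℝ) : ‖Psi f s x‖ ≤ Cq * AA f s :=
  (Psi_bd hf s x).trans (mul_le_of_le_one_right (mul_nonneg Cq0.le (AA_nn _ _)) (W_pow_le_one _ _))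
lemma Fw_norm_int {f : ℝ → ℂ} (hf : Integrable f) (s : Tile) : Integrable ((Is s).indicator (Fw f s.1 s.2.2)) :=
  (Fw_int hf _ _).indicator (II_meas _ _)
/-- same frequency pair estimate -/
lemma W_pair (k n n' : ℤ) : ∫ x, W (nu k n x) ^ 20 * W (nu k n' x) ^ 20 ≤ 4 * 8^(-k) * W ((n:ℝ) - n') ^ 2 := by
  have h : ∀ x, W (nu k n x) ^ 20 * W (nu k n' x) ^ 20 ≤ W ((n:ℝ) - n') ^ 2 * W (nu k n x) ^ 2 := by
    intro x
    have h1 : W (nu k n' x) * W (nu k n x) ≤ W ((n:ℝ) - n') := by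
      have := W_mul_le (nu k n' x) (-nu k n x)
      rw [W_neg] at this
      refine this.trans (le_of_eq ?_)
      unfold nu; congr 1; ring
    have := W_nn (nu k n x); have := W_nn (nu k n' x)
    calc W (nu k n x) ^ 20 * W (nu k n' x) ^ 20 = (W (nu k n' x) * W (nu k n x)) ^ 2 * (W (nu k n x) ^ 18 * W (nu k n' x) ^ 18) := by ring
      _ ≤ W ((n:ℝ) - n') ^ 2 * (W (nu k n x) ^ 2 * 1) := by
        gcongr ?_ ^ 2 * (?_ * ?_)
        · exact W_pow_anti (by norm_num) _
        · exact W_pow_le_one _ _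
      _ = _ := by ring
  calc _ ≤ ∫ x, W ((n:ℝ) - n') ^ 2 * W (nu k n x) ^ 2 :=
        integral_mono_of_nonneg (ae_of_all _ fun x => by have := W_nn (nu k n x); have := W_nn (nu k n' x); positivity)
          ((intWn le_rfl k n).const_mul _) (ae_of_all _ h)
    _ ≤ W ((n:ℝ) - n') ^ 2 * (4 * 8^(-k)) := by rw [integral_const_mul]; gcongr; exact intWn_le le_rfl k n
    _ = _ := by ring
lemma Psi_orth {f : ℝ → ℂ} (hf : Nice f) {s t : Tile} (h : Disjoint (om1 s.1 s.2.2) (om1 t.1 t.2.2)) :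
    ∫ x, Psi f s x * (starRingEnd ℂ) (Psi f t x) = 0 := by
  have hc : Measurable (fun x => (starRingEnd ℂ) (Psi f t x)) := Complex.continuous_conj.measurable.comp (Psi_meas hf.m t)
  have := fub (Fw_norm_int hf.i s) (ph_int s.1 s.2.2) (H := fun x => (starRingEnd ℂ) (Psi f t x))
    hc.aestronglyMeasurable (M := Cq * AA f t) (fun x => by rw [RCLike.norm_conj]; exact Psi_bd' hf.i t x)
  unfold Psi at this ⊢
  rw [this]
  have e : ∀ y, ∫ x, ph s.1 s.2.2 (x - y) * (starRingEnd ℂ) (Psi f t x) = 0 := by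
    intro y
    have h2 := fub (Fw_norm_int hf.i t) (ph_int t.1 t.2.2) (H := fun x => (starRingEnd ℂ) (ph s.1 s.2.2 (x - y)))
      (by apply Continuous.aestronglyMeasurable; exact Complex.continuous_conj.comp (by fun_prop))
      (M := Cp * 8^s.1) (fun x => by rw [RCLike.norm_conj]; exact ph_bd' _ _ _)
    have h3 : ∀ y', ∫ x, ph t.1 t.2.2 (x - y') * (starRingEnd ℂ) (ph s.1 s.2.2 (x - y)) = 0 := by
      intro y'
      rw [← ph_orth' h y y']
      congr 1; ext x
      rw [ph_conj, ph_conj, mul_comm]; congr 2 <;> ring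
    simp only [h3, mul_zero, integral_zero] at h2
    apply (starRingEnd ℂ).injective
    rw [← integral_conj, map_zero, ← h2]
    congr 1; ext x; rw [map_mul, Complex.conj_conj, mul_comm]; rfl
  unfold Psi at e
  simp only [e, mul_zero, integral_zero]
lemma om1_om2_disj (k m : ℤ) : Disjoint (om1 k m) (om2 k m) := by
  rw [Set.disjoint_left]; intro x h1 h2; have := h1.2; have := h2.2; linarith
lemma om2_om1 {ξ : ℝ} {s t : Tile} (hs : ξ ∈ o2 s) (ht : ξ ∈ o2 t) (h : s.1 ≠ t.1) : Disjoint (om1 s.1 s.2.2) (om1 t.1 t.2.2) := by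
  rcases lt_or_gt_of_ne h with h | h
  · exact ((om1_om2_disj _ _).mono_right ((om1_sub _ _).trans (om2_nest h hs.1 ht))).symm
  · exact ((om1_om2_disj _ _).mono_right ((om1_sub _ _).trans (om2_nest h ht.1 hs)))
lemma Psi_mul_int {f : ℝ → ℂ} (hf : Nice f) (s t : Tile) : Integrable (fun x => Psi f s x * (starRingEnd ℂ) (Psi f t x)) := by
  have hc : Measurable (fun x => (starRingEnd ℂ) (Psi f t x)) := Complex.continuous_conj.measurable.comp (Psi_meas hf.m t)
  exact (Psi_int hf.i s).mul_bdd (c := Cq * AA f t) hc.aestronglyMeasurable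
    (ae_of_all _ fun x => by rw [RCLike.norm_conj]; exact Psi_bd' hf.i t x)
lemma tree_orth {f : ℝ → ℂ} (hf : Nice f) (S : Finset Tile) (ξ : ℝ) (hS : ∀ s ∈ S, ξ ∈ o2 s) :
    ∫ x, ‖∑ s ∈ S, Psi f s x‖ ^ 2 ≤ 64 * Cq ^ 2 * ∑ s ∈ S, 8^(-s.1) * AA f s ^ 2 := by
  refine (gram S (Psi f) (fun s _ t _ => Psi_mul_int hf s t)).trans ?_
  have h := schur S (fun s => AA f s)
  calc _ ≤ ∑ s ∈ S, ∑ t ∈ S, 4 * Cq ^ 2 * (if s.1 = t.1 ∧ s.2.2 = t.2.2 then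
      AA f s * AA f t * 8^(-s.1) * W ((s.2.1 : ℝ) - t.2.1) ^ 2 else 0) := by
        refine Finset.sum_le_sum fun s hs => Finset.sum_le_sum fun t ht => ?_
        by_cases hk : s.1 = t.1
        · have hm : s.2.2 = t.2.2 := II_disj (hS s hs).1 (by rw [hk]; exact (hS t ht).1)
          rw [if_pos ⟨hk, hm⟩]
          refine (norm_integral_le_integral_norm _).trans ?_
          have a1 := AA_nn f s; have a2 := AA_nn f t; have q := Cq0
          calc _ ≤ ∫ x, (Cq ^ 2 * AA f s * AA f t) * (W (nu s.1 s.2.1 x) ^ 20 * W (nu s.1 t.2.1 x) ^ 20) := by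
                refine integral_mono_of_nonneg (ae_of_all _ fun x => norm_nonneg _) (Integrable.const_mul ?_ _) (ae_of_all _ fun x => ?_)
                · exact (intWn (by norm_num) _ _).mul_bdd (c := 1) (by fun_prop) (ae_of_all _ fun x => by
                    rw [Real.norm_of_nonneg (pow_nonneg (W_nn _) _)]; exact W_pow_le_one _ _)
                · dsimp only
                  rw [norm_mul, RCLike.norm_conj]
                  refine (mul_le_mul (Psi_bd hf.i s x) (Psi_bd hf.i t x) (norm_nonneg _) (by have := W_nn (nus s x); positivity)).trans (le_of_eq ?_)
                  rw [nus, nus, hk]; ring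
            _ ≤ (Cq ^ 2 * AA f s * AA f t) * (4 * 8^(-s.1) * W ((s.2.1:ℝ) - t.2.1) ^ 2) := by
                rw [integral_const_mul]; gcongr; exact W_pair _ _ _
            _ = _ := by ring
        · rw [if_neg (fun h => hk h.1), Psi_orth hf (om2_om1 (hS s hs) (hS t ht) hk)]; simp
    _ = 4 * Cq ^ 2 * ∑ s ∈ S, ∑ t ∈ S, (if s.1 = t.1 ∧ s.2.2 = t.2.2 then
      AA f s * AA f t * 8^(-s.1) * W ((s.2.1 : ℝ) - t.2.1) ^ 2 else 0) := by
        simp only [Finset.mul_sum]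
    _ ≤ 4 * Cq ^ 2 * (16 * ∑ s ∈ S, 8^(-s.1) * AA f s ^ 2) := by have := Cq0; gcongr
    _ = _ := by ring
open Classical in
def SizeLE (A : Tile → ℝ) (S : Finset Tile) (σ : ℝ) : Prop := ∀ (kT nT : ℤ) (ξ : ℝ),
  ∑ s ∈ S with (Is s ⊆ II kT nT ∧ ξ ∈ o2 s), 8^(-s.1) * A s ^ 2 ≤ σ ^ 2 * 8^(-kT)
def DensLE (E : Set ℝ) (N : ℝ → ℝ) (S : Finset Tile) (δ : ℝ) : Prop := ∀ s ∈ S, ∀ k n m : ℤ,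
  Is s ⊆ II k n → II (-k) m ⊆ om s → ∫ x in E ∩ N ⁻¹' (II (-k) m), W (nu k n x) ^ 6 ≤ δ * 8^(-k)
open Classical in
def TT (f : ℝ → ℂ) (N : ℝ → ℝ) (S : Finset Tile) (x : ℝ) : ℂ := ∑ s ∈ S, if N x ∈ o2 s then Psi f s x else 0
end Carl
end
noncomputable section
namespace Carl
open Classical
def cs (s : Tile) : ℝ := (s.2.1 : ℝ) * 8^(-s.1)
lemma cs_II (s : Tile) : cs s ∈ Is s := cen_II _ _
lemma nus_eq (s : Tile) (x : ℝ) : nus s x = 8^s.1 * (x - cs s) := by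
  have : (8:ℝ)^s.1 * 8^(-s.1) = 1 := by rw [← e8_add]; simp
  unfold nus nu cs; linear_combination (s.2.1:ℝ) * this
def far (T : Finset Tile) (k : ℤ) (x : ℝ) : Prop :=
  ∀ s ∈ T, k ≤ s.1 → 2 ≤ |⌊(8:ℝ)^k * cs s⌋ - ⌊(8:ℝ)^k * x⌋|
def KK (T : Finset Tile) (kT : ℤ) : ℕ := ∑ s ∈ T, (s.1 - kT).toNat + 1
lemma KK_lt {T : Finset Tile} (kT : ℤ) {s : Tile} (hs : s ∈ T) : s.1 < kT + KK T kT := by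
  have := Finset.single_le_sum (f := fun s : Tile => (s.1 - kT).toNat) (fun _ _ => Nat.zero_le _) hs
  unfold KK; omega
lemma far_KK (T : Finset Tile) (kT : ℤ) (x : ℝ) : far T (kT + KK T kT) x :=
  fun _ hs h => absurd (KK_lt kT hs) (not_lt.2 h)
lemma far_ex (T : Finset Tile) (kT : ℤ) (x : ℝ) : ∃ j : ℕ, far T (kT + j) x := ⟨_, far_KK T kT x⟩
def kJ (T : Finset Tile) (kT : ℤ) (x : ℝ) : ℤ := kT + (Nat.find (far_ex T kT x) : ℕ)
lemma far_congr {T : Finset Tile} {k : ℤ} {x y : ℝ} (h : ⌊(8:ℝ)^k * x⌋ = ⌊(8:ℝ)^k * y⌋) : far T k x ↔ far T k y := by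
  unfold far; rw [h]
lemma kJ_far (T : Finset Tile) (kT : ℤ) (x : ℝ) : far T (kJ T kT x) x := by
  unfold kJ; convert Nat.find_spec (far_ex T kT x)
lemma kJ_ge (T : Finset Tile) (kT : ℤ) (x : ℝ) : kT ≤ kJ T kT x := by unfold kJ; omega
lemma kJ_le (T : Finset Tile) (kT : ℤ) (x : ℝ) : kJ T kT x ≤ kT + KK T kT := by
  have := Nat.find_min' (far_ex T kT x) (far_KK T kT x)
  unfold kJ; convert add_le_add_right (Nat.cast_le (α := ℤ).2 this) kT
lemma kJ_min {T : Finset Tile} {kT k : ℤ} {x : ℝ} (h : kT ≤ k) (hf : far T k x) : kJ T kT x ≤ k := by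
  obtain ⟨j, rfl⟩ := Int.le.dest h
  have := Nat.find_min' (far_ex T kT x) hf
  unfold kJ; convert add_le_add_right (Nat.cast_le (α := ℤ).2 this) kT
lemma kJ_le' {T : Finset Tile} {kT k : ℤ} {x y : ℝ} (hk : kJ T kT x ≤ k) (h : ⌊(8:ℝ)^k * x⌋ = ⌊(8:ℝ)^k * y⌋) :
    kJ T kT y ≤ kJ T kT x :=
  kJ_min (kJ_ge _ _ _) ((far_congr (floor_nest hk h)).1 (kJ_far _ _ _))
lemma kJ_congr {T : Finset Tile} {kT k : ℤ} {x y : ℝ} (hk : kJ T kT x ≤ k) (h : ⌊(8:ℝ)^k * x⌋ = ⌊(8:ℝ)^k * y⌋) :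
    kJ T kT y = kJ T kT x :=
  le_antisymm (kJ_le' hk h) (kJ_le' ((kJ_le' hk h).trans hk) h.symm)
lemma kJ_meas (T : Finset Tile) (kT : ℤ) : Measurable (kJ T kT) := by
  have h : Measurable fun x => Nat.find (far_ex T kT x) := by
    refine measurable_find (far_ex T kT) (fun j => ?_)
    have : {x | far T (kT + j) x} = ⋂ s ∈ T, {x | kT + j ≤ s.1 → 2 ≤ |⌊(8:ℝ)^(kT + j : ℤ) * cs s⌋ - ⌊(8:ℝ)^(kT + j : ℤ) * x⌋|} := by
      ext x; simp [far]
    rw [this]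
    refine Finset.measurableSet_biInter _ fun s _ => ?_
    by_cases hc : kT + j ≤ s.1
    · simp only [hc, true_imp_iff]
      have hm : Measurable fun x : ℝ => |⌊(8:ℝ)^(kT + j : ℤ) * cs s⌋ - ⌊(8:ℝ)^(kT + j : ℤ) * x⌋| :=
        (measurable_from_top (f := fun z : ℤ => |⌊(8:ℝ)^(kT + j : ℤ) * cs s⌋ - z|)).comp
          (Int.measurable_floor.comp (measurable_const_mul _))
      exact measurableSet_le measurable_const hm
    · simp [hc]
  have h2 : Measurable fun n : ℕ => kT + (n:ℤ) := measurable_from_top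
  exact h2.comp h
lemma kJ_dist {T : Finset Tile} {kT : ℤ} {x : ℝ} {s : Tile} (hs : s ∈ T) (h : kJ T kT x ≤ s.1) :
    W (nus s x) ≤ 8^(kJ T kT x) * 8^(-s.1) := by
  have h1 := kJ_far T kT x s hs h
  set k := kJ T kT x
  have h2 : 1 ≤ |(8:ℝ)^k * x - 8^k * cs s| := by
    have a1 := Int.floor_le ((8:ℝ)^k * x); have a2 := Int.lt_floor_add_one ((8:ℝ)^k * x)
    have b1 := Int.floor_le ((8:ℝ)^k * cs s); have b2 := Int.lt_floor_add_one ((8:ℝ)^k * cs s)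
    rcases le_abs.1 h1 with h | h
    · have : (2:ℝ) ≤ ⌊(8:ℝ)^k * cs s⌋ - ⌊(8:ℝ)^k * x⌋ := by exact_mod_cast h
      rw [abs_sub_comm]; refine le_trans ?_ (le_abs_self _); linarith
    · have : (2:ℝ) ≤ -(⌊(8:ℝ)^k * cs s⌋ - ⌊(8:ℝ)^k * x⌋) := by exact_mod_cast h
      refine le_trans ?_ (le_abs_self _); linarith
  have e : (8:ℝ)^s.1 = 8^(s.1-k) * 8^k := by rw [← e8_add]; simp
  have h3 : 8^(s.1 - k) ≤ |nus s x| := by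
    rw [nus_eq, e, mul_assoc, mul_sub, abs_mul, abs_of_pos (e8 _)]
    exact le_mul_of_one_le_right (e8 _).le h2
  have e2 : (8:ℝ)^k * 8^(-s.1) = (8^(s.1-k))⁻¹ := by rw [← zpow_neg, ← e8_add]; congr 1; ring
  rw [e2, W]; gcongr; linarith
/-- nearness -/
lemma kJ_near {T : Finset Tile} {kT : ℤ} {x : ℝ} (h : kT < kJ T kT x) :
    ∃ s ∈ T, kJ T kT x - 1 ≤ s.1 ∧ |⌊(8:ℝ)^(kJ T kT x - 1) * cs s⌋ - ⌊(8:ℝ)^(kJ T kT x - 1) * x⌋| ≤ 1 := by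
  by_contra hc
  push Not at hc
  have : far T (kJ T kT x - 1) x := fun s hs hk => by have := hc s hs hk; omega
  have := kJ_min (kT := kT) (by omega) this
  omega
lemma W_under {s : Tile} {kT nT : ℤ} (h : Is s ⊆ II kT nT) (x : ℝ) : W (nus s x) ≤ 2 * W (nu kT nT x) := by
  refine le_trans ?_ (W_II (h (cs_II s)))
  rw [nus_eq]
  apply W_anti
  rw [abs_mul, abs_mul, abs_of_pos (e8 _), abs_of_pos (e8 _)]
  gcongr
  · norm_num
  · exact II_sub_scale h
/-- tiles with ξ in ω: (k,n) determines the tile -/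
lemma tile_inj {ξ : ℝ} {s t : Tile} (hs : ξ ∈ om s) (ht : ξ ∈ om t) (h1 : s.1 = t.1) (h2 : s.2.1 = t.2.1) : s = t := by
  have : s.2.2 = t.2.2 := II_disj hs (by rw [h1]; exact ht)
  ext <;> assumption
/-- sum at a single scale -/
lemma sumscale {S : Finset Tile} {k : ℤ} (hk : ∀ s ∈ S, s.1 = k) (hm : ∀ s ∈ S, ∀ t ∈ S, s.2.1 = t.2.1 → s = t) {p : ℕ} (hp : 2 ≤ p) (x : ℝ) :
    ∑ s ∈ S, W (nus s x) ^ p ≤ 16 := by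
  calc _ ≤ ∑ s ∈ S, W (8^k * x - s.2.1) ^ 2 := Finset.sum_le_sum fun s hs => by
        rw [nus, nu, hk s hs]; exact W_pow_anti hp _
    _ = ∑ n ∈ S.image (fun s => s.2.1), W (8^k * x - n) ^ 2 := by
        rw [Finset.sum_image]; exact fun s hs t ht h => hm s hs t ht h
    _ ≤ _ := (sumW le_rfl _ _).trans (by norm_num)
lemma tree1_pt {T : Finset Tile} {kT nT : ℤ} {ξ : ℝ} (hT : ∀ s ∈ T, Is s ⊆ II kT nT ∧ ξ ∈ om s) (x : ℝ) :
    ∑ s ∈ T with kJ T kT x ≤ s.1, W (nus s x) ^ 14 ≤ 128 * W (nu kT nT x) ^ 2 := by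
  set T' := T.filter (fun s => kJ T kT x ≤ s.1)
  have hT' : ∀ s ∈ T', s ∈ T ∧ kJ T kT x ≤ s.1 := fun s hs => Finset.mem_filter.1 hs
  rw [← Finset.sum_fiberwise_of_maps_to (s := T') (t := T'.image Prod.fst) (g := Prod.fst)
    (fun s hs => Finset.mem_image_of_mem _ hs)]
  have w := W_nn (nu kT nT x)
  have hpt : ∀ s ∈ T', W (nus s x) ^ 14 ≤ (4 * W (nu kT nT x) ^ 2 * 8^(kJ T kT x) * 8^(-s.1)) * W (nus s x) ^ 2 := by
    intro s hs
    have h1 := W_under (hT s (hT' s hs).1).1 x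
    have h2 := kJ_dist (hT' s hs).1 (hT' s hs).2
    have w' := W_nn (nus s x)
    calc W (nus s x) ^ 14 = W (nus s x) ^ 2 * W (nus s x) * W (nus s x) ^ 2 * W (nus s x) ^ 9 := by ring
      _ ≤ (2 * W (nu kT nT x)) ^ 2 * (8^(kJ T kT x) * 8^(-s.1)) * W (nus s x) ^ 2 * 1 := by
        gcongr ?_ ^ 2 * ?_ * ?_ * ?_
        exact W_pow_le_one _ _
      _ = _ := by ring
  calc _ ≤ ∑ k ∈ T'.image Prod.fst, (64 * W (nu kT nT x) ^ 2 * 8^(kJ T kT x)) * 8^(-k) := by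
        refine Finset.sum_le_sum fun k _ => ?_
        calc _ ≤ ∑ s ∈ T' with s.1 = k, (4 * W (nu kT nT x) ^ 2 * 8^(kJ T kT x) * 8^(-k)) * W (nus s x) ^ 2 := by
              refine Finset.sum_le_sum fun s hs => ?_
              rw [Finset.mem_filter] at hs
              rw [← hs.2]; exact hpt s hs.1
          _ ≤ (4 * W (nu kT nT x) ^ 2 * 8^(kJ T kT x) * 8^(-k)) * 16 := by
              rw [← Finset.mul_sum]
              gcongr
              refine sumscale (k := k) (fun s hs => (Finset.mem_filter.1 hs).2) (fun s hs t ht h => ?_) le_rfl x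
              rw [Finset.mem_filter] at hs ht
              exact tile_inj (hT s (hT' s hs.1).1).2 (hT t (hT' t ht.1).1).2 (hs.2.trans ht.2.symm) h
          _ = _ := by ring
    _ ≤ (64 * W (nu kT nT x) ^ 2 * 8^(kJ T kT x)) * (2 * 8^(-(kJ T kT x))) := by
        rw [← Finset.mul_sum]
        gcongr
        apply geoUp
        intro k hk
        obtain ⟨s, hs, rfl⟩ := Finset.mem_image.1 hk
        exact (hT' s hs).2
    _ = _ := by
        have : (8:ℝ)^(kJ T kT x) * 8^(-(kJ T kT x)) = 1 := by rw [← e8_add]; simp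
        linear_combination (128 * W (nu kT nT x) ^ 2) * this
lemma size_single {A : Tile → ℝ} {S : Finset Tile} {σ : ℝ} (hσ : 0 ≤ σ) (h : SizeLE A S σ) {s : Tile} (hs : s ∈ S) : A s ≤ σ := by
  have hξ : ((s.2.2:ℝ) + 1/2) * 8^s.1 ∈ o2 s := by
    have : (8:ℝ)^(-s.1) * 8^s.1 = 1 := by rw [← e8_add]; simp
    have e : nu (-s.1) s.2.2 (((s.2.2:ℝ) + 1/2) * 8^s.1) = 1/2 := by unfold nu; linear_combination ((s.2.2:ℝ) + 1/2) * this
    refine ⟨nu_II.2 ?_, ?_⟩ <;> rw [e] <;> norm_num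
  have h1 := h s.1 s.2.1 (((s.2.2:ℝ) + 1/2) * 8^s.1)
  have h2 : (8:ℝ)^(-s.1) * A s ^ 2 ≤ σ ^ 2 * 8^(-s.1) := by
    refine le_trans ?_ h1
    refine Finset.single_le_sum (f := fun s : Tile => (8:ℝ)^(-s.1) * A s ^ 2) (fun t _ => ?_) (Finset.mem_filter.2 ⟨hs, subset_rfl, hξ⟩)
    have := e8 (-t.1); positivity
  have h3 := e8 (-s.1)
  exact abs_le_of_sq_le_sq' (by nlinarith) hσ |>.2
lemma W_set_int (k n : ℤ) {p : ℕ} (hp : 2 ≤ p) (A : Set ℝ) : IntegrableOn (fun x => W (nu k n x) ^ p) A := (intWn hp k n).integrableOn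
/-- one tile, part 1 -/
lemma tree1_tile {f : ℝ → ℂ} (hf : Nice f) {T : Finset Tile} {kT : ℤ} {σ δ : ℝ} (hσ : 0 ≤ σ) (hδ : 0 ≤ δ)
    {E : Set ℝ} (hE : MeasurableSet E) {N : ℝ → ℝ} (hN : Measurable N) (hD : DensLE E N T δ) {s : Tile} (hs : s ∈ T) (hA : AA f s ≤ σ) :
    ∫ x in E, (if N x ∈ o2 s ∧ kJ T kT x ≤ s.1 then ‖Psi f s x‖ else 0) ≤
      2^15 * Cq * σ * δ * ∫ x in {x | kJ T kT x ≤ s.1}, W (nus s x) ^ 14 := by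
  set X := {x | kJ T kT x ≤ s.1}
  have hXm : MeasurableSet X := measurableSet_le (kJ_meas T kT) measurable_const
  have hom : MeasurableSet (N ⁻¹' (om s)) := hN (II_meas _ _)
  have ho2 : MeasurableSet (N ⁻¹' (o2 s)) := hN (om2_meas _ _)
  have hq := Cq0
  have hI : 0 ≤ ∫ x in X, W (nus s x) ^ 14 := integral_nonneg fun x => pow_nonneg (W_nn _) _
  rcases X.eq_empty_or_nonempty with hX | hX
  · have : ∀ x, ¬ (kJ T kT x ≤ s.1) := fun x hx => by have : x ∈ X := hx; simp [hX] at this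
    simp only [this, and_false, if_false, integral_zero]; exact mul_nonneg (by positivity) hI
  obtain ⟨x0, hx0, hmax⟩ := near_max (u := fun x => W (nus s x) ^ 14) hX (M := 1) (fun x => pow_nonneg (W_nn _) _) (fun x => W_pow_le_one _ _)
  have hd := hD s hs s.1 s.2.1 s.2.2 subset_rfl subset_rfl
  have w0 := W_nn (nus s x0)
  calc _ ≤ ∫ x in E, (N ⁻¹' (om s)).indicator (fun x => (Cq * σ * (2 * W (nus s x0) ^ 14)) * W (nus s x) ^ 6) x := by
        refine integral_mono_of_nonneg (ae_of_all _ fun x => by dsimp only; split_ifs <;> simp)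
          (((W_set_int _ _ (by norm_num) _).const_mul _).indicator hom) (ae_of_all _ fun x => ?_)
        have w := W_nn (nus s x)
        dsimp only
        split_ifs with h
        · rw [indicator_of_mem (show x ∈ N ⁻¹' (om s) from h.1.1)]
          calc _ ≤ Cq * AA f s * W (nus s x) ^ 20 := Psi_bd hf.i s x
            _ = Cq * AA f s * W (nus s x) ^ 14 * W (nus s x) ^ 6 := by ring
            _ ≤ Cq * σ * (2 * W (nus s x0) ^ 14) * W (nus s x) ^ 6 := by
              have := hmax x h.2
              gcongr ?_ * _
              have := AA_nn f s
              gcongr ?_ * ?_ * ?_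
        · apply indicator_nonneg; intro y _; have := W_nn (nus s y); positivity
    _ = (Cq * σ * (2 * W (nus s x0) ^ 14)) * ∫ x in E ∩ N ⁻¹' (om s), W (nus s x) ^ 6 := by
        rw [setIntegral_indicator hom, integral_const_mul]
    _ ≤ (Cq * σ * (2 * W (nus s x0) ^ 14)) * (δ * 8^(-s.1)) := by gcongr
    _ = 2 * Cq * σ * δ * (8^(-s.1) * W (nus s x0) ^ 14) := by ring
    _ ≤ 2 * Cq * σ * δ * (2^14 * ∫ x in II s.1 ⌊(8:ℝ)^s.1 * x0⌋, W (nus s x) ^ 14) := by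
        refine mul_le_mul_of_nonneg_left (P1 (by norm_num) le_rfl (self_II _ _)) (by positivity)
    _ ≤ 2 * Cq * σ * δ * (2^14 * ∫ x in X, W (nus s x) ^ 14) := by
        refine mul_le_mul_of_nonneg_left (mul_le_mul_of_nonneg_left ?_ (by norm_num)) (by positivity)
        refine setIntegral_mono_set (W_set_int _ _ (p := 14) (by norm_num) _) (ae_of_all _ fun x => pow_nonneg (W_nn _) _) ?_
        refine HasSubset.Subset.eventuallyLE ?_
        intro y hy
        change kJ T kT y ≤ s.1
        rw [kJ_congr (x := x0) (k := s.1) hx0 hy.symm]; exact hx0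
    _ = _ := by ring
lemma tree1 {f : ℝ → ℂ} (hf : Nice f) {T : Finset Tile} {kT nT : ℤ} {ξ : ℝ} (hT : ∀ s ∈ T, Is s ⊆ II kT nT ∧ ξ ∈ om s)
    {σ δ : ℝ} (hσ : 0 ≤ σ) (hδ : 0 ≤ δ) (hS : SizeLE (AA f) T σ)
    {E : Set ℝ} (hE : MeasurableSet E) {N : ℝ → ℝ} (hN : Measurable N) (hD : DensLE E N T δ) :
    ∑ s ∈ T, ∫ x in E, (if N x ∈ o2 s ∧ kJ T kT x ≤ s.1 then ‖Psi f s x‖ else 0) ≤ 2^24 * Cq * σ * δ * 8^(-kT) := by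
  have hXm : ∀ s : Tile, MeasurableSet {x | kJ T kT x ≤ s.1} := fun s => measurableSet_le (kJ_meas T kT) measurable_const
  have hq := Cq0
  calc _ ≤ ∑ s ∈ T, 2^15 * Cq * σ * δ * ∫ x in {x | kJ T kT x ≤ s.1}, W (nus s x) ^ 14 := by
        refine Finset.sum_le_sum fun s hs => ?_
        convert tree1_tile hf hσ hδ hE hN hD hs (size_single hσ hS hs)
    _ = 2^15 * Cq * σ * δ * ∫ x, ∑ s ∈ T, {x | kJ T kT x ≤ s.1}.indicator (fun x => W (nus s x) ^ 14) x := by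
        rw [← Finset.mul_sum, integral_finsetSum]
        · simp only [integral_indicator (hXm _)]
        · exact fun s _ => (intWn (by norm_num) _ _).indicator (hXm s)
    _ ≤ 2^15 * Cq * σ * δ * ∫ x, 128 * W (nu kT nT x) ^ 2 := by
        gcongr
        · exact integrable_finsetSum _ fun s _ => (intWn (by norm_num) _ _).indicator (hXm s)
        · exact (intWn le_rfl _ _).const_mul _
        · intro x
          refine le_trans (le_of_eq ?_) (tree1_pt hT x)
          rw [Finset.sum_filter]
          exact Finset.sum_congr rfl fun s _ => by simp [indicator_apply]
    _ ≤ 2^15 * Cq * σ * δ * (128 * (4 * 8^(-kT))) := by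
        rw [integral_const_mul]; gcongr; exact intWn_le le_rfl _ _
    _ = _ := by ring
end Carl
end
noncomputable section
namespace Carl
open Classical
lemma II_nu_abs {k n n' : ℤ} {x : ℝ} (h : |n - n'| ≤ 1) (hx : x ∈ II k n') : |nu k n x| ≤ 2 := by
  have h1 := nu_II.1 hx
  have h2 : |(n:ℝ) - n'| ≤ 1 := by exact_mod_cast h
  rw [abs_le] at *
  unfold nu at *
  constructor <;> linarith [h2.1, h2.2, h1.1, h1.2]
lemma W_third {t : ℝ} (h : |t| ≤ 2) : 1/3 ≤ W t := by
  unfold W; rw [one_div]; gcongr; linarith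
def AJ (E : Set ℝ) (N : ℝ → ℝ) (T : Finset Tile) (kT : ℤ) : Set ℝ := {x | x ∈ E ∧ ∃ s ∈ T, s.1 < kJ T kT x ∧ N x ∈ om s}
lemma AJ_meas {E : Set ℝ} (hE : MeasurableSet E) {N : ℝ → ℝ} (hN : Measurable N) (T : Finset Tile) (kT : ℤ) : MeasurableSet (AJ E N T kT) := by
  have : AJ E N T kT = E ∩ ⋃ s ∈ T, ({x | s.1 < kJ T kT x} ∩ N ⁻¹' (om s)) := by
    ext x; simp only [AJ, mem_inter_iff, mem_iUnion, exists_prop]; rfl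
  rw [this]
  exact hE.inter (Finset.measurableSet_biUnion _ fun s _ => (measurableSet_lt measurable_const (kJ_meas T kT)).inter (hN (II_meas _ _)))
lemma AJ_gt {E : Set ℝ} {N : ℝ → ℝ} {T : Finset Tile} {kT : ℤ} (hT : ∀ s ∈ T, kT ≤ s.1) {x : ℝ} (hx : x ∈ AJ E N T kT) : kT < kJ T kT x := by
  obtain ⟨s, hs, h, -⟩ := hx.2
  exact (hT s hs).trans_lt h
lemma dens_J {T : Finset Tile} {kT nT : ℤ} {ξ : ℝ} (hT : ∀ s ∈ T, Is s ⊆ II kT nT ∧ ξ ∈ om s) {δ : ℝ}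
    {E : Set ℝ} (hE : MeasurableSet E) {N : ℝ → ℝ} (hN : Measurable N) (hD : DensLE E N T δ) {x0 : ℝ} (hx0 : kT < kJ T kT x0) :
    volume (AJ E N T kT ∩ II (kJ T kT x0) ⌊(8:ℝ)^(kJ T kT x0) * x0⌋) ≤ ENNReal.ofReal (5832 * δ * 8^(-kJ T kT x0)) := by
  obtain ⟨s, hs, hk, hn⟩ := kJ_near hx0
  set K := kJ T kT x0
  set k := K - 1
  set nn := ⌊(8:ℝ)^k * cs s⌋
  set mm := ⌊(8:ℝ)^(-k) * ξ⌋
  have hkK : k ≤ K := by omega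
  have hd := hD s hs k nn mm (II_sub hk (self_II k (cs s)) (cs_II s)) (II_sub (by omega) (hT s hs).2 (self_II _ _))
  set B := E ∩ N ⁻¹' (II (-k) mm) ∩ II K ⌊(8:ℝ)^K * x0⌋
  have hBm : MeasurableSet B := (hE.inter (hN (II_meas _ _))).inter (II_meas _ _)
  have hsub : AJ E N T kT ∩ II K ⌊(8:ℝ)^K * x0⌋ ⊆ B := by
    rintro x ⟨hx, hxJ⟩
    refine ⟨⟨hx.1, ?_⟩, hxJ⟩
    obtain ⟨t, ht, htk, hN⟩ := hx.2
    have : kJ T kT x = K := kJ_congr (x := x0) (k := K) le_rfl hxJ.symm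
    rw [this] at htk
    exact II_sub (by omega) (self_II _ ξ) (hT t ht).2 hN
  have hBv : volume B ≠ ∞ := ne_top_of_le_ne_top (by rw [II_vol]; exact ENNReal.ofReal_ne_top) (measure_mono inter_subset_right : volume B ≤ volume (II K ⌊(8:ℝ)^K * x0⌋))
  have h1 : (1/3:ℝ)^6 * volume.real B ≤ ∫ x in B, W (nu k nn x) ^ 6 := by
    refine setIntegral_ge_of_const_le_real hBm hBv (fun x hx => ?_) (W_set_int _ _ (by norm_num) _)
    refine pow_le_pow_left₀ (by norm_num) (W_third (II_nu_abs hn ?_)) 6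
    exact (floor_nest hkK hx.2)
  have h2 : ∫ x in B, W (nu k nn x) ^ 6 ≤ ∫ x in E ∩ N ⁻¹' (II (-k) mm), W (nu k nn x) ^ 6 :=
    setIntegral_mono_set (W_set_int _ _ (p := 6) (by norm_num) _) (ae_of_all _ fun x => pow_nonneg (W_nn _) _)
      (LE.le.eventuallyLE inter_subset_left)
  have e : (8:ℝ)^(-k) = 8 * 8^(-K) := by rw [show -k = 1 + -K by simp only [k]; ring, e8_add]; norm_num
  refine (measure_mono hsub).trans ?_
  rw [← ENNReal.ofReal_toReal hBv]
  apply ENNReal.ofReal_le_ofReal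
  rw [e] at hd
  change volume.real B ≤ _
  linarith
lemma et_conv {f : ℝ → ℂ} (hf : Nice f) (T : Finset Tile) {ξ : ℝ} (hT : ∀ s ∈ T, ξ ∈ o2 s) (κ : ℤ) (x : ℝ) :
    ∫ y, (∑ s ∈ T, Psi f s y) * et κ ξ (x - y) = ∑ s ∈ T with s.1 < κ, Psi f s x := by
  have hi : ∀ s, Integrable fun y => Psi f s y * et κ ξ (x - y) := fun s =>
    (Psi_int hf.i s).mul_bdd (c := Cp * 8^κ) (by apply Continuous.aestronglyMeasurable; fun_prop) (ae_of_all _ fun y => et_bd' _ _ _)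
  simp only [Finset.sum_mul]
  rw [integral_finsetSum _ (fun s _ => hi s), Finset.sum_filter]
  refine Finset.sum_congr rfl fun s hs => ?_
  have h := fub (Fw_norm_int hf.i s) (ph_int s.1 s.2.2) (H := fun y => et κ ξ (x - y))
    (by apply Continuous.aestronglyMeasurable; fun_prop) (M := Cp * 8^κ) (fun y => et_bd' _ _ _)
  unfold Psi
  rw [h]
  have e : ∀ y, ∫ z, ph s.1 s.2.2 (z - y) * et κ ξ (x - z) = if s.1 < κ then ph s.1 s.2.2 (x - y) else 0 := by
    intro y
    rw [← ph_eta (hT s hs) (x - y), ← integral_sub_right_eq_self (fun z => ph s.1 s.2.2 z * et κ ξ (x - y - z)) y]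
    congr 1; ext z; congr 2; ring
  simp only [e]
  split_ifs <;> simp
lemma et_max {f : ℝ → ℂ} (hf : Nice f) (T : Finset Tile) {ξ : ℝ} (hT : ∀ s ∈ T, ξ ∈ o2 s) (κ : ℤ) {x y : ℝ}
    (hxy : |(8:ℝ)^κ * (x - y)| ≤ 1) :
    ‖∑ s ∈ T with s.1 < κ, Psi f s x‖ₑ ≤ ENNReal.ofReal (16 * Cp) * ∫⁻ z, ‖∑ s ∈ T, Psi f s z‖ₑ * aK κ (y - z) := by
  rw [← et_conv hf T hT κ x]
  refine (enorm_integral_le_lintegral_enorm _).trans ?_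
  rw [← lintegral_const_mul' _ _ ENNReal.ofReal_ne_top]
  refine lintegral_mono fun z => ?_
  dsimp only
  rw [enorm_mul, mul_left_comm]
  refine mul_le_mul_right ?_ _
  rw [← ofReal_norm, aK, ← ENNReal.ofReal_mul (by have := Cp0; positivity)]
  apply ENNReal.ofReal_le_ofReal
  refine (et_bd _ _ _).trans ?_
  have h1 : W (8^κ * (x - z)) ≤ 2 * W (8^κ * (y - z)) := W_le_two (by rw [← mul_sub]; simpa using hxy)
  have := Cp0; have w := W_nn (8^κ * (x - z)); have := e8 κ
  unfold aR
  calc _ ≤ Cp * 8^κ * W (8^κ * (x - z)) ^ 4 := by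
        refine mul_le_mul_of_nonneg_left (W_pow_anti (by norm_num) _) (by positivity)
    _ ≤ Cp * 8^κ * (2 * W (8^κ * (y - z))) ^ 4 := by gcongr
    _ = _ := by ring
/-- pointwise bound for part 2 -/
lemma tree2_pt {f : ℝ → ℂ} (hf : Nice f) {T : Finset Tile} {ξ : ℝ} (hT : ∀ s ∈ T, ξ ∈ om s) {σ : ℝ} (hσ : 0 ≤ σ)
    (hS : ∀ s ∈ T, AA f s ≤ σ) (η : ℝ) (K : ℤ) {x y : ℝ} {M : ℝ≥0∞} (hxy : |(8:ℝ)^K * (x - y)| ≤ 1)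
    (hM : ∀ κ, κ ≤ K → (κ = K ∨ ∃ s ∈ T, κ = s.1) → ∫⁻ z, ‖∑ s ∈ T with ξ ∈ o2 s, Psi f s z‖ₑ * aK κ (y - z) ≤ M) :
    ‖∑ s ∈ T with (η ∈ o2 s ∧ s.1 < K), Psi f s x‖ₑ ≤ ENNReal.ofReal (32 * Cp) * M + ENNReal.ofReal (16 * Cq * σ) := by
  have hq := Cq0
  set U1 := (T.filter fun s => η ∈ o2 s ∧ s.1 < K).filter fun s => ξ ∈ o2 s
  set U2 := (T.filter fun s => η ∈ o2 s ∧ s.1 < K).filter fun s => ¬ ξ ∈ o2 s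
  rw [← Finset.sum_filter_add_sum_filter_not _ (fun s => ξ ∈ o2 s)]
  refine (enorm_add_le _ _).trans (add_le_add ?_ ?_)
  · change ‖∑ s ∈ U1, Psi f s x‖ₑ ≤ _
    rcases U1.eq_empty_or_nonempty with h0 | hne
    · rw [h0]; simp
    obtain ⟨s1, hs1, hmin⟩ := Finset.exists_min_image U1 (fun s => s.1) hne
    simp only [U1, Finset.mem_filter] at hs1 hmin
    have e : ∑ s ∈ U1, Psi f s x = ∑ s ∈ (T.filter fun s => ξ ∈ o2 s) with s.1 < K, Psi f s x
        - ∑ s ∈ (T.filter fun s => ξ ∈ o2 s) with s.1 < s1.1, Psi f s x := by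
      rw [eq_sub_iff_add_eq, ← Finset.sum_union]
      · apply Finset.sum_congr _ fun _ _ => rfl
        ext s
        simp only [U1, Finset.mem_union, Finset.mem_filter]
        constructor
        · rintro (h | h)
          · exact ⟨⟨h.1.1, h.2⟩, h.1.2.2⟩
          · exact ⟨h.1, h.2.trans hs1.1.2.2⟩
        · rintro ⟨⟨h1, h2⟩, h3⟩
          by_cases hc : s.1 < s1.1
          · exact .inr ⟨⟨h1, h2⟩, hc⟩
          · refine .inl ⟨⟨h1, ?_, h3⟩, h2⟩
            rcases (not_lt.1 hc).lt_or_eq with hlt | heq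
            · exact om2_nest hlt hs1.2.1 h2 hs1.1.2.1.1
            · have : s1.2.2 = s.2.2 := II_disj hs1.2.1 (by rw [heq]; exact h2.1)
              have h4 := hs1.1.2.1
              unfold o2 at h4 ⊢
              rwa [heq, this] at h4
      · rw [Finset.disjoint_left]
        intro s hs hs'
        simp only [U1, Finset.mem_filter] at hs hs'
        have := hmin s hs
        omega
    rw [e]
    refine (enorm_sub_le).trans ?_
    have hTT : ∀ s ∈ T.filter fun s => ξ ∈ o2 s, ξ ∈ o2 s := fun s hs => (Finset.mem_filter.1 hs).2
    have hle : |(8:ℝ)^s1.1 * (x - y)| ≤ 1 := by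
      refine le_trans ?_ hxy
      rw [abs_mul, abs_mul, abs_of_pos (e8 _), abs_of_pos (e8 _)]
      gcongr
      · norm_num
      · exact hs1.1.2.2.le
    refine (add_le_add (et_max hf _ hTT K hxy) (et_max hf _ hTT s1.1 hle)).trans ?_
    refine (add_le_add (mul_le_mul_right (hM K le_rfl (.inl rfl)) _) (mul_le_mul_right (hM s1.1 hs1.1.2.2.le (.inr ⟨s1, hs1.1.1, rfl⟩)) _)).trans (le_of_eq ?_)
    have := Cp0
    rw [← add_mul, ← ENNReal.ofReal_add (by positivity) (by positivity)]
    congr 2; ring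
  · change ‖∑ s ∈ U2, Psi f s x‖ₑ ≤ _
    rw [← ofReal_norm]
    apply ENNReal.ofReal_le_ofReal
    have hU : ∀ s ∈ U2, (s ∈ T ∧ η ∈ o2 s ∧ s.1 < K) ∧ ξ ∉ o2 s := fun s hs => by simpa only [U2, Finset.mem_filter] using hs
    rcases U2.eq_empty_or_nonempty with h0 | ⟨s1, hs1⟩
    · rw [h0]; simp; positivity
    have hne : ∀ s ∈ U2, ∀ t ∈ U2, ¬ s.1 < t.1 := fun s hs t ht h =>
      (hU t ht).2 (om2_nest h (hU s hs).1.2.1.1 (hU t ht).1.2.1 (hT s (hU s hs).1.1))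
    calc _ ≤ ∑ s ∈ U2, ‖Psi f s x‖ := norm_sum_le _ _
      _ ≤ ∑ s ∈ U2, Cq * σ * W (nus s x) ^ 20 := by
          refine Finset.sum_le_sum fun s hs => (Psi_bd hf.i s x).trans ?_
          have := W_nn (nus s x); have := hS s (hU s hs).1.1
          gcongr
      _ ≤ Cq * σ * 16 := by
          rw [← Finset.mul_sum]
          gcongr
          refine sumscale (k := s1.1) (fun s hs => ?_) (fun s hs t ht h => ?_) (by norm_num) x
          · have := hne s hs s1 hs1; have := hne s1 hs1 s hs; omega
          · have := hne s hs t ht; have := hne t ht s hs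
            exact tile_inj (hT s (hU s hs).1.1) (hT t (hU t ht).1.1) (by omega) h
      _ = _ := by ring
lemma kJ_3I {T : Finset Tile} {kT nT : ℤ} (hT : ∀ s ∈ T, Is s ⊆ II kT nT) {x : ℝ} (h : kT < kJ T kT x) : 1/3 ≤ W (nu kT nT x) := by
  obtain ⟨s, hs, hk, hn⟩ := kJ_near h
  set k := kJ T kT x - 1
  have hk' : kT ≤ k := by omega
  apply W_third
  have h1 : ⌊(8:ℝ)^kT * cs s⌋ = nT := hT s hs (cs_II s)
  have a1 := Int.floor_le ((8:ℝ)^k * x); have a2 := Int.lt_floor_add_one ((8:ℝ)^k * x)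
  have b1 := Int.floor_le ((8:ℝ)^k * cs s); have b2 := Int.lt_floor_add_one ((8:ℝ)^k * cs s)
  obtain ⟨c1, c2⟩ := nu_II.1 (show cs s ∈ II kT nT from h1)
  obtain ⟨d1, d2⟩ := nu_II.1 (hT s hs (cs_II s))
  -- move to end of the k-interval
  have hn' : |(⌊(8:ℝ)^k * cs s⌋:ℝ) - ⌊(8:ℝ)^k * x⌋| ≤ 1 := by exact_mod_cast hn
  rw [abs_le] at hn'
  have h8 : (8:ℝ)^kT ≤ 8^k := e8_le hk'
  have key : |(8:ℝ)^k * (x - cs s)| ≤ 2 := by rw [abs_le]; constructor <;> nlinarith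
  obtain ⟨j, hj⟩ := Int.le.dest hk'
  rcases Nat.eq_zero_or_pos j with rfl | hj0
  · have hkk : k = kT := by simpa using hj.symm
    rw [hkk] at hn
    exact II_nu_abs (n' := ⌊(8:ℝ)^kT * x⌋) (by rw [← h1]; exact hn) (self_II _ _)
  · have h88 : 8 * (8:ℝ)^kT ≤ 8^k := by
      have : (8:ℝ)^(kT+1) ≤ 8^k := e8_le (by omega)
      rw [e8_add] at this; linarith
    have : |(8:ℝ)^kT * (x - cs s)| ≤ 1 := by
      rw [abs_mul, abs_of_pos (e8 _)] at *
      have := abs_nonneg (x - cs s); nlinarith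
    rw [abs_le] at *
    unfold nu at *
    constructor <;> nlinarith
lemma csW {M : ℝ → ℝ≥0∞} (hM : Measurable M) {B : ℝ} (hB : 0 ≤ B) (kT nT : ℤ) (h : ∫⁻ x, M x ^ 2 ≤ ENNReal.ofReal (B ^ 2 * 8^(-kT))) :
    ∫⁻ x, M x * ENNReal.ofReal (W (nu kT nT x) ^ 2) ≤ ENNReal.ofReal (2 * B * 8^(-kT)) := by
  have h1 := csE hM.aemeasurable (g := fun x => ENNReal.ofReal (W (nu kT nT x) ^ 2)) (by fun_prop)
  have h2 : ∫⁻ x, ENNReal.ofReal (W (nu kT nT x) ^ 2) ^ 2 ≤ ENNReal.ofReal (4 * 8^(-kT)) := by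
    have e : ∀ x, ENNReal.ofReal (W (nu kT nT x) ^ 2) ^ 2 = ENNReal.ofReal (W (nu kT nT x) ^ 4) := fun x => by
      rw [← ENNReal.ofReal_pow (pow_nonneg (W_nn _) _), ← pow_mul]
    simp only [e]
    rw [← ofReal_integral_eq_lintegral_ofReal (intWn (by norm_num) _ _) (ae_of_all _ fun x => pow_nonneg (W_nn _) _)]
    exact ENNReal.ofReal_le_ofReal (intWn_le (by norm_num) _ _)
  refine (ENNReal.pow_le_pow_left_iff (n := 2) (by norm_num)).1 (h1.trans ((mul_le_mul' h h2).trans (le_of_eq ?_)))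
  have := e8 (-kT)
  rw [← ENNReal.ofReal_mul (by positivity), ← ENNReal.ofReal_pow (by positivity)]
  congr 1; ring
end Carl
end
noncomputable section
namespace Carl
open Classical
def hJ (E : Set ℝ) (N : ℝ → ℝ) (T : Finset Tile) (kT : ℤ) (p : ℝ × ℝ) : ℝ≥0∞ :=
  if p.1 ∈ AJ E N T kT ∧ ⌊(8:ℝ)^(kJ T kT p.1) * p.1⌋ = ⌊(8:ℝ)^(kJ T kT p.1) * p.2⌋ then ENNReal.ofReal (8^(kJ T kT p.1)) else 0
lemma hJ_meas {E : Set ℝ} (hE : MeasurableSet E) {N : ℝ → ℝ} (hN : Measurable N) (T : Finset Tile) (kT : ℤ) : Measurable (hJ E N T kT) := by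
  have h1 : Measurable (fun q : ℤ × (ℝ × ℝ) => if q.2.1 ∈ AJ E N T kT ∧ ⌊(8:ℝ)^q.1 * q.2.1⌋ = ⌊(8:ℝ)^q.1 * q.2.2⌋ then ENNReal.ofReal (8^q.1) else 0) := by
    refine measurable_from_prod_countable_right fun k => ?_
    dsimp only
    refine Measurable.ite (MeasurableSet.inter (measurable_fst (AJ_meas hE hN T kT)) (measurableSet_eq_fun ?_ ?_)) measurable_const measurable_const
    · exact Int.measurable_floor.comp (measurable_fst.const_mul _)
    · exact Int.measurable_floor.comp (measurable_snd.const_mul _)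
  exact h1.comp (((kJ_meas T kT).comp measurable_fst).prodMk measurable_id)
lemma hJ_int {T : Finset Tile} {kT nT : ℤ} {ξ : ℝ} (hT : ∀ s ∈ T, Is s ⊆ II kT nT ∧ ξ ∈ om s) {δ : ℝ} (hδ : 0 ≤ δ)
    {E : Set ℝ} (hE : MeasurableSet E) {N : ℝ → ℝ} (hN : Measurable N) (hD : DensLE E N T δ) (y : ℝ) :
    ∫⁻ x, hJ E N T kT (x, y) ≤ ENNReal.ofReal (52488 * δ) * ENNReal.ofReal (W (nu kT nT y) ^ 2) := by
  have hsc : ∀ s ∈ T, kT ≤ s.1 := fun s hs => II_sub_scale (hT s hs).1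
  by_cases hy : kT < kJ T kT y
  · have hle : ∀ x, hJ E N T kT (x, y) ≤ (AJ E N T kT ∩ II (kJ T kT y) ⌊(8:ℝ)^(kJ T kT y) * y⌋).indicator (fun _ => ENNReal.ofReal (8^(kJ T kT y))) x := by
      intro x
      unfold hJ
      split_ifs with h
      · have hk := kJ_congr (x := x) le_rfl h.2
        dsimp only at h ⊢
        rw [indicator_of_mem, hk]
        refine ⟨h.1, ?_⟩
        rw [hk]; exact h.2
      · exact zero_le
    refine (lintegral_mono hle).trans ?_
    rw [lintegral_indicator ((AJ_meas hE hN T kT).inter (II_meas _ _)), setLIntegral_const]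
    refine (mul_le_mul_right (dens_J hT hE hN hD hy) _).trans ?_
    have h8 := e8 (kJ T kT y)
    rw [← ENNReal.ofReal_mul h8.le, ← ENNReal.ofReal_mul (by positivity)]
    apply ENNReal.ofReal_le_ofReal
    have h3 := pow_le_pow_left₀ (by norm_num) (kJ_3I (fun s hs => (hT s hs).1) hy) 2
    have : (8:ℝ)^(kJ T kT y) * 8^(-(kJ T kT y)) = 1 := by rw [← e8_add]; simp
    calc _ = 5832 * δ * ((8:ℝ)^(kJ T kT y) * 8^(-(kJ T kT y))) := by ring
      _ = 52488 * δ * (1/3)^2 := by rw [this]; ring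
      _ ≤ _ := by gcongr
  · have : ∀ x, hJ E N T kT (x, y) = 0 := by
      intro x
      unfold hJ
      rw [if_neg]
      rintro ⟨h1, h2⟩
      have hk := kJ_congr (x := x) le_rfl h2
      dsimp only at hk h1
      exact hy (hk ▸ AJ_gt hsc h1)
    simp [this]
def RR (f : ℝ → ℂ) (N : ℝ → ℝ) (T : Finset Tile) (kT : ℤ) (x : ℝ) : ℂ := ∑ s ∈ T with (N x ∈ o2 s ∧ s.1 < kJ T kT x), Psi f s x
lemma enorm_sq_int {g : ℝ → ℂ} (hi : Integrable fun x => ‖g x‖ ^ 2) : ∫⁻ x, ‖g x‖ₑ ^ 2 = ENNReal.ofReal (∫ x, ‖g x‖ ^ 2) := by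
  rw [ofReal_integral_eq_lintegral_ofReal hi (ae_of_all _ fun x => by positivity)]
  congr 1; ext x; rw [ENNReal.ofReal_pow (norm_nonneg _), ofReal_norm]
def Ct : ℝ := 52488 * (32 * Cp * (2 * (1536 * 8 * Cq)) + 64 * Cq)
lemma tree2 {f : ℝ → ℂ} (hf : Nice f) {T : Finset Tile} {kT nT : ℤ} {ξ : ℝ} (hT : ∀ s ∈ T, Is s ⊆ II kT nT ∧ ξ ∈ om s)
    {σ δ : ℝ} (hσ : 0 ≤ σ) (hδ : 0 ≤ δ) (hS : SizeLE (AA f) T σ)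
    {E : Set ℝ} (hE : MeasurableSet E) {N : ℝ → ℝ} (hN : Measurable N) (hD : DensLE E N T δ) :
    ∫⁻ x in E, ‖RR f N T kT x‖ₑ ≤ ENNReal.ofReal (Ct * σ * δ * 8^(-kT)) := by
  have hp := Cp0; have hq := Cq0
  set T2 := T.filter (fun s => ξ ∈ o2 s)
  set Γ : ℝ → ℂ := fun z => ∑ s ∈ T2, Psi f s z
  have hΓm : Measurable Γ := Finset.measurable_fun_sum _ fun s _ => Psi_meas hf.m s
  have hΓi : Integrable fun x => ‖Γ x‖ ^ 2 := by
    have h1 : Integrable Γ := integrable_finsetSum _ fun s _ => Psi_int hf.i s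
    have : ∀ x, ‖Γ x‖ ≤ ∑ s ∈ T2, Cq * AA f s := fun x => (norm_sum_le _ _).trans (Finset.sum_le_sum fun s _ => Psi_bd' hf.i s x)
    simp only [pow_two]
    exact h1.norm.mul_bdd (c := ∑ s ∈ T2, Cq * AA f s) hΓm.norm.aestronglyMeasurable (ae_of_all _ fun x => by simpa using this x)
  have hΓ2 : ∫⁻ x, ‖Γ x‖ₑ ^ 2 ≤ ENNReal.ofReal ((8 * Cq * σ) ^ 2 * 8^(-kT)) := by
    rw [enorm_sq_int hΓi]
    apply ENNReal.ofReal_le_ofReal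
    refine (tree_orth hf T2 ξ (fun s hs => (Finset.mem_filter.1 hs).2)).trans ?_
    have h1 := hS kT nT ξ
    have h2 : T.filter (fun s => Is s ⊆ II kT nT ∧ ξ ∈ o2 s) = T2 := by
      ext s; simp only [T2, Finset.mem_filter]; exact ⟨fun h => ⟨h.1, h.2.2⟩, fun h => ⟨h.1, (hT s h.1).1, h.2⟩⟩
    rw [h2] at h1
    calc _ ≤ 64 * Cq ^ 2 * (σ ^ 2 * 8^(-kT)) := by gcongr
      _ = _ := by ring
  obtain ⟨M, hMm, hM, hM2⟩ := maximal (Finset.Icc kT (kT + KK T kT)) (Finset.nonempty_Icc.2 (by omega)) (g := fun z => ‖Γ z‖ₑ) hΓm.enorm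
  have hM2' : ∫⁻ x, M x ^ 2 ≤ ENNReal.ofReal ((1536 * 8 * Cq * σ) ^ 2 * 8^(-kT)) := by
    refine hM2.trans ((mul_le_mul_right hΓ2 _).trans (le_of_eq ?_))
    rw [show (768^2 * 4 : ℝ≥0∞) = ENNReal.ofReal (768^2 * 4) by
      rw [ENNReal.ofReal_mul (by norm_num), ENNReal.ofReal_pow (by norm_num)]; simp, ← ENNReal.ofReal_mul (by norm_num)]
    congr 1; ring
  set G : ℝ → ℝ≥0∞ := fun y => ENNReal.ofReal (32 * Cp) * M y + ENNReal.ofReal (16 * Cq * σ)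
  have hGm : Measurable G := by fun_prop
  have hhm := hJ_meas hE hN T kT
  have pt : ∀ x ∈ E, ‖RR f N T kT x‖ₑ ≤ ∫⁻ y, hJ E N T kT (x, y) * G y := by
    intro x hx
    by_cases hxA : x ∈ AJ E N T kT
    · set K := kJ T kT x
      have h1 : ∀ y ∈ II K ⌊(8:ℝ)^K * x⌋, ‖RR f N T kT x‖ₑ ≤ G y := by
        intro y hy
        refine tree2_pt (x := x) (y := y) hf (fun s hs => (hT s hs).2) hσ (fun s hs => size_single hσ hS hs) (N x) K ?_ ?_
        · have := II_comp (k0 := K) (n0 := 0) le_rfl (self_II K x) hy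
          rwa [nu_sub] at this
        · rintro κ hκ hκ'
          refine hM y κ (Finset.mem_Icc.2 ⟨?_, hκ.trans (kJ_le T kT x)⟩)
          rcases hκ' with rfl | ⟨s, hs, rfl⟩
          · exact kJ_ge T kT x
          · exact II_sub_scale (hT s hs).1
      have h2 : ∫⁻ y, hJ E N T kT (x, y) * G y ≥ ∫⁻ y in II K ⌊(8:ℝ)^K * x⌋, ENNReal.ofReal (8^K) * ‖RR f N T kT x‖ₑ := by
        rw [← lintegral_indicator (II_meas _ _)]
        refine lintegral_mono fun y => ?_
        by_cases hy : y ∈ II K ⌊(8:ℝ)^K * x⌋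
        · rw [indicator_of_mem hy]
          unfold hJ
          rw [if_pos ⟨hxA, hy.symm⟩]
          exact mul_le_mul_right (h1 y hy) _
        · rw [indicator_of_notMem hy]; exact zero_le
      refine le_trans (le_of_eq ?_) h2
      rw [setLIntegral_const, II_vol, mul_right_comm, ← ENNReal.ofReal_mul (e8 _).le, ← e8_add]; simp
    · have : RR f N T kT x = 0 := by
        unfold RR
        rw [Finset.filter_false_of_mem, Finset.sum_empty]
        intro s hs h
        exact hxA ⟨hx, s, hs, h.2, h.1.1⟩
      rw [this]; simp
  calc _ ≤ ∫⁻ x in E, ∫⁻ y, hJ E N T kT (x, y) * G y := setLIntegral_mono' hE pt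
    _ ≤ ∫⁻ x, ∫⁻ y, hJ E N T kT (x, y) * G y := setLIntegral_le_lintegral _ _
    _ = ∫⁻ y, ∫⁻ x, hJ E N T kT (x, y) * G y := by
        apply lintegral_lintegral_swap
        exact (hhm.mul (hGm.comp measurable_snd)).aemeasurable
    _ ≤ ∫⁻ y, (ENNReal.ofReal (52488 * δ) * ENNReal.ofReal (W (nu kT nT y) ^ 2)) * G y := by
        refine lintegral_mono fun y => ?_
        dsimp only
        rw [lintegral_mul_const _ (by exact hhm.comp (measurable_id.prodMk measurable_const))]
        exact mul_le_mul_left (hJ_int hT hδ hE hN hD y) _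
    _ = ENNReal.ofReal (52488 * δ) * (ENNReal.ofReal (32 * Cp) * (∫⁻ y, M y * ENNReal.ofReal (W (nu kT nT y) ^ 2)) + ENNReal.ofReal (16 * Cq * σ) * ∫⁻ y, ENNReal.ofReal (W (nu kT nT y) ^ 2)) := by
        rw [← lintegral_const_mul _ (by fun_prop), ← lintegral_const_mul _ (by fun_prop), ← lintegral_add_left (by fun_prop), ← lintegral_const_mul _ (by fun_prop)]
        refine lintegral_congr fun y => ?_
        simp only [G]; ring
    _ ≤ ENNReal.ofReal (52488 * δ) * (ENNReal.ofReal (32 * Cp) * ENNReal.ofReal (2 * (1536 * 8 * Cq * σ) * 8^(-kT)) + ENNReal.ofReal (16 * Cq * σ) * ENNReal.ofReal (4 * 8^(-kT))) := by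
        gcongr
        · exact csW hMm (by positivity) kT nT hM2'
        · rw [← ofReal_integral_eq_lintegral_ofReal (intWn le_rfl _ _) (ae_of_all _ fun x => pow_nonneg (W_nn _) _)]
          exact ENNReal.ofReal_le_ofReal (intWn_le le_rfl _ _)
    _ = _ := by
        have := e8 (-kT)
        rw [← ENNReal.ofReal_mul (by positivity), ← ENNReal.ofReal_mul (by positivity), ← ENNReal.ofReal_add (by positivity) (by positivity), ← ENNReal.ofReal_mul (by positivity)]
        congr 1; unfold Ct; ring
lemma ite_meas {f : ℝ → ℂ} (hf : Nice f) (s : Tile) {P : ℝ → Prop} (hP : MeasurableSet {x | P x}) : Measurable fun x => if P x then Psi f s x else 0 :=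
  Measurable.ite hP (Psi_meas hf.m s) measurable_const
lemma ite_int {f : ℝ → ℂ} (hf : Nice f) (s : Tile) {P : ℝ → Prop} (hP : MeasurableSet {x | P x}) : Integrable fun x => if P x then Psi f s x else 0 :=
  (Psi_int hf.i s).mono (ite_meas hf s hP).aestronglyMeasurable (ae_of_all _ fun x => by split_ifs <;> simp)
lemma TT_int {f : ℝ → ℂ} (hf : Nice f) {N : ℝ → ℝ} (hN : Measurable N) (S : Finset Tile) : Integrable (TT f N S) :=
  integrable_finsetSum _ fun s _ => ite_int hf s (hN (om2_meas _ _))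
lemma TT_meas {f : ℝ → ℂ} (hf : Nice f) {N : ℝ → ℝ} (hN : Measurable N) (S : Finset Tile) : Measurable (TT f N S) :=
  Finset.measurable_fun_sum _ fun s _ => ite_meas hf s (hN (om2_meas _ _))
def Ctree : ℝ := 2^24 * Cq + Ct
lemma Ctree0 : 0 < Ctree := by have := Cp0; have := Cq0; unfold Ctree Ct; positivity
/-- the tree estimate -/
lemma tree {f : ℝ → ℂ} (hf : Nice f) {T : Finset Tile} {kT nT : ℤ} {ξ : ℝ} (hT : ∀ s ∈ T, Is s ⊆ II kT nT ∧ ξ ∈ om s)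
    {σ δ : ℝ} (hσ : 0 ≤ σ) (hδ : 0 ≤ δ) (hS : SizeLE (AA f) T σ)
    {E : Set ℝ} (hE : MeasurableSet E) {N : ℝ → ℝ} (hN : Measurable N) (hD : DensLE E N T δ) :
    ∫ x in E, ‖TT f N T x‖ ≤ Ctree * σ * δ * 8^(-kT) := by
  have hp := Cp0; have hq := Cq0
  have h2 := tree2 hf hT hσ hδ hS hE hN hD
  have h1 := tree1 hf hT hσ hδ hS hE hN hD
  have mP : ∀ s : Tile, MeasurableSet {x | N x ∈ o2 s ∧ kJ T kT x ≤ s.1} := fun s =>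
    (hN (om2_meas _ _)).inter (measurableSet_le (kJ_meas T kT) measurable_const)
  have mR : ∀ s : Tile, MeasurableSet {x | N x ∈ o2 s ∧ s.1 < kJ T kT x} := fun s =>
    (hN (om2_meas _ _)).inter (measurableSet_lt measurable_const (kJ_meas T kT))
  have hR : Integrable (RR f N T kT) := by
    have : RR f N T kT = fun x => ∑ s ∈ T, if N x ∈ o2 s ∧ s.1 < kJ T kT x then Psi f s x else 0 := by
      ext x; exact Finset.sum_filter _ _
    rw [this]
    exact integrable_finsetSum _ fun s _ => (ite_int hf s (mR s)).congr (ae_of_all _ fun x => by dsimp only; split_ifs <;> rfl)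
  have i1 : ∀ s : Tile, Integrable fun x => if N x ∈ o2 s ∧ kJ T kT x ≤ s.1 then ‖Psi f s x‖ else 0 := fun s =>
    (ite_int hf s (mP s)).norm.congr (ae_of_all _ fun x => by dsimp only; split_ifs <;> simp)
  have hRi : ∫ x in E, ‖RR f N T kT x‖ ≤ Ct * σ * δ * 8^(-kT) := by
    rw [integral_norm_eq_lintegral_enorm hR.1.restrict]
    exact ENNReal.toReal_le_of_le_ofReal (by have := e8 (-kT); unfold Ct; positivity) h2
  calc ∫ x in E, ‖TT f N T x‖ ≤ ∫ x in E, ((∑ s ∈ T, (if N x ∈ o2 s ∧ kJ T kT x ≤ s.1 then ‖Psi f s x‖ else 0)) + ‖RR f N T kT x‖) := by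
        refine integral_mono_of_nonneg (ae_of_all _ fun x => norm_nonneg _)
          ((integrable_finsetSum _ fun s _ => (i1 s)).integrableOn.add hR.norm.integrableOn) (ae_of_all _ fun x => ?_)
        dsimp only
        have e : TT f N T x = (∑ s ∈ T, if N x ∈ o2 s ∧ kJ T kT x ≤ s.1 then Psi f s x else 0) + RR f N T kT x := by
          unfold TT RR
          rw [Finset.sum_filter, ← Finset.sum_add_distrib]
          refine Finset.sum_congr rfl fun s _ => ?_
          by_cases a : N x ∈ o2 s <;> by_cases b : kJ T kT x ≤ s.1
          · simp [a, b]
          · simp [a, b, not_le.1 b]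
          · simp [a]
          · simp [a]
        rw [e]
        refine (norm_add_le _ _).trans (add_le_add_left ((norm_sum_le _ _).trans (Finset.sum_le_sum fun s _ => ?_)) _)
        split_ifs <;> simp
    _ = (∑ s ∈ T, ∫ x in E, (if N x ∈ o2 s ∧ kJ T kT x ≤ s.1 then ‖Psi f s x‖ else 0)) + ∫ x in E, ‖RR f N T kT x‖ := by
        rw [integral_add (integrable_finsetSum _ fun s _ => (i1 s).integrableOn) hR.norm.integrableOn,
          integral_finsetSum _ fun s _ => (i1 s).integrableOn]
    _ ≤ 2^24 * Cq * σ * δ * 8^(-kT) + Ct * σ * δ * 8^(-kT) := add_le_add h1 hRi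
    _ = _ := by unfold Ctree; ring
end Carl
end
noncomputable section
namespace Carl
open Classical
lemma SizeLE.mono {A : Tile → ℝ} {S R : Finset Tile} {σ : ℝ} (h : SizeLE A S σ) (hR : R ⊆ S) : SizeLE A R σ :=
  fun kT nT ξ => (Finset.sum_le_sum_of_subset_of_nonneg (Finset.filter_subset_filter _ hR)
    fun _ _ _ => mul_nonneg (e8 _).le (sq_nonneg _)).trans (h kT nT ξ)
lemma DensLE.mono {E : Set ℝ} {N : ℝ → ℝ} {S R : Finset Tile} {δ : ℝ} (h : DensLE E N S δ) (hR : R ⊆ S) : DensLE E N R δ :=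
  fun s hs => h s (hR hs)
def Cov (R : Finset Tile) (X : ℝ) : Prop := ∃ (ι : Type) (P : Finset ι) (k n : ι → ℤ) (ξ : ι → ℝ),
  (∀ s ∈ R, ∃ t ∈ P, Is s ⊆ II (k t) (n t) ∧ ξ t ∈ om s) ∧ ∑ t ∈ P, (8:ℝ)^(-k t) ≤ X
lemma cov_est {f : ℝ → ℂ} (hf : Nice f) {R : Finset Tile} {σ δ X : ℝ} (hσ : 0 ≤ σ) (hδ : 0 ≤ δ) (hS : SizeLE (AA f) R σ)
    {E : Set ℝ} (hE : MeasurableSet E) {N : ℝ → ℝ} (hN : Measurable N) (hD : DensLE E N R δ) (hX : Cov R X) :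
    ∫ x in E, ‖TT f N R x‖ ≤ Ctree * σ * δ * X := by
  obtain ⟨ι, P, k, n, ξ, h1, h2⟩ := hX
  by_cases hR : R = ∅
  · subst hR
    have : 0 ≤ X := (Finset.sum_nonneg fun t _ => (e8 _).le).trans h2
    have := Ctree0
    simp only [TT, Finset.sum_empty, norm_zero, integral_zero]; positivity
  obtain ⟨s0, hs0⟩ := Finset.nonempty_iff_ne_empty.2 hR
  obtain ⟨t0, ht0⟩ := h1 s0 hs0
  haveI : Nonempty ι := ⟨t0⟩
  choose! c hc using h1
  have e : ∀ x, TT f N R x = ∑ t ∈ P, TT f N (R.filter (c · = t)) x := fun x =>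
    (Finset.sum_fiberwise_of_maps_to (fun s hs => (hc s hs).1) _).symm
  calc _ ≤ ∫ x in E, ∑ t ∈ P, ‖TT f N (R.filter (c · = t)) x‖ := by
        refine integral_mono_of_nonneg (ae_of_all _ fun _ => norm_nonneg _)
          (integrable_finsetSum _ fun t _ => (TT_int hf hN _).norm.integrableOn) (ae_of_all _ fun x => ?_)
        dsimp only; rw [e]; exact norm_sum_le _ _
    _ = ∑ t ∈ P, ∫ x in E, ‖TT f N (R.filter (c · = t)) x‖ :=
        integral_finsetSum _ fun t _ => (TT_int hf hN _).norm.integrableOn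
    _ ≤ ∑ t ∈ P, Ctree * σ * δ * 8^(-k t) := by
        refine Finset.sum_le_sum fun t _ => tree (nT := n t) (ξ := ξ t) hf ?_ hσ hδ (hS.mono (Finset.filter_subset _ _)) hE hN
          (hD.mono (Finset.filter_subset _ _))
        intro s hs
        obtain ⟨a, rfl⟩ := Finset.mem_filter.1 hs
        exact (hc s a).2
    _ ≤ _ := by
        rw [← Finset.mul_sum]
        exact mul_le_mul_of_nonneg_left h2 (by have := Ctree0; positivity)
lemma mass_j {E : Set ℝ} (hE : MeasurableSet E) {N : ℝ → ℝ} (hN : Measurable N) {δ : ℝ} (hδ : 0 ≤ δ) {k n : ℤ} {Ω : Set ℝ} (hΩ : MeasurableSet Ω)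
    (h : δ * 8^(-k) < ∫ x in E ∩ N ⁻¹' Ω, W (nu k n x) ^ 6) :
    ∃ j : ℤ, δ * 8^(-k) ≤ 2^10 * W j ^ 4 * volume.real (E ∩ N ⁻¹' Ω ∩ II k (n + j)) := by
  by_contra! hc
  refine h.not_ge ?_
  have hm : MeasurableSet (E ∩ N ⁻¹' Ω) := hE.inter (hN hΩ)
  have hs := hasSum_integral_iUnion (μ := volume) (f := fun x => W (nu k n x) ^ 6) (s := fun j : ℤ => E ∩ N ⁻¹' Ω ∩ II k (n + j))
    (fun j => hm.inter (II_meas _ _)) (fun i j hij => Set.disjoint_left.2 fun x hx hx' => hij (by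
      have := II_disj hx.2 hx'.2; simpa using this)) (W_set_int k n (by norm_num) _)
  rw [← Set.inter_iUnion, show (⋃ j, II k (n + j)) = univ by
    ext x; simp only [mem_iUnion, mem_univ, iff_true]; exact ⟨⌊(8:ℝ)^k*x⌋ - n, by rw [add_sub_cancel]; exact self_II k x⟩, inter_univ] at hs
  refine hasSum_le_of_sum_le hs fun J => ?_
  calc ∑ j ∈ J, ∫ x in E ∩ N ⁻¹' Ω ∩ II k (n + j), W (nu k n x) ^ 6
      ≤ ∑ j ∈ J, δ * 8^(-k) * (2^6 * W j ^ 2 / 2^10) := by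
        refine Finset.sum_le_sum fun j _ => ?_
        have hv : volume (E ∩ N ⁻¹' Ω ∩ II k (n + j)) < ⊤ :=
          (measure_mono inter_subset_right).trans_lt (by rw [II_vol]; exact ENNReal.ofReal_lt_top)
        calc _ ≤ ∫ x in E ∩ N ⁻¹' Ω ∩ II k (n + j), 2^6 * W j ^ 6 := by
              refine setIntegral_mono_on (W_set_int k n (by norm_num) _) (integrableOn_const hv.ne) (hm.inter (II_meas _ _)) fun x hx => ?_
              have : W (nu k n x) ≤ 2 * W j := W_le_two (by
                have := nu_II.1 hx.2; unfold nu at *; push_cast at this; rw [abs_le]; constructor <;> linarith)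
              calc _ ≤ (2 * W j) ^ 6 := pow_le_pow_left₀ (W_nn _) this 6
                _ = _ := by ring
          _ = 2^6 * W j ^ 2 / 2^10 * (2^10 * W j ^ 4 * volume.real (E ∩ N ⁻¹' Ω ∩ II k (n + j))) := by
              rw [setIntegral_const, smul_eq_mul]; ring
          _ ≤ _ := by
              rw [mul_comm]
              have := W_nn j
              exact mul_le_mul_of_nonneg_right (hc j).le (by positivity)
    _ = δ * 8^(-k) * (2^6 / 2^10) * ∑ j ∈ J, W (0 - j) ^ 2 := by
        rw [Finset.mul_sum]; refine Finset.sum_congr rfl fun j _ => ?_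
        rw [zero_sub, W_neg]; ring
    _ ≤ δ * 8^(-k) * (2^6 / 2^10) * (2^2*4) :=
        mul_le_mul_of_nonneg_left (sumW le_rfl J 0) (by have := e8 (-k); positivity)
    _ = δ * 8^(-k) := by ring
/-- v ≥ v0 -/
def vge (v v0 : Tile) : Prop := Is v0 ⊆ Is v ∧ om v ⊆ om v0
lemma vge_antisymm {v w : Tile} (h : vge v w) (h' : vge w v) : v = w := by
  have h1 : v.1 = w.1 := le_antisymm (II_sub_scale h.1) (II_sub_scale h'.1)
  have hx := cen_II v.1 v.2.1
  have h2 := h'.1 hx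
  have hy := cen_II (-v.1) v.2.2
  have h3 := h.2 hy
  unfold Is at h2; unfold om at h3
  rw [← h1] at h2 h3
  exact Prod.ext h1 (Prod.ext (II_disj hx h2) (II_disj hy h3))
lemma vge_max (V : Finset Tile) {v0 : Tile} (h : v0 ∈ V) : ∃ v ∈ V, vge v v0 ∧ ∀ w ∈ V, vge w v → w = v := by
  obtain ⟨v, hv, hm⟩ := Finset.exists_min_image (V.filter (vge · v0)) (fun v => v.1) ⟨v0, Finset.mem_filter.2 ⟨h, subset_rfl, subset_rfl⟩⟩
  obtain ⟨a, b⟩ := Finset.mem_filter.1 hv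
  refine ⟨v, a, b, fun w hw hwv => ?_⟩
  have h1 := hm w (Finset.mem_filter.2 ⟨hw, b.1.trans hwv.1, hwv.2.trans b.2⟩)
  refine vge_antisymm hwv ?_
  have h0 := le_antisymm h1 (II_sub_scale hwv.1)
  have hx := cen_II v.1 v.2.1
  have hy := cen_II (-w.1) w.2.2
  exact ⟨II_sub h0.le hx (hwv.1 hx), II_sub (by omega) hy (hwv.2 hy)⟩
lemma mass {E : Set ℝ} (hE : MeasurableSet E) (hE' : volume E ≠ ⊤) {N : ℝ → ℝ} (hN : Measurable N) {δ : ℝ} (hδ : 0 < δ) (S : Finset Tile) :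
    ∃ S' ⊆ S, DensLE E N S' δ ∧ Cov (S \ S') (2^16 * (volume.real E / δ)) := by
  set S' := S.filter fun s => ∀ k n m : ℤ, Is s ⊆ II k n → II (-k) m ⊆ om s →
    ∫ x in E ∩ N ⁻¹' (II (-k) m), W (nu k n x) ^ 6 ≤ δ * 8^(-k) with hS'
  refine ⟨S', Finset.filter_subset _ _, fun s hs => (Finset.mem_filter.1 hs).2, ?_⟩
  have hv : ∀ s ∈ S \ S', ∃ (v : Tile) (j : ℤ), Is s ⊆ II v.1 (v.2.1 - j) ∧ om v ⊆ om s ∧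
      δ * 8^(-v.1) ≤ 2^10 * W j ^ 4 * volume.real (E ∩ N ⁻¹' (om v) ∩ Is v) := by
    intro s hs
    obtain ⟨h1, h2⟩ := Finset.mem_sdiff.1 hs
    have h2 : ¬ ∀ k n m : ℤ, Is s ⊆ II k n → II (-k) m ⊆ om s →
      ∫ x in E ∩ N ⁻¹' (II (-k) m), W (nu k n x) ^ 6 ≤ δ * 8^(-k) := fun h => h2 (Finset.mem_filter.2 ⟨h1, h⟩)
    push Not at h2
    obtain ⟨k, n, m, a, b, c⟩ := h2
    obtain ⟨j, hj⟩ := mass_j hE hN hδ.le (II_meas _ _) c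
    exact ⟨(k, n + j, m), j, by simpa using a, b, hj⟩
  choose! v j hvj using hv
  set J := (S \ S').image j
  let V : ℤ → Finset Tile := fun i => ((S \ S').filter (j · = i)).image v
  let M : ℤ → Finset Tile := fun i => (V i).filter fun v => ∀ w ∈ V i, vge w v → w = v
  have hVd : ∀ i, ∀ v ∈ V i, δ * 8^(-v.1) ≤ 2^10 * W i ^ 4 * volume.real (E ∩ N ⁻¹' (om v) ∩ Is v) := by
    intro i u hu
    obtain ⟨s, hs, rfl⟩ := Finset.mem_image.1 hu
    obtain ⟨hs', rfl⟩ := Finset.mem_filter.1 hs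
    exact (hvj s hs').2.2
  have hM : ∀ i, ∑ v ∈ M i, (8:ℝ)^(-v.1) ≤ 2^10 * W i ^ 4 * (volume.real E / δ) := by
    intro i
    have hW := W_nn i
    have h1 : ∑ v ∈ M i, volume.real (E ∩ N ⁻¹' (om v) ∩ Is v) ≤ volume.real E := by
      rw [← measureReal_biUnion_finset]
      · exact measureReal_mono (by simp only [iUnion_subset_iff]; intro u _ x hx; exact hx.1.1) hE'
      · intro a ha b hb hab
        rw [Function.onFun, Set.disjoint_left]
        intro x hx hx'
        obtain ⟨ha, ha'⟩ := Finset.mem_filter.1 ha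
        obtain ⟨hb, hb'⟩ := Finset.mem_filter.1 hb
        rcases le_total a.1 b.1 with hl | hl
        · exact hab (hb' a ha ⟨II_sub hl hx.2 hx'.2, II_sub (neg_le_neg hl) hx'.1.2 hx.1.2⟩)
        · exact hab.symm (ha' b hb ⟨II_sub hl hx'.2 hx.2, II_sub (neg_le_neg hl) hx.1.2 hx'.1.2⟩)
      · exact fun u _ => (hE.inter (hN (II_meas _ _))).inter (II_meas _ _)
    rw [← mul_div_assoc, le_div_iff₀ hδ, mul_comm, Finset.mul_sum]
    calc _ ≤ ∑ v ∈ M i, 2^10 * W i ^ 4 * volume.real (E ∩ N ⁻¹' (om v) ∩ Is v) :=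
          Finset.sum_le_sum fun u hu => hVd i u (Finset.mem_filter.1 hu).1
      _ ≤ _ := by rw [← Finset.mul_sum]; exact mul_le_mul_of_nonneg_left h1 (by positivity)
  refine ⟨_, J.sigma fun i => M i ×ˢ Finset.Icc (-|i|) |i|, fun p => p.2.1.1, fun p => p.2.1.2.1 + p.2.2, fun p => p.2.1.2.2 * 8^(-(-p.2.1.1)), ?_, ?_⟩
  · intro s hs
    obtain ⟨a, b, c⟩ := hvj s hs
    obtain ⟨u, hu, h1, h2⟩ := vge_max (V (j s)) (v0 := v s) (Finset.mem_image_of_mem _ (Finset.mem_filter.2 ⟨hs, rfl⟩))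
    set y := ((v s).2.1 : ℝ) * 8^(-(v s).1)
    set x := (((v s).2.1 - j s : ℤ) : ℝ) * 8^(-(v s).1)
    have hx : x ∈ II (v s).1 ((v s).2.1 - j s) := cen_II _ _
    have hy : y ∈ Is u := h1.1 (cen_II _ _)
    have hk : u.1 ≤ (v s).1 := II_sub_scale h1.1
    have hd : |(8:ℝ)^u.1 * x - 8^u.1 * y| ≤ |(j s : ℝ)| := by
      rw [show (8:ℝ)^u.1 * x - 8^u.1 * y = (8^u.1 * 8^(-(v s).1)) * (-(j s)) by simp only [x, y]; push_cast; ring, abs_mul, abs_neg]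
      refine mul_le_of_le_one_left (abs_nonneg _) ?_
      rw [abs_of_pos (by positivity), ← e8_add]
      exact zpow_le_one_of_nonpos₀ (by norm_num) (by omega)
    have hfl : |⌊(8:ℝ)^u.1 * x⌋ - u.2.1| ≤ |j s| := by
      have h3 := mem_II.1 hy
      have h4 := Int.floor_le ((8:ℝ)^u.1 * x); have h5 := Int.lt_floor_add_one ((8:ℝ)^u.1 * x)
      have h6 := abs_le.1 hd
      have : |(j s : ℝ)| = ((|j s| : ℤ) : ℝ) := by push_cast; rfl
      rw [this] at h6
      rw [abs_le]
      constructor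
      · have : (-(|j s| : ℤ) : ℝ) - 1 < ((⌊(8:ℝ)^u.1 * x⌋ - u.2.1 : ℤ) : ℝ) := by push_cast at *; linarith
        have : -|j s| - 1 < ⌊(8:ℝ)^u.1 * x⌋ - u.2.1 := by exact_mod_cast this
        omega
      · have : ((⌊(8:ℝ)^u.1 * x⌋ - u.2.1 : ℤ) : ℝ) < ((|j s| : ℤ) : ℝ) + 1 := by push_cast at *; linarith
        have : ⌊(8:ℝ)^u.1 * x⌋ - u.2.1 < |j s| + 1 := by exact_mod_cast this
        omega
    refine ⟨⟨j s, u, ⌊(8:ℝ)^u.1 * x⌋ - u.2.1⟩, ?_, ?_, ?_⟩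
    · simp only [Finset.mem_sigma, Finset.mem_product, Finset.mem_Icc]
      exact ⟨Finset.mem_image_of_mem _ hs, Finset.mem_filter.2 ⟨hu, h2⟩, abs_le.1 hfl⟩
    · dsimp only
      rw [add_sub_cancel]
      exact a.trans (II_sub hk (self_II _ _) hx)
    · exact b (h1.2 (cen_II _ _))
  · rw [Finset.sum_sigma]
    calc _ ≤ ∑ i ∈ J, 2^11 * (volume.real E / δ) * W (0 - i) ^ 3 := by
          refine Finset.sum_le_sum fun i _ => ?_
          rw [Finset.sum_product]
          simp only [Finset.sum_const, nsmul_eq_mul]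
          rw [← Finset.mul_sum]
          have h1 : ((Finset.Icc (-|i|) |i|).card : ℝ) ≤ 2 * (1 + |(i:ℝ)|) := by
            rw [Int.card_Icc]
            have : ((|i| + 1 - -|i|).toNat : ℤ) = 2 * |i| + 1 := by rw [Int.toNat_of_nonneg] <;> [ring; (have := abs_nonneg i; omega)]
            have : (((|i| + 1 - -|i|).toNat : ℤ) : ℝ) = 2 * |(i:ℝ)| + 1 := by rw [this]; push_cast; rfl
            have : (((|i| + 1 - -|i|).toNat : ℕ) : ℝ) = 2 * |(i:ℝ)| + 1 := by exact_mod_cast this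
            rw [this]; linarith
          have hW := W_nn i
          have hWe : (1 + |(i:ℝ)|) * W i = 1 := by unfold W; field_simp
          calc _ ≤ 2 * (1 + |(i:ℝ)|) * (2^10 * W i ^ 4 * (volume.real E / δ)) :=
                mul_le_mul h1 (hM i) (Finset.sum_nonneg fun _ _ => (e8 _).le) (by positivity)
            _ = _ := by rw [zero_sub, W_neg]; linear_combination (2^11 * W i ^ 3 * (volume.real E / δ)) * hWe
      _ ≤ 2^11 * (volume.real E / δ) * (2^3*4) := by
          rw [← Finset.mul_sum]
          exact mul_le_mul_of_nonneg_left (sumW (by norm_num) J 0) (by positivity)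
      _ = _ := by ring
end Carl
end
noncomputable section
namespace Carl
open Classical
lemma Nice.sq {f : ℝ → ℂ} (hf : Nice f) : Integrable (fun x => ‖f x‖ ^ 2) := by
  obtain ⟨M, hM⟩ := hf.b
  simp_rw [pow_two]
  exact hf.i.norm.mul_bdd (c := M) hf.m.norm.aestronglyMeasurable (ae_of_all _ fun x => by simpa using hM x)
def BB (f : ℝ → ℂ) (y : Tile → ℝ) (s : Tile) : ℝ := ‖Fw f s.1 s.2.2 (y s)‖
lemma BB_nn (f : ℝ → ℂ) (y : Tile → ℝ) (s : Tile) : 0 ≤ BB f y s := norm_nonneg _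
def pk (y : Tile → ℝ) (s : Tile) (z : ℝ) : ℂ := (starRingEnd ℂ) (ph s.1 s.2.2 (y s - z))
lemma pk_meas (y : Tile → ℝ) (s : Tile) : Measurable (pk y s) := by
  unfold pk; exact Complex.continuous_conj.measurable.comp ((ph_meas _ _).comp (by fun_prop))
lemma pk_int (y : Tile → ℝ) (s : Tile) : Integrable (pk y s) := by
  refine ((ph_int s.1 s.2.2).comp_sub_left (y s)).congr' (pk_meas y s).aestronglyMeasurable (ae_of_all _ fun z => ?_)
  simp [pk]
lemma pk_bd (y : Tile → ℝ) (s : Tile) (z : ℝ) : ‖pk y s z‖ ≤ Cp * 8^s.1 * W (8^s.1 * (y s - z)) ^ 20 := by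
  unfold pk; rw [RCLike.norm_conj]; exact ph_bd _ _ _
lemma pk_bd' (y : Tile → ℝ) (s : Tile) (z : ℝ) : ‖pk y s z‖ ≤ Cp * 8^s.1 := by
  unfold pk; rw [RCLike.norm_conj]; exact ph_bd' _ _ _
lemma pk_mul_int (y : Tile → ℝ) (s t : Tile) : Integrable (fun x => pk y s x * (starRingEnd ℂ) (pk y t x)) :=
  (pk_int y s).mul_bdd (c := Cp * 8^t.1) (Complex.continuous_conj.measurable.comp (pk_meas y t)).aestronglyMeasurable
    (ae_of_all _ fun x => by rw [RCLike.norm_conj]; exact pk_bd' _ _ _)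
lemma pk_pair (y : Tile → ℝ) {s t : Tile} (h : s.1 ≤ t.1) :
    ‖∫ x, pk y s x * (starRingEnd ℂ) (pk y t x)‖ ≤ 4 * Cp^2 * 8^s.1 * W (8^s.1 * (y s - y t)) ^ 4 := by
  have hp := Cp0
  have hI : Integrable fun z => (8^s.1 * W (8^s.1 * (y s - z)) ^ (4+2)) * (8^t.1 * W (8^t.1 * (y t - z)) ^ (4+2)) := by
    refine Integrable.mul_bdd (c := 8^t.1) ?_ (by fun_prop) (ae_of_all _ fun z => ?_)
    · refine Integrable.const_mul ?_ _
      have := (intWa (p := 6) (by norm_num) (e8 s.1) (8^s.1 * y s))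
      refine this.congr (ae_of_all _ fun z => ?_)
      dsimp only; rw [← W_neg]; congr 2; ring
    · have := W_nn (8^t.1 * (y t - z)); have := e8 t.1
      rw [Real.norm_of_nonneg (by positivity)]
      exact mul_le_of_le_one_right this.le (W_pow_le_one _ _)
  calc _ ≤ ∫ z, Cp^2 * ((8^s.1 * W (8^s.1 * (y s - z)) ^ (4+2)) * (8^t.1 * W (8^t.1 * (y t - z)) ^ (4+2))) := by
        refine norm_integral_le_of_norm_le (hI.const_mul _) (ae_of_all _ fun z => ?_)
        rw [norm_mul, RCLike.norm_conj]
        have h1 := W_nn (8^t.1 * (y t - z)); have h2 := W_nn (8^s.1 * (y s - z))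
        have e1 := e8 s.1; have e2 := e8 t.1
        calc _ ≤ (Cp * 8^s.1 * W (8^s.1 * (y s - z)) ^ 6) * (Cp * 8^t.1 * W (8^t.1 * (y t - z)) ^ 6) := by
              refine mul_le_mul ((pk_bd y s z).trans ?_) ((pk_bd y t z).trans ?_) (norm_nonneg _) (by positivity)
              · exact mul_le_mul_of_nonneg_left (W_pow_anti (by norm_num) _) (by positivity)
              · exact mul_le_mul_of_nonneg_left (W_pow_anti (by norm_num) _) (by positivity)
          _ = _ := by ring
    _ ≤ Cp^2 * (4 * 8^s.1 * W (8^s.1 * (y s - y t)) ^ 4) := by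
        rw [integral_const_mul]
        exact mul_le_mul_of_nonneg_left (D1 4 h _ _) (by positivity)
    _ = _ := by ring
def DD (y : Tile → ℝ) (s t : Tile) : ℝ := if om s ⊆ om1 t.1 t.2.2 then 8^(-t.1) * W (nus s (y t)) ^ 4 else 0
lemma DD_nn (y : Tile → ℝ) (s t : Tile) : 0 ≤ DD y s t := by
  unfold DD; split_ifs
  · have := W_nn (nus s (y t)); have := e8 (-t.1); positivity
  · rfl
lemma gram_term {f : ℝ → ℂ} {y : Tile → ℝ} (hy : ∀ s, y s ∈ Is s) {s t : Tile} {σ : ℝ} (hs : BB f y s ≤ σ) (ht : BB f y t ≤ σ) :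
    8^(-s.1) * 8^(-t.1) * BB f y s * BB f y t * ‖∫ x, pk y s x * (starRingEnd ℂ) (pk y t x)‖ ≤
      16 * Cp^2 * (if s.1 = t.1 ∧ s.2.2 = t.2.2 then BB f y s * BB f y t * 8^(-s.1) * W ((s.2.1 : ℝ) - t.2.1) ^ 2 else 0)
      + 64 * Cp^2 * σ^2 * (DD y s t + DD y t s) := by
  have hp := Cp0
  have a1 := BB_nn f y s; have a2 := BB_nn f y t
  have d1 := DD_nn y s t; have d2 := DD_nn y t s
  have off : ∀ {s t : Tile}, BB f y s ≤ σ → BB f y t ≤ σ → s.1 < t.1 → II (-s.1) s.2.2 ⊆ om1 t.1 t.2.2 →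
     8^(-s.1) * 8^(-t.1) * BB f y s * BB f y t * (4 * Cp^2 * 8^s.1 * W (8^s.1 * (y s - y t)) ^ 4) ≤ 64 * Cp^2 * σ^2 * DD y s t := by
    intro s t hs ht h1 h2
    have a1 := BB_nn f y s; have a2 := BB_nn f y t
    unfold DD; rw [if_pos h2]
    have hW : W (8^s.1 * (y s - y t)) ≤ 2 * W (nus s (y t)) := by
      rw [← W_neg, ← mul_neg, neg_sub]; exact W_II (hy s)
    have e := e8_neg' s.1; have := e8 (-t.1)
    have hW0 := W_nn (nus s (y t))
    calc _ = 4 * Cp^2 * 8^(-t.1) * (BB f y s * BB f y t) * W (8^s.1 * (y s - y t)) ^ 4 := by linear_combination (4 * Cp^2 * 8^(-t.1) * (BB f y s * BB f y t) * W (8^s.1 * (y s - y t)) ^ 4) * e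
      _ ≤ 4 * Cp^2 * 8^(-t.1) * (σ * σ) * (2 * W (nus s (y t))) ^ 4 := by
          refine mul_le_mul (mul_le_mul_of_nonneg_left (mul_le_mul hs ht a2 (a1.trans hs)) (by positivity)) (pow_le_pow_left₀ (W_nn _) hW 4) (pow_nonneg (W_nn _) 4) ?_
          have := a1.trans hs; positivity
      _ = _ := by ring
  have i0 : 0 ≤ (if s.1 = t.1 ∧ s.2.2 = t.2.2 then BB f y s * BB f y t * 8^(-s.1) * W ((s.2.1 : ℝ) - t.2.1) ^ 2 else 0) := by
    split_ifs
    · have := W_nn ((s.2.1 : ℝ) - t.2.1); have := e8 (-s.1); positivity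
    · rfl
  have c0 : 0 ≤ 8^(-s.1) * 8^(-t.1) * BB f y s * BB f y t := by positivity
  by_cases hd : Disjoint (om1 s.1 s.2.2) (om1 t.1 t.2.2)
  · have : ∫ x, pk y s x * (starRingEnd ℂ) (pk y t x) = 0 := by
      have h := ph_orth' hd.symm (y t) (y s)
      rw [← h]; congr 1; ext z; unfold pk; rw [Complex.conj_conj]; ring
    rw [this, norm_zero, mul_zero]; positivity
  rcases om1_cases hd with ⟨h1, h2⟩ | ⟨h1, h2⟩ | ⟨h1, h2⟩
  · rw [if_pos ⟨h1, h2⟩]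
    refine le_trans ?_ (le_add_of_nonneg_right (by positivity))
    have hW : W (8^s.1 * (y s - y t)) ≤ 2 * W ((s.2.1 : ℝ) - t.2.1) := by
      apply W_le_two
      have y1 := mem_II.1 (hy s)
      have y2 := mem_II.1 (hy t)
      rw [← h1] at y2
      rw [abs_le]; constructor <;> linarith
    refine (mul_le_mul_of_nonneg_left (pk_pair y h1.le) c0).trans ?_
    rw [← h1]
    have e := e8_neg' s.1; have := e8 (-s.1)
    have h4 : W (8^s.1 * (y s - y t)) ^ 4 ≤ (2 * W ((s.2.1 : ℝ) - t.2.1)) ^ 2 :=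
      (W_pow_anti (by norm_num) _).trans (pow_le_pow_left₀ (W_nn _) hW 2)
    calc _ = 4 * Cp^2 * BB f y s * BB f y t * 8^(-s.1) * W (8^s.1 * (y s - y t)) ^ 4 := by linear_combination (4 * Cp^2 * 8^(-s.1) * (BB f y s * BB f y t) * W (8^s.1 * (y s - y t)) ^ 4) * e
      _ ≤ _ := (mul_le_mul_of_nonneg_left h4 (by positivity))
      _ = _ := by ring
  · refine (mul_le_mul_of_nonneg_left (pk_pair y h1.le) c0).trans ((off hs ht h1 h2).trans ?_)
    have : 0 ≤ 64 * Cp^2 * σ^2 * DD y t s := by positivity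
    rw [mul_add]; linarith [mul_nonneg (by positivity : 0 ≤ 16 * Cp^2) i0]
  · have hsym : ‖∫ x, pk y s x * (starRingEnd ℂ) (pk y t x)‖ = ‖∫ x, pk y t x * (starRingEnd ℂ) (pk y s x)‖ := by
      rw [← RCLike.norm_conj (K := ℂ), ← integral_conj]; congr 2; ext x; simp [mul_comm]
    rw [hsym]
    refine (mul_le_mul_of_nonneg_left (pk_pair y h1.le) c0).trans (le_trans (le_of_eq (by ring)) ((off ht hs h1 h2).trans ?_))
    have : 0 ≤ 64 * Cp^2 * σ^2 * DD y s t := by positivity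
    rw [mul_add]; linarith [mul_nonneg (by positivity : 0 ≤ 16 * Cp^2) i0]
lemma DD_sum {y : Tile → ℝ} (hy : ∀ s, y s ∈ Is s) {U : Finset Tile} {P : Finset (ℤ × ℤ × ℝ)} {top : Tile → ℤ × ℤ × ℝ}
    (h1 : ∀ s ∈ U, top s ∈ P ∧ Is s ⊆ II (top s).1 (top s).2.1 ∧ (top s).2.2 ∈ o2 s)
    (h3 : ∀ s ∈ U, ∀ t ∈ U, om s ⊆ om1 t.1 t.2.2 → Disjoint (Is t) (II (top s).1 (top s).2.1)) :
    ∑ s ∈ U, ∑ t ∈ U, DD y s t ≤ 2^12 * ∑ p ∈ P, (8:ℝ)^(-p.1) := by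
  have hs : ∀ s ∈ U, ∑ t ∈ U, DD y s t ≤ 2^4 * ∫ y in (II (top s).1 (top s).2.1)ᶜ, W (nu s.1 s.2.1 y) ^ 4 := by
    intro s hs
    unfold DD; rw [← Finset.sum_filter]
    refine P2 (p := 4) (by norm_num) _ (fun t => t.1) (fun t => t.2.1) y s.1 s.2.1 _ ?_ ?_ ?_ ?_
    · intro t ht
      have := II_sub_scale ((Finset.mem_filter.1 ht).2.trans (om1_sub _ _))
      omega
    · exact fun t _ => hy t
    · intro t ht x hx hx'
      obtain ⟨a, b⟩ := Finset.mem_filter.1 ht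
      exact Set.disjoint_left.1 (h3 s hs t a b) hx hx'
    · have key : ∀ t ∈ U, ∀ t' ∈ U, om s ⊆ om1 t.1 t.2.2 → om s ⊆ om1 t'.1 t'.2.2 → t ≠ t' → t.1 ≤ t'.1 → Disjoint (Is t) (Is t') := by
        intro t ht t' ht' a a' hne hle
        have hξ := cen_II (-s.1) s.2.2
        rcases hle.eq_or_lt with he | hlt
        · rw [Set.disjoint_left]
          intro x hx hx'
          have hx'' : x ∈ II t.1 t'.2.1 := by rw [he]; exact hx'
          exact hne (tile_inj (om1_sub _ _ (a hξ)) (om1_sub _ _ (a' hξ)) he (II_disj hx hx''))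
        · exact ((h3 t ht t' ht' (om1_nest hlt (om1_sub _ _ (a hξ)) (a' hξ))).symm).mono_left (h1 t ht).2.1
      intro t ht t' ht' hne
      obtain ⟨a, b⟩ := Finset.mem_filter.1 ht
      obtain ⟨a', b'⟩ := Finset.mem_filter.1 ht'
      rcases le_total t.1 t'.1 with h | h
      · exact key t a t' a' b b' hne h
      · exact (key t' a' t a b' b hne.symm h).symm
  calc _ ≤ ∑ s ∈ U, 2^4 * ∫ y in (II (top s).1 (top s).2.1)ᶜ, W (nu s.1 s.2.1 y) ^ 4 := Finset.sum_le_sum hs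
    _ = ∑ p ∈ P, ∑ s ∈ U with top s = p, 2^4 * ∫ y in (II (top s).1 (top s).2.1)ᶜ, W (nu s.1 s.2.1 y) ^ 4 :=
        (Finset.sum_fiberwise_of_maps_to (fun s hs => (h1 s hs).1) _).symm
    _ ≤ ∑ p ∈ P, 2^12 * (8:ℝ)^(-p.1) := by
        refine Finset.sum_le_sum fun p _ => ?_
        have := Q1 (U.filter (top · = p)) p.1 p.2.1 (fun s hs => by
            obtain ⟨a, rfl⟩ := Finset.mem_filter.1 hs; exact (h1 s a).2.1) (fun s hs t ht => by
            obtain ⟨a, rfl⟩ := Finset.mem_filter.1 hs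
            obtain ⟨b, hb⟩ := Finset.mem_filter.1 ht
            exact tile_inj (ξ := (top s).2.2) (h1 s a).2.2.1 (hb ▸ (h1 t b).2.2.1))
        rw [← Finset.mul_sum, Finset.sum_congr rfl fun s hs => by rw [(Finset.mem_filter.1 hs).2]]
        linarith
    _ = _ := by rw [Finset.mul_sum]
lemma bessel0 {f : ℝ → ℂ} (hf : Nice f) {y : Tile → ℝ} (hy : ∀ s, y s ∈ Is s) {U : Finset Tile} {σ D : ℝ}
    (hA : ∀ s ∈ U, BB f y s ≤ σ) (hD : ∑ s ∈ U, ∑ t ∈ U, DD y s t ≤ D)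
    (h2 : σ^2 * D ≤ 2^14 * ∑ s ∈ U, 8^(-s.1) * BB f y s ^ 2) :
    ∑ s ∈ U, 8^(-s.1) * BB f y s ^ 2 ≤ 2^22 * Cp^2 * ∫ x, ‖f x‖ ^ 2 := by
  have hp := Cp0
  set B := ∑ s ∈ U, 8^(-s.1) * BB f y s ^ 2
  let c : Tile → ℂ := fun s => ((8:ℝ)^(-s.1) : ℝ) * Fw f s.1 s.2.2 (y s)
  have hc : ∀ s, ‖c s‖ = 8^(-s.1) * BB f y s := fun s => by
    simp only [c, norm_mul, Complex.norm_real, Real.norm_of_nonneg (e8 (-s.1)).le]; rfl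
  let h : Tile → ℝ → ℂ := fun s z => c s * pk y s z
  have hcc : ∀ s t x, h s x * (starRingEnd ℂ) (h t x) = (c s * (starRingEnd ℂ) (c t)) * (pk y s x * (starRingEnd ℂ) (pk y t x)) := by
    intro s t x; simp only [h, map_mul]; ring
  have hint : ∀ s t, Integrable (fun x => h s x * (starRingEnd ℂ) (h t x)) := fun s t => by
    simp_rw [hcc]; exact (pk_mul_int y s t).const_mul _
  have hg := gram U h fun s _ t _ => hint s t
  have hG : ∫ x, ‖∑ s ∈ U, h s x‖ ^ 2 ≤ 2^22 * Cp^2 * B := by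
    refine hg.trans ?_
    calc _ ≤ ∑ s ∈ U, ∑ t ∈ U, (16 * Cp^2 * (if s.1 = t.1 ∧ s.2.2 = t.2.2 then BB f y s * BB f y t * 8^(-s.1) * W ((s.2.1 : ℝ) - t.2.1) ^ 2 else 0)
            + 64 * Cp^2 * σ^2 * (DD y s t + DD y t s)) := by
          refine Finset.sum_le_sum fun s hs => Finset.sum_le_sum fun t ht => ?_
          refine le_trans (le_of_eq ?_) (gram_term hy (hA s hs) (hA t ht))
          simp_rw [hcc]
          rw [integral_const_mul, norm_mul, norm_mul, RCLike.norm_conj, hc, hc]; ring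
      _ = 16 * Cp^2 * (∑ s ∈ U, ∑ t ∈ U, (if s.1 = t.1 ∧ s.2.2 = t.2.2 then BB f y s * BB f y t * 8^(-s.1) * W ((s.2.1 : ℝ) - t.2.1) ^ 2 else 0))
          + 64 * Cp^2 * σ^2 * (∑ s ∈ U, ∑ t ∈ U, DD y s t + ∑ s ∈ U, ∑ t ∈ U, DD y t s) := by
          simp only [Finset.sum_add_distrib, ← Finset.mul_sum]
      _ ≤ 16 * Cp^2 * (16 * B) + 64 * Cp^2 * σ^2 * (D + D) := by
          have d' := hD; rw [Finset.sum_comm] at d'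
          have sch := schur U (BB f y)
          refine add_le_add (mul_le_mul_of_nonneg_left ?_ (by positivity)) (mul_le_mul_of_nonneg_left (add_le_add hD d') (by positivity))
          convert sch using 5
      _ = 256 * Cp^2 * B + 2^7 * Cp^2 * (σ^2 * D) := by ring
      _ ≤ 256 * Cp^2 * B + 2^7 * Cp^2 * (2^14 * B) := by
          have := mul_le_mul_of_nonneg_left h2 (by positivity : 0 ≤ 2^7 * Cp^2); linarith
      _ ≤ _ := by
          have : 0 ≤ B := Finset.sum_nonneg fun s _ => mul_nonneg (e8 _).le (sq_nonneg _)
          nlinarith [mul_nonneg (sq_nonneg Cp) this]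
  have hgi : Integrable fun x => ‖∑ s ∈ U, h s x‖ ^ 2 := by
    have e : ∀ x, ‖∑ s ∈ U, h s x‖ ^ 2 = (∑ s ∈ U, ∑ t ∈ U, h s x * (starRingEnd ℂ) (h t x)).re := fun x => by
      rw [← Finset.sum_mul_sum, ← map_sum, Complex.mul_conj, Complex.ofReal_re, Complex.normSq_eq_norm_sq]
    simp_rw [e]
    exact (integrable_finsetSum _ fun s _ => integrable_finsetSum _ fun t _ => hint s t).re
  set R := 2^22 * Cp^2
  have hR : 0 < R := by positivity
  have hfp : ∀ s, Integrable fun x => f x * (starRingEnd ℂ) (h s x) := fun s =>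
    hf.i.mul_bdd (c := ‖c s‖ * (Cp * 8^s.1)) (Complex.continuous_conj.measurable.comp ((pk_meas y s).const_mul _)).aestronglyMeasurable
      (ae_of_all _ fun x => by
        rw [RCLike.norm_conj]; simp only [h, norm_mul]
        exact mul_le_mul_of_nonneg_left (pk_bd' _ _ _) (norm_nonneg _))
  have hB : (B : ℂ) = ∫ x, f x * (starRingEnd ℂ) (∑ s ∈ U, h s x) := by
    simp_rw [map_sum, Finset.mul_sum]
    rw [integral_finsetSum _ fun s _ => hfp s]
    simp only [B]; push_cast
    refine Finset.sum_congr rfl fun s _ => ?_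
    have : ∀ x, f x * (starRingEnd ℂ) (h s x) = (starRingEnd ℂ) (c s) * (f x * ph s.1 s.2.2 (y s - x)) := fun x => by
      simp only [h, pk, map_mul, Complex.conj_conj]; ring
    simp_rw [this]
    rw [integral_const_mul]
    change _ = _ * Fw f s.1 s.2.2 (y s)
    simp only [c, map_mul, Complex.conj_ofReal]
    rw [mul_assoc, mul_comm ((starRingEnd ℂ) _), Complex.mul_conj, Complex.normSq_eq_norm_sq]
    push_cast; rfl
  have hB2 : B ≤ ∫ x, (R / 2 * ‖f x‖ ^ 2 + (1 / (2 * R)) * ‖∑ s ∈ U, h s x‖ ^ 2) := by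
    calc B ≤ ‖(B:ℂ)‖ := by rw [Complex.norm_real]; exact le_abs_self B
      _ ≤ _ := by
        rw [hB]
        refine norm_integral_le_of_norm_le ((hf.sq.const_mul _).add (hgi.const_mul _)) (ae_of_all _ fun x => ?_)
        rw [norm_mul, RCLike.norm_conj]
        have : 0 ≤ (R * ‖f x‖ - ‖∑ s ∈ U, h s x‖) ^ 2 / (2 * R) := by positivity
        have e : (R * ‖f x‖ - ‖∑ s ∈ U, h s x‖) ^ 2 / (2 * R) = R / 2 * ‖f x‖ ^ 2 + (1 / (2 * R)) * ‖∑ s ∈ U, h s x‖ ^ 2 - ‖f x‖ * ‖∑ s ∈ U, h s x‖ := by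
          field_simp; ring
        linarith
  rw [integral_add (hf.sq.const_mul _) (hgi.const_mul _), integral_const_mul, integral_const_mul] at hB2
  have h5 : 1 / (2 * R) * ∫ x, ‖∑ s ∈ U, h s x‖ ^ 2 ≤ B / 2 := by
    refine (mul_le_mul_of_nonneg_left hG (by positivity)).trans (le_of_eq ?_)
    field_simp
  linarith
lemma bessel {f : ℝ → ℂ} (hf : Nice f) {U : Finset Tile} {P : Finset (ℤ × ℤ × ℝ)} {top : Tile → ℤ × ℤ × ℝ} {σ : ℝ}
    (h1 : ∀ s ∈ U, top s ∈ P ∧ Is s ⊆ II (top s).1 (top s).2.1 ∧ (top s).2.2 ∈ o2 s)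
    (h3 : ∀ s ∈ U, ∀ t ∈ U, om s ⊆ om1 t.1 t.2.2 → Disjoint (Is t) (II (top s).1 (top s).2.1))
    (hA : ∀ s ∈ U, AA f s ≤ σ)
    (h2 : σ^2 * ∑ p ∈ P, (8:ℝ)^(-p.1) ≤ 4 * ∑ s ∈ U, 8^(-s.1) * AA f s ^ 2) :
    ∑ s ∈ U, 8^(-s.1) * AA f s ^ 2 ≤ 2^22 * Cp^2 * ∫ x, ‖f x‖ ^ 2 :=
  bessel0 hf (fun s => (ys_spec hf.i s).1) hA (DD_sum (fun s => (ys_spec hf.i s).1) h1 h3) (by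
    change _ ≤ 2^14 * ∑ s ∈ U, 8^(-s.1) * AA f s ^ 2
    linarith)
end Carl
end
noncomputable section
namespace Carl
open Classical
def lend (s : Tile) : ℝ := ((s.2.2:ℝ) + 1/2) * 8^s.1
lemma o2_iff (s : Tile) (ξ : ℝ) : ξ ∈ o2 s ↔ lend s ≤ ξ ∧ ξ < ((s.2.2:ℝ) + 1) * 8^s.1 := by
  have h := e8 s.1
  have e := e8_neg' s.1
  unfold o2 om2 lend
  simp only [mem_ofPred_eq, nu_II]
  unfold nu
  have e2 : ξ = 8^s.1 * (8^(-s.1) * ξ) := by rw [← mul_assoc, e8_neg, one_mul]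
  set w := 8^(-s.1) * ξ
  constructor
  · rintro ⟨⟨a, b⟩, c⟩
    rw [e2]; constructor <;> nlinarith
  · rintro ⟨a, b⟩
    rw [e2, mul_comm _ w] at a b
    have a' := le_of_mul_le_mul_right a h
    have b' := lt_of_mul_lt_mul_right b h.le
    refine ⟨⟨?_, ?_⟩, ?_⟩ <;> linarith
def viol (A : Tile → ℝ) (σ : ℝ) (S : Finset Tile) (p : ℤ × ℤ × ℝ) : Prop :=
  (σ/2)^2 * 8^(-p.1) < ∑ s ∈ S with (Is s ⊆ II p.1 p.2.1 ∧ p.2.2 ∈ o2 s), 8^(-s.1) * A s ^ 2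
lemma viol_lend {A : Tile → ℝ} {σ : ℝ} {S : Finset Tile} {p : ℤ × ℤ × ℝ} (h : viol A σ S p) :
    ∃ ξ ∈ S.image lend, viol A σ S (p.1, p.2.1, ξ) := by
  set T := S.filter fun s => Is s ⊆ II p.1 p.2.1 ∧ p.2.2 ∈ o2 s
  have hne : T.Nonempty := by
    by_contra hc
    rw [Finset.not_nonempty_iff_eq_empty] at hc
    unfold viol at h; simp only [T] at hc; rw [hc, Finset.sum_empty] at h
    have := e8 (-p.1); have := mul_nonneg (sq_nonneg (σ/2)) this.le
    linarith
  obtain ⟨t, ht, hm⟩ := Finset.exists_max_image T lend hne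
  refine ⟨lend t, Finset.mem_image_of_mem _ (Finset.mem_filter.1 ht).1, h.trans_le ?_⟩
  refine Finset.sum_le_sum_of_subset_of_nonneg ?_ fun s _ _ => mul_nonneg (e8 _).le (sq_nonneg _)
  intro s hs
  obtain ⟨a, b, c⟩ := Finset.mem_filter.1 hs
  refine Finset.mem_filter.2 ⟨a, b, (o2_iff _ _).2 ⟨hm s hs, ?_⟩⟩
  exact ((o2_iff _ _).1 (Finset.mem_filter.1 ht).2.2).1.trans_lt ((o2_iff _ _).1 c).2
lemma greedy (A : Tile → ℝ) {σ : ℝ} : ∀ (n : ℕ) (S : Finset Tile), S.card ≤ n →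
    ∃ S' ⊆ S, SizeLE A S' (σ/2) ∧ ∃ U ⊆ S, ∃ (P : Finset (ℤ × ℤ × ℝ)) (top : Tile → ℤ × ℤ × ℝ),
    (∀ s ∈ U, top s ∈ P ∧ Is s ⊆ II (top s).1 (top s).2.1 ∧ (top s).2.2 ∈ o2 s) ∧
    (∀ s ∈ U, ∀ t ∈ U, om s ⊆ om1 t.1 t.2.2 → Disjoint (Is t) (II (top s).1 (top s).2.1)) ∧
    (σ^2 * ∑ p ∈ P, (8:ℝ)^(-p.1) ≤ 4 * ∑ s ∈ U, 8^(-s.1) * A s ^ 2) ∧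
    (∀ s ∈ S \ S', ∃ p ∈ P, Is s ⊆ II p.1 p.2.1 ∧ p.2.2 ∈ om s) ∧ (∀ p ∈ P, ∃ s ∈ U, top s = p) ∧
    ∀ p ∈ P, p.2.2 ∈ S.image lend ∧ viol A σ S p := by
  intro n
  induction n with
  | zero =>
    intro S hS
    obtain rfl : S = ∅ := by simpa using hS
    exact ⟨∅, by simp, fun kT nT ξ => by simp; have := e8 (-kT); simp at this; positivity, ∅, by simp, ∅, fun _ => (0,0,0), by simp⟩
  | succ n ih =>
    intro S hS
    by_cases hsz : SizeLE A S (σ/2)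
    · exact ⟨S, subset_rfl, hsz, ∅, by simp, ∅, fun _ => (0,0,0), by simp⟩
    unfold SizeLE at hsz; push Not at hsz
    obtain ⟨k, m, ξ, hv⟩ := hsz
    obtain ⟨ξ', h1, h2⟩ := viol_lend (p := (k, m, ξ)) hv
    obtain ⟨ξ0, h0, hmin⟩ := Finset.exists_min_image ((S.image lend).filter fun ξ => ∃ k m, viol A σ S (k, m, ξ)) id
      ⟨ξ', Finset.mem_filter.2 ⟨h1, _, _, h2⟩⟩
    obtain ⟨h0, k0, n0, hv0⟩ := Finset.mem_filter.1 h0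
    clear hv h1 h2 ξ ξ' k m
    set T0 := S.filter fun s => Is s ⊆ II k0 n0 ∧ ξ0 ∈ o2 s with hT0
    set S1 := S.filter fun s => ¬ (Is s ⊆ II k0 n0 ∧ ξ0 ∈ om s) with hS1
    have hne : T0.Nonempty := by
      by_contra hc
      rw [Finset.not_nonempty_iff_eq_empty] at hc
      unfold viol at hv0; simp only [T0] at hc; rw [hc, Finset.sum_empty] at hv0
      have := e8 (-k0); have := mul_nonneg (sq_nonneg (σ/2)) this.le
      simp only at hv0
      linarith
    have hcard : S1.card ≤ n := by
      obtain ⟨t, ht⟩ := hne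
      obtain ⟨a, b, c⟩ := Finset.mem_filter.1 ht
      have : S1.card < S.card := Finset.card_lt_card (Finset.filter_ssubset.2 ⟨t, a, not_not.2 ⟨b, c.1⟩⟩)
      omega
    have hS1S : S1 ⊆ S := Finset.filter_subset _ _
    obtain ⟨S', hS', hsz, U, hU, P, top, c1, c3, c2, c4, c5, c6⟩ := ih S1 hcard
    have hd : ∀ s ∈ U, s ∉ T0 := fun s hs hs' =>
      (Finset.mem_filter.1 (hU hs)).2 ⟨(Finset.mem_filter.1 hs').2.1, (Finset.mem_filter.1 hs').2.2.1⟩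
    have hvm : ∀ p ∈ P, viol A σ S p ∧ ξ0 ≤ p.2.2 ∧ p.2.2 ∈ S.image lend := by
      intro p hp
      have hi := Finset.image_subset_image hS1S (c6 p hp).1
      have : viol A σ S p := (c6 p hp).2.trans_le (Finset.sum_le_sum_of_subset_of_nonneg
        (Finset.filter_subset_filter _ hS1S) fun s _ _ => mul_nonneg (e8 _).le (sq_nonneg _))
      exact ⟨this, hmin p.2.2 (Finset.mem_filter.2 ⟨hi, p.1, p.2.1, this⟩), hi⟩
    have htP : (k0, n0, ξ0) ∉ P := by
      intro h
      obtain ⟨s, hs, hst⟩ := c5 _ h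
      have := (c1 s hs).2
      rw [hst] at this
      exact (Finset.mem_filter.1 (hU hs)).2 ⟨this.1, this.2.1⟩
    refine ⟨S', hS'.trans hS1S, hsz, T0 ∪ U, Finset.union_subset (Finset.filter_subset _ _) (hU.trans hS1S),
      insert (k0, n0, ξ0) P, fun s => if s ∈ T0 then (k0, n0, ξ0) else top s, ?_, ?_, ?_, ?_, ?_, ?_⟩
    · intro s hs
      dsimp only
      by_cases h : s ∈ T0
      · rw [if_pos h]; exact ⟨Finset.mem_insert_self _ _, (Finset.mem_filter.1 h).2⟩
      · rw [if_neg h]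
        have := c1 s ((Finset.mem_union.1 hs).resolve_left h)
        exact ⟨Finset.mem_insert_of_mem this.1, this.2⟩
    · intro s hs t ht hst
      dsimp only
      by_cases h : s ∈ T0
      · rw [if_pos h]
        obtain ⟨sS, sI, sξ⟩ := Finset.mem_filter.1 h
        have ht1 := hst sξ.1
        by_cases h' : t ∈ T0
        · exact absurd (Finset.mem_filter.1 h').2.2 (Set.disjoint_left.1 (om1_om2_disj _ _) ht1)
        · have hn := (Finset.mem_filter.1 (hU ((Finset.mem_union.1 ht).resolve_left h'))).2
          have hk1 := II_sub_scale sI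
          have hk2 := II_sub_scale (hst.trans (om1_sub _ _))
          rcases II_sub_or (n' := t.2.1) (n := n0) (by omega : k0 ≤ t.1) with hh | hh
          · exact absurd ⟨hh, ht1.1⟩ hn
          · exact hh.symm
      · rw [if_neg h]
        have hsU := (Finset.mem_union.1 hs).resolve_left h
        by_cases h' : t ∈ T0
        · exfalso
          obtain ⟨sP, sI, sξ⟩ := c1 s hsU
          have a := hst sξ.1
          have b := (Finset.mem_filter.1 h').2.2
          have c := (hvm _ sP).2.1
          have d := a.2; have e := b.2
          have f : nu (-t.1) t.2.2 ξ0 ≤ nu (-t.1) t.2.2 (top s).2.2 := by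
            unfold nu; have := e8 (-t.1); nlinarith
          linarith
        · exact c3 s hsU t ((Finset.mem_union.1 ht).resolve_left h') hst
    · rw [Finset.sum_insert htP, Finset.sum_union (Finset.disjoint_left.2 fun s h h' => hd s h' h)]
      have : (σ/2)^2 * 8^(-k0) < ∑ s ∈ T0, 8^(-s.1) * A s ^ 2 := hv0
      linarith
    · intro s hs
      obtain ⟨a, b⟩ := Finset.mem_sdiff.1 hs
      by_cases h : Is s ⊆ II k0 n0 ∧ ξ0 ∈ om s
      · exact ⟨_, Finset.mem_insert_self _ _, h⟩
      · obtain ⟨p, hp, hp'⟩ := c4 s (Finset.mem_sdiff.2 ⟨Finset.mem_filter.2 ⟨a, h⟩, b⟩)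
        exact ⟨p, Finset.mem_insert_of_mem hp, hp'⟩
    · intro p hp
      rcases Finset.mem_insert.1 hp with rfl | hp
      · obtain ⟨t, ht⟩ := hne
        exact ⟨t, Finset.mem_union_left _ ht, if_pos ht⟩
      · obtain ⟨s, hs, hs'⟩ := c5 p hp
        exact ⟨s, Finset.mem_union_right _ hs, by dsimp only; rw [if_neg (hd s hs), hs']⟩
    · intro p hp
      rcases Finset.mem_insert.1 hp with rfl | hp
      · exact ⟨h0, hv0⟩
      · exact ⟨(hvm p hp).2.2, (hvm p hp).1⟩
lemma size {f : ℝ → ℂ} (hf : Nice f) {σ : ℝ} (hσ : 0 < σ) {S : Finset Tile} (hS : SizeLE (AA f) S σ) :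
    ∃ S' ⊆ S, SizeLE (AA f) S' (σ/2) ∧ Cov (S \ S') (2^24 * Cp^2 * ((∫ x, ‖f x‖ ^ 2) / σ^2)) := by
  obtain ⟨S', hS', hsz, U, hU, P, top, c1, c3, c2, c4, -, -⟩ := greedy (AA f) (σ := σ) S.card S le_rfl
  refine ⟨S', hS', hsz, _, P, fun p => p.1, fun p => p.2.1, fun p => p.2.2, c4, ?_⟩
  have := bessel hf c1 c3 (fun s hs => size_single hσ.le hS (hU hs)) c2
  rw [← mul_div_assoc, le_div_iff₀ (by positivity), mul_comm]
  linarith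
end Carl
end
noncomputable section
namespace Carl
open Classical
lemma Psi_pair {f : ℝ → ℂ} (hf : Nice f) (s : Tile) :
    ∫ x, Psi f s x * (starRingEnd ℂ) (f x) = ((8^(-s.1) * AA f s ^ 2 : ℝ) : ℂ) := by
  obtain ⟨M, hM⟩ := hf.b
  have := fub (Fw_norm_int hf.i s) (ph_int s.1 s.2.2) (H := fun x => (starRingEnd ℂ) (f x))
    (Complex.continuous_conj.measurable.comp hf.m).aestronglyMeasurable (M := M) (fun x => by rw [RCLike.norm_conj]; exact hM x)
  unfold Psi
  rw [this, (ys_spec hf.i s).2, ← integral_indicator (II_meas _ _), ← integral_complex_ofReal]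
  congr 1; ext y
  by_cases h : y ∈ Is s
  · rw [indicator_of_mem h, indicator_of_mem h]
    have e : ∫ x, ph s.1 s.2.2 (x - y) * (starRingEnd ℂ) (f x) = (starRingEnd ℂ) (Fw f s.1 s.2.2 y) := by
      unfold Fw
      rw [← integral_conj]
      congr 1; ext x
      rw [map_mul, ph_conj, neg_sub, mul_comm]
    rw [e, Complex.mul_conj']; push_cast; rfl
  · rw [indicator_of_notMem h, indicator_of_notMem h]; simp
lemma size_exists (A : Tile → ℝ) (S : Finset Tile) : ∃ σ, 0 ≤ σ ∧ SizeLE A S σ := by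
  refine ⟨Real.sqrt (∑ s ∈ S, A s ^ 2), Real.sqrt_nonneg _, fun kT nT ξ => ?_⟩
  rw [Real.sq_sqrt (Finset.sum_nonneg fun _ _ => sq_nonneg _), Finset.sum_mul]
  refine (Finset.sum_le_sum (fun s hs => ?_)).trans
    (Finset.sum_le_sum_of_subset_of_nonneg (Finset.filter_subset _ _) fun s _ _ => mul_nonneg (sq_nonneg (A s)) (e8 _).le)
  rw [mul_comm]
  exact mul_le_mul_of_nonneg_left (e8_le (neg_le_neg (II_sub_scale (Finset.mem_filter.1 hs).2.1))) (sq_nonneg _)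
lemma size_imp {A : Tile → ℝ} {S : Finset Tile} {c : ℝ} (hc : 0 ≤ c)
    (h : ∀ σ, 0 ≤ σ → SizeLE A S σ → SizeLE A S (Real.sqrt (c * σ))) : SizeLE A S c := by
  set X := {σ | 0 ≤ σ ∧ SizeLE A S σ} with hX
  have hcl : IsClosed X := by
    have : X = Ici 0 ∩ ⋂ (kT : ℤ) (nT : ℤ) (ξ : ℝ), {σ | ∑ s ∈ S with (Is s ⊆ II kT nT ∧ ξ ∈ o2 s), 8^(-s.1) * A s ^ 2 ≤ σ ^ 2 * 8^(-kT)} := by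
      ext σ; simp only [hX, SizeLE, mem_ofPred_eq, mem_inter_iff, mem_Ici, mem_iInter]
    rw [this]
    refine isClosed_Ici.inter (isClosed_iInter fun k => isClosed_iInter fun n => isClosed_iInter fun ξ => ?_)
    exact isClosed_le continuous_const (by fun_prop)
  have hb : BddBelow X := ⟨0, fun σ h => h.1⟩
  have hm : sInf X ∈ X := hcl.csInf_mem (size_exists A S) hb
  have h2 := csInf_le hb ⟨Real.sqrt_nonneg _, h _ hm.1 hm.2⟩
  have h3 : sInf X ≤ c := by
    have := (Real.le_sqrt hm.1 (mul_nonneg hc hm.1)).1 h2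
    by_contra! hh
    nlinarith [hm.1]
  intro kT nT ξ
  refine (hm.2 kT nT ξ).trans ?_
  have := e8 (-kT); have := hm.1
  gcongr
def Om (F : Set ℝ) (l : ℝ) : Set ℝ := {x | ∃ k : ℤ, l * 8^(-k) < ∫ z in F, W (nu k ⌊(8:ℝ)^k * x⌋ z) ^ 6}
lemma Om_eq (F : Set ℝ) (l : ℝ) : Om F l = ⋃ p : ℤ × ℤ, if l * 8^(-p.1) < ∫ z in F, W (nu p.1 p.2 z) ^ 6 then II p.1 p.2 else ∅ := by
  ext x
  simp only [Om, mem_ofPred_eq, mem_iUnion, Prod.exists]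
  constructor
  · rintro ⟨k, h⟩; exact ⟨k, _, by rw [if_pos h]; exact self_II k x⟩
  · rintro ⟨k, n, h⟩
    split_ifs at h with h'
    · exact ⟨k, by rw [show ⌊(8:ℝ)^k * x⌋ = n from h]; exact h'⟩
    · exact h.elim
lemma Om_meas (F : Set ℝ) (l : ℝ) : MeasurableSet (Om F l) := by
  rw [Om_eq]; refine MeasurableSet.iUnion fun p => ?_
  split_ifs
  · exact II_meas _ _
  · exact MeasurableSet.empty
lemma notOm {F : Set ℝ} {l : ℝ} {x : ℝ} (h : x ∉ Om F l) {k n : ℤ} (hx : x ∈ II k n) : ∫ z in F, W (nu k n z) ^ 6 ≤ l * 8^(-k) := by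
  by_contra! hh
  exact h ⟨k, by rw [show ⌊(8:ℝ)^k * x⌋ = n from hx]; exact hh⟩
lemma Om_vol {F : Set ℝ} (hF : MeasurableSet F) (hF' : volume F ≠ ⊤) {l : ℝ} (hl : 0 < l) :
    volume (Om F l) ≤ ENNReal.ofReal (2^16 * (volume.real F / l)) := by
  rw [Om_eq, iUnion_eq_iUnion_finset, Directed.measure_iUnion]
  swap
  · exact directed_of_isDirected_le fun A B h => biUnion_subset_biUnion_left h
  refine iSup_le fun t => ?_
  set S0 : Finset Tile := (t.filter fun p => l * 8^(-p.1) < ∫ z in F, W (nu p.1 p.2 z) ^ 6).image fun p => (p.1, p.2, 0) with hS0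
  obtain ⟨S', h1, h2, ι, P, k, n, ξ, h3, h4⟩ := mass hF hF' (N := fun _ => 0) measurable_const hl S0
  have h5 : ∀ p ∈ t, l * 8^(-p.1) < ∫ z in F, W (nu p.1 p.2 z) ^ 6 → ∃ i ∈ P, II p.1 p.2 ⊆ II (k i) (n i) := by
    intro p hp hb
    have hpS : ((p.1, p.2, 0) : Tile) ∈ S0 := Finset.mem_image_of_mem _ (Finset.mem_filter.2 ⟨hp, hb⟩)
    obtain ⟨i, hi, h6, -⟩ := h3 (p.1, p.2, 0) (Finset.mem_sdiff.2 ⟨hpS, fun h => by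
      have := h2 _ h p.1 p.2 0 subset_rfl subset_rfl
      rw [show (fun _ : ℝ => (0:ℝ)) ⁻¹' (II (-p.1) 0) = univ from preimage_const_of_mem (by simp [II]), inter_univ] at this
      exact hb.not_ge this⟩)
    exact ⟨i, hi, h6⟩
  calc _ ≤ volume (⋃ i ∈ P, II (k i) (n i)) := by
        refine measure_mono (iUnion₂_subset fun p hp => ?_)
        split_ifs with hb
        · obtain ⟨i, hi, h⟩ := h5 p hp hb
          exact h.trans (subset_biUnion_of_mem (u := fun i => II (k i) (n i)) hi)
        · exact empty_subset _
    _ ≤ ∑ i ∈ P, volume (II (k i) (n i)) := measure_biUnion_finset_le _ _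
    _ = ENNReal.ofReal (∑ i ∈ P, 8^(-k i)) := by
        rw [ENNReal.ofReal_sum_of_nonneg fun i _ => (e8 _).le]; simp_rw [II_vol]
    _ ≤ _ := ENNReal.ofReal_le_ofReal h4
lemma good_dens {F : Set ℝ} {l ξ : ℝ} {S : Finset Tile} (hS : ∀ s ∈ S, ¬ Is s ⊆ Om F l) : DensLE F (fun _ => ξ) S l := by
  intro s hs k n m h1 h2
  obtain ⟨x, hx, hx'⟩ := not_subset.1 (hS s hs)
  refine le_trans ?_ (notOm hx' (h1 hx))
  exact setIntegral_mono_set (W_set_int k n (by norm_num) _) (ae_of_all _ fun x => pow_nonneg (W_nn _) 6) (ae_of_all _ fun x hx => hx.1)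
lemma sizeCZ {f : ℝ → ℂ} (hf : Nice f) {F : Set ℝ} (hF : MeasurableSet F) (hf1 : ∀ x, ‖f x‖ ≤ F.indicator 1 x)
    {l : ℝ} (hl : 0 ≤ l) {S : Finset Tile} (hS : ∀ s ∈ S, ¬ Is s ⊆ Om F l) : SizeLE (AA f) S (Ctree * l) := by
  have hc := Ctree0
  refine size_imp (by positivity) fun σ hσ hs kT nT ξ => ?_
  rw [Real.sq_sqrt (by positivity)]
  set T := S.filter (fun s => Is s ⊆ II kT nT ∧ ξ ∈ o2 s) with hT
  have hTS : T ⊆ S := Finset.filter_subset _ _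
  have hT' : ∀ s ∈ T, Is s ⊆ II kT nT ∧ ξ ∈ o2 s := fun s hs => (Finset.mem_filter.1 hs).2
  have ht := tree hf (N := fun _ => ξ) (fun s hs => ⟨(hT' s hs).1, (hT' s hs).2.1⟩) hσ hl (hs.mono hTS) hF measurable_const
    ((good_dens hS).mono hTS)
  have e : ∀ x, TT f (fun _ => ξ) T x = ∑ s ∈ T, Psi f s x := fun x => Finset.sum_congr rfl fun s hs => if_pos (hT' s hs).2
  have hconj : Measurable fun x => (starRingEnd ℂ) (f x) := Complex.continuous_conj.measurable.comp hf.m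
  obtain ⟨M, hM⟩ := hf.b
  have h1 : ((∑ s ∈ T, 8^(-s.1) * AA f s ^ 2 : ℝ) : ℂ) = ∫ x, TT f (fun _ => ξ) T x * (starRingEnd ℂ) (f x) := by
    simp_rw [e, Finset.sum_mul]
    rw [integral_finsetSum _ fun s _ => (Psi_int hf.i s).mul_bdd (c := M) hconj.aestronglyMeasurable
      (ae_of_all _ fun x => by rw [RCLike.norm_conj]; exact hM x), Complex.ofReal_sum]
    exact Finset.sum_congr rfl fun s _ => (Psi_pair hf s).symm
  calc _ ≤ ‖((∑ s ∈ T, 8^(-s.1) * AA f s ^ 2 : ℝ) : ℂ)‖ := by rw [Complex.norm_real]; exact le_abs_self _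
    _ ≤ ∫ x, F.indicator (fun x => ‖TT f (fun _ => ξ) T x‖) x := by
        rw [h1]
        refine norm_integral_le_of_norm_le ((TT_int hf measurable_const T).norm.indicator hF) (ae_of_all _ fun x => ?_)
        rw [norm_mul, RCLike.norm_conj]
        have := hf1 x
        by_cases hx : x ∈ F
        · rw [indicator_of_mem hx] at *; exact mul_le_of_le_one_right (norm_nonneg _) this
        · rw [indicator_of_notMem hx] at *; rw [le_antisymm this (norm_nonneg _), mul_zero]
    _ = ∫ x in F, ‖TT f (fun _ => ξ) T x‖ := integral_indicator hF
    _ ≤ _ := ht.trans (le_of_eq (by ring))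
end Carl
end
noncomputable section
namespace Carl
open Classical
lemma Psi_out {f : ℝ → ℂ} {F : Set ℝ} (hF : MeasurableSet F) (hf1 : ∀ x, ‖f x‖ ≤ F.indicator 1 x)
    {l x : ℝ} (hl : 0 ≤ l) (hx : x ∉ Om F l) (s : Tile) : ‖Psi f s x‖ ≤ 2^32 * Cp^2 * l * W (nus s x) ^ 4 := by
  have hw := W_pos (nus s x); have hC := Cp0; have h8 := e8 s.1
  set w := W (nus s x) with hwd
  have h := notOm hx (self_II s.1 x)
  refine (Psi_bd0 (f := f) s (B := Cp * 8^s.1 * ((4/w)^6 * (l * 8^(-s.1)))) (fun y hy => ?_) x).trans ?_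
  · calc _ ≤ ∫ z, F.indicator (fun z => Cp * 8^s.1 * ((4/w)^6 * W (nu s.1 ⌊(8:ℝ)^s.1 * x⌋ z) ^ 6)) z := by
          refine norm_integral_le_of_norm_le ((((intWn (by norm_num) _ _).const_mul _).const_mul _).indicator hF) (ae_of_all _ fun z => ?_)
          rw [norm_mul]
          have := hf1 z
          by_cases hz : z ∈ F
          · rw [indicator_of_mem hz] at *
            refine (mul_le_of_le_one_left (norm_nonneg _) this).trans ((ph_bd _ _ _).trans (mul_le_mul_of_nonneg_left ?_ (by positivity)))
            rw [← mul_pow]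
            refine (W_pow_anti (by norm_num : 6 ≤ 20) _).trans (pow_le_pow_left₀ (W_nn _) ?_ 6)
            have a1 := W_le_mul (8^s.1 * (y - z)) (8^s.1 * (x - y))
            have a2 : W (8^s.1 * (y - z) + 8^s.1 * (x - y)) ≤ 2 * W (nu s.1 ⌊(8:ℝ)^s.1 * x⌋ z) := by
              rw [← W_neg, show -(8^s.1 * (y - z) + 8^s.1 * (x - y)) = 8^s.1 * (z - x) by ring]
              exact W_II (self_II s.1 x)
            have a3 : 1 + |8^s.1 * (x - y)| ≤ 2 / w := by
              have b := W_le_two (u := nus s x) (v := 8^s.1 * (x - y)) (by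
                have := nu_II.1 hy; unfold nus nu at *; rw [abs_le]; constructor <;> nlinarith)
              rw [le_div_iff₀ hw]
              have e : (1 + |8^s.1 * (x - y)|) * W (8^s.1 * (x - y)) = 1 := by
                unfold W; exact mul_inv_cancel₀ (by positivity)
              have p : (0:ℝ) ≤ 1 + |8^s.1 * (x - y)| := by positivity
              nlinarith
            calc _ ≤ _ := a1
              _ ≤ 2 / w * (2 * W (nu s.1 ⌊(8:ℝ)^s.1 * x⌋ z)) := mul_le_mul a3 a2 (W_nn _) (by positivity)
              _ = _ := by ring
          · rw [indicator_of_notMem hz] at *; rw [le_antisymm this (norm_nonneg _), zero_mul]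
      _ ≤ _ := by
          rw [integral_indicator hF, integral_const_mul, integral_const_mul]
          exact mul_le_mul_of_nonneg_left (mul_le_mul_of_nonneg_left h (by positivity)) (by positivity)
  · have e := e8_neg s.1
    calc _ = 2^32 * Cp^2 * l * w ^ 14 * (8^s.1 * 8^(-s.1)) := by rw [← hwd]; field_simp; norm_num
      _ ≤ _ := by
        rw [e, mul_one]; exact mul_le_mul_of_nonneg_left (W_pow_anti (by norm_num) _) (by positivity)
lemma max_top {O : Set ℝ} (hO : volume O ≠ ⊤) {s : Tile} (hs : Is s ⊆ O) : ∃ p : ℤ × ℤ, Is s ⊆ II p.1 p.2 ∧ II p.1 p.2 ⊆ O ∧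
    ∀ k n : ℤ, II p.1 p.2 ⊆ II k n → II k n ⊆ O → p.1 ≤ k := by
  have hb : ∃ b : ℤ, ∀ k : ℤ, (∃ n, Is s ⊆ II k n ∧ II k n ⊆ O) → b ≤ k := by
    obtain ⟨m, hm⟩ := pow_unbounded_of_one_lt (volume.real O) (by norm_num : (1:ℝ) < 8)
    refine ⟨-m, fun k hk0 => ?_⟩
    obtain ⟨n, -, h⟩ := hk0
    have h1 := measureReal_mono h hO
    rw [II_real] at h1
    by_contra! hk
    have h2 := e8_le (show (m:ℤ) ≤ -k by omega)
    rw [zpow_natCast] at h2; linarith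
  obtain ⟨k, ⟨n, h1, h2⟩, h3⟩ := Int.exists_least_of_bdd hb ⟨s.1, s.2.1, subset_rfl, hs⟩
  exact ⟨(k, n), h1, h2, fun k' n' h4 h5 => h3 k' ⟨n', h1.trans h4, h5⟩⟩
lemma bad_est {f : ℝ → ℂ} (hf : Nice f) {F : Set ℝ} (hF : MeasurableSet F) (hF' : volume F ≠ ⊤) (hf1 : ∀ x, ‖f x‖ ≤ F.indicator 1 x)
    {l : ℝ} (hl : 0 < l) {S : Finset Tile} (hS : ∀ s ∈ S, Is s ⊆ Om F l) {N : ℝ → ℝ} (hN : Measurable N)  :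
    ∫ x in (Om F l)ᶜ, ‖TT f N S x‖ ≤ 2^56 * Cp^2 * volume.real F := by
  set O := Om F l with hO
  have hC := Cp0
  have hOv := Om_vol hF hF' hl
  have hOt : volume O ≠ ⊤ := (hOv.trans_lt ENNReal.ofReal_lt_top).ne
  have hOr : volume.real O ≤ 2^16 * (volume.real F / l) := ENNReal.toReal_le_of_le_ofReal (by positivity) hOv
  have hmax : ∀ s : Tile, ∃ p : ℤ × ℤ, s ∈ S → Is s ⊆ II p.1 p.2 ∧ II p.1 p.2 ⊆ O ∧
    ∀ k n : ℤ, II p.1 p.2 ⊆ II k n → II k n ⊆ O → p.1 ≤ k := fun s => by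
      by_cases h : s ∈ S
      · obtain ⟨p, hp⟩ := max_top hOt (hS s h); exact ⟨p, fun _ => hp⟩
      · exact ⟨(0,0), fun h' => (h h').elim⟩
  choose J hJ using hmax
  set P := S.image J with hP
  have hPs : ∑ p ∈ P, (8:ℝ)^(-p.1) ≤ volume.real O := by
    have hd : (P : Set (ℤ × ℤ)).PairwiseDisjoint fun p => II p.1 p.2 := by
      have key : ∀ p ∈ P, ∀ q ∈ P, p.1 ≤ q.1 → p ≠ q → Disjoint (II p.1 p.2) (II q.1 q.2) := by
        intro p hp q hq h hpq
        refine (II_sub_or h).resolve_left fun hsub => hpq ?_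
        obtain ⟨s, hs, rfl⟩ := Finset.mem_image.1 hp
        obtain ⟨t, ht, rfl⟩ := Finset.mem_image.1 hq
        have e := le_antisymm h ((hJ t ht).2.2 _ _ hsub (hJ s hs).2.1)
        have := hsub (cen_II _ _)
        rw [e] at this
        exact Prod.ext e (II_disj this (cen_II _ _))
      intro p hp q hq hpq
      rcases le_total p.1 q.1 with h | h
      · exact key p hp q hq h hpq
      · exact (key q hq p hp h hpq.symm).symm
    have := measureReal_biUnion_finset (μ := volume) hd (fun p _ => II_meas p.1 p.2) (fun p _ => by rw [II_vol]; exact ENNReal.ofReal_ne_top)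
    simp_rw [II_real] at this
    rw [← this]
    refine measureReal_mono (iUnion₂_subset fun p hp => ?_) hOt
    obtain ⟨s, hs, rfl⟩ := Finset.mem_image.1 hp
    exact (hJ s hs).2.1
  let π : Tile → Tile := fun s => (s.1, s.2.1, 0)
  let R : ℤ × ℤ → Finset Tile := fun p => (S.filter fun s => J s = p).image π
  have hpt : ∀ x ∈ Oᶜ, ‖TT f N S x‖ ≤ 2^32 * Cp^2 * l * ∑ p ∈ P, ∑ t ∈ R p, W (nus t x) ^ 4 := by
    intro x hx
    unfold TT
    rw [← Finset.sum_fiberwise_of_maps_to (t := P) (g := J) fun s hs => Finset.mem_image_of_mem _ hs, Finset.mul_sum]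
    refine (norm_sum_le _ _).trans (Finset.sum_le_sum fun p _ => ?_)
    rw [← Finset.sum_filter]
    refine (norm_sum_le _ _).trans ?_
    rw [Finset.mul_sum]
    calc _ ≤ ∑ s ∈ (S.filter fun s => J s = p).filter fun s => N x ∈ o2 s, 2^32 * Cp^2 * l * W (nus (π s) x) ^ 4 :=
          Finset.sum_le_sum fun s _ => Psi_out hF hf1 hl.le hx s
      _ = ∑ t ∈ ((S.filter fun s => J s = p).filter fun s => N x ∈ o2 s).image π, 2^32 * Cp^2 * l * W (nus t x) ^ 4 := by
          rw [Finset.sum_image]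
          intro s hs t ht hst
          have a := (Finset.mem_filter.1 hs).2.1; have b := (Finset.mem_filter.1 ht).2.1
          have c := congrArg Prod.fst hst; have d := congrArg (fun u : Tile => u.2.1) hst
          exact tile_inj a b c d
      _ ≤ _ := by
          refine Finset.sum_le_sum_of_subset_of_nonneg (Finset.image_subset_image (Finset.filter_subset _ _)) fun t _ _ => ?_
          have := W_nn (nus t x); positivity
  have hint : ∀ A : Set ℝ, ∀ t : Tile, IntegrableOn (fun x => W (nus t x) ^ 4) A := fun A t => W_set_int _ _ (by norm_num) _
  calc _ ≤ ∫ x in Oᶜ, 2^32 * Cp^2 * l * ∑ p ∈ P, ∑ t ∈ R p, W (nus t x) ^ 4 :=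
        setIntegral_mono_on (TT_int hf hN S).norm.integrableOn
          ((integrable_finsetSum _ fun p _ => integrable_finsetSum _ fun t _ => hint _ t).const_mul _) (Om_meas F l).compl hpt
    _ = 2^32 * Cp^2 * l * ∑ p ∈ P, ∑ t ∈ R p, ∫ x in Oᶜ, W (nus t x) ^ 4 := by
        rw [integral_const_mul, integral_finsetSum _ fun p _ => integrable_finsetSum _ fun t _ => hint _ t]
        congr 1
        exact Finset.sum_congr rfl fun p _ => integral_finsetSum _ fun t _ => hint _ t
    _ ≤ 2^32 * Cp^2 * l * ∑ p ∈ P, 256 * 8^(-p.1) := by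
        refine mul_le_mul_of_nonneg_left (Finset.sum_le_sum fun p hp => ?_) (by positivity)
        obtain ⟨s0, hs0, rfl⟩ := Finset.mem_image.1 hp
        refine le_trans (Finset.sum_le_sum fun t _ => ?_) (Q1 (R (J s0)) (J s0).1 (J s0).2 ?_ ?_)
        · exact setIntegral_mono_set (hint _ t) (ae_of_all _ fun x => pow_nonneg (W_nn _) 4)
            (ae_of_all _ (compl_subset_compl.2 (hJ s0 hs0).2.1))
        · intro t ht
          obtain ⟨s, hs, rfl⟩ := Finset.mem_image.1 ht
          obtain ⟨h1, h2⟩ := Finset.mem_filter.1 hs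
          have := (hJ s h1).1; rw [h2] at this; exact this
        · intro t ht t' ht' h1 h2
          obtain ⟨s, hs, rfl⟩ := Finset.mem_image.1 ht
          obtain ⟨s', hs', rfl⟩ := Finset.mem_image.1 ht'
          exact Prod.ext h1 (Prod.ext h2 rfl)
    _ = 2^40 * Cp^2 * l * ∑ p ∈ P, (8:ℝ)^(-p.1) := by rw [← Finset.mul_sum]; ring
    _ ≤ 2^40 * Cp^2 * l * (2^16 * (volume.real F / l)) := mul_le_mul_of_nonneg_left (hPs.trans hOr) (by positivity)
    _ = _ := by field_simp
end Carl
end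
noncomputable section
namespace Carl
open Classical
lemma TT_split (f : ℝ → ℂ) (N : ℝ → ℝ) {S R : Finset Tile} (h : R ⊆ S) (x : ℝ) : TT f N S x = TT f N (S \ R) x + TT f N R x := by
  unfold TT; exact (Finset.sum_sdiff h).symm
lemma TT_split_int {f : ℝ → ℂ} (hf : Nice f) {N : ℝ → ℝ} (hN : Measurable N) {S R : Finset Tile} (h : R ⊆ S) (E : Set ℝ) :
    ∫ x in E, ‖TT f N S x‖ ≤ (∫ x in E, ‖TT f N (S \ R) x‖) + ∫ x in E, ‖TT f N R x‖ := by
  have hi := fun S => (TT_int hf hN S).norm.integrableOn (s := E)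
  rw [← integral_add (hi _) (hi _)]
  refine setIntegral_mono (hi _) ((hi _).add (hi _)) fun x => ?_
  dsimp only; rw [TT_split f N h x]; exact norm_add_le _ _
lemma step {f : ℝ → ℂ} (hf : Nice f) {N : ℝ → ℝ} (hN : Measurable N) {E : Set ℝ} (hE : MeasurableSet E) (hE' : volume E ≠ ⊤)
    {F0 : ℝ} (hF0 : ∫ x, ‖f x‖ ^ 2 ≤ F0) {S : Finset Tile} {σ δ σ' δ' : ℝ} (hσ : 0 < σ) (hδ : 0 < δ) (hσ' : 0 ≤ σ') (hδ' : 0 ≤ δ')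
    (s1 : SizeLE (AA f) S σ) (s2 : SizeLE (AA f) S σ') (d2 : DensLE E N S δ') :
    ∃ R ⊆ S, SizeLE (AA f) R (σ/2) ∧ DensLE E N R (δ/4) ∧ ∫ x in E, ‖TT f N S x‖ ≤
      Ctree * σ' * δ' * (2^18 * (volume.real E / δ) + 2^24 * Cp^2 * (F0 / σ^2)) + ∫ x in E, ‖TT f N R x‖ := by
  obtain ⟨S1, h1, hd1, c1⟩ := mass hE hE' hN (by positivity : 0 < δ/4) S
  obtain ⟨S2, h2, hs2, c2⟩ := size hf hσ (s1.mono h1)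
  refine ⟨S2, h2.trans h1, hs2, hd1.mono h2, ?_⟩
  have e1 := cov_est hf hσ' hδ' (s2.mono Finset.sdiff_subset) hE hN (d2.mono Finset.sdiff_subset) c1
  have e2 := cov_est hf hσ' hδ' (s2.mono (Finset.sdiff_subset.trans h1)) hE hN (d2.mono (Finset.sdiff_subset.trans h1)) c2
  have a1 := TT_split_int hf hN h1 E
  have a2 := TT_split_int hf hN h2 E
  have hC := Ctree0; have hp := Cp0
  have e3 : Ctree * σ' * δ' * (2^24 * Cp^2 * ((∫ x, ‖f x‖ ^ 2) / σ^2)) ≤ Ctree * σ' * δ' * (2^24 * Cp^2 * (F0 / σ^2)) :=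
    mul_le_mul_of_nonneg_left (mul_le_mul_of_nonneg_left (by gcongr) (by positivity)) (by positivity)
  have e4 : Ctree * σ' * δ' * (2^16 * (volume.real E / (δ/4))) = Ctree * σ' * δ' * (2^18 * (volume.real E / δ)) := by
    field_simp; norm_num; ring
  rw [e4] at e1
  linarith
def C0 : ℝ := ∑' i : ℤ, (3/4 : ℝ) ^ i.natAbs
lemma C0_sum : Summable fun i : ℤ => (3/4 : ℝ) ^ i.natAbs := by
  refine Summable.of_nat_of_neg ?_ ?_ <;>
  · simp only [Int.natAbs_neg, Int.natAbs_natCast]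
    exact summable_geometric_of_lt_one (by norm_num) (by norm_num)
lemma C0_nn : 0 ≤ C0 := tsum_nonneg fun _ => by positivity
lemma C0_le (m : ℤ) (n : ℕ) : ∑ j ∈ Finset.range n, (3/4 : ℝ) ^ (m + j).natAbs ≤ C0 := by
  have : ∑ j ∈ Finset.range n, (3/4 : ℝ) ^ (m + j).natAbs = ∑ i ∈ (Finset.range n).image (fun j : ℕ => m + j), (3/4 : ℝ) ^ i.natAbs := by
    rw [Finset.sum_image]; intro a _ b _ h; simpa using h
  rw [this]; exact C0_sum.sum_le_tsum _ fun _ _ => by positivity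
/-- the numeric term bound -/
lemma term_bd {ρ L : ℝ} (hρ : 0 ≤ ρ) (hL : 0 ≤ L) (i : ℤ) :
    min ((2:ℝ)^(-i) * ρ) L * min ((4:ℝ)^(-i)) 4 * 4^i ≤ 4 * Real.sqrt (ρ * L) * (3/4 : ℝ) ^ i.natAbs := by
  have p2 : (0:ℝ) < 2^(-i) := by positivity
  have p4 : (0:ℝ) < 4^(-i) := by positivity
  have p4' : (0:ℝ) < 4^i := by positivity
  have h4 : (4:ℝ)^(-i) * 4^i = 1 := by rw [← zpow_add₀ (by norm_num)]; simp
  have h1 : min ((2:ℝ)^(-i) * ρ) L ≤ Real.sqrt (2^(-i)) * Real.sqrt (ρ * L) := by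
    rw [← Real.sqrt_mul p2.le, ← mul_assoc]
    apply Real.le_sqrt_of_sq_le
    rw [pow_two]; exact mul_le_mul (min_le_left _ _) (min_le_right _ _) (le_min (by positivity) hL) (by positivity)
  have h2 : Real.sqrt (2^(-i)) * (min ((4:ℝ)^(-i)) 4 * 4^i) ≤ 4 * (3/4 : ℝ) ^ i.natAbs := by
    rcases le_total 0 i with h | h
    · obtain ⟨n, rfl⟩ := Int.eq_ofNat_of_zero_le h
      have a : min ((4:ℝ)^(-(n:ℤ))) 4 * 4^(n:ℤ) ≤ 1 := by rw [← h4]; gcongr; exact min_le_left _ _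
      have b : Real.sqrt (2^(-(n:ℤ))) ≤ (3/4) ^ n := by
        apply Real.sqrt_le_iff.2 ⟨by positivity, ?_⟩
        rw [← pow_mul, mul_comm, pow_mul, zpow_neg, zpow_natCast, ← inv_pow]
        gcongr; norm_num
      rw [Int.natAbs_natCast]
      have c : (0:ℝ) ≤ (3/4)^n := by positivity
      have d := mul_le_mul b a (by positivity) c
      linarith
    · obtain ⟨n, hn⟩ := Int.eq_ofNat_of_zero_le (neg_nonneg.2 h)
      obtain rfl : i = -n := by omega
      have a : min ((4:ℝ)^(-(-(n:ℤ)))) 4 * 4^(-(n:ℤ)) ≤ 4 * 4^(-(n:ℤ)) := by gcongr; exact min_le_right _ _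
      have b : Real.sqrt (2^(-(-(n:ℤ)))) ≤ 3^n := by
        apply Real.sqrt_le_iff.2 ⟨by positivity, ?_⟩
        rw [← pow_mul, mul_comm, pow_mul, neg_neg, zpow_natCast]
        gcongr; norm_num
      rw [Int.natAbs_neg, Int.natAbs_natCast]
      have d := mul_le_mul b a (by positivity) (by positivity)
      refine d.trans (le_of_eq ?_)
      rw [zpow_neg, zpow_natCast, div_pow]; ring
  calc _ ≤ (Real.sqrt (2^(-i)) * Real.sqrt (ρ * L)) * (min ((4:ℝ)^(-i)) 4 * 4^i) := by
        rw [mul_assoc]; exact mul_le_mul_of_nonneg_right h1 (by positivity)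
    _ = Real.sqrt (ρ * L) * (Real.sqrt (2^(-i)) * (min ((4:ℝ)^(-i)) 4 * 4^i)) := by ring
    _ ≤ Real.sqrt (ρ * L) * (4 * (3/4 : ℝ) ^ i.natAbs) := mul_le_mul_of_nonneg_left h2 (Real.sqrt_nonneg _)
    _ = _ := by ring
def K1 : ℝ := Ctree * (2^18 + 2^24 * Cp^2) * 4
lemma K1_nn : 0 ≤ K1 := by have := Ctree0; have := Cp0; unfold K1; positivity
lemma SizeLE.weaken {A : Tile → ℝ} {S : Finset Tile} {σ σ' : ℝ} (h : SizeLE A S σ) (h0 : 0 ≤ σ) (hh : σ ≤ σ') : SizeLE A S σ' :=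
  fun kT nT ξ => (h kT nT ξ).trans (by have := e8 (-kT); gcongr)
lemma DensLE.weaken {E : Set ℝ} {N : ℝ → ℝ} {S : Finset Tile} {δ δ' : ℝ} (h : DensLE E N S δ) (hh : δ ≤ δ') : DensLE E N S δ' :=
  fun s hs k n m h1 h2 => (h s hs k n m h1 h2).trans (by have := e8 (-k); gcongr)
lemma dens4 (E : Set ℝ) (N : ℝ → ℝ) (S : Finset Tile) : DensLE E N S 4 :=
  fun _ _ k n _ _ _ => setW_le (by norm_num) k n _
lemma stages {f : ℝ → ℂ} (hf : Nice f) {N : ℝ → ℝ} (hN : Measurable N) {E : Set ℝ} (hE : MeasurableSet E) (hE' : volume E ≠ ⊤)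
    {ρ L : ℝ} (hρ : 0 < ρ) (hL : 0 ≤ L) (hF0 : ∫ x, ‖f x‖ ^ 2 ≤ ρ^2 * volume.real E) {S : Finset Tile} (sL : SizeLE (AA f) S L)
    (i : ℤ) (s1 : SizeLE (AA f) S ((2:ℝ)^(-i) * ρ)) (d1 : DensLE E N S ((4:ℝ)^(-i))) (n : ℕ) :
    ∃ R ⊆ S, SizeLE (AA f) R ((2:ℝ)^(-(i+n)) * ρ) ∧ DensLE E N R ((4:ℝ)^(-(i+n))) ∧
      ∫ x in E, ‖TT f N S x‖ ≤ K1 * volume.real E * Real.sqrt (ρ * L) * (∑ j ∈ Finset.range n, (3/4 : ℝ) ^ (i + j).natAbs) + ∫ x in E, ‖TT f N R x‖ := by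
  induction n with
  | zero => exact ⟨S, subset_rfl, by simpa using s1, by simpa using d1, by simp⟩
  | succ n ih =>
    obtain ⟨R, hR, a1, a2, a3⟩ := ih
    set t : ℤ := i + n with ht
    have p2 : (0:ℝ) < 2^(-t) := by positivity
    have p4 : (0:ℝ) < 4^(-t) := by positivity
    have sm : SizeLE (AA f) R (min ((2:ℝ)^(-t) * ρ) L) := by
      rcases min_choice ((2:ℝ)^(-t) * ρ) L with h | h <;> rw [h]
      · exact a1
      · exact sL.mono hR
    have dm : DensLE E N R (min ((4:ℝ)^(-t)) 4) := by
      rcases min_choice ((4:ℝ)^(-t)) 4 with h | h <;> rw [h]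
      · exact a2
      · exact dens4 _ _ _
    obtain ⟨R', hR', b1, b2, b3⟩ := step hf hN hE hE' hF0 (by positivity : (0:ℝ) < (2:ℝ)^(-t) * ρ) p4 (le_min (by positivity) hL)
      (le_min p4.le (by norm_num)) a1 sm dm
    refine ⟨R', hR'.trans hR, ?_, ?_, ?_⟩
    · convert b1 using 1
      rw [show -(i + ((n+1 : ℕ):ℤ)) = -t - 1 by push_cast; omega, zpow_sub_one₀ (by norm_num)]; ring
    · convert b2 using 1
      rw [show -(i + ((n+1 : ℕ):ℤ)) = -t - 1 by push_cast; omega, zpow_sub_one₀ (by norm_num)]; ring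
    · have tb := term_bd hρ.le hL t
      have e : Ctree * min ((2:ℝ)^(-t) * ρ) L * min ((4:ℝ)^(-t)) 4 * (2^18 * (volume.real E / (4:ℝ)^(-t)) + 2^24 * Cp^2 * (ρ^2 * volume.real E / ((2:ℝ)^(-t) * ρ)^2))
          = Ctree * (2^18 + 2^24 * Cp^2) * volume.real E * (min ((2:ℝ)^(-t) * ρ) L * min ((4:ℝ)^(-t)) 4 * 4^t) := by
        have h1 : volume.real E / (4:ℝ)^(-t) = volume.real E * 4^t := by rw [zpow_neg, div_inv_eq_mul]
        have h2 : ρ^2 * volume.real E / ((2:ℝ)^(-t) * ρ)^2 = volume.real E * 4^t := by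
          rw [mul_pow, ← zpow_natCast ((2:ℝ)^(-t)), ← zpow_mul, mul_comm (-t), zpow_mul, div_eq_iff (by positivity)]
          norm_num
          field_simp
        rw [h1, h2]; ring
      rw [e] at b3
      rw [Finset.sum_range_succ, mul_add]
      have hK : Ctree * (2^18 + 2^24 * Cp^2) * volume.real E * (min ((2:ℝ)^(-t) * ρ) L * min ((4:ℝ)^(-t)) 4 * 4^t) ≤
          K1 * volume.real E * Real.sqrt (ρ * L) * (3/4 : ℝ) ^ t.natAbs := by
        refine (mul_le_mul_of_nonneg_left tb ?_).trans (le_of_eq (by unfold K1; ring))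
        have := Ctree0; have := Cp0; positivity
      linarith
lemma TT_small {f : ℝ → ℂ} (hf : Nice f) {N : ℝ → ℝ} (hN : Measurable N) (E : Set ℝ) (S : Finset Tile) :
    ∃ B : ℝ, ∀ R ⊆ S, ∀ σ, 0 ≤ σ → SizeLE (AA f) R σ → ∫ x in E, ‖TT f N R x‖ ≤ B * σ := by
  refine ⟨∑ s ∈ S, Cq * (4 * 8^(-s.1)), fun R hR σ hσ hs => ?_⟩
  have hq := Cq0
  calc _ ≤ ∫ x, ‖TT f N R x‖ := setIntegral_le_integral (TT_int hf hN R).norm (ae_of_all _ fun _ => norm_nonneg _)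
    _ ≤ ∫ x, ∑ s ∈ R, Cq * σ * W (nus s x) ^ 20 := by
        refine integral_mono (TT_int hf hN R).norm (integrable_finsetSum _ fun s _ => (intWn (by norm_num) _ _).const_mul _) fun x => ?_
        refine (norm_sum_le _ _).trans (Finset.sum_le_sum fun s h => ?_)
        have hw := pow_nonneg (W_nn (nus s x)) 20
        split_ifs
        · refine (Psi_bd hf.i s x).trans ?_
          have := size_single hσ hs h
          gcongr
        · rw [norm_zero]; positivity
    _ = ∑ s ∈ R, Cq * σ * ∫ x, W (nus s x) ^ 20 := by
        rw [integral_finsetSum _ fun s _ => (intWn (by norm_num) _ _).const_mul _]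
        simp_rw [integral_const_mul]
    _ ≤ ∑ s ∈ R, Cq * σ * (4 * 8^(-s.1)) := Finset.sum_le_sum fun s _ => mul_le_mul_of_nonneg_left (intWn_le (by norm_num) _ _) (by positivity)
    _ ≤ ∑ s ∈ S, Cq * σ * (4 * 8^(-s.1)) := Finset.sum_le_sum_of_subset_of_nonneg hR fun s _ _ => by have := e8 (-s.1); positivity
    _ = _ := by rw [Finset.sum_mul]; exact Finset.sum_congr rfl fun s _ => by ring
def K2 : ℝ := K1 * C0
lemma K2_nn : 0 ≤ K2 := mul_nonneg K1_nn C0_nn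
lemma total {f : ℝ → ℂ} (hf : Nice f) {N : ℝ → ℝ} (hN : Measurable N) {E : Set ℝ} (hE : MeasurableSet E) (hE' : volume E ≠ ⊤)
    {ρ L : ℝ} (hρ : 0 < ρ) (hL : 0 ≤ L) (hF0 : ∫ x, ‖f x‖ ^ 2 ≤ ρ^2 * volume.real E) {S : Finset Tile} (sL : SizeLE (AA f) S L) :
    ∫ x in E, ‖TT f N S x‖ ≤ K2 * (volume.real E * Real.sqrt (ρ * L)) := by
  obtain ⟨m, hm⟩ : ∃ m : ℕ, L / ρ ≤ 2^m ∧ 4 ≤ (4:ℝ)^m := by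
    obtain ⟨m, hm⟩ := pow_unbounded_of_one_lt (L/ρ) (by norm_num : (1:ℝ) < 2)
    refine ⟨m + 1, hm.le.trans (pow_le_pow_right₀ (by norm_num) (by omega)), ?_⟩
    calc (4:ℝ) = 4^1 := by norm_num
      _ ≤ _ := pow_le_pow_right₀ (by norm_num) (by omega)
  have s1 : SizeLE (AA f) S ((2:ℝ)^(-(-(m:ℤ))) * ρ) := by
    refine sL.weaken hL ?_
    rw [neg_neg, zpow_natCast, ← div_le_iff₀ hρ]; exact hm.1
  have d1 : DensLE E N S ((4:ℝ)^(-(-(m:ℤ)))) := (dens4 _ _ _).weaken (by rw [neg_neg, zpow_natCast]; exact hm.2)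
  obtain ⟨B, hB⟩ := TT_small hf hN E S
  have key : ∀ n : ℕ, ∫ x in E, ‖TT f N S x‖ ≤ K2 * (volume.real E * Real.sqrt (ρ * L)) + B * (2^m * ρ * (1/2)^n) := by
    intro n
    obtain ⟨R, hR, a1, -, a3⟩ := stages hf hN hE hE' hρ hL hF0 sL (-m) s1 d1 n
    have b := hB R hR _ (by positivity) a1
    have e : (2:ℝ)^(-(-(m:ℤ)+n)) * ρ = 2^m * ρ * (1/2)^n := by
      rw [show -(-(m:ℤ)+n) = m + -n by ring, zpow_add₀ (by norm_num), zpow_neg, zpow_natCast, zpow_natCast, one_div, inv_pow]; ring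
    rw [e] at b
    have c : K1 * volume.real E * Real.sqrt (ρ * L) * (∑ j ∈ Finset.range n, (3/4 : ℝ) ^ (-(m:ℤ) + j).natAbs) ≤ K1 * volume.real E * Real.sqrt (ρ * L) * C0 := by
      refine mul_le_mul_of_nonneg_left (C0_le _ _) ?_
      have := K1_nn; positivity
    have d : K2 * (volume.real E * Real.sqrt (ρ * L)) = K1 * volume.real E * Real.sqrt (ρ * L) * C0 := by unfold K2; ring
    linarith
  have lim : Tendsto (fun n : ℕ => K2 * (volume.real E * Real.sqrt (ρ * L)) + B * (2^m * ρ * (1/2)^n)) atTop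
      (𝓝 (K2 * (volume.real E * Real.sqrt (ρ * L)) + B * (2^m * ρ * 0))) :=
    ((tendsto_pow_atTop_nhds_zero_of_lt_one (by norm_num) (by norm_num)).const_mul _).const_mul _ |>.const_add _
  simpa using ge_of_tendsto' lim key
end Carl
end
noncomputable section
namespace Carl
open Classical
lemma Om_empty (F : Set ℝ) : Om F 4 = ∅ := by
  ext x; simp only [Om, mem_ofPred_eq, mem_empty_iff_false, iff_false, not_exists, not_lt]
  intro k; exact setW_le (by norm_num) _ _ _
lemma f_sq {f : ℝ → ℂ} {F : Set ℝ} (hF : MeasurableSet F) (hF' : volume F ≠ ⊤) (hf1 : ∀ x, ‖f x‖ ≤ F.indicator 1 x) :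
    ∫ x, ‖f x‖ ^ 2 ≤ volume.real F := by
  calc _ ≤ ∫ x, F.indicator (fun _ => (1:ℝ)) x := by
        refine integral_mono_of_nonneg (ae_of_all _ fun _ => by positivity) ((integrable_indicator_iff hF).2 (by simpa [integrableOn_const_iff] using hF'.lt_top)) (ae_of_all _ fun x => ?_)
        have := hf1 x
        by_cases hx : x ∈ F
        · simp only [hx, indicator_of_mem, Pi.one_apply] at this ⊢; exact pow_le_one₀ (norm_nonneg _) this
        · simp only [hx, not_false_eq_true, indicator_of_notMem] at this ⊢; rw [le_antisymm this (norm_nonneg _)]; norm_num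
    _ = _ := by rw [integral_indicator hF]; simp
lemma TT_zero {f : ℝ → ℂ} {F : Set ℝ} (hF0 : volume F = 0) (hf1 : ∀ x, ‖f x‖ ≤ F.indicator 1 x) (N : ℝ → ℝ) (S : Finset Tile) (x : ℝ) :
    TT f N S x = 0 := by
  have h : ∀ᵐ y, f y = 0 := by
    filter_upwards [measure_eq_zero_iff_ae_notMem.1 hF0] with y hy
    have := hf1 y; simp only [hy, not_false_eq_true, indicator_of_notMem] at this; exact norm_le_zero_iff.1 this
  have h2 : ∀ k m y, Fw f k m y = 0 := fun k m y => integral_eq_zero_of_ae (by filter_upwards [h] with z hz; simp [hz])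
  refine Finset.sum_eq_zero fun s _ => ?_
  have : Psi f s x = 0 := integral_eq_zero_of_ae (ae_of_all _ fun y => by
    have : (Is s).indicator (Fw f s.1 s.2.2) y = 0 := by by_cases hy : y ∈ Is s <;> simp [hy, h2]
    simp [this])
  simp [this]
def K3 : ℝ := K2 * Real.sqrt (2^17 * Ctree) + 2^56 * Cp^2
lemma K3_nn : 0 ≤ K3 := by have := K2_nn; have := Ctree0; unfold K3; positivity
lemma good_est {f : ℝ → ℂ} (hf : Nice f) {F E : Set ℝ} (hF : MeasurableSet F) (hF' : volume F ≠ ⊤) (hf1 : ∀ x, ‖f x‖ ≤ F.indicator 1 x)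
    {N : ℝ → ℝ} (hN : Measurable N) (hE : MeasurableSet E) (hE' : volume E ≠ ⊤) {a b l : ℝ} (ha : 0 < a) (hb : 0 < b)
    (hX : volume.real F = a^4) (hY : volume.real E = b^4) (hl : 0 ≤ l) {S : Finset Tile} (hS : ∀ s ∈ S, ¬ Is s ⊆ Om F l) :
    ∫ x in E, ‖TT f N S x‖ ≤ K2 * (b^3 * a * Real.sqrt (Ctree * l)) := by
  have hc := Ctree0
  have := total hf hN hE hE' (ρ := a^2/b^2) (by positivity) (L := Ctree * l) (by positivity)
    ((f_sq hF hF' hf1).trans (by rw [hX, hY]; field_simp; exact le_rfl)) (sizeCZ hf hF hf1 hl hS)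
  have e : Real.sqrt (a^2/b^2 * (Ctree * l)) = a / b * Real.sqrt (Ctree * l) := by
    rw [Real.sqrt_mul (by positivity), ← div_pow, Real.sqrt_sq (by positivity)]
  rw [e, hY] at this
  refine this.trans (le_of_eq ?_)
  field_simp
lemma restr1 {f : ℝ → ℂ} (hf : Nice f) {F E : Set ℝ} (hF : MeasurableSet F) (hF' : volume F ≠ ⊤) (hf1 : ∀ x, ‖f x‖ ≤ F.indicator 1 x)
    {N : ℝ → ℝ} (hN : Measurable N) (hE : MeasurableSet E) (hE' : volume E ≠ ⊤) {a b : ℝ} (ha : 0 < a) (hb : 0 < b)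
    (hX : volume.real F = a^4) (hY : volume.real E = b^4) (S : Finset Tile) :
    ∫ x in E, ‖TT f N S x‖ ≤ K3 * (b^3 * a) := by
  have := good_est hf hF hF' hf1 hN hE hE' ha hb hX hY (l := 4) (by norm_num) (S := S) fun s _ h => by
    rw [Om_empty] at h; exact (II_ne s.1 s.2.1).ne_empty (subset_empty_iff.1 h)
  refine this.trans ?_
  have h1 : Real.sqrt (Ctree * 4) ≤ Real.sqrt (2^17 * Ctree) := Real.sqrt_le_sqrt (by linarith [Ctree0])
  have h2 : K2 * Real.sqrt (Ctree * 4) ≤ K3 := by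
    unfold K3; have := mul_le_mul_of_nonneg_left h1 K2_nn; have := Cp0; nlinarith [sq_nonneg Cp]
  calc _ = K2 * Real.sqrt (Ctree * 4) * (b^3 * a) := by ring
    _ ≤ _ := mul_le_mul_of_nonneg_right h2 (by positivity)
lemma restr2 {f : ℝ → ℂ} (hf : Nice f) {F : Set ℝ} (hF : MeasurableSet F) (hF' : volume F ≠ ⊤) (hf1 : ∀ x, ‖f x‖ ≤ F.indicator 1 x)
    {N : ℝ → ℝ} (hN : Measurable N) {a : ℝ} (ha : 0 < a)
    (hX : volume.real F = a^4) (S : Finset Tile) (n : ℕ) : ∀ {E : Set ℝ} {b : ℝ}, MeasurableSet E → volume E ≠ ⊤ → 0 < b →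
      volume.real E = b^4 → b^4 ≤ 2^n * a^4 → ∫ x in E, ‖TT f N S x‖ ≤ 8 * K3 * (a^3 * b) := by
  have hc := Ctree0; have hk := K3_nn
  have base : ∀ {E : Set ℝ} {b : ℝ}, MeasurableSet E → volume E ≠ ⊤ → 0 < b →
      volume.real E = b^4 → b ≤ a → ∫ x in E, ‖TT f N S x‖ ≤ 8 * K3 * (a^3 * b) := by
    intro E b hE hE' hb hY h
    refine (restr1 hf hF hF' hf1 hN hE hE' ha hb hX hY S).trans ?_
    have h2 : b^3 * a ≤ a^3 * b := by
      have : b^2 ≤ a^2 := pow_le_pow_left₀ hb.le h 2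
      nlinarith [mul_pos ha hb]
    have : 0 ≤ K3 * (a^3 * b) := by positivity
    nlinarith [mul_le_mul_of_nonneg_left h2 hk]
  induction n with
  | zero => 
    intro E b hE hE' hb hY h
    exact base hE hE' hb hY (le_of_pow_le_pow_left₀ (n := 4) (by norm_num) ha.le (by simpa using h))
  | succ n ih =>
    intro E b hE hE' hb hY h
    rcases le_total b a with hba | hba
    · exact base hE hE' hb hY hba
    set l := 2^17 * (a^4 / b^4) with hl
    have hl0 : 0 < l := by positivity
    have hO := Om_meas F l
    have hv : volume.real (E ∩ Om F l) ≤ b^4/2 := by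
      have h1 := Om_vol hF hF' hl0
      have h2 : volume (E ∩ Om F l) ≤ ENNReal.ofReal (b^4/2) := (measure_mono inter_subset_right).trans (h1.trans (ENNReal.ofReal_le_ofReal (by
        rw [hX, hl]; apply le_of_eq; field_simp)))
      exact ENNReal.toReal_le_of_le_ofReal (by positivity) h2
    have i0 := (TT_int hf hN S).norm
    have split : ∫ x in E, ‖TT f N S x‖ = (∫ x in E ∩ Om F l, ‖TT f N S x‖) + ∫ x in E \ Om F l, ‖TT f N S x‖ :=
      (integral_inter_add_sdiff hO i0.integrableOn).symm
    have p1 : ∫ x in E ∩ Om F l, ‖TT f N S x‖ ≤ 8 * K3 * (a^3 * (0.85 * b)) := by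
      rcases (measureReal_nonneg (μ := volume) (s := E ∩ Om F l)).eq_or_lt with h0 | h0
      · have ht : volume (E ∩ Om F l) ≠ ⊤ := measure_ne_top_of_subset inter_subset_left hE'
        have : volume (E ∩ Om F l) = 0 := by
          rw [measureReal_def] at h0; exact ((ENNReal.toReal_eq_zero_iff _).1 h0.symm).resolve_right ht
        rw [Measure.restrict_eq_zero.2 this, integral_zero_measure]; positivity
      · set v := volume.real (E ∩ Om F l)
        have hv4 : (Real.sqrt (Real.sqrt v))^4 = v := by
          rw [show (4:ℕ) = 2*2 by norm_num, pow_mul, Real.sq_sqrt (Real.sqrt_nonneg _), Real.sq_sqrt h0.le]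
        refine (ih (hE.inter hO) (measure_ne_top_of_subset inter_subset_left hE') (b := Real.sqrt (Real.sqrt v)) (by positivity) hv4.symm ?_).trans ?_
        · rw [hv4]; refine hv.trans ?_; rw [pow_succ 2 n] at h; linarith
        · have : Real.sqrt (Real.sqrt v) ≤ 0.85 * b := by
            refine le_of_pow_le_pow_left₀ (n := 4) (by norm_num) (by positivity) ?_
            rw [hv4, mul_pow]; have : 0 < b^4 := by positivity
            norm_num at *; linarith
          refine mul_le_mul_of_nonneg_left (mul_le_mul_of_nonneg_left this (by positivity)) (by positivity)
    set B := S.filter fun s => Is s ⊆ Om F l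
    have p2 : ∫ x in E \ Om F l, ‖TT f N S x‖ ≤ K3 * (a^3 * b) := by
      have g := good_est hf hF hF' hf1 hN hE hE' ha hb hX hY hl0.le (S := S \ B) fun s hs => by
        simp only [B, Finset.mem_sdiff, Finset.mem_filter, not_and] at hs; exact hs.2 hs.1
      have bd := bad_est hf hF hF' hf1 hl0 (S := B) (fun s hs => (Finset.mem_filter.1 hs).2) hN
      have sp : _ ≤ (∫ x in E \ Om F l, ‖TT f N (S \ B) x‖) + ∫ x in E \ Om F l, ‖TT f N B x‖ := TT_split_int hf hN (Finset.filter_subset (fun s => Is s ⊆ Om F l) S) (E \ Om F l)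
      have g2 : ∫ x in E \ Om F l, ‖TT f N (S \ B) x‖ ≤ ∫ x in E, ‖TT f N (S \ B) x‖ :=
        setIntegral_mono_set (TT_int hf hN _).norm.integrableOn (ae_of_all _ fun _ => norm_nonneg _) (ae_of_all _ fun x hx => hx.1)
      have b2 : ∫ x in E \ Om F l, ‖TT f N B x‖ ≤ ∫ x in (Om F l)ᶜ, ‖TT f N B x‖ :=
        setIntegral_mono_set (TT_int hf hN _).norm.integrableOn (ae_of_all _ fun _ => norm_nonneg _) (ae_of_all _ fun x hx => hx.2)
      have e : Real.sqrt (Ctree * l) = a^2/b^2 * Real.sqrt (2^17 * Ctree) := by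
        rw [hl, show Ctree * (2^17 * (a^4/b^4)) = (a^2/b^2)^2 * (2^17 * Ctree) by field_simp, Real.sqrt_mul (by positivity), Real.sqrt_sq (by positivity)]
      rw [e] at g
      have e2 : K2 * (b^3 * a * (a^2/b^2 * Real.sqrt (2^17 * Ctree))) = K2 * Real.sqrt (2^17 * Ctree) * (a^3 * b) := by
        field_simp
      rw [hX] at bd
      obtain ⟨c, hcc⟩ : ∃ c : ℝ, c = 2^56 * Cp^2 := ⟨_, rfl⟩
      have c0 : 0 ≤ c := hcc ▸ mul_nonneg (by norm_num) (sq_nonneg _)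
      have e4 : K3 * (a^3 * b) = K2 * Real.sqrt (2^17 * Ctree) * (a^3 * b) + c * (a^3 * b) := by rw [hcc]; unfold K3; ring
      rw [← hcc] at bd
      have e3 : c * a^4 ≤ c * (a^3 * b) := by
        have : a^4 ≤ a^3 * b := by rw [pow_succ a 3]; exact mul_le_mul_of_nonneg_left hba (by positivity)
        exact mul_le_mul_of_nonneg_left this c0
      rw [e2] at g; rw [e4]
      exact sp.trans (add_le_add (g2.trans g) (b2.trans (bd.trans e3)))
    rw [split]
    have : 0 ≤ K3 * (a^3 * b) := by positivity
    nlinarith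
/-- restricted estimate, both forms -/
lemma restr {f : ℝ → ℂ} (hf : Nice f) {F E : Set ℝ} (hF : MeasurableSet F) (hF' : volume F ≠ ⊤) (hf1 : ∀ x, ‖f x‖ ≤ F.indicator 1 x)
    {N : ℝ → ℝ} (hN : Measurable N) (hE : MeasurableSet E) (hE' : volume E ≠ ⊤) {a b : ℝ} (ha : 0 ≤ a) (hb : 0 ≤ b)
    (hX : volume.real F = a^4) (hY : volume.real E = b^4) (S : Finset Tile) :
    ∫ x in E, ‖TT f N S x‖ ≤ 8 * K3 * (b^3 * a) ∧ ∫ x in E, ‖TT f N S x‖ ≤ 8 * K3 * (a^3 * b) := by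
  have hk := K3_nn
  have z : ∀ {A : Set ℝ}, volume A ≠ ⊤ → volume.real A = 0 → volume A = 0 := fun h h0 => by
    rw [measureReal_def] at h0; exact ((ENNReal.toReal_eq_zero_iff _).1 h0).resolve_right h
  rcases ha.eq_or_lt with ha0 | ha0
  · have := TT_zero (z hF' (by rw [hX, ← ha0]; norm_num)) hf1 N S
    simp only [this, norm_zero, integral_zero]; constructor <;> positivity
  rcases hb.eq_or_lt with hb0 | hb0
  · have := z hE' (by rw [hY, ← hb0]; norm_num)
    rw [Measure.restrict_eq_zero.2 this, integral_zero_measure]; constructor <;> positivity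
  constructor
  · refine (restr1 hf hF hF' hf1 hN hE hE' ha0 hb0 hX hY S).trans ?_
    have : 0 ≤ K3 * (b^3 * a) := by positivity
    nlinarith
  · obtain ⟨n, hn⟩ := pow_unbounded_of_one_lt (b^4/a^4) (by norm_num : (1:ℝ) < 2)
    exact restr2 hf hF hF' hf1 hN ha0 hX S n hE hE' hb0 hY ((div_le_iff₀ (by positivity)).1 hn.le)
end Carl
end
noncomputable section
namespace Carl
open Classical
lemma fph_int {f : ℝ → ℂ} (hf : Integrable f) (k m : ℤ) (x : ℝ) : Integrable (fun y => f y * ph k m (x - y)) :=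
  hf.mul_bdd (c := Cp * 8^k) ((ph_cont k m).comp (by fun_prop : Continuous fun y => x - y)).aestronglyMeasurable
    (ae_of_all _ fun y => ph_bd' k m _)
lemma Fw_add {f g : ℝ → ℂ} (hf : Integrable f) (hg : Integrable g) (k m : ℤ) (x : ℝ) :
    Fw (fun y => f y + g y) k m x = Fw f k m x + Fw g k m x := by
  unfold Fw; rw [← integral_add (fph_int hf k m x) (fph_int hg k m x)]; simp only [add_mul]
lemma Psi_add {f g : ℝ → ℂ} (hf : Integrable f) (hg : Integrable g) (s : Tile) (x : ℝ) :
    Psi (fun y => f y + g y) s x = Psi f s x + Psi g s x := by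
  unfold Psi
  rw [← integral_add (fph_int (Fw_norm_int hf s) _ _ x) (fph_int (Fw_norm_int hg s) _ _ x)]
  congr 1; ext y; by_cases h : y ∈ Is s <;> simp [h, Fw_add hf hg, add_mul]
lemma TT_add {f g : ℝ → ℂ} (hf : Integrable f) (hg : Integrable g) (N : ℝ → ℝ) (S : Finset Tile) (x : ℝ) :
    TT (fun y => f y + g y) N S x = TT f N S x + TT g N S x := by
  unfold TT; rw [← Finset.sum_add_distrib]; refine Finset.sum_congr rfl fun s _ => ?_
  split_ifs
  · exact Psi_add hf hg s x
  · simp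
lemma TT_smul (c : ℂ) (f : ℝ → ℂ) (N : ℝ → ℝ) (S : Finset Tile) (x : ℝ) :
    TT (fun y => c * f y) N S x = c * TT f N S x := by
  unfold TT; rw [Finset.mul_sum]; refine Finset.sum_congr rfl fun s _ => ?_
  have : Psi (fun y => c * f y) s x = c * Psi f s x := by
    unfold Psi; rw [← integral_const_mul]; congr 1; ext y
    by_cases h : y ∈ Is s <;> simp only [h, indicator_of_mem, indicator_of_notMem, not_false_eq_true, zero_mul, mul_zero]
    rw [← mul_assoc]; congr 1; unfold Fw; rw [← integral_const_mul]; simp only [mul_assoc]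
  split_ifs <;> simp [this]
lemma TT_fsum {ι : Type*} (A : Finset ι) {f : ι → ℝ → ℂ} (hf : ∀ i, Integrable (f i)) (N : ℝ → ℝ) (S : Finset Tile) (x : ℝ) :
    TT (fun y => ∑ i ∈ A, f i y) N S x = ∑ i ∈ A, TT (f i) N S x := by
  induction A using Finset.induction_on with
  | empty => simpa using TT_smul 0 (fun _ => 0) N S x
  | insert a A ha ih =>
    simp only [Finset.sum_insert ha]
    rw [← ih, TT_add (hf a) (integrable_finsetSum _ fun i _ => hf i)]
lemma TT_bd (S : Finset Tile) : ∃ B, 0 ≤ B ∧ ∀ (f : ℝ → ℂ), Integrable f → ∀ (N : ℝ → ℝ) x, ‖TT f N S x‖ ≤ B * ∫ y, ‖f y‖ := by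
  have hC := Cp0
  refine ⟨∑ s ∈ S, 2^20 * Cp * (Cp * 8^s.1), Finset.sum_nonneg fun s _ => by have := e8 s.1; positivity, fun f hf N x => ?_⟩
  rw [Finset.sum_mul]
  refine (norm_sum_le _ _).trans (Finset.sum_le_sum fun s _ => ?_)
  have h8 := e8 s.1
  have i0 : 0 ≤ ∫ y, ‖f y‖ := integral_nonneg fun _ => norm_nonneg _
  have h := Psi_bd0 (f := f) s (fun y _ => Fw_bd hf _ _ y) x
  have h2 : 2^20 * Cp * (Cp * 8^s.1 * ∫ y, ‖f y‖) * W (nus s x) ^ 20 ≤ 2^20 * Cp * (Cp * 8^s.1 * ∫ y, ‖f y‖) :=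
    mul_le_of_le_one_right (mul_nonneg (by positivity) (mul_nonneg (by positivity) i0)) (W_pow_le_one _ _)
  rw [← mul_assoc] at h2
  split_ifs
  · linarith
  · rw [norm_zero]; exact mul_nonneg (by positivity) i0
def Lv (h : ℝ → ℝ) (l : ℤ) : Set ℝ := {x | (2:ℝ)^l ≤ h x ∧ h x < 2^(l+1)}
lemma Lv_meas {h : ℝ → ℝ} (hh : Measurable h) (l : ℤ) : MeasurableSet (Lv h l) :=
  (measurableSet_le measurable_const hh).inter (measurableSet_lt hh measurable_const)
lemma Lv_lt {h : ℝ → ℝ} {l l' : ℤ} {x : ℝ} (a : x ∈ Lv h l) (b : x ∈ Lv h l') : l' ≤ l := by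
  have : (2:ℝ)^l' < 2^(l+1) := b.1.trans_lt a.2
  rw [zpow_lt_zpow_iff_right₀ (by norm_num)] at this; omega
lemma Lv_disj (h : ℝ → ℝ) : Pairwise (Function.onFun Disjoint (Lv h)) := fun i j hij => by
  rw [Function.onFun, Set.disjoint_left]; intro x a b; exact hij (le_antisymm (Lv_lt b a) (Lv_lt a b))
lemma Lv_ex {h : ℝ → ℝ} {x : ℝ} (hx : 0 < h x) : ∃ l, x ∈ Lv h l :=
  ⟨Int.log 2 (h x), by exact_mod_cast Int.zpow_log_le_self (b := 2) (by norm_num) hx, by exact_mod_cast Int.lt_zpow_succ_log_self (b := 2) (by norm_num) (h x)⟩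
lemma Lv_sum {h : ℝ → ℝ} (hh : Measurable h) (u : ℝ → ℝ≥0∞) (hu : ∀ x, h x ≤ 0 → u x = 0) :
    ∫⁻ x, u x = ∑' l, ∫⁻ x in Lv h l, u x := by
  rw [← lintegral_iUnion (fun l => Lv_meas hh l) (Lv_disj h), ← lintegral_indicator (MeasurableSet.iUnion fun l => Lv_meas hh l)]
  congr 1; ext x
  by_cases hx : 0 < h x
  · rw [indicator_of_mem]; exact mem_iUnion.2 (Lv_ex hx)
  · rw [hu x (not_lt.1 hx)]; simp [indicator, hu x (not_lt.1 hx)]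
lemma Lv_vol {h : ℝ → ℝ} (hh : Measurable h) (h2 : ∫⁻ x, ENNReal.ofReal (h x) ^ 2 ≠ ⊤) (l : ℤ) :
    volume (Lv h l) ≠ ⊤ ∧ ENNReal.ofReal (4^l * volume.real (Lv h l)) ≤ ∫⁻ x in Lv h l, ENNReal.ofReal (h x) ^ 2 := by
  have p : (0:ℝ) < 4^l := by positivity
  have k : ENNReal.ofReal (4^l) * volume (Lv h l) ≤ ∫⁻ x in Lv h l, ENNReal.ofReal (h x) ^ 2 := by
    rw [← setLIntegral_const]
    refine setLIntegral_mono' (Lv_meas hh l) fun x hx => ?_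
    rw [← ENNReal.ofReal_pow ((by positivity : (0:ℝ) ≤ 2^l).trans hx.1)]
    refine ENNReal.ofReal_le_ofReal ?_
    calc (4:ℝ)^l = (2^l)^2 := by rw [show (4:ℝ) = 2^2 by norm_num, ← zpow_natCast, ← zpow_natCast, ← zpow_mul, ← zpow_mul, mul_comm]
      _ ≤ _ := pow_le_pow_left₀ (by positivity) hx.1 2
  have t : volume (Lv h l) ≠ ⊤ := fun ht => by
    rw [ht, ENNReal.mul_top (by simpa using p)] at k
    exact h2 (top_le_iff.1 (k.trans (setLIntegral_le_lintegral _ _)))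
  refine ⟨t, ?_⟩
  rwa [ENNReal.ofReal_mul p.le, measureReal_def, ENNReal.ofReal_toReal t]
lemma wt {a b ε I : ℝ} (ha : 0 ≤ a) (hb : 0 ≤ b) (hε : 0 < ε) (hε1 : ε ≤ 1) (j l : ℤ) (h1 : I ≤ b^3 * a) (h2 : I ≤ a^3 * b) :
    2^j * 2^l * I ≤ (3/4:ℝ)^(j-l).natAbs * ((ε^3)⁻¹ * (4^j * a^4) + ε * (4^l * b^4)) := by
  have gen : ∀ {p q : ℝ}, 0 ≤ p → 0 ≤ q → q^3*p ≤ (ε^3)⁻¹ * p^4 + ε * q^4 ∧ p^3*q ≤ (ε^3)⁻¹ * p^4 + ε * q^4 := by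
    intro p q hp hq
    have e3 : 1 ≤ (ε^3)⁻¹ := (one_le_inv₀ (by positivity)).2 (pow_le_one₀ hε.le hε1)
    rcases le_total p (ε*q) with h | h
    · have hpq : p ≤ q := h.trans (mul_le_of_le_one_left hq hε1)
      have k1 : q^3*p ≤ ε*q^4 := by nlinarith [mul_le_mul_of_nonneg_left h (pow_nonneg hq 3)]
      have k2 : p^3*q ≤ q^3*p := by nlinarith [mul_nonneg hp hq, pow_le_pow_left₀ hp hpq 2]
      have : 0 ≤ (ε^3)⁻¹ * p^4 := by positivity
      exact ⟨by linarith, by linarith⟩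
    · have k0 : 0 ≤ ε * q^4 := by positivity
      have e1 : ε⁻¹ ≤ (ε^3)⁻¹ := inv_anti₀ (by positivity) (pow_le_of_le_one hε.le hε1 (by norm_num))
      have hq' : q ≤ ε⁻¹ * p := by rw [inv_mul_eq_div, le_div_iff₀ hε]; linarith
      have k1 : q^3*p ≤ (ε^3)⁻¹ * p^4 := by
        have := mul_le_mul_of_nonneg_right (pow_le_pow_left₀ hq hq' 3) hp
        rw [mul_pow, inv_pow] at this; linarith [this, (by ring : (ε^3)⁻¹ * p^3 * p = (ε^3)⁻¹ * p^4)]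
      have k2 : p^3*q ≤ (ε^3)⁻¹ * p^4 := by
        have a1 := mul_le_mul_of_nonneg_left hq' (pow_nonneg hp 3)
        have a2 := mul_le_mul_of_nonneg_right e1 (pow_nonneg hp 4)
        linarith [(by ring : p^3 * (ε⁻¹ * p) = ε⁻¹ * p^4)]
      exact ⟨by linarith, by linarith⟩
  set s := Real.sqrt 2 with hs
  have s2 : s^2 = 2 := Real.sq_sqrt (by norm_num)
  have s0 : 0 < s := by positivity
  have s34 : s⁻¹ ≤ 3/4 := by
    rw [inv_le_comm₀ s0 (by norm_num)]; apply Real.le_sqrt_of_sq_le; norm_num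
  have c2 : ∀ i : ℤ, (2:ℝ)^i = s^i * s^i := fun i => by rw [← mul_zpow, ← pow_two, s2]
  have c4 : ∀ i : ℤ, (4:ℝ)^i = (s^i)^4 := fun i => by
    rw [show (4:ℝ) = 2*2 by norm_num, mul_zpow, c2]; ring
  obtain ⟨g1, g2⟩ := gen (p := s^j * a) (q := s^l * b) (by positivity) (by positivity)
  have R : (ε^3)⁻¹ * (4^j * a^4) + ε * (4^l * b^4) = (ε^3)⁻¹ * (s^j * a)^4 + ε * (s^l * b)^4 := by rw [c4, c4]; ring
  rw [R, c2, c2]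
  set X := (ε^3)⁻¹ * (s^j * a)^4 + ε * (s^l * b)^4 with hX
  have X0 : 0 ≤ X := by positivity
  have fin : ∀ n : ℕ, s⁻¹^n * X ≤ (3/4:ℝ)^n * X := fun n => mul_le_mul_of_nonneg_right (pow_le_pow_left₀ (by positivity) s34 n) X0
  have sj : 0 < s^j := by positivity
  have sl : 0 < s^l := by positivity
  rcases le_total l j with h | h
  · obtain ⟨n, hn⟩ := Int.eq_ofNat_of_zero_le (sub_nonneg.2 h)
    rw [hn]; refine le_trans ?_ (fin n)
    have e : s^j = s^l * s^n := by rw [← zpow_natCast, ← zpow_add₀ s0.ne']; congr 1; omega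
    have q1 : s^j * s^j * (s^l * s^l) * I ≤ s^j * s^j * (s^l * s^l) * (a^3 * b) := mul_le_mul_of_nonneg_left h2 (by positivity)
    have q2 : s^j * s^j * (s^l * s^l) * (a^3 * b) = s⁻¹^n * ((s^j * a)^3 * (s^l * b)) := by
      rw [e, inv_pow]; field_simp
    exact q1.trans (q2.le.trans (mul_le_mul_of_nonneg_left g2 (by positivity)))
  · obtain ⟨n, hn⟩ := Int.eq_ofNat_of_zero_le (sub_nonneg.2 h)
    rw [show j - l = -(n:ℤ) by omega]; rw [Int.natAbs_neg, Int.natAbs_natCast]; refine le_trans ?_ (fin n)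
    have e : s^l = s^j * s^n := by rw [← zpow_natCast, ← zpow_add₀ s0.ne']; congr 1; omega
    have q1 : s^j * s^j * (s^l * s^l) * I ≤ s^j * s^j * (s^l * s^l) * (b^3 * a) := mul_le_mul_of_nonneg_left h1 (by positivity)
    have q2 : s^j * s^j * (s^l * s^l) * (b^3 * a) = s⁻¹^n * ((s^l * b)^3 * (s^j * a)) := by
      rw [e, inv_pow]; field_simp
    exact q1.trans (q2.le.trans (mul_le_mul_of_nonneg_left g1 (by positivity)))
end Carl
end
noncomputable section
namespace Carl
open Classical
lemma Nice.ind {f : ℝ → ℂ} (hf : Nice f) {A : Set ℝ} (hA : MeasurableSet A) : Nice (A.indicator f) := by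
  obtain ⟨M, hM⟩ := hf.b
  exact ⟨hf.m.indicator hA, hf.i.indicator hA, M, fun x => (norm_indicator_le_norm_self f x).trans (hM x)⟩
lemma Nice.cm {f : ℝ → ℂ} (hf : Nice f) (c : ℂ) : Nice (fun y => c * f y) := by
  obtain ⟨M, hM⟩ := hf.b
  exact ⟨measurable_const.mul hf.m, hf.i.const_mul c, ‖c‖ * M, fun x => by rw [norm_mul]; exact mul_le_mul_of_nonneg_left (hM x) (norm_nonneg _)⟩
lemma sq_fin {f : ℝ → ℂ} (hf : Integrable f) {M : ℝ} (hM : ∀ x, ‖f x‖ ≤ M) : ∫⁻ x, ENNReal.ofReal ‖f x‖ ^ 2 ≠ ⊤ := by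
  refine (lt_of_le_of_lt (b := ENNReal.ofReal M * ∫⁻ x, ENNReal.ofReal ‖f x‖) ?_ ?_).ne
  · rw [← lintegral_const_mul' _ _ ENNReal.ofReal_ne_top]
    refine lintegral_mono fun x => ?_
    dsimp only; rw [pow_two]; exact mul_le_mul_left (ENNReal.ofReal_le_ofReal (hM x)) _
  · simp only [ofReal_norm]; exact ENNReal.mul_lt_top ENNReal.ofReal_lt_top hf.2
lemma TT_tsum {f : ℝ → ℂ} (hf : Nice f) (N : ℝ → ℝ) (S : Finset Tile) (x : ℝ) :
    ‖TT f N S x‖ₑ ≤ ∑' j, ‖TT ((Lv (fun y => ‖f y‖) j).indicator f) N S x‖ₑ := by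
  obtain ⟨B, hB, h⟩ := TT_bd S
  set F := Lv (fun y => ‖f y‖)
  have hF : ∀ j, MeasurableSet (F j) := Lv_meas hf.m.norm
  have hi : ∀ j, Integrable ((F j).indicator f) := fun j => (hf.ind (hF j)).i
  set A : ℕ → Finset ℤ := fun n => Finset.Icc (-n:ℤ) n
  set r : ℕ → ℝ → ℂ := fun n y => f y - ∑ j ∈ A n, (F j).indicator f y
  have hsum : ∀ n y, ∑ j ∈ A n, (F j).indicator f y = 0 ∨ ∑ j ∈ A n, (F j).indicator f y = f y := by
    intro n y
    by_cases hy : ∃ j ∈ A n, y ∈ F j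
    · obtain ⟨j, hj, hy⟩ := hy
      right; rw [Finset.sum_eq_single j]
      · simp [hy]
      · intro i _ hij; exact indicator_of_notMem (fun h => Set.disjoint_left.1 (Lv_disj _ hij) h hy) _
      · exact fun h => absurd hj h
    · left; push Not at hy; exact Finset.sum_eq_zero fun j hj => indicator_of_notMem (hy j hj) _
  have hri : ∀ n, Integrable (r n) := fun n => hf.i.sub (integrable_finsetSum _ fun j _ => hi j)
  have hr0 : Tendsto (fun n => ∫ y, ‖r n y‖) atTop (𝓝 0) := by
    have := tendsto_integral_of_dominated_convergence (F := fun n y => ‖r n y‖) (f := fun _ => (0:ℝ)) (fun y => ‖f y‖)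
      (fun n => (hri n).norm.1) hf.i.norm (fun n => ae_of_all _ fun y => ?_) (ae_of_all _ fun y => ?_)
    · simpa using this
    · rw [norm_norm]; dsimp only [r]; rcases hsum n y with h | h <;> rw [h] <;> simp
    · refine tendsto_const_nhds.congr' ?_
      by_cases hy : 0 < ‖f y‖
      · obtain ⟨j, hj⟩ := Lv_ex (h := fun y => ‖f y‖) hy
        filter_upwards [eventually_ge_atTop j.natAbs] with n hn
        dsimp only [r]
        rw [Finset.sum_eq_single_of_mem j (by simp only [A, Finset.mem_Icc]; omega) fun i _ hij => indicator_of_notMem (fun h => Set.disjoint_left.1 (Lv_disj _ hij) h hj) _]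
        rw [indicator_of_mem hj]; simp
      · have : f y = 0 := norm_le_zero_iff.1 (not_lt.1 hy)
        filter_upwards with n; dsimp only [r]
        rcases hsum n y with h | h <;> rw [h, this] <;> simp
  have key : ∀ n, ‖TT f N S x‖ₑ ≤ (∑' j, ‖TT ((F j).indicator f) N S x‖ₑ) + ENNReal.ofReal (B * ∫ y, ‖r n y‖) := by
    intro n
    have e : TT f N S x = (∑ j ∈ A n, TT ((F j).indicator f) N S x) + TT (r n) N S x := by
      rw [← TT_fsum (A n) hi, ← TT_add (integrable_finsetSum _ fun j _ => hi j) (hri n)]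
      congr 1; ext y; simp [r]
    rw [e]
    refine (enorm_add_le _ _).trans (add_le_add ((enorm_sum_le _ _).trans (ENNReal.sum_le_tsum _)) ?_)
    rw [← ofReal_norm]; exact ENNReal.ofReal_le_ofReal (h _ (hri n) N x)
  have lim := (ENNReal.tendsto_ofReal (hr0.const_mul B)).const_add (∑' j, ‖TT ((F j).indicator f) N S x‖ₑ)
  simpa using ge_of_tendsto' lim key
lemma sum2 (V U : ℤ → ℝ≥0∞) (c e D : ℝ≥0∞) : ∑' l : ℤ, ∑' j : ℤ, D * (ENNReal.ofReal ((3/4:ℝ)^(j-l).natAbs) * (c * V j + e * U l))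
    = D * (ENNReal.ofReal C0 * (c * ∑' j, V j + e * ∑' l, U l)) := by
  have hw : ∀ l : ℤ, ∑' j : ℤ, ENNReal.ofReal ((3/4:ℝ)^(j-l).natAbs) = ENNReal.ofReal C0 := fun l => by
    rw [C0, ENNReal.ofReal_tsum_of_nonneg (fun _ => by positivity) C0_sum]
    exact (Equiv.subRight l).tsum_eq (fun i : ℤ => ENNReal.ofReal ((3/4:ℝ)^i.natAbs))
  have hw2 : ∀ j : ℤ, ∑' l : ℤ, ENNReal.ofReal ((3/4:ℝ)^(j-l).natAbs) = ENNReal.ofReal C0 := fun j => by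
    rw [C0, ENNReal.ofReal_tsum_of_nonneg (fun _ => by positivity) C0_sum]
    exact (Equiv.subLeft j).tsum_eq (fun i : ℤ => ENNReal.ofReal ((3/4:ℝ)^i.natAbs))
  simp only [ENNReal.tsum_mul_left, mul_add, ENNReal.tsum_add]
  congr 1
  · rw [ENNReal.tsum_comm]; simp only [ENNReal.tsum_mul_right, hw2, ENNReal.tsum_mul_left]
  · simp only [ENNReal.tsum_mul_right, hw, ENNReal.tsum_mul_left]
lemma term2 {f : ℝ → ℂ} (hf : Nice f) {N : ℝ → ℝ} (hN : Measurable N) (S : Finset Tile) {ε : ℝ} (hε : 0 < ε) (hε1 : ε ≤ 1) {E : ℤ → Set ℝ}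
    (hE : ∀ l, MeasurableSet (E l)) (hE' : ∀ l, volume (E l) ≠ ⊤) (hF' : ∀ j, volume (Lv (fun y => ‖f y‖) j) ≠ ⊤) (j l : ℤ) :
    ENNReal.ofReal (2^(l+1)) * ∫⁻ x in E l, ‖TT ((Lv (fun y => ‖f y‖) j).indicator f) N S x‖ₑ ≤
      ENNReal.ofReal (32 * K3) * (ENNReal.ofReal ((3/4:ℝ)^(j-l).natAbs) * (ENNReal.ofReal ((ε^3)⁻¹) *
        ENNReal.ofReal (4^j * volume.real (Lv (fun y => ‖f y‖) j)) + ENNReal.ofReal ε * ENNReal.ofReal (4^l * volume.real (E l)))) := by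
  have hF : MeasurableSet (Lv (fun y => ‖f y‖) j) := Lv_meas hf.m.norm j
  set F := Lv (fun y => ‖f y‖) j with hFd
  have hk := K3_nn
  set c : ℂ := ((2^(j+1) : ℝ) : ℂ) with hc
  have cn : ‖c‖ = 2^(j+1) := by rw [hc, Complex.norm_real, Real.norm_of_nonneg (by positivity)]
  have c0 : c ≠ 0 := norm_ne_zero_iff.1 (by rw [cn]; positivity)
  set g : ℝ → ℂ := fun y => c⁻¹ * F.indicator f y with hg
  have gN : Nice g := (hf.ind hF).cm _
  have g1 : ∀ x, ‖g x‖ ≤ F.indicator 1 x := fun x => by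
    dsimp only [g]
    by_cases hx : x ∈ F
    · rw [indicator_of_mem hx, indicator_of_mem hx, norm_mul, norm_inv, cn, Pi.one_apply, inv_mul_eq_div, div_le_one (by positivity)]; exact hx.2.le
    · simp [hx]
  have s4 : ∀ v : ℝ, 0 ≤ v → v = (Real.sqrt (Real.sqrt v))^4 := fun v hv => by
    rw [show (4:ℕ) = 2*2 by norm_num, pow_mul, Real.sq_sqrt (Real.sqrt_nonneg _), Real.sq_sqrt hv]
  set a := Real.sqrt (Real.sqrt (volume.real F))
  set b := Real.sqrt (Real.sqrt (volume.real (E l)))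
  have ha : volume.real F = a^4 := s4 _ measureReal_nonneg
  have hb : volume.real (E l) = b^4 := s4 _ measureReal_nonneg
  have a0 : 0 ≤ a := Real.sqrt_nonneg _
  have b0 : 0 ≤ b := Real.sqrt_nonneg _
  obtain ⟨r1, r2⟩ := restr gN hF (hF' j) g1 hN (hE l) (hE' l) a0 b0 ha hb S
  have r : ∫ x in E l, ‖TT g N S x‖ ≤ 8 * K3 * min (b^3*a) (a^3*b) := by
    rcases min_choice (b^3*a) (a^3*b) with h | h <;> rw [h] <;> assumption
  have w := wt a0 b0 hε hε1 j l (min_le_left (b^3*a) (a^3*b)) (min_le_right _ _)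
  have e : ∀ x, ‖TT (F.indicator f) N S x‖ₑ = ENNReal.ofReal (2^(j+1)) * ‖TT g N S x‖ₑ := fun x => by
    rw [TT_smul, ← ofReal_norm, ← ofReal_norm, ← ENNReal.ofReal_mul (by positivity), norm_mul, norm_inv, cn]
    congr 1; field_simp
  simp only [e]
  rw [lintegral_const_mul' _ _ ENNReal.ofReal_ne_top, ← ofReal_integral_norm_eq_lintegral_enorm (TT_int gN hN S).integrableOn,
    ← ENNReal.ofReal_mul (by positivity), ← ENNReal.ofReal_mul (by positivity), ← ENNReal.ofReal_mul (by positivity), ← ENNReal.ofReal_mul (by positivity), ← ENNReal.ofReal_add (by positivity) (by positivity), ← ENNReal.ofReal_mul (by positivity), ← ENNReal.ofReal_mul (by positivity)]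
  refine ENNReal.ofReal_le_ofReal ?_
  rw [ha, hb, zpow_add₀ (by norm_num), zpow_add₀ (by norm_num)]
  have p : (0:ℝ) ≤ 2^l * 2^j * 4 := by positivity
  calc (2:ℝ)^l * 2^(1:ℤ) * (2^j * 2^(1:ℤ) * ∫ x in E l, ‖TT g N S x‖) = 2^l * 2^j * 4 * ∫ x in E l, ‖TT g N S x‖ := by norm_num; ring
    _ ≤ 2^l * 2^j * 4 * (8 * K3 * min (b^3*a) (a^3*b)) := mul_le_mul_of_nonneg_left r p
    _ = 32 * K3 * (2^j * 2^l * min (b^3*a) (a^3*b)) := by ring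
    _ ≤ _ := mul_le_mul_of_nonneg_left w (by positivity)
/-- strong L2 bound for the model operators -/
lemma model2 : ∃ C : ℝ, 0 < C ∧ ∀ (f : ℝ → ℂ), Nice f → ∀ (N : ℝ → ℝ), Measurable N → ∀ S : Finset Tile,
    ∫⁻ x, ‖TT f N S x‖ₑ ^ 2 ≤ ENNReal.ofReal C * ∫⁻ x, ‖f x‖ₑ ^ 2 := by
  have hk := K3_nn; have hC0 := C0_nn
  set D := 32 * K3 * C0 with hD
  have D0 : 0 ≤ D := by positivity
  set ε := 1 / (2*D+2) with hε
  have e0 : 0 < ε := by positivity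
  have e1 : ε ≤ 1 := by rw [hε, div_le_one (by positivity)]; linarith
  have e2 : D * ε ≤ 1/2 := by rw [hε, mul_one_div, div_le_iff₀ (by positivity)]; linarith
  refine ⟨2 * D * (ε^3)⁻¹ + 1, by positivity, fun f hf N hN S => ?_⟩
  obtain ⟨M, hM⟩ := hf.b
  obtain ⟨B, hB, hBB⟩ := TT_bd S
  set h : ℝ → ℝ := fun x => ‖TT f N S x‖ with hh
  have hm : Measurable h := (TT_meas hf hN S).norm
  have hU : ∫⁻ x, ENNReal.ofReal (h x) ^ 2 ≠ ⊤ := sq_fin (TT_int hf hN S) (hBB f hf.i N)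
  have hV : ∫⁻ x, ENNReal.ofReal ‖f x‖ ^ 2 ≠ ⊤ := sq_fin hf.i hM
  have main : ∫⁻ x, ENNReal.ofReal (h x) ^ 2 ≤ ENNReal.ofReal (32 * K3) * (ENNReal.ofReal C0 * (ENNReal.ofReal ((ε^3)⁻¹) * (∫⁻ x, ENNReal.ofReal ‖f x‖ ^ 2)
       + ENNReal.ofReal ε * ∫⁻ x, ENNReal.ofReal (h x) ^ 2)) := by
    conv_rhs => rw [Lv_sum hm (fun x => ENNReal.ofReal (h x) ^ 2) fun x hx => by simp [ENNReal.ofReal_of_nonpos hx],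
      Lv_sum hf.m.norm (fun x => ENNReal.ofReal ‖f x‖ ^ 2) fun x hx => by simp [ENNReal.ofReal_of_nonpos hx]]
    rw [← sum2, Lv_sum hm (fun x => ENNReal.ofReal (h x) ^ 2) fun x hx => by simp [ENNReal.ofReal_of_nonpos hx]]
    refine ENNReal.tsum_le_tsum fun l => ?_
    have m : ∀ j, Measurable (TT ((Lv (fun y => ‖f y‖) j).indicator f) N S) := fun j => TT_meas (hf.ind (Lv_meas hf.m.norm j)) hN S
    calc ∫⁻ x in Lv h l, ENNReal.ofReal (h x) ^ 2
        ≤ ∫⁻ x in Lv h l, ENNReal.ofReal (2^(l+1)) * ∑' j, ‖TT ((Lv (fun y => ‖f y‖) j).indicator f) N S x‖ₑ := by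
          refine setLIntegral_mono' (Lv_meas hm l) fun x hx => ?_
          rw [pow_two]
          refine mul_le_mul' (ENNReal.ofReal_le_ofReal hx.2.le) ?_
          dsimp only [h]; rw [ofReal_norm]; exact TT_tsum hf N S x
      _ = ∑' j, ENNReal.ofReal (2^(l+1)) * ∫⁻ x in Lv h l, ‖TT ((Lv (fun y => ‖f y‖) j).indicator f) N S x‖ₑ := by
          rw [lintegral_const_mul' _ _ ENNReal.ofReal_ne_top, lintegral_tsum fun j => (m j).enorm.aemeasurable, ENNReal.tsum_mul_left]
      _ ≤ _ := by
          refine ENNReal.tsum_le_tsum fun j => ?_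
          refine (term2 hf hN S e0 e1 (Lv_meas hm) (fun l => (Lv_vol hm hU l).1) (fun j => (Lv_vol hf.m.norm hV j).1) j l).trans ?_
          gcongr
          · exact (Lv_vol hf.m.norm hV j).2
          · exact (Lv_vol hm hU l).2
  simp only [← ofReal_norm]
  change ∫⁻ x, ENNReal.ofReal (h x) ^ 2 ≤ _
  obtain ⟨U, hU2⟩ : ∃ U, U = ∫⁻ x, ENNReal.ofReal (h x) ^ 2 := ⟨_, rfl⟩
  obtain ⟨V, hV2⟩ : ∃ V, V = ∫⁻ x, ENNReal.ofReal ‖f x‖ ^ 2 := ⟨_, rfl⟩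
  rw [← hU2, ← hV2] at main
  rw [← hU2, ← hV2]; rw [← hU2] at hU; rw [← hV2] at hV
  lift U to NNReal using hU
  lift V to NNReal using hV
  have m2 : (U:ℝ) ≤ 32 * K3 * (C0 * ((ε^3)⁻¹ * V + ε * U)) := by
    have := ENNReal.toReal_mono (by finiteness) main
    rwa [ENNReal.toReal_mul, ENNReal.toReal_mul, ENNReal.toReal_add (by finiteness) (by finiteness), ENNReal.toReal_mul, ENNReal.toReal_mul, ENNReal.toReal_ofReal (by positivity), ENNReal.toReal_ofReal (by positivity), ENNReal.toReal_ofReal (by positivity), ENNReal.toReal_ofReal (by positivity)] at this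
  rw [← ENNReal.ofReal_coe_nnreal, ← ENNReal.ofReal_coe_nnreal, ← ENNReal.ofReal_mul (by positivity)]
  refine ENNReal.ofReal_le_ofReal ?_
  have m3 : 32 * K3 * (C0 * ((ε^3)⁻¹ * V + ε * U)) = D * (ε^3)⁻¹ * V + D * ε * U := by rw [hD]; ring
  have u0 : (0:ℝ) ≤ U := U.2
  have v0 : (0:ℝ) ≤ V := V.2
  have := mul_le_mul_of_nonneg_right e2 u0
  linarith
end Carl
end
noncomputable section
namespace Carl
open Classical
def Ph (s : ℝ) : ℂ := ∫ v, phi v * phi (s - v)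
lemma Ph_bd (s : ℝ) : ‖Ph s‖ ≤ 4 * Cp^2 * W s ^ 18 := by
  have hC := Cp0
  refine (norm_integral_le_integral_norm _).trans ?_
  calc _ ≤ ∫ v, Cp^2 * W s ^ 18 * W v ^ 2 := by
        refine integral_mono_of_nonneg (ae_of_all _ fun _ => norm_nonneg _) ((intW le_rfl).const_mul _) (ae_of_all _ fun v => ?_)
        dsimp only
        have h1 := W_mul_le v (s - v)
        rw [add_sub_cancel] at h1
        have h2 := pow_le_pow_left₀ (mul_nonneg (W_nn _) (W_nn _)) h1 18
        have h3 : W (s - v) ^ 20 ≤ W (s - v) ^ 18 := W_pow_anti (by norm_num) _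
        rw [norm_mul]
        calc _ ≤ (Cp * W v ^ 20) * (Cp * W (s - v) ^ 18) :=
              mul_le_mul (phi_bd v) ((phi_bd _).trans (mul_le_mul_of_nonneg_left h3 hC.le)) (norm_nonneg _) (mul_nonneg hC.le (pow_nonneg (W_nn _) _))
          _ = Cp^2 * (W v * W (s - v)) ^ 18 * W v ^ 2 := by ring
          _ ≤ _ := by have := W_nn v; gcongr
    _ ≤ Cp^2 * W s ^ 18 * 4 := by
        rw [integral_const_mul]
        exact mul_le_mul_of_nonneg_left (intW_le le_rfl) (mul_nonneg (sq_nonneg _) (pow_nonneg (W_nn _) _))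
    _ = _ := by ring
lemma Ph_cont : Continuous Ph := by
  have hC := Cp0
  refine continuous_of_dominated (bound := fun v => Cp * ‖phi v‖) (fun s => ?_) (fun s => ae_of_all _ fun v => ?_)
    (phi.integrable.norm.const_mul _) (ae_of_all _ fun v => ?_)
  · exact (phi.continuous.mul (phi.continuous.comp (by fun_prop))).aestronglyMeasurable
  · rw [norm_mul, mul_comm]
    refine mul_le_mul_of_nonneg_right ((phi_bd _).trans ?_) (norm_nonneg _)
    exact mul_le_of_le_one_right hC.le (pow_le_one₀ (W_nn _) (W_le_one _))
  · exact continuous_const.mul (phi.continuous.comp (by fun_prop))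
lemma Ph_chi (s : ℝ) : Ph s = ∫ z, (chi z : ℂ)^2 * ee (s * z) := by
  have hF : Integrable (fun z => (chi z : ℂ)) := by
    have := (FourierTransform.fourier phi).integrable (μ := volume)
    rw [SchwartzMap.fourier_coe] at this
    exact this.congr (ae_of_all _ phi_spec.1)
  have inv : ∀ x, phi x = ∫ z, (chi z : ℂ) * ee (z * x) := by
    intro x
    have h := Continuous.fourierInv_fourier_eq phi.continuous phi.integrable
      (by rw [← SchwartzMap.fourier_coe]; exact (FourierTransform.fourier phi).integrable)
    rw [← h, Real.fourierInv_eq_fourier_neg, fourier_ee]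
    refine integral_congr_ae (ae_of_all _ fun y => ?_)
    dsimp only
    rw [phi_spec.1, mul_comm]; congr 2; ring
  have hm := (phi.integrable (μ := volume)).mul_prod hF
  have h1 : Integrable (fun p : ℝ × ℝ => phi p.1 * ((chi p.2 : ℂ) * ee (p.2 * (s - p.1)))) (volume.prod volume) := by
    refine (Integrable.mul_bdd (c := 1) hm (g := fun p : ℝ × ℝ => ee (p.2 * (s - p.1))) ?_ (ae_of_all _ fun p => (ee_norm _).le)).congr
      (ae_of_all _ fun p => by simp only [mul_assoc])
    exact (ee_cont.comp (by fun_prop)).aestronglyMeasurable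
  calc Ph s = ∫ v, ∫ z, phi v * ((chi z : ℂ) * ee (z * (s - v))) := by
        unfold Ph; congr 1; ext v; rw [inv (s - v), integral_const_mul]
    _ = ∫ z, ∫ v, phi v * ((chi z : ℂ) * ee (z * (s - v))) := integral_integral_swap h1
    _ = _ := by
        congr 1; ext z
        have := phi_spec.1 z
        rw [fourier_ee] at this
        rw [pow_two]; nth_rewrite 2 [← this]
        rw [← integral_mul_const, ← integral_mul_const]
        congr 1; ext v
        have : z * (s - v) = s * z + -(v * z) := by ring
        rw [this, ee_add]; ring
/-- kernel of one scale -/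
lemma Fw_ph {f : ℝ → ℂ} (hf : Nice f) (k m : ℤ) (x : ℝ) :
    ∫ y, Fw f k m y * ph k m (x - y) = ∫ t, f (x - t) * sc Ph k m t := by
  unfold Fw
  rw [fub (H := fun y => ph k m (x - y)) hf.i (ph_int k m) ((ph_cont k m).comp (by fun_prop : Continuous fun y => x - y)).aestronglyMeasurable (fun y => ph_bd' k m _),
    ← integral_sub_left_eq_self _ volume x]
  congr 1; ext t; congr 1
  have h := Measure.integral_comp_mul_left (fun v => phi v * phi (8^k * t - v)) ((8:ℝ)^k)
  rw [abs_inv, abs_of_pos (e8 k)] at h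
  have h8 := (e8 k).ne'
  have h8' : ((8:ℝ)^k : ℂ) ≠ 0 := by exact_mod_cast h8
  have e : Ph (8^k * t) = (8^k : ℝ) • ∫ v, phi (8^k * v) * phi (8^k * t - 8^k * v) := by
    rw [h, smul_smul, mul_inv_cancel₀ h8, one_smul]; rfl
  unfold sc
  rw [e, ← integral_add_right_eq_self _ (x - t), Complex.real_smul, ← integral_const_mul, ← integral_const_mul, ← integral_mul_const]
  congr 1; ext v
  unfold ph sc
  have h1 : v + (x - t) - (x - t) = v := by ring
  have h2 : x - (v + (x - t)) = t - v := by ring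
  rw [h1, h2]
  have h3 : (m:ℝ) * 8^k * t = m * 8^k * v + m * 8^k * (t - v) := by ring
  rw [h3, ee_add, mul_sub]; ring
def m0 (k : ℤ) (ξ : ℝ) : ℤ := ⌊(8:ℝ)^(-k) * ξ⌋
def TK (f : ℝ → ℂ) (N : ℝ → ℝ) (S : Finset ℤ) (x : ℝ) : ℂ :=
  ∑ k ∈ S, if N x ∈ om2 k (m0 k (N x)) then ∫ t, f (x - t) * sc Ph k (m0 k (N x)) t else 0
lemma Psi_sum {f : ℝ → ℂ} (hf : Nice f) (k m : ℤ) (x : ℝ) :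
    HasSum (fun n : ℤ => Psi f (k, n, m) x) (∫ t, f (x - t) * sc Ph k m t) := by
  rw [← Fw_ph hf]
  have hU : (⋃ n : ℤ, II k n) = univ := by
    ext y; simp only [mem_iUnion, mem_univ, iff_true]; exact ⟨_, self_II k y⟩
  have hi : Integrable (fun y => Fw f k m y * ph k m (x - y)) :=
    Integrable.mul_bdd (c := Cp * 8^k) (Fw_int hf.i k m) ((ph_cont k m).comp (by fun_prop : Continuous fun y => x - y)).aestronglyMeasurable
      (ae_of_all _ fun y => ph_bd' _ _ _)
  have h := hasSum_integral_iUnion (f := fun y => Fw f k m y * ph k m (x - y)) (μ := volume) (fun n : ℤ => II_meas k n) (by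
    intro a b hab
    exact Set.disjoint_left.2 fun y hy hy' => hab (II_disj hy hy')) (by rw [hU]; exact hi.integrableOn)
  rw [hU, setIntegral_univ] at h
  simp only [Psi_eq]; exact h
def SL (S : Finset ℤ) (L : ℕ) : Finset Tile := S ×ˢ (Finset.Icc (-(L:ℤ)) L ×ˢ Finset.Icc (-(L:ℤ)) L)
lemma TT_lim {f : ℝ → ℂ} (hf : Nice f) (N : ℝ → ℝ) (S : Finset ℤ) (x : ℝ) :
    Tendsto (fun L => TT f N (SL S L) x) atTop (𝓝 (TK f N S x)) := by
  have e : ∀ L, TT f N (SL S L) x = ∑ k ∈ S, ∑ n ∈ Finset.Icc (-(L:ℤ)) L, ∑ m ∈ Finset.Icc (-(L:ℤ)) L,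
      if N x ∈ om2 k m then Psi f (k, n, m) x else 0 := by
    intro L; unfold TT SL; rw [Finset.sum_product]; refine Finset.sum_congr rfl fun k _ => ?_
    rw [Finset.sum_product]
  simp only [e]
  unfold TK
  refine tendsto_finsetSum _ fun k _ => ?_
  set m := m0 k (N x) with hm
  have h1 : Tendsto (fun L : ℕ => ∑ n ∈ Finset.Icc (-(L:ℤ)) L, if N x ∈ om2 k m then Psi f (k, n, m) x else 0) atTop
      (𝓝 (if N x ∈ om2 k m then ∫ t, f (x - t) * sc Ph k m t else 0)) := by
    split_ifs with h
    · exact (Psi_sum hf k m x).comp Finset.tendsto_Icc_neg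
    · simp
  refine h1.congr' ?_
  filter_upwards [eventually_ge_atTop m.natAbs] with L hL
  refine Finset.sum_congr rfl fun n _ => ?_
  have hmL : m ∈ Finset.Icc (-(L:ℤ)) L := Finset.mem_Icc.2 ⟨by omega, by omega⟩
  symm; refine Finset.sum_eq_single_of_mem m hmL fun m' _ hne => ?_
  rw [if_neg]
  intro h
  exact hne (II_disj (om2_sub _ _ h) (self_II (-k) (N x)))
theorem model3 : ∃ C : ℝ, 0 < C ∧ ∀ f, Nice f → ∀ N, Measurable N → ∀ S : Finset ℤ,
    ∫⁻ x, ‖TK f N S x‖ₑ ^ 2 ≤ ENNReal.ofReal C * ∫⁻ x, ‖f x‖ₑ ^ 2 := by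
  obtain ⟨C, hC, h⟩ := model2
  refine ⟨C, hC, fun f hf N hN S => ?_⟩
  have hl : ∀ x, ‖TK f N S x‖ₑ ^ 2 = liminf (fun L => ‖TT f N (SL S L) x‖ₑ ^ 2) atTop := fun x =>
    (((ENNReal.continuous_pow 2).tendsto _).comp (TT_lim hf N S x).enorm).liminf_eq.symm
  simp only [hl]
  refine (lintegral_liminf_le fun L => (TT_meas hf hN _).enorm.pow_const 2).trans ?_
  exact (liminf_le_of_frequently_le' (Frequently.of_forall fun L => h f hf N hN (SL S L)))
end Carl
end
noncomputable section
namespace Carl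
open Classical
def bb (η s : ℝ) : ℂ := if 1/2 ≤ Int.fract η then ee (-(Int.fract η * s)) else 0
lemma bb_meas : Measurable (fun p : ℝ × ℝ => bb p.1 p.2) := by
  unfold bb
  exact Measurable.ite (measurableSet_le measurable_const (measurable_fract.comp measurable_fst))
    (ee_meas.comp ((measurable_fract.comp measurable_fst).mul measurable_snd).neg) measurable_const
lemma bb_norm (η s : ℝ) : ‖bb η s‖ ≤ 1 := by
  unfold bb; split_ifs
  · rw [ee_norm]
  · simp
def Dk (k : ℤ) (α l ν t : ℝ) : ℂ := ((8^k / l^2 : ℝ) : ℂ) * (Ph (8^k * t / l) * bb (8^(-k) * (l * ν + α)) (8^k * t / l))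
def Bk (k : ℤ) (t : ℝ) : ℝ := 8^k * (4 * Cp^2 * W (8^k / 8 * t) ^ 18)
lemma Bk_int (k : ℤ) : Integrable (Bk k) := by
  have h8 := e8 k
  have := intWa (p := 18) (by norm_num) (a := 8^k / 8) (by positivity) 0
  simp only [sub_zero] at this
  exact (this.const_mul _).const_mul _
lemma K_bd {k : ℤ} {l t : ℝ} (hl : 1 ≤ l) (hl8 : l ≤ 8) {z : ℂ} (hz : ‖z‖ ≤ 1) :
    ‖((8^k / l^2 : ℝ) : ℂ) * (Ph (8^k * t / l) * z)‖ ≤ Bk k t := by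
  have h8 := e8 k
  have hl0 : 0 < l := by linarith
  rw [norm_mul, norm_mul, Complex.norm_real, Real.norm_of_nonneg (by positivity)]
  unfold Bk
  have h1 : 8^k / l^2 ≤ (8:ℝ)^k := div_le_self h8.le (by nlinarith)
  have h2 : W (8^k * t / l) ≤ W (8^k / 8 * t) := by
    apply W_anti
    rw [mul_div_right_comm, abs_mul, abs_mul, abs_of_pos (div_pos h8 hl0), abs_of_pos (by positivity)]
    refine mul_le_mul_of_nonneg_right (div_le_div_of_nonneg_left h8.le hl0 hl8) (abs_nonneg _)
  have h3 : W (8^k * t / l) ^ 18 ≤ W (8^k / 8 * t) ^ 18 := pow_le_pow_left₀ (W_nn _) h2 _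
  refine mul_le_mul h1 ?_ (by positivity) h8.le
  have hC := sq_nonneg Cp
  have h4 := (Ph_bd (8^k * t / l)).trans (mul_le_mul_of_nonneg_left h3 (by linarith))
  exact (mul_le_of_le_one_right (norm_nonneg _) hz).trans h4
lemma Dk_meas (k : ℤ) : Measurable (fun q : ℝ × ℝ × ℝ × ℝ => Dk k q.1 q.2.1 q.2.2.1 q.2.2.2) := by
  unfold Dk
  have hP := Ph_cont.measurable
  have hb := bb_meas
  refine Measurable.mul (by fun_prop) (Measurable.mul (hP.comp (by fun_prop)) ?_)
  exact hb.comp (Measurable.prodMk (by fun_prop) (by fun_prop))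
theorem model4 : ∃ C : ℝ, 0 < C ∧ ∀ f, Nice f → ∀ N, Measurable N → ∀ S : Finset ℤ, ∀ α l : ℝ, 1 ≤ l → l ≤ 8 →
    ∫⁻ x, ‖∫ t, f (x - t) * (ee (N x * t) * ∑ k ∈ S, Dk k α l (N x) t)‖ₑ ^ 2 ≤ ENNReal.ofReal C * ∫⁻ x, ‖f x‖ₑ ^ 2 := by
  obtain ⟨C, hC, h⟩ := model3
  refine ⟨C, hC, fun f hf N hN S α l hl hl8 => ?_⟩
  have hl0 : 0 < l := by linarith
  obtain ⟨M, hM⟩ := hf.b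
  set f' : ℝ → ℂ := fun y => ee (α * y) * f (l * y) with hf'
  set N' : ℝ → ℝ := fun x => l * N (l * x) + α with hN'
  have hfm := hf.m
  have nf : Nice f' := by
    refine ⟨(ee_meas.comp (by fun_prop)).mul (by fun_prop), ?_, M, fun y => by rw [hf', norm_mul, ee_norm, one_mul]; exact hM _⟩
    exact Integrable.bdd_mul (c := 1) (hf.i.comp_mul_left' hl0.ne') (ee_meas.comp (by fun_prop)).aestronglyMeasurable (ae_of_all _ fun y => (ee_norm _).le)
  set Φ : ℝ → ℂ := fun x => ∫ t, f (x - t) * (ee (N x * t) * ∑ k ∈ S, Dk k α l (N x) t) with hΦ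
  have key : ∀ x, TK f' N' S x = (l:ℂ) * (ee (α * x) * Φ (l * x)) := by
    intro x
    have hi : ∀ k ∈ S, Integrable (fun t => f (l * x - t) * (ee (N (l * x) * t) * Dk k α l (N (l * x)) t)) := by
      intro k _
      refine Integrable.bdd_mul (c := M) ?_ (hfm.comp (by fun_prop)).aestronglyMeasurable (ae_of_all _ fun y => hM _)
      refine Integrable.bdd_mul (c := 1) ?_ (ee_meas.comp (by fun_prop)).aestronglyMeasurable (ae_of_all _ fun y => (ee_norm _).le)
      refine (Bk_int k).mono' ((Dk_meas k).comp (f := fun t : ℝ => (α, l, N (l * x), t)) (by fun_prop)).aestronglyMeasurable (ae_of_all _ fun t => ?_)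
      exact K_bd hl hl8 (bb_norm _ _)
    rw [hΦ]; dsimp only
    simp only [Finset.mul_sum]
    rw [integral_finsetSum _ hi, Finset.mul_sum, Finset.mul_sum]
    unfold TK
    refine Finset.sum_congr rfl fun k _ => ?_
    set η := 8^(-k) * N' x with hη
    have hc : N' x ∈ om2 k (m0 k (N' x)) ↔ 1/2 ≤ Int.fract η := by
      have : nu (-k) (m0 k (N' x)) (N' x) = Int.fract η := rfl
      unfold om2; rw [mem_ofPred_eq, this]
      exact ⟨fun h => h.2, fun h => ⟨self_II _ _, h⟩⟩
    by_cases hp : 1/2 ≤ Int.fract η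
    · rw [if_pos (hc.2 hp)]
      have h1 := Measure.integral_comp_mul_left (fun t => f (l * x - t) * (ee (N (l * x) * t) * Dk k α l (N (l * x)) t)) l
      rw [abs_of_pos (inv_pos.2 hl0)] at h1
      have h2 := congrArg (fun z => (l:ℝ) • z) h1
      beta_reduce at h2
      rw [smul_smul, mul_inv_cancel₀ hl0.ne', one_smul] at h2
      rw [← h2, Complex.real_smul, ← integral_const_mul, ← integral_const_mul, ← integral_const_mul]
      congr 1; ext t
      have e1 : 8^k * (l * t) / l = 8^k * t := by field_simp
      simp only [hf', Dk, bb]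
      rw [show (8:ℝ)^(-k) * (l * N (l * x) + α) = η from rfl, if_pos hp, e1]
      unfold sc
      have e2 : (m0 k (N' x) : ℝ) = η - Int.fract η := by rw [Int.self_sub_fract]; rfl
      have e3 : α * (x - t) + (m0 k (N' x) : ℝ) * 8^k * t = α * x + N (l * x) * (l * t) + -(Int.fract η * (8^k * t)) := by
        rw [e2, hη, hN']; dsimp only; linear_combination ((l * N (l * x) + α) * t) * e8_neg k
      have e4 := congrArg ee e3
      rw [ee_add, ee_add, ee_add] at e4
      rw [mul_sub l]
      have hl' : (l:ℂ) ≠ 0 := by exact_mod_cast hl0.ne'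
      push_cast
      have e5 : (l:ℂ) * l * (8^k / l^2) = 8^k := by field_simp
      linear_combination ((8^k:ℂ) * Ph (8^k * t) * f (l * x - l * t)) * e4 - (Ph (8^k * t) * f (l * x - l * t) * (ee (α * x) * ee (N (l * x) * (l * t)) * ee (-(Int.fract η * (8^k * t))))) * e5
    · rw [if_neg (mt hc.1 hp)]
      have : ∀ t, Dk k α l (N (l * x)) t = 0 := fun t => by
        unfold Dk bb; rw [show (8:ℝ)^(-k) * (l * N (l * x) + α) = η from rfl, if_neg hp]; simp
      simp [this]
  have sub : ∀ g : ℝ → ℝ≥0∞, ∫⁻ x, g (l * x) = ENNReal.ofReal l⁻¹ * ∫⁻ x, g x := by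
    intro g
    have := lintegral_map_equiv (μ := volume) g (Homeomorph.mulLeft₀ l hl0.ne').toMeasurableEquiv
    have e : Measure.map (Homeomorph.mulLeft₀ l hl0.ne').toMeasurableEquiv volume = ENNReal.ofReal |l⁻¹| • (volume : Measure ℝ) :=
      Real.map_volume_mul_left hl0.ne'
    rw [e, lintegral_smul_measure, abs_of_pos (inv_pos.2 hl0)] at this
    exact this.symm
  have h0 := h f' nf N' (by fun_prop) S
  have h1 : ∫⁻ x, ‖f' x‖ₑ ^ 2 = ENNReal.ofReal l⁻¹ * ∫⁻ x, ‖f x‖ₑ ^ 2 := by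
    rw [← sub fun x => ‖f x‖ₑ ^ 2]
    refine lintegral_congr fun x => ?_
    rw [hf', enorm_mul, ← ofReal_norm (ee _), ee_norm, ENNReal.ofReal_one, one_mul]
  have h2 : ENNReal.ofReal l⁻¹ * ∫⁻ x, ‖Φ x‖ₑ ^ 2 ≤ ∫⁻ x, ‖TK f' N' S x‖ₑ ^ 2 := by
    rw [← sub fun x => ‖Φ x‖ₑ ^ 2]
    refine lintegral_mono fun x => ?_
    dsimp only
    rw [key, enorm_mul, enorm_mul, ← ofReal_norm (ee _), ee_norm, ENNReal.ofReal_one, one_mul]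
    gcongr
    refine le_mul_of_one_le_left (zero_le) ?_
    rw [← ofReal_norm, Complex.norm_real, Real.norm_of_nonneg hl0.le]; exact ENNReal.one_le_ofReal.2 hl
  rw [h1] at h0
  have h3 := h2.trans h0
  rw [mul_left_comm] at h3
  exact (ENNReal.mul_le_mul_iff_right (by simpa using hl0) (by finiteness)).1 h3
lemma csP (P : Measure ℝ) {f : ℝ → ℝ≥0∞} (hf : AEMeasurable f P) : (∫⁻ x, f x ∂P) ^ 2 ≤ P univ * ∫⁻ x, f x ^ 2 ∂P := by
  have h := ENNReal.lintegral_mul_le_Lp_mul_Lq P (Real.HolderConjugate.two_two) (aemeasurable_const (b := 1)) hf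
  have h2 := pow_le_pow_left' h 2
  simp only [Pi.mul_apply, one_mul] at h2
  refine h2.trans (le_of_eq ?_)
  rw [mul_pow, ← ENNReal.rpow_natCast, ← ENNReal.rpow_natCast, ← ENNReal.rpow_mul, ← ENNReal.rpow_mul]
  norm_num
lemma avg {f : ℝ → ℂ} (hf : Nice f) (P : Measure ℝ) [IsFiniteMeasure P] {k : ℝ → ℝ → ℝ → ℂ}
    (hk : Measurable fun q : ℝ × ℝ × ℝ => k q.1 q.2.1 q.2.2) {B : ℝ → ℝ} (hB : Integrable B)
    (hkB : ∀ᵐ p ∂P, ∀ x t, ‖k p x t‖ ≤ B t) {A : ℝ≥0∞} (hA : ∀ᵐ p ∂P, ∫⁻ x, ‖∫ t, f (x - t) * k p x t‖ₑ ^ 2 ≤ A) :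
    ∫⁻ x, ‖∫ t, f (x - t) * ∫ p, k p x t ∂P‖ₑ ^ 2 ≤ P univ ^ 2 * A := by
  obtain ⟨M, hM⟩ := hf.b
  have hfm := hf.m
  have hE : Measurable (fun q : ℝ × ℝ => ∫ t, f (q.2 - t) * k q.1 q.2 t) := by
    have : StronglyMeasurable (fun q : (ℝ × ℝ) × ℝ => f (q.1.2 - q.2) * k q.1.1 q.1.2 q.2) :=
      (Measurable.mul (hfm.comp (by fun_prop)) (hk.comp (f := fun q : (ℝ × ℝ) × ℝ => (q.1.1, q.1.2, q.2)) (by fun_prop))).stronglyMeasurable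
    exact this.integral_prod_right'.measurable
  have h1 : ∀ x, ‖∫ t, f (x - t) * ∫ p, k p x t ∂P‖ₑ ^ 2 ≤ P univ * ∫⁻ p, ‖∫ t, f (x - t) * k p x t‖ₑ ^ 2 ∂P := by
    intro x
    have hi : Integrable (fun q : ℝ × ℝ => f (x - q.2) * k q.1 x q.2) (P.prod volume) := by
      have h0 : Integrable (fun q : ℝ × ℝ => (1:ℝ) * (M * B q.2)) (P.prod volume) := (integrable_const (1:ℝ)).mul_prod (hB.const_mul M)
      refine h0.mono' (Measurable.mul (hfm.comp (by fun_prop)) (hk.comp (f := fun q : ℝ × ℝ => (q.1, x, q.2)) (by fun_prop))).aestronglyMeasurable ?_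
      filter_upwards [Measure.quasiMeasurePreserving_fst.ae hkB] with q hq
      rw [norm_mul, one_mul]
      exact mul_le_mul (hM _) (hq x _) (norm_nonneg _) ((norm_nonneg _).trans (hM 0))
    have e : ∫ t, f (x - t) * ∫ p, k p x t ∂P = ∫ p, (∫ t, f (x - t) * k p x t) ∂P := by
      refine Eq.trans ?_ (integral_integral_swap hi).symm; simp only [integral_const_mul]
    rw [e]
    refine (pow_le_pow_left' (enorm_integral_le_lintegral_enorm _) 2).trans ?_
    exact csP P (hE.comp (f := fun p => (p, x)) (by fun_prop)).enorm.aemeasurable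
  refine (lintegral_mono h1).trans ?_
  rw [lintegral_const_mul' _ _ (measure_ne_top _ _), pow_two, mul_assoc]
  refine mul_le_mul_right ?_ _
  rw [lintegral_lintegral_swap]
  · refine (lintegral_mono_ae hA).trans ?_
    rw [lintegral_const, mul_comm]
  · exact ((hE.comp (f := fun q : ℝ × ℝ => (q.2, q.1)) (by fun_prop)).enorm.pow_const 2).aemeasurable
end Carl
end
noncomputable section
namespace Carl
open Classical
def be (s : ℝ) : ℂ := ∫ η in (0:ℝ)..1, bb η s
def th (s : ℝ) : ℂ := Ph s * be s
def GG (r : ℝ) : ℂ := ∫ s in (0:ℝ)..r, th s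
def kap (K : ℕ) (t : ℝ) : ℂ := (GG (8^(K:ℤ) * t) - GG (8^(-(K:ℤ)-1) * t)) / t
lemma be_eq (s : ℝ) : be s = ∫ v in (1/2:ℝ)..1, ee (-(v * s)) := by
  have hi : ∀ a b, IntervalIntegrable (fun v => bb v s) volume a b := fun a b =>
    (intervalIntegrable_const (c := (1:ℝ))).mono_fun (bb_meas.comp (f := fun v => (v, s)) (by fun_prop)).aestronglyMeasurable
      (ae_of_all _ fun v => by simpa using bb_norm v s)
  unfold be
  rw [← intervalIntegral.integral_add_adjacent_intervals (hi 0 (1/2)) (hi _ _)]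
  have h1 : ∫ v in (0:ℝ)..1/2, bb v s = 0 := by
    rw [intervalIntegral.integral_of_le (by norm_num), ← integral_Ico_eq_integral_Ioc, ← integral_zero ℝ ℂ (μ := volume.restrict (Ico (0:ℝ) (1/2)))]
    refine setIntegral_congr_fun measurableSet_Ico fun v hv => ?_
    have := Int.fract_eq_self.2 ⟨hv.1, hv.2.trans (by norm_num)⟩
    simp only [bb, this]; rw [if_neg (not_le.2 hv.2)]
  rw [h1, zero_add, intervalIntegral.integral_of_le (by norm_num), intervalIntegral.integral_of_le (by norm_num),
    ← integral_Ico_eq_integral_Ioc, ← integral_Ico_eq_integral_Ioc]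
  refine setIntegral_congr_fun measurableSet_Ico fun v hv => ?_
  have := Int.fract_eq_self.2 ⟨(by norm_num : (0:ℝ) ≤ 1/2).trans hv.1, hv.2⟩
  simp only [bb, this]; rw [if_pos hv.1]
lemma be_norm (s : ℝ) : ‖be s‖ ≤ 1 := by
  refine (intervalIntegral.norm_integral_le_of_norm_le_const (C := 1) fun v _ => bb_norm v s).trans (by norm_num)
lemma be_cont : Continuous be := by
  have : be = fun s => ∫ v in (1/2:ℝ)..1, ee (-(v * s)) := funext be_eq
  rw [this]
  exact intervalIntegral.continuous_parametric_intervalIntegral_of_continuous' (by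
    exact ee_cont.comp (by fun_prop : Continuous fun p : ℝ × ℝ => -(p.2 * p.1))) _ _
lemma th_cont : Continuous th := Ph_cont.mul be_cont
lemma th_bd (s : ℝ) : ‖th s‖ ≤ 4 * Cp^2 * W s ^ 18 := by
  unfold th; rw [norm_mul]; exact (mul_le_of_le_one_right (norm_nonneg _) (be_norm s)).trans (Ph_bd s)
lemma th_int : Integrable th :=
  ((intW (p := 18) (by norm_num)).const_mul (4 * Cp^2)).mono' th_cont.aestronglyMeasurable (ae_of_all _ th_bd)
lemma GG_deriv (r : ℝ) : HasDerivAt GG (th r) r := (th_cont.integral_hasStrictDerivAt 0 r).hasDerivAt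
lemma GG_cont : Continuous GG := continuous_iff_continuousAt.2 fun r => (GG_deriv r).continuousAt
lemma bb_avg {k : ℤ} {K : ℕ} (hk : k ≤ K) (c s : ℝ) :
    ∫ α in Ioc (0:ℝ) (8^K), bb (8^(-k) * (c + α)) s = (8^K : ℝ) * be s := by
  obtain ⟨j, hj⟩ := Int.le.dest hk
  have hP : Function.Periodic (fun η => bb η s) 1 := fun η => by simp only [bb, Int.fract_add_one]
  have hi : ∀ a b, IntervalIntegrable (fun v => bb v s) volume a b := fun a b =>
    (intervalIntegrable_const (c := (1:ℝ))).mono_fun (bb_meas.comp (f := fun v => (v, s)) (by fun_prop)).aestronglyMeasurable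
      (ae_of_all _ fun v => by simpa using bb_norm v s)
  have h8 := (e8 (-k)).ne'
  have e8K : (8:ℝ)^(-k) * 8^K = 8^j := by
    rw [← zpow_natCast, ← zpow_natCast, ← e8_add]; congr 1; omega
  rw [← intervalIntegral.integral_of_le (by positivity)]
  have h := intervalIntegral.integral_comp_add_mul (fun η => bb η s) h8 (8^(-k) * c) (a := 0) (b := 8^K)
  simp only [mul_add]
  rw [h, mul_zero, add_zero, e8K]
  have h2 := hP.intervalIntegral_add_zsmul_eq ((8^j : ℕ) : ℤ) (8^(-k) * c) hi
  rw [hP.intervalIntegral_add_eq _ 0, zero_add] at h2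
  have e : (((8^j : ℕ) : ℤ) • (1:ℝ)) = 8^j := by simp
  rw [e] at h2
  rw [h2, Complex.real_smul]
  unfold be
  rw [zsmul_eq_mul, ← mul_assoc]
  congr 1
  have : ((8:ℝ)^(-k))⁻¹ * 8^j = 8^K := by rw [← e8K, inv_mul_cancel_left₀ h8]
  exact_mod_cast this
def Ek (k : ℤ) (l t : ℝ) : ℂ := ((8^k / l^2 : ℝ) : ℂ) * (Ph (8^k * t / l) * be (8^k * t / l))
lemma Ek_meas (k : ℤ) : Measurable (fun q : ℝ × ℝ => Ek k q.1 q.2) := by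
  unfold Ek
  have h1 := Ph_cont.measurable
  have h2 := be_cont.measurable
  exact Measurable.mul (by fun_prop) (Measurable.mul (h1.comp (by fun_prop)) (h2.comp (by fun_prop)))
lemma Ek_avg (k : ℤ) {t : ℝ} (ht : t ≠ 0) : ∫ l in Ioc (1:ℝ) 8, Ek k l t = (GG (8^k * t) - GG (8^(k-1) * t)) / t := by
  rw [← intervalIntegral.integral_of_le (by norm_num)]
  have ht' : (t:ℂ) ≠ 0 := by exact_mod_cast ht
  have hd : ∀ l ∈ uIcc (1:ℝ) 8, HasDerivAt (fun l => -GG (8^k * t / l) / t) (Ek k l t) l := by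
    intro l hl
    rw [uIcc_of_le (by norm_num)] at hl
    have hl0 : l ≠ 0 := by linarith [hl.1]
    have h1 : HasDerivAt (fun l => 8^k * t / l) (-(8^k * t) / l^2) l := by
      have := (hasDerivAt_inv hl0).const_mul (8^k * t)
      refine this.congr_deriv ?_; ring
    have h2 := (((GG_deriv (8^k * t / l)).scomp l h1).neg).div_const (t:ℂ)
    refine h2.congr_deriv ?_
    unfold Ek th
    rw [Complex.real_smul]
    have hl' : (l:ℂ) ≠ 0 := by exact_mod_cast hl0
    push_cast; field_simp
  have hc : ContinuousOn (fun l => Ek k l t) (uIcc (1:ℝ) 8) := by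
    intro l hl
    rw [uIcc_of_le (by norm_num)] at hl
    have hl0 : l ≠ 0 := by linarith [hl.1]
    have hA : ContinuousAt (fun l : ℝ => 8^k * t / l) l := by fun_prop (disch := assumption)
    refine ContinuousAt.continuousWithinAt ?_
    refine ContinuousAt.mul ?_ (ContinuousAt.mul (Ph_cont.continuousAt.comp hA) (be_cont.continuousAt.comp hA))
    exact Complex.continuous_ofReal.continuousAt.comp (by fun_prop (disch := simpa using hl0))
  rw [intervalIntegral.integral_eq_sub_of_hasDerivAt hd hc.intervalIntegrable]
  have : (8:ℝ)^k * t / 8 = 8^(k-1) * t := by rw [zpow_sub_one₀ (by norm_num)]; ring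
  rw [this, div_one]; ring
def Sc (K : ℕ) : Finset ℤ := (Finset.range (2*K+1)).image (fun i : ℕ => (i:ℤ) - K)
lemma Sc_le {K : ℕ} {k : ℤ} (h : k ∈ Sc K) : k ≤ K := by
  unfold Sc at h; rw [Finset.mem_image] at h; obtain ⟨i, hi, rfl⟩ := h; rw [Finset.mem_range] at hi; omega
lemma Ek_bd {k : ℤ} {l : ℝ} (hl : l ∈ Ioc (1:ℝ) 8) (t : ℝ) : ‖Ek k l t‖ ≤ Bk k t := K_bd hl.1.le hl.2 (be_norm _)
lemma Ek_int (k : ℤ) (t : ℝ) : IntegrableOn (fun l => Ek k l t) (Ioc (1:ℝ) 8) := by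
  refine Integrable.mono' (g := fun _ => Bk k t) (integrable_const _) ((Ek_meas k).comp (f := fun l : ℝ => (l, t)) (by fun_prop)).aestronglyMeasurable ?_
  rw [ae_restrict_iff' measurableSet_Ioc]
  exact ae_of_all _ fun l hl => Ek_bd hl t
lemma kap_eq (K : ℕ) {t : ℝ} (ht : t ≠ 0) : ∫ l in Ioc (1:ℝ) 8, ∑ k ∈ Sc K, Ek k l t = kap K t := by
  rw [integral_finsetSum _ fun k _ => Ek_int k t]
  simp only [Ek_avg _ ht]
  unfold Sc
  rw [Finset.sum_image (by intro a _ b _ h; dsimp only at h; omega), ← Finset.sum_div]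
  unfold kap
  congr 1
  have := Finset.sum_range_sub (fun i : ℕ => GG (8^((i:ℤ) - K - 1) * t)) (2*K+1)
  push_cast at this
  simp only [add_sub_right_comm _ (1:ℤ), sub_add_cancel] at this
  rw [this]
  congr 4
  · ring
  · ring
lemma kap_bd (K : ℕ) {t : ℝ} (ht : t ≠ 0) : ‖kap K t‖ ≤ 7 * ∑ k ∈ Sc K, Bk k t := by
  rw [← kap_eq K ht]
  refine (norm_setIntegral_le_of_norm_le_const (C := ∑ k ∈ Sc K, Bk k t) (by simp) fun l hl => ?_).trans (le_of_eq ?_)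
  · exact (norm_sum_le _ _).trans (Finset.sum_le_sum fun k _ => Ek_bd hl t)
  · rw [mul_comm]; norm_num
lemma kap_meas (K : ℕ) : Measurable (kap K) := by
  unfold kap
  have := GG_cont.measurable
  exact Measurable.div ((this.comp (by fun_prop)).sub (this.comp (by fun_prop))) (by fun_prop)
lemma ae_ne (a : ℝ) : ∀ᵐ t : ℝ, t ≠ a := by
  rw [ae_iff]; simp
lemma kap_int (K : ℕ) : Integrable (kap K) := by
  refine ((integrable_finsetSum (Sc K) fun k _ => Bk_int k).const_mul 7).mono' (kap_meas K).aestronglyMeasurable ?_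
  filter_upwards [ae_ne 0] with t ht
  exact kap_bd K ht
theorem oneD : ∃ C : ℝ, 0 < C ∧ ∀ f, Nice f → ∀ N, Measurable N → ∀ K : ℕ,
    ∫⁻ x, ‖∫ t, f (x - t) * (ee (N x * t) * kap K t)‖ₑ ^ 2 ≤ ENNReal.ofReal C * ∫⁻ x, ‖f x‖ₑ ^ 2 := by
  obtain ⟨C, hC, h⟩ := model4
  refine ⟨49 * C, by positivity, fun f hf N hN K => ?_⟩
  have hB : Integrable (fun t => ∑ k ∈ Sc K, Bk k t) := integrable_finsetSum (Sc K) fun k _ => Bk_int k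
  have nee : ∀ x t : ℝ, ∀ z : ℂ, ‖ee (N x * t) * z‖ = ‖z‖ := fun x t z => by rw [norm_mul, ee_norm, one_mul]
  have m1 : ∀ l : ℝ, Measurable (fun q : ℝ × ℝ × ℝ => ee (N q.2.1 * q.2.2) * ∑ k ∈ Sc K, Dk k q.1 l (N q.2.1) q.2.2) := fun l =>
    (ee_meas.comp (by fun_prop)).mul (Finset.measurable_fun_sum _ fun k _ =>
      (Dk_meas k).comp (f := fun q : ℝ × ℝ × ℝ => (q.1, l, N q.2.1, q.2.2)) (by fun_prop))
  have h1 : ∀ l ∈ Ioc (1:ℝ) 8, ∫⁻ x, ‖∫ t, f (x - t) * (ee (N x * t) * ∑ k ∈ Sc K, Ek k l t)‖ₑ ^ 2 ≤ ENNReal.ofReal C * ∫⁻ x, ‖f x‖ₑ ^ 2 := by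
    intro l hl
    have h2 := avg hf (volume.restrict (Ioc (0:ℝ) (8^K))) (m1 l) hB
      (ae_of_all _ fun p x t => by
        rw [nee]; exact (norm_sum_le _ _).trans (Finset.sum_le_sum fun k _ => K_bd hl.1.le hl.2 (bb_norm _ _)))
      (ae_of_all _ fun p => h f hf N hN (Sc K) p l hl.1.le hl.2)
    have e : ∀ x t : ℝ, ∫ p in Ioc (0:ℝ) (8^K), ee (N x * t) * ∑ k ∈ Sc K, Dk k p l (N x) t = (8^K : ℝ) * (ee (N x * t) * ∑ k ∈ Sc K, Ek k l t) := by
      intro x t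
      rw [integral_const_mul, integral_finsetSum]
      · rw [Finset.mul_sum, Finset.mul_sum, Finset.mul_sum]
        refine Finset.sum_congr rfl fun k hk => ?_
        unfold Dk Ek
        rw [integral_const_mul, integral_const_mul, bb_avg (Sc_le hk)]
        ring
      · intro k _
        refine Integrable.mono' (g := fun _ => Bk k t) (integrable_const _) ((Dk_meas k).comp (f := fun p : ℝ => (p, l, N x, t)) (by fun_prop)).aestronglyMeasurable
          (ae_of_all _ fun p => K_bd hl.1.le hl.2 (bb_norm _ _))
    simp only [e] at h2
    have e2 : ∀ x, ‖∫ t, f (x - t) * ((8^K : ℝ) * (ee (N x * t) * ∑ k ∈ Sc K, Ek k l t))‖ₑ ^ 2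
        = ENNReal.ofReal (8^K) ^ 2 * ‖∫ t, f (x - t) * (ee (N x * t) * ∑ k ∈ Sc K, Ek k l t)‖ₑ ^ 2 := by
      intro x
      simp only [mul_left_comm (f _) (((8^K : ℝ) : ℂ))]
      rw [integral_const_mul, enorm_mul, mul_pow, ← ofReal_norm ((8^K : ℝ) : ℂ), Complex.norm_real, Real.norm_of_nonneg (by positivity)]
    simp only [e2] at h2
    rw [lintegral_const_mul' _ _ (by finiteness), Measure.restrict_apply_univ, Real.volume_Ioc, sub_zero] at h2
    exact (ENNReal.mul_le_mul_iff_right (by simp) (by finiteness)).1 h2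
  have h3 := avg hf (volume.restrict (Ioc (1:ℝ) 8)) (k := fun l x t => ee (N x * t) * ∑ k ∈ Sc K, Ek k l t)
    ((ee_meas.comp (by fun_prop)).mul (Finset.measurable_fun_sum _ fun k _ =>
      (Ek_meas k).comp (f := fun q : ℝ × ℝ × ℝ => (q.1, q.2.2)) (by fun_prop))) hB
    ((ae_restrict_iff' measurableSet_Ioc).2 (ae_of_all _ fun l hl x t => by
      rw [nee]; exact (norm_sum_le _ _).trans (Finset.sum_le_sum fun k _ => Ek_bd hl t)))
    ((ae_restrict_iff' measurableSet_Ioc).2 (ae_of_all _ h1))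
  have e3 : ∀ x, ∫ t, f (x - t) * ∫ l in Ioc (1:ℝ) 8, ee (N x * t) * ∑ k ∈ Sc K, Ek k l t = ∫ t, f (x - t) * (ee (N x * t) * kap K t) := by
    intro x
    refine integral_congr_ae ?_
    filter_upwards [ae_ne 0] with t ht
    rw [integral_const_mul, kap_eq K ht]
  simp only [e3] at h3
  refine h3.trans (le_of_eq ?_)
  rw [Measure.restrict_apply_univ, Real.volume_Ioc, ← ENNReal.ofReal_pow (by norm_num), ← mul_assoc, ← ENNReal.ofReal_mul (by norm_num)]
  norm_num
end Carl
end
noncomputable section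
namespace Carl
open Classical
def cp : ℂ := ∫ s in Ioi (0:ℝ), th s
def QQm : Measure (ℝ × ℝ) := volume.prod (volume.restrict (Ioc (1/2:ℝ) 1))
instance : SFinite QQm := by unfold QQm; infer_instance
lemma chi2_int : Integrable (fun z => (chi z : ℂ)^2) := by
  have h : Integrable (fun _ : ℝ => (1:ℝ)) (volume.restrict (Icc (0:ℝ) (1/8))) := integrable_const _
  refine Integrable.mono' (g := (Icc (0:ℝ) (1/8)).indicator fun _ => (1:ℝ)) ((integrable_indicator_iff measurableSet_Icc).2 h)
    ((Complex.continuous_ofReal.comp phi_spec.2.2.2.2.2).pow 2).aestronglyMeasurable (ae_of_all _ fun z => ?_)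
  by_cases hz : chi z = 0
  · simp only [hz]; simpa using indicator_nonneg (fun _ _ => zero_le_one) _
  · have := chi_supp hz
    rw [indicator_of_mem (show z ∈ Icc (0:ℝ) (1/8) from ⟨this.1.le, this.2.le⟩), norm_pow, Complex.norm_real, Real.norm_of_nonneg (phi_spec.2.1 z)]
    exact pow_le_one₀ (phi_spec.2.1 z) (phi_spec.2.2.1 z)
lemma chiQ_int : Integrable (fun q : ℝ × ℝ => (chi q.1 : ℂ)^2) QQm := by
  have := chi2_int.mul_prod (integrable_const (1:ℂ) (μ := volume.restrict (Ioc (1/2:ℝ) 1)))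
  simp only [mul_one] at this; exact this
lemma th_Q (s : ℝ) : th s = ∫ q, (chi q.1 : ℂ)^2 * ee (s * (q.1 - q.2)) ∂QQm := by
  unfold th QQm
  rw [Ph_chi, be_eq, intervalIntegral.integral_of_le (by norm_num), ← integral_prod_mul]
  congr 1; ext q
  rw [show s * (q.1 - q.2) = s * q.1 + -(q.2 * s) by ring, ee_add]; ring
lemma th_conj (s : ℝ) : th (-s) = (starRingEnd ℂ) (th s) := by
  rw [th_Q, th_Q, ← integral_conj]
  congr 1; ext q
  rw [map_mul, map_pow, Complex.conj_ofReal, ← ee_neg]; congr 2; ring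
lemma GG_conj (r : ℝ) : GG (-r) = -(starRingEnd ℂ) (GG r) := by
  unfold GG
  have h := intervalIntegral.integral_comp_neg th (a := 0) (b := r)
  simp only [th_conj, neg_zero] at h
  rw [intervalIntegral.integral_symm, ← h]
  congr 1
  rw [intervalIntegral, intervalIntegral, map_sub, integral_conj, integral_conj]
def Aq : ℝ := ∫ q, chi q.1 ^ 2 * (2 * Real.pi * (q.2 - q.1))⁻¹ ∂QQm
lemma Q_ae : ∀ᵐ q ∂QQm, chi q.1 ≠ 0 → 1 ≤ 2 * Real.pi * (q.2 - q.1) ∧ 2 * Real.pi * (q.2 - q.1) ≤ 8 := by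
  have h : ∀ᵐ v ∂(volume.restrict (Ioc (1/2:ℝ) 1)), v ∈ Ioc (1/2:ℝ) 1 := ae_restrict_mem measurableSet_Ioc
  have h2 : ∀ᵐ q ∂QQm, q.2 ∈ Ioc (1/2:ℝ) 1 := Measure.quasiMeasurePreserving_snd.ae h
  filter_upwards [h2] with q hq hc
  have := chi_supp hc
  have := Real.pi_gt_three; have := Real.pi_lt_four
  have := hq.1; have := hq.2
  constructor <;> nlinarith
lemma Aq_pos : 0 < Aq := by
  have hr : Integrable (fun q : ℝ × ℝ => chi q.1 ^ 2) QQm := by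
    have := chiQ_int.re
    refine this.congr (ae_of_all _ fun q => ?_)
    simp [← Complex.ofReal_pow]
  have hc := phi_spec.2.2.2.2.2
  have h1 : ∫ q, chi q.1 ^ 2 * (1/8) ∂QQm ≤ Aq := by
    refine integral_mono_ae (hr.mul_const _) ?_ ?_
    · refine hr.mono (Continuous.measurable (by fun_prop) |>.mul (by fun_prop)).aestronglyMeasurable ?_
      filter_upwards [Q_ae] with q hq
      rw [norm_mul]
      by_cases h : chi q.1 = 0
      · simp [h]
      · refine mul_le_of_le_one_right (norm_nonneg _) ?_
        have := (hq h).1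
        rw [norm_inv, Real.norm_of_nonneg (by linarith)]
        exact inv_le_one_of_one_le₀ this
    · filter_upwards [Q_ae] with q hq
      by_cases h : chi q.1 = 0
      · simp [h]
      · have := hq h
        refine mul_le_mul_of_nonneg_left ?_ (sq_nonneg _)
        rw [one_div]; exact inv_anti₀ (by linarith) this.2
  refine lt_of_lt_of_le ?_ h1
  have e : ∫ q, chi q.1 ^ 2 * (1/8) ∂QQm = (∫ z, chi z ^ 2) * ∫ v in Ioc (1/2:ℝ) 1, (1/8:ℝ) := by
    unfold QQm; exact integral_prod_mul (fun z => chi z ^ 2) (fun _ : ℝ => (1/8:ℝ))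
  rw [e]
  refine mul_pos ?_ (by simp; norm_num)
  refine Continuous.integral_pos_of_hasCompactSupport_nonneg_nonzero (x := 1/16) (by fun_prop) ?_ (fun z => sq_nonneg _) ?_
  · refine HasCompactSupport.of_support_subset_isCompact (isCompact_Icc (a := (0:ℝ)) (b := 1/8)) fun z hz => ?_
    have := chi_supp (x := z) (by intro h; simp [h] at hz)
    exact ⟨this.1.le, this.2.le⟩
  · have := phi_spec.2.2.2.1 (1/16) (by norm_num)
    rw [this]; norm_num
lemma Lap {ε : ℝ} (hε : 0 < ε) : ∫ s in Ioi (0:ℝ), (Real.exp (-(ε * s)) : ℂ) * th s =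
    ∫ q, (chi q.1 : ℂ)^2 * (ε + (2 * Real.pi * (q.2 - q.1) : ℝ) * Complex.I)⁻¹ ∂QQm := by
  have he : IntegrableOn (fun s : ℝ => Real.exp (-(ε * s))) (Ioi 0) := by
    simpa using exp_neg_integrableOn_Ioi 0 hε
  have hi : Integrable (fun p : ℝ × (ℝ × ℝ) => (Real.exp (-(ε * p.1)) : ℂ) * ((chi p.2.1 : ℂ)^2 * ee (p.1 * (p.2.1 - p.2.2))))
      ((volume.restrict (Ioi 0)).prod QQm) := by
    refine (Integrable.mul_bdd (c := 1) (he.ofReal.mul_prod chiQ_int) (g := fun p : ℝ × (ℝ × ℝ) => ee (p.1 * (p.2.1 - p.2.2))) ?_ (ae_of_all _ fun p => (ee_norm _).le)).congr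
      (ae_of_all _ fun p => ?_)
    · exact (ee_cont.comp (by fun_prop)).aestronglyMeasurable
    · simp only [mul_assoc]; rfl
  calc _ = ∫ s in Ioi (0:ℝ), ∫ q, (Real.exp (-(ε * s)) : ℂ) * ((chi q.1 : ℂ)^2 * ee (s * (q.1 - q.2))) ∂QQm := by
        simp only [th_Q, ← integral_const_mul]
    _ = ∫ q, (∫ s in Ioi (0:ℝ), (Real.exp (-(ε * s)) : ℂ) * ((chi q.1 : ℂ)^2 * ee (s * (q.1 - q.2)))) ∂QQm := integral_integral_swap hi
    _ = _ := by
        congr 1; ext q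
        set a : ℂ := -(ε + (2 * Real.pi * (q.2 - q.1) : ℝ) * Complex.I) with ha
        have har : a.re < 0 := by simp [ha, hε]
        have h := integral_exp_mul_complex_Ioi har 0
        have e : ∀ s : ℝ, (Real.exp (-(ε * s)) : ℂ) * ((chi q.1 : ℂ)^2 * ee (s * (q.1 - q.2))) = (chi q.1 : ℂ)^2 * Complex.exp (a * s) := by
          intro s
          unfold ee
          rw [Complex.ofReal_exp, mul_left_comm, ← Complex.exp_add]
          congr 2; rw [ha]; push_cast; ring
        simp only [e]
        rw [integral_const_mul, h]
        simp only [Complex.ofReal_zero, mul_zero, Complex.exp_zero]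
        rw [ha, neg_div_neg_eq, one_div]
lemma cp_eq : cp = -(Aq : ℂ) * Complex.I := by
  have l1 : Tendsto (fun ε : ℝ => ∫ s in Ioi (0:ℝ), (Real.exp (-(ε * s)) : ℂ) * th s) (𝓝[>] 0) (𝓝 cp) := by
    refine tendsto_integral_filter_of_dominated_convergence (fun s => ‖th s‖) ?_ ?_ th_int.norm.integrableOn ?_
    · exact Eventually.of_forall fun ε => (Continuous.mul (by fun_prop) th_cont).aestronglyMeasurable
    · filter_upwards [self_mem_nhdsWithin] with ε hε
      rw [ae_restrict_iff' measurableSet_Ioi]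
      refine ae_of_all _ fun s hs => ?_
      rw [norm_mul, Complex.norm_real, Real.norm_of_nonneg (Real.exp_pos _).le]
      refine mul_le_of_le_one_left (norm_nonneg _) (Real.exp_le_one_iff.2 ?_)
      have := mul_pos (mem_Ioi.1 hε) (mem_Ioi.1 hs); linarith
    · refine ae_of_all _ fun s => ?_
      have : Continuous (fun ε : ℝ => (Real.exp (-(ε * s)) : ℂ) * th s) := by fun_prop
      have h := (this.tendsto 0).mono_left (nhdsWithin_le_nhds (s := Ioi 0))
      simpa using h
  have l2 : Tendsto (fun ε : ℝ => ∫ q, (chi q.1 : ℂ)^2 * (ε + (2 * Real.pi * (q.2 - q.1) : ℝ) * Complex.I)⁻¹ ∂QQm) (𝓝[>] 0)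
      (𝓝 (∫ q, (chi q.1 : ℂ)^2 * ((2 * Real.pi * (q.2 - q.1) : ℝ) * Complex.I)⁻¹ ∂QQm)) := by
    refine tendsto_integral_filter_of_dominated_convergence (fun q => ‖(chi q.1 : ℂ)^2‖) ?_ ?_ chiQ_int.norm ?_
    · have hc := phi_spec.2.2.2.2.2.measurable
      exact Eventually.of_forall fun ε => (by fun_prop : Measurable _).aestronglyMeasurable
    · refine Eventually.of_forall fun ε => ?_
      filter_upwards [Q_ae] with q hq
      by_cases h : chi q.1 = 0
      · simp [h]
      · rw [norm_mul]
        refine mul_le_of_le_one_right (norm_nonneg _) ?_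
        rw [norm_inv]
        refine inv_le_one_of_one_le₀ ((hq h).1.trans ?_)
        have := Complex.abs_im_le_norm (ε + (2 * Real.pi * (q.2 - q.1) : ℝ) * Complex.I)
        refine (le_abs_self _).trans (le_trans (le_of_eq ?_) this)
        simp
    · filter_upwards [Q_ae] with q hq
      by_cases h : chi q.1 = 0
      · simp [h]
      · have h0 : ((2 * Real.pi * (q.2 - q.1) : ℝ) : ℂ) * Complex.I ≠ 0 :=
          mul_ne_zero (by exact_mod_cast (one_pos.trans_le (hq h).1).ne') Complex.I_ne_zero
        have hc : ContinuousAt (fun ε : ℝ => (chi q.1 : ℂ)^2 * (ε + (2 * Real.pi * (q.2 - q.1) : ℝ) * Complex.I)⁻¹) 0 := by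
          refine continuousAt_const.mul (ContinuousAt.inv₀ (by fun_prop) (by simpa using h0))
        have := hc.tendsto.mono_left (nhdsWithin_le_nhds (s := Ioi 0))
        simpa using this
  have l3 := tendsto_nhds_unique (l1.congr' (by filter_upwards [self_mem_nhdsWithin] with ε hε using Lap hε)) l2
  rw [l3, Aq, ← integral_complex_ofReal, ← integral_neg, ← integral_mul_const]
  congr 1; ext q
  rw [mul_inv, Complex.inv_I]; push_cast; ring
lemma cp_ne : cp ≠ 0 := by
  rw [cp_eq]; exact mul_ne_zero (neg_ne_zero.2 (by exact_mod_cast Aq_pos.ne')) Complex.I_ne_zero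
def Cth : ℝ := 4 * Cp^2
lemma Cth0 : 0 < Cth := by unfold Cth; have := Cp0; positivity
lemma GG_small (s : ℝ) : ‖GG s‖ ≤ Cth * |s| := by
  have := intervalIntegral.norm_integral_le_of_norm_le_const (f := th) (a := 0) (b := s) (C := Cth) fun v _ =>
    (th_bd v).trans (mul_le_of_le_one_right Cth0.le (pow_le_one₀ (W_nn _) (W_le_one _)))
  rwa [sub_zero] at this
lemma GG_big0 {s : ℝ} (hs : 0 ≤ s) : ‖GG s - cp‖ ≤ 4 * Cth * W s := by
  have h : GG s - cp = -∫ u in Ioi s, th u := by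
    have := intervalIntegral.integral_interval_add_Ioi th_int.integrableOn (th_int.integrableOn (s := Ioi s)) (a := 0)
    unfold cp GG; rw [← this]; ring
  rw [h, norm_neg]
  refine (norm_integral_le_integral_norm _).trans ?_
  have hW := W_nn s
  calc _ ≤ ∫ u in Ioi s, Cth * W s * W u ^ 2 := by
        refine setIntegral_mono_on th_int.norm.integrableOn ((intW le_rfl).const_mul _).integrableOn measurableSet_Ioi fun u hu => ?_
        refine (th_bd u).trans ?_
        have h1 : W u ≤ W s := W_anti (by rw [abs_of_nonneg hs, abs_of_nonneg (hs.trans (le_of_lt hu))]; exact le_of_lt hu)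
        have h2 : W u ^ 18 ≤ W u ^ 3 := W_pow_anti (by norm_num) _
        have h3 : W u ^ 3 ≤ W s * W u ^ 2 := by rw [pow_succ, mul_comm]; exact mul_le_mul_of_nonneg_right h1 (sq_nonneg _)
        rw [mul_assoc Cth]; exact mul_le_mul_of_nonneg_left (h2.trans h3) Cth0.le
    _ ≤ ∫ u, Cth * W s * W u ^ 2 := setIntegral_le_integral ((intW le_rfl).const_mul _) (ae_of_all _ fun u => mul_nonneg (mul_nonneg Cth0.le hW) (sq_nonneg _))
    _ ≤ Cth * W s * 4 := by
        rw [integral_const_mul]; exact mul_le_mul_of_nonneg_left (intW_le le_rfl) (mul_nonneg Cth0.le hW)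
    _ = _ := by ring
lemma GG_big (s : ℝ) : ‖GG s - cp‖ ≤ 4 * Cth * W s := by
  rcases le_total 0 s with h | h
  · exact GG_big0 h
  · have h1 := GG_big0 (neg_nonneg.2 h)
    rw [GG_conj, W_neg] at h1
    refine le_trans (le_of_eq ?_) h1
    have e : cp = -(starRingEnd ℂ) cp := by rw [cp_eq]; simp
    rw [← Complex.norm_conj, map_sub, ← norm_neg]; congr 1
    nth_rewrite 2 [e]; simp; ring
lemma GG_qbd {s : ℝ} (hs : s ≠ 0) {p : Prop} (h1 : p → 1 ≤ |s|) (h2 : ¬ p → |s| ≤ 1) :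
    ‖(GG s - if p then cp else 0) / s‖ ≤ 8 * Cth * W s ^ 2 := by
  have hs0 := abs_pos.2 hs
  have hC := Cth0
  have hW : (1 + |s|) * W s = 1 := by unfold W; field_simp
  have hw := W_pos s
  rw [norm_div, Complex.norm_real, Real.norm_eq_abs, div_le_iff₀ hs0]
  split_ifs with hp
  · refine (GG_big s).trans ?_
    have h := h1 hp
    have : 1 ≤ 2 * W s * |s| := by nlinarith
    nlinarith [mul_pos hC hw]
  · rw [sub_zero]
    refine (GG_small s).trans ?_
    have h := h2 hp
    have : 1 ≤ 2 * W s := by nlinarith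
    have : 1 ≤ 8 * W s ^ 2 := by nlinarith
    nlinarith [mul_pos hC hs0]
end Carl
end
noncomputable section
namespace Carl
open Classical
def Qa (s : ℝ) : ℂ := (GG s - if 1 ≤ |s| then cp else 0) / s
def Qb (s : ℝ) : ℂ := (GG s - if 1 < |s| then cp else 0) / s
def cq : ℂ := ∫ s, Qa s
lemma Qa_bd (s : ℝ) : ‖Qa s‖ ≤ 8 * Cth * W s ^ 2 := by
  by_cases h : s = 0
  · simp only [Qa, h, Complex.ofReal_zero, div_zero, norm_zero]; have := Cth0; have := W_nn 0; positivity
  · exact GG_qbd h id fun h => (not_le.1 h).le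
lemma Qb_bd (s : ℝ) : ‖Qb s‖ ≤ 8 * Cth := by
  have := Cth0
  by_cases h : s = 0
  · simp only [Qb, h, Complex.ofReal_zero, div_zero, norm_zero]; positivity
  · exact (GG_qbd h le_of_lt not_lt.1).trans (mul_le_of_le_one_right (by positivity) (pow_le_one₀ (W_nn _) (W_le_one _)))
lemma Qa_meas : Measurable Qa :=
  (GG_cont.measurable.sub (Measurable.ite (measurableSet_le measurable_const (by fun_prop)) measurable_const measurable_const)).div (by fun_prop)
lemma Qb_meas : Measurable Qb :=
  (GG_cont.measurable.sub (Measurable.ite (measurableSet_lt measurable_const (by fun_prop)) measurable_const measurable_const)).div (by fun_prop)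
lemma kap_split {K : ℕ} {t : ℝ} (ht : t ≠ 0) :
    kap K t = cp * {t : ℝ | (8:ℝ)^(-(K:ℤ)) ≤ |t| ∧ |t| ≤ (8:ℝ)^((K:ℤ)+1)}.indicator (fun t => 1 / (t:ℂ)) t
      + ((8:ℝ)^(K:ℤ) : ℝ) * Qa (8^(K:ℤ) * t) - ((8:ℝ)^(-(K:ℤ)-1) : ℝ) * Qb (8^(-(K:ℤ)-1) * t) := by
  set c : ℝ := (8:ℝ)^(K:ℤ) with hc
  set d : ℝ := (8:ℝ)^(-(K:ℤ)-1) with hd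
  have c0 : 0 < c := e8 _
  have d0 : 0 < d := e8 _
  have e1 : (8:ℝ)^(-(K:ℤ)) = c⁻¹ := by rw [zpow_neg]
  have e2 : (8:ℝ)^((K:ℤ)+1) = d⁻¹ := by rw [hd, ← zpow_neg]; congr 1; ring
  have dc : d ≤ c := zpow_le_zpow_right₀ (by norm_num) (by omega)
  have tc : (t:ℂ) ≠ 0 := by exact_mod_cast ht
  have cc : (c:ℂ) ≠ 0 := by exact_mod_cast c0.ne'
  have dd : (d:ℂ) ≠ 0 := by exact_mod_cast d0.ne'
  have h1 : 1 ≤ |c * t| ↔ c⁻¹ ≤ |t| := by rw [abs_mul, abs_of_pos c0, inv_le_iff_one_le_mul₀' c0]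
  have h2 : 1 < |d * t| ↔ ¬ |t| ≤ d⁻¹ := by rw [abs_mul, abs_of_pos d0, not_le, inv_lt_iff_one_lt_mul₀' d0]
  have h3 : 1 < |d * t| → 1 ≤ |c * t| := fun h => h.le.trans (by
    rw [abs_mul, abs_mul, abs_of_pos c0, abs_of_pos d0]; exact mul_le_mul_of_nonneg_right dc (abs_nonneg _))
  rw [e1, e2, indicator_apply]
  simp only [mem_ofPred_eq, ← h1, Qa, Qb, kap, ← hc, ← hd]
  by_cases p1 : 1 ≤ |c * t| <;> by_cases p2 : 1 < |d * t|
  · rw [if_neg (fun h => (h2.1 p2) h.2), if_pos p1, if_pos p2]; push_cast; field_simp; ring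
  · rw [if_pos ⟨p1, not_not.1 (mt h2.2 p2)⟩, if_pos p1, if_neg p2]; push_cast; field_simp; ring
  · exact absurd (h3 p2) p1
  · rw [if_neg (fun h => p1 h.1), if_neg p1, if_neg p2]; push_cast; field_simp; ring
lemma kap_lim {h : ℝ → ℂ} (hc : Continuous h) (hi : Integrable h) {M : ℝ} (hM : ∀ t, ‖h t‖ ≤ M) {g : ℂ}
    (hg : Tendsto (fun p : ℝ × ℝ => ∫ t in {t : ℝ | p.1 ≤ |t| ∧ |t| ≤ p.2}, h t / (t:ℂ)) ((𝓝[>] (0:ℝ)) ×ˢ atTop) (𝓝 g)) :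
    Tendsto (fun K : ℕ => ∫ t, h t * kap K t) atTop (𝓝 (cp * g + cq * h 0)) := by
  have hp : Tendsto (fun K : ℕ => (8:ℝ)^K) atTop atTop := tendsto_pow_atTop_atTop_of_one_lt (by norm_num)
  have hn : Tendsto (fun K : ℕ => (8:ℝ)^(-(K:ℤ))) atTop (𝓝 0) := by
    simp only [zpow_neg, zpow_natCast]; exact tendsto_inv_atTop_zero.comp hp
  have lS : Tendsto (fun K : ℕ => ∫ t in {t : ℝ | (8:ℝ)^(-(K:ℤ)) ≤ |t| ∧ |t| ≤ (8:ℝ)^((K:ℤ)+1)}, h t / (t:ℂ)) atTop (𝓝 g) := by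
    refine hg.comp (Tendsto.prodMk (tendsto_nhdsWithin_iff.2 ⟨hn, Eventually.of_forall fun K => e8 _⟩) ?_)
    refine tendsto_atTop_mono (fun K => ?_) hp
    rw [← zpow_natCast]; exact zpow_le_zpow_right₀ (by norm_num) (by omega)
  have lA : Tendsto (fun K : ℕ => ∫ t, h t * (((8:ℝ)^(K:ℤ) : ℝ) * Qa (8^(K:ℤ) * t))) atTop (𝓝 (cq * h 0)) := by
    have e : ∀ K : ℕ, ∫ t, h t * (((8:ℝ)^(K:ℤ) : ℝ) * Qa (8^(K:ℤ) * t)) = ∫ s, h ((8:ℝ)^(-(K:ℤ)) * s) * Qa s := by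
      intro K
      have c0 := e8 (K:ℤ)
      have := Measure.integral_comp_mul_left (fun s => h ((8:ℝ)^(-(K:ℤ)) * s) * Qa s) ((8:ℝ)^(K:ℤ))
      rw [abs_of_pos (inv_pos.2 c0)] at this
      simp only [← mul_assoc, ← zpow_add₀ (by norm_num : (8:ℝ) ≠ 0), neg_add_cancel, zpow_zero, one_mul] at this
      simp only [mul_left_comm (h _)]
      rw [integral_const_mul, this, Complex.real_smul, ← mul_assoc, ← Complex.ofReal_mul, mul_inv_cancel₀ c0.ne', Complex.ofReal_one, one_mul]
    simp only [e]
    have e0 : cq * h 0 = ∫ s, h 0 * Qa s := by rw [integral_const_mul, mul_comm]; rfl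
    rw [e0]
    refine tendsto_integral_of_dominated_convergence (fun s => M * (8 * Cth * W s ^ 2)) (fun K => ?_) (((intW le_rfl).const_mul _).const_mul _) (fun K => ae_of_all _ fun s => ?_) (ae_of_all _ fun s => ?_)
    · exact ((hc.comp (by fun_prop)).measurable.mul Qa_meas).aestronglyMeasurable
    · rw [norm_mul]; exact mul_le_mul (hM _) (Qa_bd s) (norm_nonneg _) ((norm_nonneg _).trans (hM 0))
    · refine Tendsto.mul_const _ ?_
      have := (hc.tendsto 0).comp (by simpa using hn.mul_const s : Tendsto (fun K : ℕ => (8:ℝ)^(-(K:ℤ)) * s) atTop (𝓝 0))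
      exact this
  have lB : Tendsto (fun K : ℕ => ∫ t, h t * (((8:ℝ)^(-(K:ℤ)-1) : ℝ) * Qb (8^(-(K:ℤ)-1) * t))) atTop (𝓝 0) := by
    refine squeeze_zero_norm (a := fun K : ℕ => (8:ℝ)^(-(K:ℤ)) * (8 * Cth * ∫ t, ‖h t‖)) (fun K => ?_) (by simpa using hn.mul_const _)
    refine (norm_integral_le_integral_norm _).trans ?_
    rw [← integral_const_mul, ← integral_const_mul]
    refine integral_mono_of_nonneg (ae_of_all _ fun t => norm_nonneg _) ((hi.norm.const_mul _).const_mul _) (ae_of_all _ fun t => ?_)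
    have c0 := e8 (-(K:ℤ)-1)
    dsimp only
    rw [norm_mul, norm_mul, Complex.norm_real, Real.norm_of_nonneg c0.le]
    have h1 : (8:ℝ)^(-(K:ℤ)-1) ≤ (8:ℝ)^(-(K:ℤ)) := zpow_le_zpow_right₀ (by norm_num) (by omega)
    have h2 := mul_le_mul h1 (Qb_bd (8^(-(K:ℤ)-1) * t)) (norm_nonneg _) (e8 _).le
    calc _ ≤ ‖h t‖ * _ := mul_le_mul_of_nonneg_left h2 (norm_nonneg _)
      _ = _ := by ring
  have lim := ((lS.const_mul cp).add lA).sub lB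
  rw [sub_zero] at lim
  refine lim.congr fun K => ?_
  have iA : Integrable (fun t => h t * (((8:ℝ)^(K:ℤ) : ℝ) * Qa (8^(K:ℤ) * t))) := by
    refine hi.mul_bdd (c := (8:ℝ)^(K:ℤ) * (8 * Cth)) (measurable_const.mul (Qa_meas.comp (by fun_prop))).aestronglyMeasurable (ae_of_all _ fun t => ?_)
    have c0 := e8 (K:ℤ)
    rw [norm_mul, Complex.norm_real, Real.norm_of_nonneg c0.le]
    have := Cth0
    exact mul_le_mul_of_nonneg_left ((Qa_bd _).trans (mul_le_of_le_one_right (by positivity) (pow_le_one₀ (W_nn _) (W_le_one _)))) c0.le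
  have iB : Integrable (fun t => h t * (((8:ℝ)^(-(K:ℤ)-1) : ℝ) * Qb (8^(-(K:ℤ)-1) * t))) := by
    refine hi.mul_bdd (c := (8:ℝ)^(-(K:ℤ)-1) * (8 * Cth)) (measurable_const.mul (Qb_meas.comp (by fun_prop))).aestronglyMeasurable (ae_of_all _ fun t => ?_)
    have c0 := e8 (-(K:ℤ)-1)
    rw [norm_mul, Complex.norm_real, Real.norm_of_nonneg c0.le]
    exact mul_le_mul_of_nonneg_left (Qb_bd _) c0.le
  have iK : Integrable (fun t => h t * kap K t) :=
    (kap_int K).bdd_mul (c := M) hc.aestronglyMeasurable (ae_of_all _ hM)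
  have hS : MeasurableSet {t : ℝ | (8:ℝ)^(-(K:ℤ)) ≤ |t| ∧ |t| ≤ (8:ℝ)^((K:ℤ)+1)} :=
    MeasurableSet.inter (s₁ := {t : ℝ | (8:ℝ)^(-(K:ℤ)) ≤ |t|}) (s₂ := {t : ℝ | |t| ≤ (8:ℝ)^((K:ℤ)+1)})
      (measurableSet_le measurable_const (by fun_prop)) (measurableSet_le (by fun_prop) measurable_const)
  rw [← integral_indicator hS, ← integral_const_mul]
  have e : ∫ t, cp * {t : ℝ | (8:ℝ)^(-(K:ℤ)) ≤ |t| ∧ |t| ≤ (8:ℝ)^((K:ℤ)+1)}.indicator (fun t => h t / (t:ℂ)) t =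
      ∫ t, (h t * kap K t - h t * (((8:ℝ)^(K:ℤ) : ℝ) * Qa (8^(K:ℤ) * t)) + h t * (((8:ℝ)^(-(K:ℤ)-1) : ℝ) * Qb (8^(-(K:ℤ)-1) * t))) := by
    refine integral_congr_ae ?_
    filter_upwards [ae_ne 0] with t ht
    rw [kap_split ht, indicator_apply, indicator_apply]
    split_ifs <;> ring
  have i2 : Integrable (fun t => h t * kap K t - h t * (((8:ℝ)^(K:ℤ) : ℝ) * Qa (8^(K:ℤ) * t))) := iK.sub iA
  rw [e, integral_add i2 iB, integral_sub iK iA]; ring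
end Carl
end
noncomputable section
namespace Carl
open Classical
abbrev Fo (a : ℝ → ℂ) : ℝ → ℂ := FourierTransform.fourier a
lemma Fo_eq (g : ℝ → ℂ) (ξ : ℝ) : Fo g ξ = ∫ x, ee (-(x * ξ)) * g x := fourier_ee g ξ
lemma Fo_bd (a : ℝ → ℂ) (η : ℝ) : ‖Fo a η‖ ≤ ∫ x, ‖a x‖ := by
  rw [Fo_eq]
  refine (norm_integral_le_integral_norm _).trans (le_of_eq ?_)
  congr 1; ext x; rw [norm_mul, ee_norm, one_mul]
lemma sq_int {a : ℝ → ℂ} (hi : Integrable a) {M : ℝ} (hM : ∀ x, ‖a x‖ ≤ M) : Integrable fun x => ‖a x‖^2 := by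
  have := hi.norm.mul_bdd (c := M) hi.norm.1 (ae_of_all _ fun x => by simpa using hM x)
  simpa only [sq] using this
lemma sq_lint {a : ℝ → ℂ} (h : Integrable fun x => ‖a x‖^2) : ∫⁻ x, ‖a x‖ₑ^2 = ENNReal.ofReal (∫ x, ‖a x‖^2) := by
  rw [ofReal_integral_eq_lintegral_ofReal h (ae_of_all _ fun x => by positivity)]
  congr 1; ext x; rw [ENNReal.ofReal_pow (norm_nonneg _), ofReal_norm]
lemma planch {a : ℝ → ℂ} (hc : Continuous a) (hi : Integrable a) (hG : Integrable (Fo a)) :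
    ∫⁻ x, ‖a x‖ₑ^2 = ∫⁻ η, ‖Fo a η‖ₑ^2 := by
  have inv : ∀ x, a x = ∫ η, ee (x * η) * Fo a η := by
    intro x
    have h := congrFun (hc.fourierInv_fourier_eq hi hG) x
    rw [Real.fourierInv_eq_fourier_neg, fourier_ee] at h
    rw [← h]; congr 1; ext η; congr 2; ring
  have ha : ∀ x, ‖a x‖ ≤ ∫ η, ‖Fo a η‖ := by
    intro x
    rw [inv x]
    refine (norm_integral_le_integral_norm _).trans (le_of_eq ?_)
    congr 1; ext η; rw [norm_mul, ee_norm, one_mul]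
  rw [sq_lint (sq_int hi ha), sq_lint (sq_int hG (Fo_bd a))]
  congr 1
  have cj : ∀ z : ℂ, ((‖z‖^2 : ℝ) : ℂ) = z * (starRingEnd ℂ) z := fun z => by
    rw [Complex.mul_conj, Complex.normSq_eq_norm_sq]
  have hp : Integrable (fun p : ℝ × ℝ => a p.1 * (ee (-(p.1 * p.2)) * (starRingEnd ℂ) (Fo a p.2))) (volume.prod volume) := by
    have h1 : Integrable (fun η => (starRingEnd ℂ) (Fo a η)) := by
      refine hG.norm.mono' (Complex.continuous_conj.comp_aestronglyMeasurable hG.1) (ae_of_all _ fun η => by simp)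
    refine ((hi.mul_prod h1).bdd_mul (c := 1) (f := fun p : ℝ × ℝ => ee (-(p.1 * p.2))) (ee_cont.comp (by fun_prop)).aestronglyMeasurable
      (ae_of_all _ fun p => (ee_norm _).le)).congr (ae_of_all _ fun p => ?_)
    dsimp only; ring
  have e1 : ((∫ x, ‖a x‖^2 : ℝ) : ℂ) = ∫ x, ∫ η, a x * (ee (-(x * η)) * (starRingEnd ℂ) (Fo a η)) := by
    rw [← integral_complex_ofReal]
    congr 1; ext x
    rw [cj, integral_const_mul]
    congr 1
    nth_rewrite 1 [inv x]
    rw [← integral_conj]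
    congr 1; ext η; rw [map_mul, ee_neg]
  have e2 : ((∫ η, ‖Fo a η‖^2 : ℝ) : ℂ) = ∫ η, ∫ x, a x * (ee (-(x * η)) * (starRingEnd ℂ) (Fo a η)) := by
    rw [← integral_complex_ofReal]
    congr 1; ext η
    rw [cj]
    nth_rewrite 1 [Fo_eq]
    rw [← integral_mul_const]
    congr 1; ext x; ring
  have := integral_integral_swap (f := fun x η => a x * (ee (-(x * η)) * (starRingEnd ℂ) (Fo a η))) hp
  rw [← e1, ← e2] at this
  exact_mod_cast this
abbrev Sw := SchwartzMap (ℝ × ℝ) ℂ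
def d2 (f : Sw) : Sw := LineDeriv.lineDerivOp ((0:ℝ), (1:ℝ)) f
lemma Sw_bd (f : Sw) : ∃ M : ℝ, 0 < M ∧ ∀ y x, ‖f (y, x)‖ ≤ M * W y ^ 2 * W x ^ 2 := by
  have h := fun (x : ℝ × ℝ) =>
    SchwartzMap.one_add_le_sup_seminorm_apply (𝕜 := ℝ) (m := (4,0)) (k := 4) (n := 0) le_rfl le_rfl f x
  set C := 2 ^ (4,0).1 * (Finset.Iic (4,0)).sup (fun m => SchwartzMap.seminorm ℝ m.1 m.2) f with hC
  refine ⟨max C 1, by positivity, fun y x => ?_⟩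
  have h := h (y, x)
  rw [norm_iteratedFDeriv_zero] at h
  have n1 : |y| ≤ ‖(y,x)‖ := norm_fst_le (y,x)
  have n2 : |x| ≤ ‖(y,x)‖ := norm_snd_le (y,x)
  unfold W
  rw [inv_pow, inv_pow, mul_assoc, ← mul_inv, ← div_eq_mul_inv, le_div_iff₀ (by positivity)]
  calc _ ≤ ‖f (y,x)‖ * ((1 + ‖(y,x)‖)^2 * (1 + ‖(y,x)‖)^2) := by gcongr
    _ = (1 + ‖(y,x)‖)^4 * ‖f (y,x)‖ := by ring
    _ ≤ _ := h.trans (le_max_left _ _)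
lemma sl_cont (f : Sw) (y : ℝ) : Continuous fun x => f (y, x) := f.continuous.comp (by fun_prop)
lemma sl_int (f : Sw) (y : ℝ) : Integrable fun x => f (y, x) := by
  obtain ⟨M, hM, h⟩ := Sw_bd f
  exact ((intW le_rfl).const_mul (M * W y ^ 2)).mono' (sl_cont f y).aestronglyMeasurable (ae_of_all _ fun x => h y x)
lemma sl_deriv (f : Sw) (y x : ℝ) : HasDerivAt (fun x => f (y, x)) (d2 f (y, x)) x := by
  have h1 : HasFDerivAt f (fderiv ℝ f (y,x)) (y,x) := f.differentiableAt.hasFDerivAt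
  have h2 : HasDerivAt (fun x : ℝ => (y, x)) ((0:ℝ),(1:ℝ)) x := (hasDerivAt_const x y).prodMk (hasDerivAt_id x)
  exact h1.comp_hasDerivAt x h2
lemma sl_four (f : Sw) (y η : ℝ) : Fo (fun x => d2 f (y, x)) η = (2 * Real.pi * Complex.I * η) * Fo (fun x => f (y, x)) η := by
  have e : deriv (fun x => f (y, x)) = fun x => d2 f (y, x) := funext fun x => (sl_deriv f y x).deriv
  have := Real.fourier_deriv (sl_int f y) (fun x => (sl_deriv f y x).differentiableAt) (by rw [e]; exact sl_int _ y)
  rw [e] at this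
  exact congrFun this η
lemma Fsl_bd0 (f : Sw) : ∃ M : ℝ, 0 < M ∧ ∀ y η, ‖Fo (fun x => f (y, x)) η‖ ≤ M * W y ^ 2 := by
  obtain ⟨M, hM, h⟩ := Sw_bd f
  refine ⟨M * 4, by positivity, fun y η => (Fo_bd _ _).trans ?_⟩
  calc _ ≤ ∫ x, M * W y ^ 2 * W x ^ 2 := integral_mono (sl_int f y).norm ((intW le_rfl).const_mul _) fun x => h y x
    _ = M * W y ^ 2 * ∫ x, W x ^ 2 := integral_const_mul _ _
    _ ≤ M * W y ^ 2 * 4 := mul_le_mul_of_nonneg_left (intW_le le_rfl) (by positivity)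
    _ = _ := by ring
lemma Fsl_bd (f : Sw) : ∃ M : ℝ, 0 < M ∧ ∀ y η, ‖Fo (fun x => f (y, x)) η‖ ≤ M * W y ^ 2 * W η ^ 2 := by
  obtain ⟨M, hM, h⟩ := Fsl_bd0 f
  obtain ⟨M', hM', h'⟩ := Fsl_bd0 (d2 (d2 f))
  refine ⟨2 * (M + M'), by positivity, fun y η => ?_⟩
  have h1 := h y η
  have h2 := h' y η
  rw [sl_four, sl_four, ← mul_assoc, norm_mul, norm_mul _ (_ * _)] at h2
  have e : ‖(2 * Real.pi * Complex.I * η : ℂ)‖ = 2 * Real.pi * |η| := by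
    simp [abs_of_pos Real.pi_pos]
  rw [e] at h2
  set A := ‖Fo (fun x => f (y, x)) η‖ with hA
  have hA0 : 0 ≤ A := norm_nonneg _
  have h3 : |η| ^ 2 * A ≤ M' * W y ^ 2 := by
    refine le_trans ?_ h2
    have := Real.pi_gt_three
    have h5 := abs_nonneg η
    have : |η| ≤ 2 * Real.pi * |η| := by nlinarith
    rw [sq]; gcongr
  have e2 : W η ^ 2 = ((1 + |η|)^2)⁻¹ := by unfold W; rw [inv_pow]
  rw [e2, ← div_eq_mul_inv, le_div_iff₀ (by positivity)]
  nlinarith [mul_nonneg hA0 (sq_nonneg (1 - |η|))]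
lemma Fsl_meas (f : Sw) : Measurable (fun p : ℝ × ℝ => Fo (fun x => f (p.1, x)) p.2) := by
  have hf := f.continuous.measurable
  simp only [Fo_eq]
  have : StronglyMeasurable (fun q : (ℝ × ℝ) × ℝ => ee (-(q.2 * q.1.2)) * f (q.1.1, q.2)) := by
    apply Measurable.stronglyMeasurable; fun_prop
  exact this.integral_prod_right'.measurable
lemma sl_planch (f : Sw) (y : ℝ) : ∫⁻ x, ‖f (y, x)‖ₑ^2 = ∫⁻ η, ‖Fo (fun x => f (y, x)) η‖ₑ^2 := by
  obtain ⟨M, hM, h⟩ := Fsl_bd f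
  refine planch (sl_cont f y) (sl_int f y) ?_
  exact ((intW le_rfl).const_mul (M * W y ^ 2)).mono' ((Fsl_meas f).comp (f := fun η => (y, η)) (by fun_prop)).aestronglyMeasurable (ae_of_all _ fun x => h y x)
end Carl
end
noncomputable section
namespace Carl
open Classical
def AK (f : Sw) (K : ℕ) (v : ℝ) (y x : ℝ) : ℂ := ∫ t, f (y - t, x - v * t) * kap K t
def BF (f : Sw) (K : ℕ) (v : ℝ) (y η : ℝ) : ℂ := ∫ t, Fo (fun x => f (y - t, x)) η * (ee ((-η * v) * t) * kap K t)
lemma Sw_sup (f : Sw) : ∃ M : ℝ, 0 < M ∧ ∀ p, ‖f p‖ ≤ M := by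
  obtain ⟨M, hM, h⟩ := Sw_bd f
  refine ⟨M, hM, fun p => (h p.1 p.2).trans ?_⟩
  have h1 := pow_le_one₀ (n := 2) (W_nn p.1) (W_le_one _)
  have h2 := pow_le_one₀ (n := 2) (W_nn p.2) (W_le_one _)
  rw [mul_assoc]
  exact mul_le_of_le_one_right hM.le (mul_le_one₀ h1 (by positivity) h2)
lemma AK_cont (f : Sw) (K : ℕ) (v y : ℝ) : Continuous (AK f K v y) := by
  obtain ⟨M, hM, h⟩ := Sw_sup f
  have hf := f.continuous
  refine continuous_of_dominated (bound := fun t => M * ‖kap K t‖) (fun x => ?_) (fun x => ae_of_all _ fun t => ?_) ((kap_int K).norm.const_mul _) (ae_of_all _ fun t => ?_)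
  · exact ((hf.comp (by fun_prop)).measurable.mul (kap_meas K)).aestronglyMeasurable
  · rw [norm_mul]; exact mul_le_mul_of_nonneg_right (h _) (norm_nonneg _)
  · fun_prop
lemma AK_pint (f : Sw) (K : ℕ) (v y : ℝ) : Integrable (fun p : ℝ × ℝ => f (y - p.2, p.1 - v * p.2) * kap K p.2) (volume.prod volume) := by
  obtain ⟨M, hM, h⟩ := Sw_bd f
  have hf := f.continuous.measurable
  have hk := kap_meas K
  have hm : Measurable (fun p : ℝ × ℝ => f (y - p.2, p.1 - v * p.2) * kap K p.2) := by fun_prop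
  rw [integrable_prod_iff' hm.aestronglyMeasurable]
  refine ⟨ae_of_all _ fun t => ((sl_int f (y - t)).comp_sub_right (v * t)).mul_const (kap K t), ?_⟩
  have e : ∀ t, ∫ x, ‖f (y - t, x - v * t) * kap K t‖ = (∫ x, ‖f (y - t, x)‖) * ‖kap K t‖ := by
    intro t
    simp only [norm_mul]
    rw [integral_mul_const, integral_sub_right_eq_self (fun x => ‖f (y - t, x)‖)]
  simp only [e]
  refine Integrable.bdd_mul (c := M * 4) (kap_int K).norm ?_ (ae_of_all _ fun t => ?_)
  · have : StronglyMeasurable (fun q : ℝ × ℝ => ‖f (y - q.1, q.2)‖) := by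
      apply Measurable.stronglyMeasurable; fun_prop
    exact this.integral_prod_right'.aestronglyMeasurable
  · rw [Real.norm_of_nonneg (integral_nonneg fun _ => norm_nonneg _)]
    calc _ ≤ ∫ x, M * W x ^ 2 := integral_mono (sl_int f _).norm ((intW le_rfl).const_mul _) fun x => (h _ x).trans (by
            have h1 := pow_le_one₀ (n := 2) (W_nn (y - t)) (W_le_one _)
            exact mul_le_mul_of_nonneg_right (mul_le_of_le_one_right hM.le h1) (sq_nonneg _))
      _ = M * ∫ x, W x ^ 2 := integral_const_mul _ _
      _ ≤ M * 4 := mul_le_mul_of_nonneg_left (intW_le le_rfl) hM.le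
lemma AK_int (f : Sw) (K : ℕ) (v y : ℝ) : Integrable (AK f K v y) := (AK_pint f K v y).integral_prod_left
lemma AK_four (f : Sw) (K : ℕ) (v y η : ℝ) : Fo (AK f K v y) η = BF f K v y η := by
  have hp : Integrable (fun p : ℝ × ℝ => ee (-(p.1 * η)) * (f (y - p.2, p.1 - v * p.2) * kap K p.2)) (volume.prod volume) :=
    (AK_pint f K v y).bdd_mul (c := 1) (ee_cont.comp (by fun_prop)).aestronglyMeasurable (ae_of_all _ fun p => (ee_norm _).le)
  rw [Fo_eq]
  calc _ = ∫ x, ∫ t, ee (-(x * η)) * (f (y - t, x - v * t) * kap K t) := by simp only [AK, integral_const_mul]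
    _ = ∫ t, ∫ x, ee (-(x * η)) * (f (y - t, x - v * t) * kap K t) :=
        integral_integral_swap (f := fun x t => ee (-(x * η)) * (f (y - t, x - v * t) * kap K t)) hp
    _ = _ := by
        unfold BF
        congr 1; ext t
        have := integral_sub_right_eq_self (fun x => ee (-((x + v * t) * η)) * (f (y - t, x) * kap K t)) (v * t) (μ := volume)
        simp only [sub_add_cancel] at this
        rw [this, Fo_eq, ← integral_mul_const]
        congr 1; ext x
        rw [show -((x + v * t) * η) = -(x * η) + -η * v * t by ring, ee_add]; ring
lemma BF_meas (f : Sw) (K : ℕ) {u : ℝ → ℝ} (hu : Measurable u) : Measurable (fun p : ℝ × ℝ => BF f K (u p.1) p.1 p.2) := by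
  have hF := Fsl_meas f
  have hk := kap_meas K
  have h1 : Measurable (fun q : (ℝ × ℝ) × ℝ => Fo (fun x => f (q.1.1 - q.2, x)) q.1.2) :=
    hF.comp (f := fun q : (ℝ × ℝ) × ℝ => (q.1.1 - q.2, q.1.2)) (by fun_prop)
  have : StronglyMeasurable (fun q : (ℝ × ℝ) × ℝ => Fo (fun x => f (q.1.1 - q.2, x)) q.1.2 * (ee ((-q.1.2 * u q.1.1) * q.2) * kap K q.2)) :=
    (h1.mul (by fun_prop)).stronglyMeasurable
  exact this.integral_prod_right'.measurable
lemma AK_meas (f : Sw) (K : ℕ) {u : ℝ → ℝ} (hu : Measurable u) : Measurable (fun p : ℝ × ℝ => AK f K (u p.1) p.1 p.2) := by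
  have hF := f.continuous.measurable
  have hk := kap_meas K
  have : StronglyMeasurable (fun q : (ℝ × ℝ) × ℝ => f (q.1.1 - q.2, q.1.2 - u q.1.1 * q.2) * kap K q.2) := by
    apply Measurable.stronglyMeasurable; fun_prop
  exact this.integral_prod_right'.measurable
lemma BF_int (f : Sw) (K : ℕ) (v y : ℝ) : Integrable (BF f K v y) := by
  obtain ⟨M, hM, h⟩ := Fsl_bd f
  refine ((intW le_rfl).const_mul (∫ t, M * ‖kap K t‖)).mono'
    ((BF_meas f K (measurable_const (a := v))).comp (f := fun η => (y, η)) (by fun_prop)).aestronglyMeasurable (ae_of_all _ fun η => ?_)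
  refine (norm_integral_le_integral_norm _).trans ?_
  rw [← integral_mul_const]
  refine integral_mono_of_nonneg (ae_of_all _ fun t => norm_nonneg _) (((kap_int K).norm.const_mul _).mul_const _) (ae_of_all _ fun t => ?_)
  dsimp only
  rw [norm_mul, norm_mul, ee_norm, one_mul]
  have h1 := pow_le_one₀ (n := 2) (W_nn (y - t)) (W_le_one _)
  calc _ ≤ M * 1 * W η ^ 2 * ‖kap K t‖ := mul_le_mul_of_nonneg_right ((h _ _).trans (by gcongr)) (norm_nonneg _)
    _ = _ := by ring
theorem twoD : ∃ C : ℝ, 0 < C ∧ ∀ u : ℝ → ℝ, Measurable u → ∀ f : Sw, ∀ K : ℕ,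
    ∫⁻ p : ℝ × ℝ, ‖AK f K (u p.1) p.1 p.2‖ₑ^2 ≤ ENNReal.ofReal C * ∫⁻ p : ℝ × ℝ, ‖f p‖ₑ^2 := by
  obtain ⟨C, hC, h⟩ := oneD
  refine ⟨C, hC, fun u hu f K => ?_⟩
  have hf := f.continuous.measurable
  have hB := BF_meas f K hu
  have hF := Fsl_meas f
  obtain ⟨M, hM, hb⟩ := Fsl_bd f
  have hN : ∀ η, Nice fun y => Fo (fun x => f (y, x)) η := fun η => by
    have hm : Measurable fun y => Fo (fun x => f (y, x)) η := hF.comp (f := fun y => (y, η)) (by fun_prop)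
    have hw := pow_le_one₀ (n := 2) (W_nn η) (W_le_one _)
    refine ⟨hm, ?_, M, fun y => (hb y η).trans ?_⟩
    · exact ((intW le_rfl).const_mul M).mono' hm.aestronglyMeasurable (ae_of_all _ fun y => (hb y η).trans (mul_le_of_le_one_right (by positivity) hw))
    · have := pow_le_one₀ (n := 2) (W_nn y) (W_le_one _)
      rw [mul_assoc]
      exact mul_le_of_le_one_right hM.le (mul_le_one₀ this (by positivity) hw)
  rw [Measure.volume_eq_prod, lintegral_prod _ ((AK_meas f K hu).enorm.pow_const 2).aemeasurable, lintegral_prod _ (hf.enorm.pow_const 2).aemeasurable]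
  calc ∫⁻ y, ∫⁻ x, ‖AK f K (u y) y x‖ₑ^2 = ∫⁻ y, ∫⁻ η, ‖BF f K (u y) y η‖ₑ^2 := by
        congr 1; ext y
        have e : Fo (AK f K (u y) y) = BF f K (u y) y := funext fun η => AK_four f K (u y) y η
        rw [planch (AK_cont f K _ y) (AK_int f K _ y) (by rw [e]; exact BF_int f K _ y), e]
    _ = ∫⁻ η, ∫⁻ y, ‖BF f K (u y) y η‖ₑ^2 := lintegral_lintegral_swap (hB.enorm.pow_const 2).aemeasurable
    _ ≤ ∫⁻ η, ENNReal.ofReal C * ∫⁻ y, ‖Fo (fun x => f (y, x)) η‖ₑ^2 :=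
        lintegral_mono fun η => h _ (hN η) (fun y => -η * u y) (by fun_prop) K
    _ = ENNReal.ofReal C * ∫⁻ η, ∫⁻ y, ‖Fo (fun x => f (y, x)) η‖ₑ^2 := lintegral_const_mul' _ _ ENNReal.ofReal_ne_top
    _ = ENNReal.ofReal C * ∫⁻ y, ∫⁻ η, ‖Fo (fun x => f (y, x)) η‖ₑ^2 := by
        rw [← lintegral_lintegral_swap (f := fun y η => ‖Fo (fun x => f (y, x)) η‖ₑ^2) (hF.enorm.pow_const 2).aemeasurable]
    _ = _ := by simp only [sl_planch]
lemma line_int (f : Sw) (v : ℝ) (p : ℝ × ℝ) : Integrable fun t => f (p.1 - t, p.2 - v * t) := by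
  obtain ⟨M, hM, h⟩ := Sw_bd f
  have hf := f.continuous
  refine (((intW le_rfl).comp_sub_left p.1).const_mul M).mono' (by fun_prop : Continuous _).aestronglyMeasurable (ae_of_all _ fun t => (h _ _).trans ?_)
  have := W_nn (p.1 - t)
  exact mul_le_of_le_one_right (by positivity) (pow_le_one₀ (W_nn _) (W_le_one _))
lemma fatou {F : ℕ → ℝ × ℝ → ℂ} (hm : ∀ K, Measurable (F K)) {G : ℝ × ℝ → ℂ} (hl : ∀ᵐ x, Tendsto (fun K => F K x) atTop (𝓝 (G x)))
    {B : ℝ≥0∞} (hB : ∀ K, ∫⁻ x, ‖F K x‖ₑ^2 ≤ B) : ∫⁻ x, ‖G x‖ₑ^2 ≤ B := by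
  have hm2 : ∀ K, Measurable fun x => ‖F K x‖ₑ^2 := fun K => (hm K).enorm.pow_const 2
  have e : ∫⁻ x, ‖G x‖ₑ^2 = ∫⁻ x, liminf (fun K => ‖F K x‖ₑ^2) atTop := by
    refine lintegral_congr_ae ?_
    filter_upwards [hl] with x hx
    exact (((ENNReal.continuous_pow 2).tendsto _).comp hx.enorm).liminf_eq.symm
  rw [e]
  refine (lintegral_liminf_le hm2).trans ?_
  exact (liminf_le_liminf (Eventually.of_forall hB)).trans (liminf_const B).le
theorem fin : ∃ C : ℝ, 0 < C ∧ ∀ u : ℝ → ℝ, Measurable u → ∀ f : Sw, ∀ g : ℝ × ℝ → ℂ,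
    (∀ᵐ x : ℝ × ℝ ∂volume, Tendsto (fun p : ℝ × ℝ => ∫ t in {t : ℝ | p.1 ≤ |t| ∧ |t| ≤ p.2}, f (x.1 - t, x.2 - u x.1 * t) / (t : ℂ))
      ((𝓝[>] (0:ℝ)) ×ˢ atTop) (𝓝 (g x))) →
    ∫⁻ x, ‖g x‖ₑ^2 ≤ ENNReal.ofReal C * ∫⁻ x, ‖f x‖ₑ^2 := by
  obtain ⟨C, hC, h⟩ := twoD
  have hcp : 0 < ‖cp‖ := norm_pos_iff.2 cp_ne
  refine ⟨2 * (C + ‖cq‖^2) / ‖cp‖^2, by positivity, fun u hu f g hg => ?_⟩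
  have hf := f.continuous
  obtain ⟨M, hM, hb⟩ := Sw_sup f
  have hl : ∀ᵐ x : ℝ × ℝ, Tendsto (fun K => AK f K (u x.1) x.1 x.2) atTop (𝓝 (cp * g x + cq * f x)) := by
    filter_upwards [hg] with x hx
    have := kap_lim (h := fun t => f (x.1 - t, x.2 - u x.1 * t)) (by fun_prop) (line_int f _ x) (fun t => hb _) hx
    simpa [AK] using this
  have fat : ∫⁻ x, ‖cp * g x + cq * f x‖ₑ^2 ≤ ENNReal.ofReal C * ∫⁻ x, ‖f x‖ₑ^2 := by
    exact fatou (fun K => AK_meas f K hu) hl fun K => h u hu f K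
  have key : ∀ z w : ℂ, ‖z‖ₑ^2 ≤ ENNReal.ofReal (2 / ‖cp‖^2) * ‖cp * z + cq * w‖ₑ^2 + ENNReal.ofReal (2 * ‖cq‖^2 / ‖cp‖^2) * ‖w‖ₑ^2 := by
    intro z w
    simp only [← ofReal_norm, ← ENNReal.ofReal_pow (norm_nonneg _)]
    rw [← ENNReal.ofReal_mul (by positivity), ← ENNReal.ofReal_mul (by positivity), ← ENNReal.ofReal_add (by positivity) (by positivity)]
    refine ENNReal.ofReal_le_ofReal ?_
    have h1 : ‖cp‖ * ‖z‖ ≤ ‖cp * z + cq * w‖ + ‖cq‖ * ‖w‖ := by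
      rw [← norm_mul, ← norm_mul]
      calc _ = ‖(cp * z + cq * w) - cq * w‖ := by rw [add_sub_cancel_right]
        _ ≤ _ := norm_sub_le _ _
    have h2 : (‖cp‖ * ‖z‖)^2 ≤ 2 * ‖cp * z + cq * w‖^2 + 2 * (‖cq‖ * ‖w‖)^2 := by
      have := pow_le_pow_left₀ (by positivity) h1 2
      nlinarith [sq_nonneg (‖cp * z + cq * w‖ - ‖cq‖ * ‖w‖)]
    have e : 2 / ‖cp‖^2 * ‖cp * z + cq * w‖^2 + 2 * ‖cq‖^2 / ‖cp‖^2 * ‖w‖^2 = (2 * ‖cp * z + cq * w‖^2 + 2 * (‖cq‖ * ‖w‖)^2) / ‖cp‖^2 := by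
      field_simp
    rw [e, le_div_iff₀ (by positivity)]; nlinarith
  calc _ ≤ ∫⁻ x, (ENNReal.ofReal (2 / ‖cp‖^2) * ‖cp * g x + cq * f x‖ₑ^2 + ENNReal.ofReal (2 * ‖cq‖^2 / ‖cp‖^2) * ‖f x‖ₑ^2) :=
        lintegral_mono fun x => key _ _
    _ = ENNReal.ofReal (2 / ‖cp‖^2) * (∫⁻ x, ‖cp * g x + cq * f x‖ₑ^2) + ENNReal.ofReal (2 * ‖cq‖^2 / ‖cp‖^2) * ∫⁻ x, ‖f x‖ₑ^2 := by
        rw [lintegral_add_right _ ((hf.measurable.enorm.pow_const 2).const_mul _), lintegral_const_mul' _ _ ENNReal.ofReal_ne_top, lintegral_const_mul' _ _ ENNReal.ofReal_ne_top]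
    _ ≤ ENNReal.ofReal (2 / ‖cp‖^2) * (ENNReal.ofReal C * ∫⁻ x, ‖f x‖ₑ^2) + ENNReal.ofReal (2 * ‖cq‖^2 / ‖cp‖^2) * ∫⁻ x, ‖f x‖ₑ^2 := by gcongr
    _ = _ := by
        rw [← mul_assoc, ← add_mul, ← ENNReal.ofReal_mul (by positivity), ← ENNReal.ofReal_add (by positivity) (by positivity)]
        congr 2; field_simp
end Carl
end

/-- The Hilbert transform along one-variable vector fields `(1, u)` is bounded on `L²(ℝ²)`
with a constant independent of `u`: if `g` is an a.e. realisation of the principal value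
integral `p.v. ∫ f(x₁ - t, x₂ - u(x₁) t) dt/t`, then `‖g‖₂ ≤ C ‖f‖₂`. -/
theorem stmt_8 :
    ∃ C : ℝ, 0 < C ∧ ∀ u : ℝ → ℝ, Measurable u → ∀ f : SchwartzMap (ℝ × ℝ) ℂ,
      ∀ g : ℝ × ℝ → ℂ,
        (∀ᵐ x : ℝ × ℝ ∂volume,
          Filter.Tendsto
            (fun p : ℝ × ℝ => ∫ t in {t : ℝ | p.1 ≤ |t| ∧ |t| ≤ p.2},
              f (x.1 - t, x.2 - u x.1 * t) / (t : ℂ))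
            ((nhdsWithin (0 : ℝ) (Set.Ioi 0)) ×ˢ Filter.atTop) (nhds (g x))) →
        eLpNorm g 2 volume ≤ ENNReal.ofReal C * eLpNorm (fun x => f x) 2 volume := by
  obtain ⟨C, hC, h⟩ := Carl.fin
  refine ⟨C ^ (1/2:ℝ), by positivity, fun u hu f g hg => ?_⟩
  have h1 := h u hu f g hg
  have e : ∀ k : ℝ × ℝ → ℂ, eLpNorm k 2 volume = (∫⁻ x, ‖k x‖ₑ^2) ^ (1/2:ℝ) := fun k => by
    rw [eLpNorm_eq_lintegral_rpow_enorm_toReal two_ne_zero ENNReal.ofNat_ne_top]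
    simp
  rw [e, e, ← ENNReal.ofReal_rpow_of_pos hC, ← ENNReal.mul_rpow_of_nonneg _ _ (by norm_num)]
  exact ENNReal.rpow_le_rpow h1 (by norm_num)
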